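/- Let Ω ⊆ ℂ^{n+r} be a pseudoconvex domain, p : Ω → ℂ^r the projection onto the last r coordinates, and assume |y| ≤ M for all y ∈ p(Ω). Let φ be a plurisubharmonic function on Ω, m ≥ 1 an integer, and y₀ ∈ p(Ω) a point such that φ is not identically -∞ on any branch of the fiber Ω_{y₀} := p^{-1}(y₀). Then there is a constant C_{r,M} depending only on r and M such that for every holomorphic function u on Ω_{y₀} with ∫_{Ω_{y₀}} |u|^{2/m} e^{-φ} < +∞ there exists a holomorphic function U on Ω with U|_{Ω_{y₀}} = u and ∫_Ω |U|^{2/m} e^{-φ} ≤ C_{r,M} ∫_{Ω_{y₀}} |u|^{2/m} e^{-φ}. -/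

import Mathlib

open MeasureTheory Complex Set
open scoped ENNReal NNReal

noncomputable section

/-- `e^x` as a map `EReal → ℝ≥0∞` (`e^{-∞} = 0`, `e^{+∞} = ∞`). -/
def expE (x : EReal) : ℝ≥0∞ := EReal.exp x

/-- `log` as a map `ℝ≥0∞ → EReal`. -/
def logE (x : ℝ≥0∞) : EReal := ENNReal.log x

/-- Truncation of an extended real to `ℝ≥0∞`. -/
def toENN (x : EReal) : ℝ≥0∞ := if x = ⊤ then ⊤ else ENNReal.ofReal x.toReal

/-- The point `c + r·e^{iθ}` on the circle of center `c` and radius `r`. -/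
def cpt (c : ℂ) (r θ : ℝ) : ℂ := c + r * Complex.exp (θ * Complex.I)

/-- The averaged "deficit" `M - (circle mean of u)` over the circle of center `c`, radius `r`,
for an upper bound `M` of `u` on that circle. -/
def circleDeficit (u : ℂ → EReal) (c : ℂ) (r M : ℝ) : ℝ≥0∞ :=
  (∫⁻ θ in Set.Ioc 0 (2 * Real.pi), toENN ((M : EReal) - u (cpt c r θ))) /
    ENNReal.ofReal (2 * Real.pi)

/-- Sub-mean value inequality for `u` at the circle of center `c` and radius `r`:
`u c ≤ (circle mean of u)`, expressed as `u c + (M - mean) ≤ M` for every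
upper bound `M` of `u` on the circle. -/
def SubmeanAt (u : ℂ → EReal) (c : ℂ) (r : ℝ) : Prop :=
  ∀ M : ℝ, (∀ θ : ℝ, u (cpt c r θ) ≤ (M : EReal)) →
    u c + ((circleDeficit u c r M : ℝ≥0∞) : EReal) ≤ (M : EReal)

/-- A function `u : ℂ → EReal` is subharmonic on a set `S` if it is upper semicontinuous on `S`
and satisfies the sub-mean value inequality on every closed disc contained in `S`. -/
def SubharmonicOn (u : ℂ → EReal) (S : Set ℂ) : Prop :=
  UpperSemicontinuousOn u S ∧
    ∀ c r, 0 < r → Metric.closedBall c r ⊆ S → SubmeanAt u c r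

/-- A function with values in `[-∞, +∞)` is plurisubharmonic on `D` if it is upper
semicontinuous on `D` and its restriction to every complex line is subharmonic. -/
def PlurisubharmonicOn {E : Type*} [NormedAddCommGroup E] [NormedSpace ℂ E]
    (φ : E → EReal) (D : Set E) : Prop :=
  UpperSemicontinuousOn φ D ∧
    ∀ a b : E, SubharmonicOn (fun w : ℂ => φ (a + w • b)) {w : ℂ | a + w • b ∈ D}

/-- A set is a pseudoconvex domain if it is open, connected and admits a continuous
plurisubharmonic exhaustion function. -/
def IsPseudoconvexDomain {E : Type*} [NormedAddCommGroup E] [NormedSpace ℂ E]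
    (Ω : Set E) : Prop :=
  IsOpen Ω ∧ IsConnected Ω ∧
    ∃ ρ : E → ℝ, ContinuousOn ρ Ω ∧ PlurisubharmonicOn (fun z => (ρ z : EReal)) Ω ∧
      ∀ c : ℝ, IsCompact {z ∈ Ω | ρ z ≤ c}

namespace BP
open Filter Topology
set_option linter.all false
open scoped ContDiff ComplexConjugate

/-- Complex coordinate space. -/
abbrev Cn (N : ℕ) := Fin N → ℂ

/-- Real coordinate direction. -/
def e1 {N : ℕ} (j : Fin N) : Cn N := Pi.single j 1
/-- Imaginary coordinate direction. -/
def eI {N : ℕ} (j : Fin N) : Cn N := Pi.single j I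

variable {N : ℕ}

lemma I_smul_e1 (j : Fin N) : (I : ℂ) • (e1 j : Cn N) = eI j := by
  simp [e1, eI, ← Pi.single_smul]

lemma I_smul_eI (j : Fin N) : (I : ℂ) • (eI j : Cn N) = - e1 j := by
  simp [e1, eI, ← Pi.single_smul, ← Pi.single_neg]

/-- Wirtinger derivative. -/
def dz (j : Fin N) (f : Cn N → ℂ) (x : Cn N) : ℂ :=
  (1/2) * (fderiv ℝ f x (e1 j) - I * fderiv ℝ f x (eI j))
/-- Conjugate Wirtinger derivative. -/
def db (j : Fin N) (f : Cn N → ℂ) (x : Cn N) : ℂ :=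
  (1/2) * (fderiv ℝ f x (e1 j) + I * fderiv ℝ f x (eI j))

lemma dz_congr {j : Fin N} {f g : Cn N → ℂ} {x : Cn N} (h : f =ᶠ[𝓝 x] g) : dz j f x = dz j g x := by
  simp [dz, h.fderiv_eq]
lemma db_congr {j : Fin N} {f g : Cn N → ℂ} {x : Cn N} (h : f =ᶠ[𝓝 x] g) : db j f x = db j g x := by
  simp [db, h.fderiv_eq]

lemma dz_mul {j : Fin N} {f g : Cn N → ℂ} {x : Cn N} (hf : DifferentiableAt ℝ f x)
    (hg : DifferentiableAt ℝ g x) :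
    dz j (fun y => f y * g y) x = dz j f x * g x + f x * dz j g x := by
  simp only [dz, fderiv_fun_mul hf hg]
  simp; ring
lemma db_mul {j : Fin N} {f g : Cn N → ℂ} {x : Cn N} (hf : DifferentiableAt ℝ f x)
    (hg : DifferentiableAt ℝ g x) :
    db j (fun y => f y * g y) x = db j f x * g x + f x * db j g x := by
  simp only [db, fderiv_fun_mul hf hg]
  simp; ring
lemma dz_add {j : Fin N} {f g : Cn N → ℂ} {x : Cn N} (hf : DifferentiableAt ℝ f x)
    (hg : DifferentiableAt ℝ g x) :
    dz j (fun y => f y + g y) x = dz j f x + dz j g x := by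
  simp only [dz, fderiv_fun_add hf hg]
  simp; ring
lemma db_add {j : Fin N} {f g : Cn N → ℂ} {x : Cn N} (hf : DifferentiableAt ℝ f x)
    (hg : DifferentiableAt ℝ g x) :
    db j (fun y => f y + g y) x = db j f x + db j g x := by
  simp only [db, fderiv_fun_add hf hg]
  simp; ring
lemma dz_sub {j : Fin N} {f g : Cn N → ℂ} {x : Cn N} (hf : DifferentiableAt ℝ f x)
    (hg : DifferentiableAt ℝ g x) :
    dz j (fun y => f y - g y) x = dz j f x - dz j g x := by
  simp only [dz, fderiv_fun_sub hf hg]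
  simp; ring
lemma db_sub {j : Fin N} {f g : Cn N → ℂ} {x : Cn N} (hf : DifferentiableAt ℝ f x)
    (hg : DifferentiableAt ℝ g x) :
    db j (fun y => f y - g y) x = db j f x - db j g x := by
  simp only [db, fderiv_fun_sub hf hg]
  simp; ring

lemma fderiv_conj {f : Cn N → ℂ} {x v : Cn N} :
    fderiv ℝ (fun y => conj (f y)) x v = conj (fderiv ℝ f x v) := by
  have : fderiv ℝ (fun y => conj (f y)) x = (conjCLE : ℂ →L[ℝ] ℂ).comp (fderiv ℝ f x) := by
    exact (conjCLE).comp_fderiv (f := f) (x := x)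
  rw [this]; simp

lemma dz_conj {j : Fin N} {f : Cn N → ℂ} {x : Cn N} :
    dz j (fun y => conj (f y)) x = conj (db j f x) := by
  have h2 : conj (2:ℂ) = 2 := map_ofNat _ 2
  simp only [dz, db, fderiv_conj, map_mul, map_div₀, map_one, h2, map_sub, map_add, conj_I]
  ring
lemma db_conj {j : Fin N} {f : Cn N → ℂ} {x : Cn N} :
    db j (fun y => conj (f y)) x = conj (dz j f x) := by
  have h2 : conj (2:ℂ) = 2 := map_ofNat _ 2
  simp only [dz, db, fderiv_conj, map_mul, map_div₀, map_one, h2, map_sub, map_add, conj_I]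
  ring

lemma contDiffOn_dz {j : Fin N} {f : Cn N → ℂ} {D : Set (Cn N)} (hD : IsOpen D) {n m : ℕ∞}
    (hf : ContDiffOn ℝ n f D) (hm : m + 1 ≤ n) : ContDiffOn ℝ m (dz j f) D := by
  have h1 : ContDiffOn ℝ m (fderiv ℝ f) D := hf.fderiv_of_isOpen hD (by exact_mod_cast hm)
  unfold dz
  exact contDiffOn_const.mul ((h1.clm_apply contDiffOn_const).sub
    (contDiffOn_const.mul (h1.clm_apply contDiffOn_const)))
lemma contDiffOn_db {j : Fin N} {f : Cn N → ℂ} {D : Set (Cn N)} (hD : IsOpen D) {n m : ℕ∞}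
    (hf : ContDiffOn ℝ n f D) (hm : m + 1 ≤ n) : ContDiffOn ℝ m (db j f) D := by
  have h1 : ContDiffOn ℝ m (fderiv ℝ f) D := hf.fderiv_of_isOpen hD (by exact_mod_cast hm)
  unfold db
  exact contDiffOn_const.mul ((h1.clm_apply contDiffOn_const).add
    (contDiffOn_const.mul (h1.clm_apply contDiffOn_const)))
lemma contDiff_dz {j : Fin N} {f : Cn N → ℂ} {n m : ℕ∞}
    (hf : ContDiff ℝ n f) (hm : m + 1 ≤ n) : ContDiff ℝ m (dz j f) :=
  contDiffOn_univ.1 (contDiffOn_dz isOpen_univ (contDiffOn_univ.2 hf) hm)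
lemma contDiff_db {j : Fin N} {f : Cn N → ℂ} {n m : ℕ∞}
    (hf : ContDiff ℝ n f) (hm : m + 1 ≤ n) : ContDiff ℝ m (db j f) :=
  contDiffOn_univ.1 (contDiffOn_db isOpen_univ (contDiffOn_univ.2 hf) hm)
lemma continuous_dz {j : Fin N} {f : Cn N → ℂ} (hf : ContDiff ℝ 1 f) : Continuous (dz j f) :=
  (contDiff_dz (n := 1) (m := 0) hf (by simp)).continuous
lemma continuous_db {j : Fin N} {f : Cn N → ℂ} (hf : ContDiff ℝ 1 f) : Continuous (db j f) :=
  (contDiff_db (n := 1) (m := 0) hf (by simp)).continuous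

lemma dz_eq_zero {j : Fin N} {f : Cn N → ℂ} {x : Cn N} (hx : x ∉ tsupport f) : dz j f x = 0 := by
  have : fderiv ℝ f x = 0 := by
    by_contra h
    exact hx (support_fderiv_subset ℝ (Function.mem_support.2 h))
  simp [dz, this]
lemma db_eq_zero {j : Fin N} {f : Cn N → ℂ} {x : Cn N} (hx : x ∉ tsupport f) : db j f x = 0 := by
  have : fderiv ℝ f x = 0 := by
    by_contra h
    exact hx (support_fderiv_subset ℝ (Function.mem_support.2 h))
  simp [db, this]
lemma tsupport_dz {j : Fin N} {f : Cn N → ℂ} : tsupport (dz j f) ⊆ tsupport f :=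
  closure_minimal (fun x hx => by by_contra h; exact hx (dz_eq_zero h)) (isClosed_tsupport _)
lemma tsupport_db {j : Fin N} {f : Cn N → ℂ} : tsupport (db j f) ⊆ tsupport f :=
  closure_minimal (fun x hx => by by_contra h; exact hx (db_eq_zero h)) (isClosed_tsupport _)
lemma hcs_dz {j : Fin N} {f : Cn N → ℂ} (h : HasCompactSupport f) : HasCompactSupport (dz j f) :=
  h.of_isClosed_subset (isClosed_tsupport _) tsupport_dz
lemma hcs_db {j : Fin N} {f : Cn N → ℂ} (h : HasCompactSupport f) : HasCompactSupport (db j f) :=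
  h.of_isClosed_subset (isClosed_tsupport _) tsupport_db

lemma ibp_aux (v : Cn N) {f g : Cn N → ℂ} (hf : ContDiff ℝ 1 f) (hg : ContDiff ℝ 1 g)
    (hc : HasCompactSupport f) :
    ∫ x, f x * fderiv ℝ g x v = - ∫ x, fderiv ℝ f x v * g x := by
  have hf' : Continuous (fun x => fderiv ℝ f x v) :=
    (hf.continuous_fderiv one_ne_zero).clm_apply continuous_const
  have hg' : Continuous (fun x => fderiv ℝ g x v) :=
    (hg.continuous_fderiv one_ne_zero).clm_apply continuous_const
  have hc' : HasCompactSupport (fun x => fderiv ℝ f x v) := hc.fderiv_apply ℝ v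
  apply integral_mul_fderiv_eq_neg_fderiv_mul_of_integrable
  · exact (hf'.mul hg.continuous).integrable_of_hasCompactSupport hc'.mul_right
  · exact (hf.continuous.mul hg').integrable_of_hasCompactSupport hc.mul_right
  · exact (hf.continuous.mul hg.continuous).integrable_of_hasCompactSupport hc.mul_right
  · exact fun x _ => (hf.differentiable one_ne_zero x)
  · exact fun x _ => (hg.differentiable one_ne_zero x)

lemma int_of_hcs {f : Cn N → ℂ} (hf : Continuous f) (hc : HasCompactSupport f) : Integrable f :=
  hf.integrable_of_hasCompactSupport hc

lemma ibp_db_g (j : Fin N) {f g : Cn N → ℂ} (hf : ContDiff ℝ 1 f) (hg : ContDiff ℝ 1 g)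
    (hc : HasCompactSupport f) :
    ∫ x, f x * db j g x = - ∫ x, db j f x * g x := by
  have hf' : ∀ v, Continuous (fun x => fderiv ℝ f x v) := fun v =>
    (hf.continuous_fderiv one_ne_zero).clm_apply continuous_const
  have hg' : ∀ v, Continuous (fun x => fderiv ℝ g x v) := fun v =>
    (hg.continuous_fderiv one_ne_zero).clm_apply continuous_const
  have hc' : ∀ v, HasCompactSupport (fun x => fderiv ℝ f x v) := fun v => hc.fderiv_apply ℝ v
  have i1 : ∀ v, Integrable (fun x => f x * fderiv ℝ g x v) := fun v =>
    int_of_hcs (hf.continuous.mul (hg' v)) hc.mul_right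
  have i2 : ∀ v, Integrable (fun x => fderiv ℝ f x v * g x) := fun v =>
    int_of_hcs ((hf' v).mul hg.continuous) (hc' v).mul_right
  have e : ∀ x, f x * db j g x = (1/2) * (f x * fderiv ℝ g x (e1 j)) +
      (I/2) * (f x * fderiv ℝ g x (eI j)) := fun x => by simp only [db]; ring
  have e' : ∀ x, db j f x * g x = (1/2) * (fderiv ℝ f x (e1 j) * g x) +
      (I/2) * (fderiv ℝ f x (eI j) * g x) := fun x => by simp only [db]; ring
  simp_rw [e, e']
  rw [integral_add ((i1 _).const_mul _) ((i1 _).const_mul _),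
    integral_add ((i2 _).const_mul _) ((i2 _).const_mul _)]
  simp only [integral_const_mul, ibp_aux _ hf hg hc]
  ring

lemma ibp_dz_g (j : Fin N) {f g : Cn N → ℂ} (hf : ContDiff ℝ 1 f) (hg : ContDiff ℝ 1 g)
    (hc : HasCompactSupport f) :
    ∫ x, f x * dz j g x = - ∫ x, dz j f x * g x := by
  have hcj : ContDiff ℝ 1 (fun x => conj (f x)) := conjCLE.contDiff.comp hf
  have hcg : ContDiff ℝ 1 (fun x => conj (g x)) := conjCLE.contDiff.comp hg
  have := ibp_db_g j hcj hcg (hc.comp_left (g := fun z => conj z) (by simp))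
  simp only [db_conj, ← map_mul, integral_conj] at this
  rw [← map_neg] at this
  exact (starRingEnd ℂ).injective this

/-- Second derivative. -/
def D2 (Φ : Cn N → ℝ) (x v w : Cn N) : ℝ := fderiv ℝ (fderiv ℝ Φ) x v w

/-- Levi form. -/
def levi (Φ : Cn N → ℝ) (x b : Cn N) : ℝ := (1/4) * (D2 Φ x b b + D2 Φ x (I • b) (I • b))
/-- Squared norm of the complex gradient in a direction. -/
def gr (σ : Cn N → ℝ) (x b : Cn N) : ℝ :=
  (1/4) * ((fderiv ℝ σ x b)^2 + (fderiv ℝ σ x (I • b))^2)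

lemma fderiv_ofReal {Φ : Cn N → ℝ} {x v : Cn N} (h : DifferentiableAt ℝ Φ x) :
    fderiv ℝ (fun y => (Φ y : ℂ)) x v = (fderiv ℝ Φ x v : ℝ) := by
  have := (ofRealCLM.hasFDerivAt.comp x h.hasFDerivAt).fderiv
  change fderiv ℝ (ofRealCLM ∘ Φ) x v = _
  rw [this]; simp

end BP

namespace BP
open Filter Topology
set_option linter.all false
open scoped ContDiff ComplexConjugate
variable {N : ℕ}

lemma pi_eq_sum (b : Cn N) : b = ∑ j, b j • (e1 j : Cn N) := by
  ext k
  simp [e1, Finset.sum_apply, Pi.single_apply]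

lemma csmul_eq (c : ℂ) (v : Cn N) : c • v = c.re • v + c.im • (I • v) := by
  ext k
  simp only [Pi.smul_apply, Pi.add_apply, smul_eq_mul, real_smul]
  conv_lhs => rw [← re_add_im c]
  ring

/-- Sesquilinear form attached to a real bilinear form. -/
def Hf (Q : Cn N →L[ℝ] Cn N →L[ℝ] ℝ) (v w : Cn N) : ℂ :=
  (1/4) * ((Q v w : ℂ) + Q (I • v) (I • w) + I * (Q v (I • w) - Q (I • v) w))

lemma I_I (v : Cn N) : I • I • v = - v := by
  rw [smul_smul]; simp

lemma Hf_smul_left (Q : Cn N →L[ℝ] Cn N →L[ℝ] ℝ) (c : ℂ) (v w : Cn N) :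
    Hf Q (c • v) w = c * Hf Q v w := by
  have h1 : c • v = c.re • v + c.im • (I • v) := csmul_eq c v
  have h2 : I • c • v = c.re • (I • v) - c.im • v := by
    rw [h1, smul_add, smul_comm I c.re, smul_comm I c.im, I_I, smul_neg, sub_eq_add_neg]
  rw [Hf, h2, h1]
  simp only [Hf, map_add, map_sub, map_smul, add_apply,
    sub_apply, smul_apply, smul_eq_mul]
  push_cast
  conv_rhs => rw [← re_add_im c]
  ring_nf
  simp only [I_sq]
  ring

lemma Hf_smul_right (Q : Cn N →L[ℝ] Cn N →L[ℝ] ℝ) (c : ℂ) (v w : Cn N) :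
    Hf Q v (c • w) = conj c * Hf Q v w := by
  have h1 : c • w = c.re • w + c.im • (I • w) := csmul_eq c w
  have h2 : I • c • w = c.re • (I • w) - c.im • w := by
    rw [h1, smul_add, smul_comm I c.re, smul_comm I c.im, I_I, smul_neg, sub_eq_add_neg]
  have h3 : conj c = c.re - c.im * I := by
    apply Complex.ext <;> simp
  rw [Hf, h2, h1]
  simp only [Hf, map_add, map_sub, map_smul, smul_eq_mul, h3]
  push_cast
  ring_nf
  simp only [I_sq]
  ring

lemma Hf_sum_left {ι : Type*} (Q : Cn N →L[ℝ] Cn N →L[ℝ] ℝ) (s : Finset ι) (v : ι → Cn N)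
    (w : Cn N) : Hf Q (∑ i ∈ s, v i) w = ∑ i ∈ s, Hf Q (v i) w := by
  induction s using Finset.cons_induction with
  | empty => simp [Hf]
  | cons a s ha ih =>
    rw [Finset.sum_cons, Finset.sum_cons, ← ih]
    simp only [Hf, smul_add, map_add, add_apply]
    push_cast; ring
lemma Hf_sum_right {ι : Type*} (Q : Cn N →L[ℝ] Cn N →L[ℝ] ℝ) (s : Finset ι) (w : ι → Cn N)
    (v : Cn N) : Hf Q v (∑ i ∈ s, w i) = ∑ i ∈ s, Hf Q v (w i) := by
  induction s using Finset.cons_induction with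
  | empty => simp [Hf]
  | cons a s ha ih =>
    rw [Finset.sum_cons, Finset.sum_cons, ← ih]
    simp only [Hf, smul_add, map_add]
    push_cast; ring

lemma Hf_expand (Q : Cn N →L[ℝ] Cn N →L[ℝ] ℝ) (b : Cn N) :
    Hf Q b b = ∑ j, ∑ k, Hf Q (e1 j) (e1 k) * b j * conj (b k) := by
  conv_lhs => rw [pi_eq_sum b]
  rw [Hf_sum_left]
  refine Finset.sum_congr rfl fun j _ => ?_
  rw [Hf_sum_right]
  refine Finset.sum_congr rfl fun k _ => ?_
  rw [Hf_smul_left, Hf_smul_right]; ring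

lemma diff_clm {f : Cn N → ℂ} {x : Cn N} (hf : ContDiffAt ℝ 2 f x) :
    DifferentiableAt ℝ (fderiv ℝ f) x :=
  ((hf.fderiv_right (m := 1) (by norm_num)).differentiableAt one_ne_zero)

lemma fderiv_fderiv_apply {f : Cn N → ℂ} {x : Cn N} (hf : ContDiffAt ℝ 2 f x) (v w : Cn N) :
    fderiv ℝ (fun y => fderiv ℝ f y v) x w = fderiv ℝ (fderiv ℝ f) x w v := by
  rw [fderiv_clm_apply (diff_clm hf) (differentiableAt_const _)]
  simp

lemma fd_symm {f : Cn N → ℂ} {x : Cn N} (hf : ContDiffAt ℝ 2 f x) (v w : Cn N) :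
    fderiv ℝ (fderiv ℝ f) x w v = fderiv ℝ (fderiv ℝ f) x v w :=
  (hf.isSymmSndFDerivAt (by simp)) w v

lemma fderiv_db {f : Cn N → ℂ} {x : Cn N} (k : Fin N) (hf : ContDiffAt ℝ 2 f x) (w : Cn N) :
    fderiv ℝ (db k f) x w = (1/2) * (fderiv ℝ (fderiv ℝ f) x w (e1 k) +
      I * fderiv ℝ (fderiv ℝ f) x w (eI k)) := by
  have d := fun v => (diff_clm hf).clm_apply (differentiableAt_const v)
  have : HasFDerivAt (db k f) ((1/2 : ℂ) • (fderiv ℝ (fun y => fderiv ℝ f y (e1 k)) x +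
      I • fderiv ℝ (fun y => fderiv ℝ f y (eI k)) x)) x := by
    unfold db
    exact ((d (e1 k)).hasFDerivAt.add ((d (eI k)).hasFDerivAt.const_mul I)).const_mul _
  rw [this.fderiv]
  simp [fderiv_fderiv_apply hf]; ring

lemma fderiv_dz {f : Cn N → ℂ} {x : Cn N} (k : Fin N) (hf : ContDiffAt ℝ 2 f x) (w : Cn N) :
    fderiv ℝ (dz k f) x w = (1/2) * (fderiv ℝ (fderiv ℝ f) x w (e1 k) -
      I * fderiv ℝ (fderiv ℝ f) x w (eI k)) := by
  have d := fun v => (diff_clm hf).clm_apply (differentiableAt_const v)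
  have : HasFDerivAt (dz k f) ((1/2 : ℂ) • (fderiv ℝ (fun y => fderiv ℝ f y (e1 k)) x -
      I • fderiv ℝ (fun y => fderiv ℝ f y (eI k)) x)) x := by
    unfold dz
    exact ((d (e1 k)).hasFDerivAt.sub ((d (eI k)).hasFDerivAt.const_mul I)).const_mul _
  rw [this.fderiv]
  simp [fderiv_fderiv_apply hf]

lemma dz_db_comm {f : Cn N → ℂ} {x : Cn N} (j k : Fin N) (hf : ContDiffAt ℝ 2 f x) :
    dz j (db k f) x = db k (dz j f) x := by
  simp only [dz.eq_1 j (db k f), db.eq_1 k (dz j f), fderiv_db _ hf, fderiv_dz _ hf]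
  rw [fd_symm hf (e1 k) (e1 j), fd_symm hf (e1 k) (eI j), fd_symm hf (eI k) (e1 j),
    fd_symm hf (eI k) (eI j)]
  ring
lemma db_db_comm {f : Cn N → ℂ} {x : Cn N} (j k : Fin N) (hf : ContDiffAt ℝ 2 f x) :
    db j (db k f) x = db k (db j f) x := by
  simp only [db.eq_1 j (db k f), db.eq_1 k (db j f), fderiv_db _ hf]
  rw [fd_symm hf (e1 k) (e1 j), fd_symm hf (e1 k) (eI j), fd_symm hf (eI k) (e1 j),
    fd_symm hf (eI k) (eI j)]
  ring

lemma fd2_ofReal {Φ : Cn N → ℝ} {x : Cn N} (h : ContDiffAt ℝ 2 Φ x) (v w : Cn N) :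
    fderiv ℝ (fderiv ℝ (fun y => (Φ y : ℂ))) x v w = (fderiv ℝ (fderiv ℝ Φ) x v w : ℝ) := by
  have h' : ContDiffAt ℝ 2 (fun y => (Φ y : ℂ)) x := ofRealCLM.contDiff.contDiffAt.comp x h
  rw [← fderiv_fderiv_apply h']
  have hd : DifferentiableAt ℝ (fderiv ℝ Φ) x :=
    ((h.fderiv_right (m := 1) (by norm_num)).differentiableAt one_ne_zero)
  have ev : (fun y => fderiv ℝ (fun y => (Φ y : ℂ)) y w) =ᶠ[𝓝 x]
      fun y => ((fderiv ℝ Φ y w : ℝ) : ℂ) := by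
    filter_upwards [h.eventually (by simp)] with y hy
    exact fderiv_ofReal (hy.differentiableAt two_ne_zero)
  rw [ev.fderiv_eq, fderiv_ofReal (hd.clm_apply (differentiableAt_const w)),
    fderiv_clm_apply hd (differentiableAt_const _)]
  simp

lemma levi_eq {Φ : Cn N → ℝ} {x : Cn N} (h : ContDiffAt ℝ 2 Φ x) (b : Cn N) :
    ∑ j, ∑ k, dz j (db k (fun y => (Φ y : ℂ))) x * b j * conj (b k) = (levi Φ x b : ℂ) := by
  have h' : ContDiffAt ℝ 2 (fun y => (Φ y : ℂ)) x := ofRealCLM.contDiff.contDiffAt.comp x h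
  have e : ∀ j k, dz j (db k (fun y => (Φ y : ℂ))) x =
      Hf (fderiv ℝ (fderiv ℝ Φ) x) (e1 j) (e1 k) := by
    intro j k
    simp only [dz.eq_1 j, fderiv_db _ h', fd2_ofReal h, Hf, I_smul_e1]
    ring_nf; simp only [I_sq]; ring
  simp only [e]
  rw [← Hf_expand]
  have s : fderiv ℝ (fderiv ℝ Φ) x (I • b) b = fderiv ℝ (fderiv ℝ Φ) x b (I • b) :=
    (h.isSymmSndFDerivAt (by simp)) _ _
  simp only [Hf, levi, D2, s]
  push_cast; ring

lemma dz_sum_eq {σ : Cn N → ℝ} {x : Cn N} (h : DifferentiableAt ℝ σ x) (b : Cn N) :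
    ∑ j, dz j (fun y => (σ y : ℂ)) x * b j =
      (1/2) * ((fderiv ℝ σ x b : ℝ) - I * (fderiv ℝ σ x (I • b) : ℝ)) := by
  have hb := pi_eq_sum b
  have e1' : ∀ j, dz j (fun y => (σ y : ℂ)) x * b j = (1/2) * ((fderiv ℝ σ x (b j • e1 j) : ℝ)
      - I * (fderiv ℝ σ x (I • b j • e1 j) : ℝ)) := by
    intro j
    have h2 : I • b j • (e1 j : Cn N) = (b j).re • (I • e1 j) - (b j).im • e1 j := by
      rw [csmul_eq (b j), smul_add, smul_comm I (b j).re, smul_comm I (b j).im, I_I, smul_neg,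
        sub_eq_add_neg]
    rw [h2, csmul_eq (b j)]
    simp only [dz, fderiv_ofReal h, map_add, map_sub, map_smul, I_smul_e1, smul_eq_mul]
    push_cast
    conv_lhs => rw [← re_add_im (b j)]
    ring_nf; simp only [I_sq]; ring
  simp only [e1', ← Finset.mul_sum, Finset.sum_sub_distrib]
  conv_rhs => rw [hb]
  simp only [Finset.smul_sum, map_sum]
  push_cast; rfl

lemma gr_eq {σ : Cn N → ℝ} {x : Cn N} (h : DifferentiableAt ℝ σ x) (b : Cn N) :
    ‖∑ j, dz j (fun y => (σ y : ℂ)) x * b j‖^2 = gr σ x b := by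
  rw [dz_sum_eq h, ← normSq_eq_norm_sq, gr]
  simp [normSq_apply]; ring

end BP

namespace BP
open Filter Topology
set_option linter.all false
open scoped ContDiff ComplexConjugate
variable {N : ℕ}

/-- weight -/
def wt (Φ : Cn N → ℝ) (x : Cn N) : ℂ := (Real.exp (-Φ x) : ℝ)

/-- weighted adjoint derivative -/
def dD (Φ : Cn N → ℝ) (j : Fin N) (f : Cn N → ℂ) (x : Cn N) : ℂ :=
  dz j f x - dz j (fun y => (Φ y : ℂ)) x * f x

lemma conj_wt (Φ : Cn N → ℝ) (x : Cn N) : conj (wt Φ x) = wt Φ x := conj_ofReal _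

lemma cd_ofReal {Φ : Cn N → ℝ} {n : WithTop ℕ∞} (h : ContDiff ℝ n Φ) :
    ContDiff ℝ n (fun y => (Φ y : ℂ)) := ofRealCLM.contDiff.comp h

lemma cd_conj {f : Cn N → ℂ} {n : WithTop ℕ∞} (h : ContDiff ℝ n f) :
    ContDiff ℝ n (fun y => conj (f y)) := conjCLE.contDiff.comp h

lemma hcs_conj {f : Cn N → ℂ} (hc : HasCompactSupport f) :
    HasCompactSupport (fun y => conj (f y)) := hc.comp_left (g := fun z => conj z) (by simp)

lemma cd_wt {Φ : Cn N → ℝ} {n : WithTop ℕ∞} (h : ContDiff ℝ n Φ) : ContDiff ℝ n (wt Φ) :=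
  cd_ofReal (Real.contDiff_exp.comp h.neg)

lemma dz_wt {Φ : Cn N → ℝ} {x : Cn N} (j : Fin N) (h : DifferentiableAt ℝ Φ x) :
    dz j (wt Φ) x = - dz j (fun y => (Φ y : ℂ)) x * wt Φ x := by
  have h1 : HasFDerivAt (fun y => Real.exp (-Φ y)) (Real.exp (-Φ x) • (-fderiv ℝ Φ x)) x :=
    (h.hasFDerivAt.neg).exp
  have h2 := fun v => fderiv_ofReal (v := v) h1.differentiableAt
  unfold wt
  simp only [dz, h2, h1.fderiv, fderiv_ofReal h]
  simp; ring

lemma cd_dD {Φ : Cn N → ℝ} (hΦ : ContDiff ℝ ∞ Φ) {f : Cn N → ℂ} (hf : ContDiff ℝ ∞ f) (j : Fin N) :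
    ContDiff ℝ ∞ (dD Φ j f) :=
  (contDiff_dz hf (by simp)).sub ((contDiff_dz (cd_ofReal hΦ) (by simp)).mul hf)

lemma hcs_dD {Φ : Cn N → ℝ} {f : Cn N → ℂ} (hc : HasCompactSupport f) (j : Fin N) :
    HasCompactSupport (dD Φ j f) := (hcs_dz hc).sub hc.mul_left

lemma le1 {f : Cn N → ℂ} (hf : ContDiff ℝ ∞ f) : ContDiff ℝ 1 f := hf.of_le (by simp)
lemma cd_le1 {E F : Type*} [NormedAddCommGroup E] [NormedSpace ℝ E] [NormedAddCommGroup F]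
    [NormedSpace ℝ F] {f : E → F} (hf : ContDiff ℝ ∞ f) : ContDiff ℝ 1 f := hf.of_le (by simp)
lemma cd_diff {E F : Type*} [NormedAddCommGroup E] [NormedSpace ℝ E] [NormedAddCommGroup F]
    [NormedSpace ℝ F] {f : E → F} (hf : ContDiff ℝ ∞ f) : Differentiable ℝ f :=
  hf.differentiable (by simp)
lemma cd_db {f : Cn N → ℂ} (hf : ContDiff ℝ ∞ f) (j : Fin N) : ContDiff ℝ ∞ (db j f) :=
  contDiff_db hf (by simp)
lemma cd_dz {f : Cn N → ℂ} (hf : ContDiff ℝ ∞ f) (j : Fin N) : ContDiff ℝ ∞ (dz j f) :=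
  contDiff_dz hf (by simp)
lemma cd_at2 {E F : Type*} [NormedAddCommGroup E] [NormedSpace ℝ E] [NormedAddCommGroup F]
    [NormedSpace ℝ F] {f : E → F} (hf : ContDiff ℝ ∞ f) (x : E) : ContDiffAt ℝ 2 f x :=
  (contDiff_infty.1 hf 2).contDiffAt

lemma M1 {Φ : Cn N → ℝ} (hΦ : ContDiff ℝ ∞ Φ) {f g : Cn N → ℂ} (hf : ContDiff ℝ ∞ f)
    (hg : ContDiff ℝ ∞ g) (hc : HasCompactSupport f) (j : Fin N) :
    ∫ x, dD Φ j f x * conj (g x) * wt Φ x = - ∫ x, f x * conj (db j g x) * wt Φ x := by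
  have h := ibp_dz_g j (f := fun x => f x * wt Φ x) (g := fun x => conj (g x))
    (le1 (hf.mul (cd_wt hΦ))) (le1 (cd_conj hg)) hc.mul_right
  have e : ∀ x, dz j (fun x => f x * wt Φ x) x = dD Φ j f x * wt Φ x := fun x => by
    rw [dz_mul (cd_diff hf x) (cd_diff (cd_wt hΦ) x), dz_wt j (cd_diff hΦ x), dD]; ring
  simp only [e, dz_conj] at h
  calc _ = ∫ x, dD Φ j f x * wt Φ x * conj (g x) := by congr 1; ext x; ring
    _ = - ∫ x, f x * wt Φ x * conj (db j g x) := by rw [h, neg_neg]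
    _ = _ := by congr 2; ext x; ring

lemma M2 {Φ : Cn N → ℝ} (hΦ : ContDiff ℝ ∞ Φ) {f : Cn N → ℂ} (hf : ContDiff ℝ ∞ f) (j k : Fin N)
    (x : Cn N) : db j (dD Φ k f) x =
      dD Φ k (db j f) x - db j (dz k (fun y => (Φ y : ℂ))) x * f x := by
  have hΦ' := cd_ofReal hΦ
  unfold dD
  rw [db_sub (cd_diff (cd_dz hf k) x) ((cd_diff (cd_dz hΦ' k) x).fun_mul (cd_diff hf x)),
    db_mul (cd_diff (cd_dz hΦ' k) x) (cd_diff hf x), dz_db_comm k j (cd_at2 hf x)]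
  ring

lemma M3 {Φ : Cn N → ℝ} (hΦ : ContDiff ℝ ∞ Φ) {f g : Cn N → ℂ} (hf : ContDiff ℝ ∞ f)
    (hg : ContDiff ℝ ∞ g) (hcf : HasCompactSupport f) (hcg : HasCompactSupport g) (j k : Fin N) :
    ∫ x, dD Φ j f x * conj (dD Φ k g x) * wt Φ x =
      (∫ x, dz j (db k (fun y => (Φ y : ℂ))) x * f x * conj (g x) * wt Φ x) +
      ∫ x, db k f x * conj (db j g x) * wt Φ x := by
  have hΦ' := cd_ofReal hΦ
  rw [M1 hΦ hf (cd_dD hΦ hg k) hcf j]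
  have hreal : ∀ x, conj (db j (dz k (fun y => (Φ y : ℂ))) x) =
      dz j (db k (fun y => (Φ y : ℂ))) x := fun x => by
    rw [← dz_conj]
    congr 1
    ext y
    rw [← db_conj]; simp
  have e : ∀ x, f x * conj (db j (dD Φ k g) x) * wt Φ x =
      f x * conj (dD Φ k (db j g) x) * wt Φ x
       - dz j (db k (fun y => (Φ y : ℂ))) x * f x * conj (g x) * wt Φ x := fun x => by
    rw [M2 hΦ hg, map_sub, map_mul, hreal]; ring
  have cw := (cd_wt hΦ).continuous
  have i1 : Integrable fun x => f x * conj (dD Φ k (db j g) x) * wt Φ x :=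
    int_of_hcs ((hf.continuous.mul (cd_conj (cd_dD hΦ (cd_db hg j) k)).continuous).mul cw)
      (hcf.mul_right).mul_right
  have i2 : Integrable fun x => dz j (db k (fun y => (Φ y : ℂ))) x * f x * conj (g x) * wt Φ x :=
    int_of_hcs ((((cd_dz (cd_db hΦ' k) j).continuous.mul hf.continuous).mul
      (cd_conj hg).continuous).mul cw) (hcf.mul_left.mul_right).mul_right
  simp only [e]
  rw [integral_sub i1 i2]
  have h2 := M1 hΦ (cd_db hg j) hf (hcs_db hcg) k
  have h3 : ∫ x, f x * conj (dD Φ k (db j g) x) * wt Φ x =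
      conj (∫ x, dD Φ k (db j g) x * conj (f x) * wt Φ x) := by
    rw [← integral_conj]; congr 1; ext x; simp only [map_mul, conj_conj, conj_wt]; ring
  have h4 : ∫ x, db k f x * conj (db j g x) * wt Φ x =
      conj (∫ x, db j g x * conj (db k f x) * wt Φ x) := by
    rw [← integral_conj]; congr 1; ext x; simp only [map_mul, conj_conj, conj_wt]; ring
  rw [h3, h2, h4, map_neg]; ring

lemma alg_id (a : Fin N → Fin N → ℂ) :
    ∑ j, ∑ k, a k j * conj (a j k) =
      ((∑ j, ∑ k, ‖a j k‖^2 - (1/2) * ∑ j, ∑ k, ‖a j k - a k j‖^2 : ℝ) : ℂ) := by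
  have e : ∀ j k, ((‖a j k - a k j‖^2 : ℝ) : ℂ) = (‖a j k‖^2 : ℝ) + (‖a k j‖^2 : ℝ)
      - a k j * conj (a j k) - a j k * conj (a k j) := fun j k => by
    simp only [← normSq_eq_norm_sq, normSq_eq_conj_mul_self, map_sub]; ring
  push_cast [Finset.sum_sub_distrib]
  push_cast at e
  simp only [e, Finset.sum_sub_distrib, Finset.sum_add_distrib]
  rw [Finset.sum_comm (f := fun j k => (‖a k j‖:ℂ)^2), Finset.sum_comm (f := fun j k => a j k * conj (a k j))]
  ring

lemma basic_ineq {Φ : Cn N → ℝ} (hΦ : ContDiff ℝ ∞ Φ) {β : Fin N → Cn N → ℂ}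
    (hβ : ∀ j, ContDiff ℝ ∞ (β j)) (hc : ∀ j, HasCompactSupport (β j)) :
    ∫ x, levi Φ x (fun j => β j x) * Real.exp (-Φ x) ≤
      (∫ x, ‖∑ j, dD Φ j (β j) x‖^2 * Real.exp (-Φ x)) +
      ∫ x, ((1/2) * ∑ j, ∑ k, ‖db j (β k) x - db k (β j) x‖^2) * Real.exp (-Φ x) := by
  have hΦ' := cd_ofReal hΦ
  have cw := (cd_wt hΦ).continuous
  have iA : ∀ j k, Integrable fun x => dD Φ j (β j) x * conj (dD Φ k (β k) x) * wt Φ x :=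
    fun j k => int_of_hcs (((cd_dD hΦ (hβ j) j).continuous.mul
      (cd_conj (cd_dD hΦ (hβ k) k)).continuous).mul cw) ((hcs_dD (hc j) j).mul_right).mul_right
  have iB : ∀ j k, Integrable fun x =>
      dz j (db k (fun y => (Φ y : ℂ))) x * β j x * conj (β k x) * wt Φ x := fun j k =>
    int_of_hcs ((((cd_dz (cd_db hΦ' k) j).continuous.mul (hβ j).continuous).mul
      (cd_conj (hβ k)).continuous).mul cw) ((hc j).mul_left.mul_right).mul_right
  have iC : ∀ j k, Integrable fun x => db k (β j) x * conj (db j (β k) x) * wt Φ x := fun j k =>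
    int_of_hcs (((cd_db (hβ j) k).continuous.mul (cd_conj (cd_db (hβ k) j)).continuous).mul cw)
      ((hcs_db (hc j)).mul_right).mul_right
  have key : ∫ x, ∑ j, ∑ k, dD Φ j (β j) x * conj (dD Φ k (β k) x) * wt Φ x =
      (∫ x, ∑ j, ∑ k, dz j (db k (fun y => (Φ y : ℂ))) x * β j x * conj (β k x) * wt Φ x) +
      ∫ x, ∑ j, ∑ k, db k (β j) x * conj (db j (β k) x) * wt Φ x := by
    rw [integral_finset_sum _ fun j _ => integrable_finset_sum _ fun k _ => iA j k,
      integral_finset_sum _ fun j _ => integrable_finset_sum _ fun k _ => iB j k,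
      integral_finset_sum _ fun j _ => integrable_finset_sum _ fun k _ => iC j k,
      ← Finset.sum_add_distrib]
    refine Finset.sum_congr rfl fun j _ => ?_
    rw [integral_finset_sum _ fun k _ => iA j k, integral_finset_sum _ fun k _ => iB j k,
      integral_finset_sum _ fun k _ => iC j k, ← Finset.sum_add_distrib]
    exact Finset.sum_congr rfl fun k _ => M3 hΦ (hβ j) (hβ k) (hc j) (hc k) j k
  have e1 : ∀ x, ∑ j, ∑ k, dD Φ j (β j) x * conj (dD Φ k (β k) x) * wt Φ x =
      ((‖∑ j, dD Φ j (β j) x‖^2 * Real.exp (-Φ x) : ℝ) : ℂ) := fun x => by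
    rw [ofReal_mul, ofReal_pow, ← mul_conj', map_sum, Finset.sum_mul_sum, Finset.sum_mul]
    simp only [Finset.sum_mul, wt]
  have e2 : ∀ x, ∑ j, ∑ k, dz j (db k (fun y => (Φ y : ℂ))) x * β j x * conj (β k x) * wt Φ x =
      ((levi Φ x (fun j => β j x) * Real.exp (-Φ x) : ℝ) : ℂ) := fun x => by
    rw [ofReal_mul, ← levi_eq (cd_at2 hΦ x) (fun j => β j x)]
    simp only [Finset.sum_mul, wt]
  have e3 : ∀ x, ∑ j, ∑ k, db k (β j) x * conj (db j (β k) x) * wt Φ x =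
      (((∑ j, ∑ k, ‖db j (β k) x‖^2) * Real.exp (-Φ x)
       - ((1/2) * ∑ j, ∑ k, ‖db j (β k) x - db k (β j) x‖^2) * Real.exp (-Φ x) : ℝ) : ℂ) :=
    fun x => by
      rw [← sub_mul, ofReal_mul, ← alg_id (fun j k => db j (β k) x)]
      simp only [Finset.sum_mul, wt]
  simp only [e1, e2, e3] at key
  rw [integral_complex_ofReal, integral_complex_ofReal, integral_complex_ofReal] at key
  rw [← ofReal_add, ofReal_inj] at key
  have cw' : Continuous fun x => Real.exp (-Φ x) := Real.continuous_exp.comp hΦ.continuous.neg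
  have hcK : ∀ f : Cn N → ℂ, Continuous f → HasCompactSupport f →
      Integrable (fun x => ‖f x‖^2 * Real.exp (-Φ x)) := fun f hf hcf => by
    apply Continuous.integrable_of_hasCompactSupport
    · exact (hf.norm.pow 2).mul cw'
    · exact (hcf.norm.comp_left (g := fun t => t^2) (by simp)).mul_right
  have iP : Integrable fun x => (∑ j, ∑ k, ‖db j (β k) x‖^2) * Real.exp (-Φ x) := by
    simp only [Finset.sum_mul]
    exact integrable_finset_sum _ fun j _ => integrable_finset_sum _ fun k _ =>
      hcK _ (cd_db (hβ k) j).continuous (hcs_db (hc k))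
  have iQ : Integrable fun x => ((1/2) * ∑ j, ∑ k, ‖db j (β k) x - db k (β j) x‖^2) * Real.exp (-Φ x) := by
    simp only [mul_assoc, Finset.sum_mul]
    exact (integrable_finset_sum _ fun j _ => integrable_finset_sum _ fun k _ =>
      hcK (fun x => db j (β k) x - db k (β j) x)
        ((cd_db (hβ k) j).continuous.sub (cd_db (hβ j) k).continuous)
        ((hcs_db (hc k)).sub (hcs_db (hc j)))).const_mul _
  rw [integral_sub iP iQ] at key
  have : 0 ≤ ∫ x, (∑ j, ∑ k, ‖db j (β k) x‖^2) * Real.exp (-Φ x) :=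
    integral_nonneg fun x => by positivity
  linarith

end BP

namespace BP
open Filter Topology
set_option linter.all false
open scoped ContDiff ComplexConjugate
variable {N : ℕ}

lemma exists_cutoff {K D : Set (Cn N)} (hK : IsCompact K) (hD : IsOpen D) (hKD : K ⊆ D) :
    ∃ η : Cn N → ℝ, ContDiff ℝ ∞ η ∧ (∀ x, 0 ≤ η x ∧ η x ≤ 1) ∧ (∀ᶠ x in 𝓝ˢ K, η x = 1) ∧
      HasCompactSupport η ∧ tsupport η ⊆ D := by
  obtain ⟨K1, hK1, h1, h2⟩ := exists_compact_between hK hD hKD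
  obtain ⟨f, hf1, hf2, hf3⟩ := exists_contMDiffMap_one_nhds_of_subset_interior
    (modelWithCornersSelf ℝ (Cn N)) (n := (⊤ : ℕ∞)) hK.isClosed h1
  have hs : tsupport f ⊆ K1 := closure_minimal
    (fun x hx => by by_contra h; exact hx (hf2 x h)) hK1.isClosed
  exact ⟨f, f.contMDiff.contDiff, fun x => hf3 x, hf1,
    hK1.of_isClosed_subset (isClosed_tsupport _) hs, hs.trans h2⟩

lemma exists_ext {D K : Set (Cn N)} (hK : IsCompact K) (hD : IsOpen D) (hKD : K ⊆ D) {F : Type*}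
    [NormedAddCommGroup F] [NormedSpace ℝ F] {Φ : Cn N → F}
    (hΦ : ContDiffOn ℝ ∞ Φ D) : ∃ Ψ : Cn N → F, ContDiff ℝ ∞ Ψ ∧ ∀ x ∈ K, Ψ =ᶠ[𝓝 x] Φ := by
  obtain ⟨η, h1, h2, h3, h4, h5⟩ := exists_cutoff hK hD hKD
  refine ⟨fun x => η x • Φ x, ?_, ?_⟩
  · rw [contDiff_iff_contDiffAt]
    intro x
    by_cases hx : x ∈ tsupport η
    · exact h1.contDiffAt.smul (hΦ.contDiffAt (hD.mem_nhds (h5 hx)))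
    · have : (fun x => η x • Φ x) =ᶠ[𝓝 x] fun _ => 0 := by
        filter_upwards [notMem_tsupport_iff_eventuallyEq.1 hx] with y hy
        simp [hy]
      exact contDiffAt_const.congr_of_eventuallyEq this
  · intro x hx
    filter_upwards [mem_nhdsSet_iff_forall.1 h3 x hx] with y hy
    have : η y = 1 := hy
    simp [this]

lemma levi_congr {Φ Ψ : Cn N → ℝ} {x : Cn N} (h : Φ =ᶠ[𝓝 x] Ψ) (b : Cn N) :
    levi Φ x b = levi Ψ x b := by
  have : fderiv ℝ Φ =ᶠ[𝓝 x] fderiv ℝ Ψ := h.fderiv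
  simp [levi, D2, this.fderiv_eq]

lemma dD_congr {Φ Ψ : Cn N → ℝ} {x : Cn N} (h : Φ =ᶠ[𝓝 x] Ψ) (j : Fin N) (f : Cn N → ℂ) :
    dD Φ j f x = dD Ψ j f x := by
  unfold dD
  rw [dz_congr (f := fun y => (Φ y : ℂ)) (g := fun y => (Ψ y : ℂ))]
  filter_upwards [h] with y hy; rw [hy]

lemma levi_zero (Φ : Cn N → ℝ) (x : Cn N) : levi Φ x 0 = 0 := by simp [levi, D2]
lemma gr_zero (Φ : Cn N → ℝ) (x : Cn N) : gr Φ x 0 = 0 := by simp [gr]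

/-- continuous on `D`, zero off compact `K ⊆ D`. -/
lemma int_of_contOn {D K : Set (Cn N)} (hK : IsCompact K) (hD : IsOpen D) (hKD : K ⊆ D) {F : Type*}
    [NormedAddCommGroup F] {f : Cn N → F} (hf : ContinuousOn f D)
    (h0 : ∀ x, x ∉ K → f x = 0) : Integrable f := by
  have hs : tsupport f ⊆ K := closure_minimal (fun x hx => by by_contra h; exact hx (h0 x h)) hK.isClosed
  have hc : Continuous f := by
    rw [continuous_iff_continuousAt]
    intro x
    by_cases hx : x ∈ K
    · exact hf.continuousAt (hD.mem_nhds (hKD hx))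
    · have : f =ᶠ[𝓝 x] fun _ => 0 := by
        filter_upwards [hK.isClosed.isOpen_compl.mem_nhds hx] with y hy using h0 y hy
      exact continuousAt_const.congr this.symm
  exact hc.integrable_of_hasCompactSupport (hK.of_isClosed_subset (isClosed_tsupport _) hs)

lemma basic_ineq_loc {D K : Set (Cn N)} (hK : IsCompact K) (hD : IsOpen D) (hKD : K ⊆ D)
    {Φ : Cn N → ℝ} (hΦ : ContDiffOn ℝ ∞ Φ D) {β : Fin N → Cn N → ℂ}
    (hβ : ∀ j, ContDiff ℝ ∞ (β j)) (hc : ∀ j, tsupport (β j) ⊆ K) :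
    ∫ x, levi Φ x (fun j => β j x) * Real.exp (-Φ x) ≤
      (∫ x, ‖∑ j, dD Φ j (β j) x‖^2 * Real.exp (-Φ x)) +
      ∫ x, ((1/2) * ∑ j, ∑ k, ‖db j (β k) x - db k (β j) x‖^2) * Real.exp (-Φ x) := by
  obtain ⟨Ψ, h1, h2⟩ := exists_ext hK hD hKD hΦ
  have := basic_ineq h1 hβ (fun j => hK.of_isClosed_subset (isClosed_tsupport _) (hc j))
  have b0 : ∀ x, x ∉ K → (fun j => β j x) = 0 := fun x hx => by
    ext j; exact image_eq_zero_of_notMem_tsupport fun h => hx (hc j h)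
  have bz : ∀ x, x ∉ K → ∀ j k, dz j (β k) x = 0 := fun x hx j k =>
    dz_eq_zero fun h => hx (hc k h)
  have bb : ∀ x, x ∉ K → ∀ j k, db j (β k) x = 0 := fun x hx j k =>
    db_eq_zero fun h => hx (hc k h)
  convert this using 2
  · ext x
    by_cases hx : x ∈ K
    · rw [levi_congr (h2 x hx), (h2 x hx).self_of_nhds]
    · rw [b0 x hx, levi_zero, levi_zero]; simp
  · congr 1; ext x
    by_cases hx : x ∈ K
    · simp only [dD_congr (h2 x hx), (h2 x hx).self_of_nhds]
    · have := fun j => congrFun (b0 x hx) j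
      simp only [Pi.zero_apply] at this
      simp [dD, bz x hx, this]
  · congr 1; ext x
    by_cases hx : x ∈ K
    · simp only [(h2 x hx).self_of_nhds]
    · simp [bb x hx]

end BP

namespace BP
open Filter Topology
set_option linter.all false
open scoped ContDiff ComplexConjugate
variable {N : ℕ}

lemma contOn_levi {D : Set (Cn N)} (hD : IsOpen D) {Φ : Cn N → ℝ} (hΦ : ContDiffOn ℝ ∞ Φ D)
    {b : Cn N → Cn N} (hb : ContinuousOn b D) : ContinuousOn (fun x => levi Φ x (b x)) D := by
  have h1 : ContDiffOn ℝ ∞ (fderiv ℝ Φ) D := hΦ.fderiv_of_isOpen hD (by simp)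
  have h2 : ContinuousOn (fderiv ℝ (fderiv ℝ Φ)) D := h1.continuousOn_fderiv_of_isOpen hD (by simp)
  have hI : ContinuousOn (fun x => I • b x) D := hb.const_smul I
  unfold levi D2
  exact continuousOn_const.mul (((h2.clm_apply hb).clm_apply hb).add
    ((h2.clm_apply hI).clm_apply hI))

lemma contOn_gr {D : Set (Cn N)} (hD : IsOpen D) {Φ : Cn N → ℝ} (hΦ : ContDiffOn ℝ ∞ Φ D)
    {b : Cn N → Cn N} (hb : ContinuousOn b D) : ContinuousOn (fun x => gr Φ x (b x)) D := by
  have h2 : ContinuousOn (fderiv ℝ Φ) D := hΦ.continuousOn_fderiv_of_isOpen hD (by simp)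
  have hI : ContinuousOn (fun x => I • b x) D := hb.const_smul I
  unfold gr
  exact continuousOn_const.mul (((h2.clm_apply hb).pow 2).add ((h2.clm_apply hI).pow 2))

lemma norm_sub_sq_le {s : ℝ} (hs : 0 < s) (X Y : ℂ) :
    ‖X - Y‖^2 ≤ (1 + 1/s) * ‖X‖^2 + (1 + s) * ‖Y‖^2 := by
  have h1 : ‖X - Y‖^2 ≤ (‖X‖ + ‖Y‖)^2 := by gcongr; exact norm_sub_le X Y
  have h2 : 2 * ‖X‖ * ‖Y‖ ≤ (1/s) * ‖X‖^2 + s * ‖Y‖^2 := by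
    have : 0 ≤ (1/s) * (‖X‖ - s * ‖Y‖)^2 := by positivity
    have e : (1/s) * (‖X‖ - s * ‖Y‖)^2 = (1/s) * ‖X‖^2 - 2 * ‖X‖ * ‖Y‖ + s * ‖Y‖^2 := by
      field_simp
      ring
    linarith
  nlinarith

lemma twisted {D K : Set (Cn N)} (hK : IsCompact K) (hD : IsOpen D) (hKD : K ⊆ D)
    {Φ σ s p : Cn N → ℝ} (hΦ : ContDiffOn ℝ ∞ Φ D) (hσ : ContDiffOn ℝ ∞ σ D)
    (hs : ContinuousOn s D) (hp : ContinuousOn p D) (hs0 : ∀ x ∈ D, 0 < s x) (i0 : Fin N)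
    (hL : ∀ x ∈ D, ∀ b : Cn N, p x * ‖b i0‖^2 ≤ levi Φ x b - (1 + s x) * gr σ x b)
    {β : Fin N → Cn N → ℂ} (hβ : ∀ j, ContDiff ℝ ∞ (β j)) (hc : ∀ j, tsupport (β j) ⊆ K) :
    ∫ x in K, p x * Real.exp (-Φ x) * ‖β i0 x‖^2 ≤
      (∫ x in K, (1 + 1 / s x) * Real.exp (-Φ x) *
        ‖∑ j, dz j (β j) x - ∑ j, dz j (fun y => ((Φ y - σ y : ℝ) : ℂ)) x * β j x‖^2) +
      ∑ j, ∑ k, (1/2) * ∫ x in K, Real.exp (-Φ x) * ‖db j (β k) x - db k (β j) x‖^2 := by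
  have hm := basic_ineq_loc hK hD hKD hΦ hβ hc
  have b0 : ∀ x, x ∉ K → (fun j => β j x) = 0 := fun x hx => by
    ext j; exact image_eq_zero_of_notMem_tsupport fun h => hx (hc j h)
  have b0' : ∀ x, x ∉ K → ∀ j, β j x = 0 := fun x hx j => congrFun (b0 x hx) j
  have bz : ∀ x, x ∉ K → ∀ j k, dz j (β k) x = 0 := fun x hx j k =>
    dz_eq_zero fun h => hx (hc k h)
  have bb : ∀ x, x ∉ K → ∀ j k, db j (β k) x = 0 := fun x hx j k =>
    db_eq_zero fun h => hx (hc k h)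
  have cb : ContinuousOn (fun x => fun j => β j x) D :=
    (continuous_pi fun j => (hβ j).continuous).continuousOn
  have ce : ContinuousOn (fun x => Real.exp (-Φ x)) D := (hΦ.continuousOn.neg).rexp
  have hφ2 : ContDiffOn ℝ ∞ (fun y => ((Φ y - σ y : ℝ) : ℂ)) D :=
    ofRealCLM.contDiff.comp_contDiffOn (hΦ.sub hσ)
  set X : Cn N → ℂ := fun x => ∑ j, dz j (β j) x -
    ∑ j, dz j (fun y => ((Φ y - σ y : ℝ) : ℂ)) x * β j x with hX
  have cX : ContinuousOn X D := by
    refine (continuousOn_finset_sum _ fun j _ => (cd_dz (hβ j) j).continuous.continuousOn).sub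
      (continuousOn_finset_sum _ fun j _ => ContinuousOn.mul ?_ (hβ j).continuous.continuousOn)
    exact (contDiffOn_dz (n := ⊤) (m := ⊤) hD hφ2 (by simp)).continuousOn
  have cS : ContinuousOn (fun x => 1 + 1 / s x) D :=
    continuousOn_const.add (continuousOn_const.div hs fun x hx => (hs0 x hx).ne')
  have iL : Integrable fun x => levi Φ x (fun j => β j x) * Real.exp (-Φ x) :=
    int_of_contOn hK hD hKD ((contOn_levi hD hΦ cb).mul ce) fun x hx => by
      rw [b0 x hx, levi_zero, zero_mul]
  have iG : Integrable fun x => (1 + s x) * gr σ x (fun j => β j x) * Real.exp (-Φ x) :=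
    int_of_contOn hK hD hKD (((continuousOn_const.add hs).mul (contOn_gr hD hσ cb)).mul ce) fun x hx => by
      rw [b0 x hx, gr_zero]; simp
  have iP : Integrable fun x => p x * Real.exp (-Φ x) * ‖β i0 x‖^2 :=
    int_of_contOn hK hD hKD ((hp.mul ce).mul ((hβ i0).continuous.norm.pow 2).continuousOn) fun x hx => by
      simp [b0' x hx]
  have iX : Integrable fun x => (1 + 1 / s x) * Real.exp (-Φ x) * ‖X x‖^2 :=
    int_of_contOn hK hD hKD ((cS.mul ce).mul (cX.norm.pow 2)) fun x hx => by
      simp [hX, bz x hx, b0' x hx]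
  have iY : ∀ j k, Integrable fun x => Real.exp (-Φ x) * ‖db j (β k) x - db k (β j) x‖^2 := fun j k =>
    int_of_contOn hK hD hKD (ce.mul (((cd_db (hβ k) j).continuous.sub
      (cd_db (hβ j) k).continuous).norm.pow 2).continuousOn) fun x hx => by
      simp [bb x hx]
  have iD : Integrable fun x => ‖∑ j, dD Φ j (β j) x‖^2 * Real.exp (-Φ x) := by
    refine int_of_contOn hK hD hKD (ContinuousOn.mul (ContinuousOn.pow (ContinuousOn.norm
      (continuousOn_finset_sum _ fun j _ => ?_)) 2) ce) fun x hx => by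
        simp [dD, bz x hx, b0' x hx]
    refine (cd_dz (hβ j) j).continuous.continuousOn.sub (ContinuousOn.mul ?_ (hβ j).continuous.continuousOn)
    exact (contDiffOn_dz (n := ⊤) (m := ⊤) hD (ofRealCLM.contDiff.comp_contDiffOn hΦ) (by simp)).continuousOn
  have sK : ∀ f : Cn N → ℝ, (∀ x, x ∉ K → f x = 0) → ∫ x in K, f x = ∫ x, f x := fun f hf =>
    setIntegral_eq_integral_of_forall_compl_eq_zero hf
  rw [sK _ fun x hx => by simp [b0' x hx], sK _ fun x hx => by simp [hX, bz x hx, b0' x hx]]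
  have eY : ∀ j k, ∫ x in K, Real.exp (-Φ x) * ‖db j (β k) x - db k (β j) x‖^2 =
     ∫ x, Real.exp (-Φ x) * ‖db j (β k) x - db k (β j) x‖^2 := fun j k => sK _ fun x hx => by simp [bb x hx]
  simp only [eY]
  have e3 : ∫ x, ((1/2) * ∑ j, ∑ k, ‖db j (β k) x - db k (β j) x‖^2) * Real.exp (-Φ x) =
      ∑ j, ∑ k, (1/2) * ∫ x, Real.exp (-Φ x) * ‖db j (β k) x - db k (β j) x‖^2 := by
    have : ∀ x, ((1/2) * ∑ j, ∑ k, ‖db j (β k) x - db k (β j) x‖^2) * Real.exp (-Φ x) =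
      ∑ j, ∑ k, (1/2) * (Real.exp (-Φ x) * ‖db j (β k) x - db k (β j) x‖^2) := fun x => by
      simp only [Finset.mul_sum, Finset.sum_mul]
      exact Finset.sum_congr rfl fun j _ => Finset.sum_congr rfl fun k _ => by ring
    simp only [this]
    rw [integral_finset_sum _ fun j _ => integrable_finset_sum _ fun k _ => (iY j k).const_mul _]
    refine Finset.sum_congr rfl fun j _ => ?_
    rw [integral_finset_sum _ fun k _ => (iY j k).const_mul _]
    refine Finset.sum_congr rfl fun k _ => ?_
    rw [integral_const_mul]
  rw [← e3]
  have m1 : ∫ x, p x * Real.exp (-Φ x) * ‖β i0 x‖^2 ≤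
      ∫ x, (levi Φ x (fun j => β j x) * Real.exp (-Φ x) -
        (1 + s x) * gr σ x (fun j => β j x) * Real.exp (-Φ x)) := by
    refine integral_mono iP (iL.sub iG) fun x => ?_
    by_cases hx : x ∈ K
    · have := mul_le_mul_of_nonneg_right (hL x (hKD hx) (fun j => β j x)) (Real.exp_pos (-Φ x)).le
      simp only at this ⊢
      nlinarith
    · have q := b0 x hx
      simp only [q, b0' x hx i0, levi_zero, gr_zero]; simp
  rw [integral_sub iL iG] at m1
  have m2 : ∫ x, ‖∑ j, dD Φ j (β j) x‖^2 * Real.exp (-Φ x) ≤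
      ∫ x, ((1 + 1 / s x) * Real.exp (-Φ x) * ‖X x‖^2 +
        (1 + s x) * gr σ x (fun j => β j x) * Real.exp (-Φ x)) := by
    refine integral_mono iD (iX.add iG) fun x => ?_
    by_cases hx : x ∈ K
    · have hxD := hKD hx
      have dσ : DifferentiableAt ℝ σ x := (hσ.contDiffAt (hD.mem_nhds hxD)).differentiableAt (by simp)
      have dΦ : DifferentiableAt ℝ Φ x := (hΦ.contDiffAt (hD.mem_nhds hxD)).differentiableAt (by simp)
      have eq : ∑ j, dD Φ j (β j) x = X x - ∑ j, dz j (fun y => (σ y : ℂ)) x * β j x := by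
        have e2 : ∀ j, dz j (fun y => ((Φ y - σ y : ℝ) : ℂ)) x =
           dz j (fun y => (Φ y : ℂ)) x - dz j (fun y => (σ y : ℂ)) x := fun j => by
          rw [← dz_sub (f := fun y => (Φ y : ℂ)) (g := fun y => (σ y : ℂ))
            (ofRealCLM.differentiableAt.comp x dΦ) (ofRealCLM.differentiableAt.comp x dσ)]
          simp only [ofReal_sub]
        simp only [hX, dD, e2, sub_mul, Finset.sum_sub_distrib]; ring
      have h := norm_sub_sq_le (hs0 x hxD) (X x) (∑ j, dz j (fun y => (σ y : ℂ)) x * β j x)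
      rw [gr_eq dσ (fun j => β j x)] at h
      rw [← eq] at h
      have := mul_le_mul_of_nonneg_right h (Real.exp_pos (-Φ x)).le
      simp only at this ⊢
      nlinarith
    · have q := b0 x hx
      have q2 : X x = 0 := by simp [hX, bz x hx, b0' x hx]
      have q3 : ∑ j, dD Φ j (β j) x = 0 := by simp [dD, bz x hx, b0' x hx]
      simp only [q, q2, q3, gr_zero]; simp
  rw [integral_add iX iG] at m2
  linarith

end BP

namespace BP
open Filter Topology
set_option linter.all false
open scoped ContDiff ComplexConjugate
variable {N : ℕ}

/-- squared Euclidean norm -/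
def nsq (x : Cn N) : ℝ := ∑ j, ‖x j‖^2

lemma contDiff_nsq : ContDiff ℝ ∞ (nsq : Cn N → ℝ) := by
  unfold nsq
  refine ContDiff.sum fun j _ => ContDiff.norm_sq ℝ ?_
  exact contDiff_apply ℝ ℂ j

/-- un-normalized bump -/
def chi0 (δ : ℝ) (x : Cn N) : ℝ := Real.smoothTransition (1 - nsq x / δ^2)
/-- rotation invariant mollifier -/
def chi (δ : ℝ) (x : Cn N) : ℝ := chi0 δ x / ∫ y : Cn N, chi0 δ y

lemma cd_chi0 (δ : ℝ) : ContDiff ℝ ∞ (chi0 δ : Cn N → ℝ) :=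
  (Real.smoothTransition.contDiff (n := ⊤)).comp (contDiff_const.sub (contDiff_nsq.div_const _))

lemma cd_chi (δ : ℝ) : ContDiff ℝ ∞ (chi δ : Cn N → ℝ) := (cd_chi0 δ).div_const _

lemma chi0_nonneg (δ : ℝ) (x : Cn N) : 0 ≤ chi0 δ x := Real.smoothTransition.nonneg _

lemma chi_nonneg (δ : ℝ) (x : Cn N) : 0 ≤ chi δ x :=
  div_nonneg (chi0_nonneg _ _) (integral_nonneg fun x => chi0_nonneg _ _)

lemma supp_chi0 {δ : ℝ} (hδ : 0 < δ) {x : Cn N} (hx : x ∉ Metric.closedBall (0 : Cn N) δ) : chi0 δ x = 0 := by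
  apply Real.smoothTransition.zero_of_nonpos
  rw [mem_closedBall_zero_iff, pi_norm_le_iff_of_nonneg hδ.le] at hx
  push Not at hx
  obtain ⟨j, hj⟩ := hx
  have h1 : ‖x j‖^2 ≤ nsq x := Finset.single_le_sum (f := fun j => ‖x j‖^2) (fun i _ => by positivity) (Finset.mem_univ j)
  have : 1 ≤ nsq x / δ^2 := by
    rw [le_div_iff₀ (by positivity)]
    nlinarith
  linarith

lemma hcs_chi0 {δ : ℝ} (hδ : 0 < δ) : HasCompactSupport (chi0 δ : Cn N → ℝ) :=
  HasCompactSupport.intro (isCompact_closedBall 0 δ) fun x hx => supp_chi0 hδ hx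

lemma int_chi0_pos {δ : ℝ} (hδ : 0 < δ) : 0 < ∫ y : Cn N, chi0 δ y :=
  (cd_chi0 δ).continuous.integral_pos_of_hasCompactSupport_nonneg_nonzero (hcs_chi0 hδ)
    (fun x => chi0_nonneg δ x) (x := 0) (by simp [chi0, nsq])

lemma supp_chi {δ : ℝ} (hδ : 0 < δ) {x : Cn N} (hx : x ∉ Metric.closedBall (0 : Cn N) δ) : chi δ x = 0 := by
  simp [chi, supp_chi0 hδ hx]

lemma hcs_chi {δ : ℝ} (hδ : 0 < δ) : HasCompactSupport (chi δ : Cn N → ℝ) :=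
  HasCompactSupport.intro (isCompact_closedBall 0 δ) fun x hx => supp_chi hδ hx

lemma int_chi {δ : ℝ} (hδ : 0 < δ) : ∫ y : Cn N, chi δ y = 1 := by
  unfold chi
  rw [integral_div, div_self (int_chi0_pos hδ).ne']

lemma integrable_chi {δ : ℝ} (hδ : 0 < δ) : Integrable (chi δ : Cn N → ℝ) :=
  (cd_chi δ).continuous.integrable_of_hasCompactSupport (hcs_chi hδ)

lemma lint_chi {δ : ℝ} (hδ : 0 < δ) : ∫⁻ y : Cn N, ENNReal.ofReal (chi δ y) = 1 := by
  rw [← ofReal_integral_eq_lintegral_ofReal (integrable_chi hδ) (ae_of_all _ fun x => chi_nonneg _ _),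
    int_chi hδ, ENNReal.ofReal_one]

lemma chi_smul (δ : ℝ) {c : ℂ} (hc : ‖c‖ = 1) (x : Cn N) : chi δ (c • x) = chi δ x := by
  have : nsq (c • x) = nsq x := by simp [nsq, hc]
  simp [chi, chi0, this]

lemma chi_neg (δ : ℝ) (x : Cn N) : chi δ (-x) = chi δ x := by
  have := chi_smul δ (c := -1) (by simp) x
  simpa using this

lemma mp_smul {c : ℂ} (hc : ‖c‖ = 1) : MeasurePreserving (fun x : Cn N => c • x) volume volume := by
  have h := volume_preserving_pi (α' := fun _ : Fin N => ℂ) (β' := fun _ : Fin N => ℂ)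
    (f := fun _ z => c * z) (fun _ =>
    (rotation ⟨c, by simp [Submonoid.unitSphere, hc]⟩).measurePreserving)
  exact h

/-- complexified mollifier -/
def chiC (δ : ℝ) (x : Cn N) : ℂ := (chi δ x : ℂ)
lemma cd_chiC (δ : ℝ) : ContDiff ℝ ∞ (chiC δ : Cn N → ℂ) := cd_ofReal (cd_chi δ)
lemma supp_chiC {δ : ℝ} (hδ : 0 < δ) {x : Cn N} (hx : x ∉ Metric.closedBall (0 : Cn N) δ) : chiC δ x = 0 := by
  simp [chiC, supp_chi hδ hx]
lemma hcs_chiC {δ : ℝ} (hδ : 0 < δ) : HasCompactSupport (chiC δ : Cn N → ℂ) :=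
  HasCompactSupport.intro (isCompact_closedBall 0 δ) fun x hx => supp_chiC hδ hx
lemma tsupp_chiC {δ : ℝ} (hδ : 0 < δ) : tsupport (chiC δ : Cn N → ℂ) ⊆ Metric.closedBall 0 δ :=
  closure_minimal (fun x hx => by by_contra h; exact hx (supp_chiC hδ h)) Metric.isClosed_closedBall

/-- mollification -/
def moll (δ : ℝ) (f : Cn N → ℂ) (x : Cn N) : ℂ := ∫ w, chiC δ (x - w) * f w

lemma moll_eq_conv (δ : ℝ) (f : Cn N → ℂ) :
    moll δ f = convolution (chiC δ) f (ContinuousLinearMap.mul ℝ ℂ) volume := by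
  ext x; rw [convolution_eq_swap]; rfl

lemma moll_eq (δ : ℝ) (f : Cn N → ℂ) (x : Cn N) : moll δ f x = ∫ w, chiC δ w * f (x - w) := by
  rw [moll_eq_conv]; rfl

lemma cd_moll {δ : ℝ} (hδ : 0 < δ) {f : Cn N → ℂ} (hf : LocallyIntegrable f) : ContDiff ℝ ∞ (moll δ f) := by
  rw [moll_eq_conv]
  exact (hcs_chiC hδ).contDiff_convolution_left (n := ⊤) _ (cd_chiC δ) hf

lemma fderiv_moll {δ : ℝ} (hδ : 0 < δ) {f : Cn N → ℂ} (hf : LocallyIntegrable f) (x v : Cn N) :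
    fderiv ℝ (moll δ f) x v = ∫ w, fderiv ℝ (chiC δ) (x - w) v * f w := by
  rw [moll_eq_conv, ((hcs_chiC hδ).hasFDerivAt_convolution_left _ (cd_le1 (cd_chiC δ)) hf x).fderiv,
    convolution_eq_swap, ContinuousLinearMap.integral_apply]
  · rfl
  · have := ((hcs_chiC (N := N) hδ).fderiv ℝ).convolutionExists_left ((ContinuousLinearMap.mul ℝ ℂ).precompL (Cn N))
      ((cd_chiC δ).continuous_fderiv (by simp)) hf x
    exact this.integrable_swap

lemma moll_supp {δ : ℝ} (hδ : 0 < δ) {f : Cn N → ℂ} {K : Set (Cn N)} (hf : ∀ x, x ∉ K → f x = 0)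
    {x : Cn N} (hx : x ∉ Metric.cthickening δ K) : moll δ f x = 0 := by
  unfold moll
  rw [integral_eq_zero_of_ae]
  refine ae_of_all _ fun w => ?_
  by_cases hw : w ∈ K
  · have : x - w ∉ Metric.closedBall (0 : Cn N) δ := fun h => hx
      (Metric.mem_cthickening_of_dist_le x w δ K hw (by simpa [dist_eq_norm] using h))
    simp [supp_chiC hδ this]
  · simp [hf w hw]

lemma int_dchi {δ : ℝ} (hδ : 0 < δ) {f : Cn N → ℂ} (hf : LocallyIntegrable f) (x v : Cn N) :
    Integrable fun w => fderiv ℝ (chiC δ) (x - w) v * f w := by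
  have hc : HasCompactSupport fun w => fderiv ℝ (chiC δ : Cn N → ℂ) w v :=
    ((hcs_chiC (N := N) hδ).fderiv ℝ).comp_left (g := fun L : Cn N →L[ℝ] ℂ => L v) (by simp)
  have := hc.convolutionExists_left (ContinuousLinearMap.mul ℝ ℂ)
    (((cd_chiC δ).continuous_fderiv (by simp)).clm_apply continuous_const) hf x
  exact this.integrable_swap

lemma db_moll {δ : ℝ} (hδ : 0 < δ) {f : Cn N → ℂ} (hf : LocallyIntegrable f) (j : Fin N) (x : Cn N) :
    db j (moll δ f) x = ∫ w, db j (chiC δ) (x - w) * f w := by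
  simp only [db, fderiv_moll hδ hf]
  rw [← integral_const_mul, ← integral_add (int_dchi hδ hf _ _) ((int_dchi hδ hf _ _).const_mul _),
    ← integral_const_mul]
  congr 1; ext w; ring

lemma dz_moll {δ : ℝ} (hδ : 0 < δ) {f : Cn N → ℂ} (hf : LocallyIntegrable f) (j : Fin N) (x : Cn N) :
    dz j (moll δ f) x = ∫ w, dz j (chiC δ) (x - w) * f w := by
  simp only [dz, fderiv_moll hδ hf]
  rw [← integral_const_mul, ← integral_sub (int_dchi hδ hf _ _) ((int_dchi hδ hf _ _).const_mul _),
    ← integral_const_mul]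
  congr 1; ext w; ring

/-- the test function `w ↦ χ_δ(x-w)` -/
def tst (δ : ℝ) (x : Cn N) (w : Cn N) : ℂ := chiC δ (x - w)
lemma cd_tst (δ : ℝ) (x : Cn N) : ContDiff ℝ ∞ (tst δ x) := (cd_chiC δ).comp (contDiff_const.sub contDiff_id)
lemma supp_tst {δ : ℝ} (hδ : 0 < δ) (x : Cn N) : tsupport (tst δ x) ⊆ Metric.closedBall x δ := by
  refine closure_minimal (fun w hw => ?_) Metric.isClosed_closedBall
  by_contra h
  exact hw (supp_chiC hδ (by simpa [dist_eq_norm, norm_sub_rev] using h))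
lemma hcs_tst {δ : ℝ} (hδ : 0 < δ) (x : Cn N) : HasCompactSupport (tst δ x) :=
  (isCompact_closedBall x δ).of_isClosed_subset (isClosed_tsupport _) (supp_tst hδ x)
lemma fderiv_tst (δ : ℝ) (x w v : Cn N) : fderiv ℝ (tst δ x) w v = - fderiv ℝ (chiC δ) (x - w) v := by
  have h : HasFDerivAt (tst δ x) ((fderiv ℝ (chiC δ) (x - w)).comp (-ContinuousLinearMap.id ℝ (Cn N))) w :=
    ((cd_diff (cd_chiC δ) (x - w)).hasFDerivAt).comp w ((hasFDerivAt_id w).const_sub x)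
  rw [h.fderiv]; simp
lemma db_tst (δ : ℝ) (j : Fin N) (x w : Cn N) : db j (tst δ x) w = - db j (chiC δ) (x - w) := by
  simp only [db, fderiv_tst]; ring
lemma dz_tst (δ : ℝ) (j : Fin N) (x w : Cn N) : dz j (tst δ x) w = - dz j (chiC δ) (x - w) := by
  simp only [dz, fderiv_tst]; ring
lemma db_moll' {δ : ℝ} (hδ : 0 < δ) {f : Cn N → ℂ} (hf : LocallyIntegrable f) (j : Fin N) (x : Cn N) :
    db j (moll δ f) x = - ∫ w, db j (tst δ x) w * f w := by
  rw [db_moll hδ hf, ← integral_neg]; congr 1; ext w; rw [db_tst]; ring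
lemma dz_moll' {δ : ℝ} (hδ : 0 < δ) {f : Cn N → ℂ} (hf : LocallyIntegrable f) (j : Fin N) (x : Cn N) :
    dz j (moll δ f) x = - ∫ w, dz j (tst δ x) w * f w := by
  rw [dz_moll hδ hf, ← integral_neg]; congr 1; ext w; rw [dz_tst]; ring

end BP

namespace BP
open Filter Topology
set_option linter.all false
open scoped ContDiff ComplexConjugate
variable {N : ℕ}

lemma db_of_hol {f : Cn N → ℂ} {x : Cn N} (h : DifferentiableAt ℂ f x) (j : Fin N) : db j f x = 0 := by
  have e : fderiv ℝ f x = (fderiv ℂ f x).restrictScalars ℝ := h.fderiv_restrictScalars ℝ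
  simp only [db, e, ContinuousLinearMap.coe_restrictScalars', ← I_smul_e1, map_smul, smul_eq_mul]
  ring_nf; simp

lemma hol_of_db {f : Cn N → ℂ} {x : Cn N} (h : DifferentiableAt ℝ f x) (h0 : ∀ j, db j f x = 0) :
    DifferentiableAt ℂ f x := by
  rw [differentiableAt_iff_restrictScalars ℝ h]
  set L := fderiv ℝ f x with hL
  refine ⟨∑ j, (ContinuousLinearMap.proj (R := ℂ) (φ := fun _ : Fin N => ℂ) j).smulRight (L (e1 j)), ?_⟩
  have hI : ∀ j, L (eI j) = I * L (e1 j) := fun j => by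
    have := h0 j
    simp only [db, ← hL] at this
    have h2 : L (e1 j) + I * L (eI j) = 0 := by linear_combination 2 * this
    linear_combination (-I) * h2 + L (eI j) * I_mul_I
  ext v
  conv_rhs => rw [pi_eq_sum v, map_sum]
  simp only [ContinuousLinearMap.coe_restrictScalars', ContinuousLinearMap.sum_apply,
    ContinuousLinearMap.smulRight_apply, ContinuousLinearMap.proj_apply]
  refine Finset.sum_congr rfl fun j _ => ?_
  rw [csmul_eq (v j) (e1 j), map_add, map_smul, map_smul, I_smul_e1, hI]
  simp only [smul_eq_mul, real_smul]
  linear_combination (-(L (e1 j))) * re_add_im (v j)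

/-- unit complex number -/
def un (θ : ℝ) : ℂ := Complex.exp (θ * I)
lemma norm_un (θ : ℝ) : ‖un θ‖ = 1 := Complex.norm_exp_ofReal_mul_I θ
lemma cont_un : Continuous un := by unfold un; fun_prop

lemma line_mean {f : Cn N → ℂ} {U : Set (Cn N)} (hU : IsOpen U) (hf : DifferentiableOn ℂ f U) {x : Cn N} {δ : ℝ}
    (hx : Metric.closedBall x δ ⊆ U) {w : Cn N} (hw : w ∈ Metric.closedBall (0 : Cn N) δ) :
    ∫ θ in Ioc 0 (2 * Real.pi), f (x - un θ • w) = (2 * Real.pi) * f x := by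
  have hd : DifferentiableOn ℂ (fun ζ : ℂ => f (x - ζ • w)) (Metric.closedBall 0 1) := by
    refine hf.comp (by fun_prop) fun ζ hζ => hx ?_
    rw [mem_closedBall_zero_iff] at hw hζ
    rw [Metric.mem_closedBall, dist_eq_norm]
    have : x - ζ • w - x = -(ζ • w) := by abel
    rw [this, norm_neg, norm_smul]
    nlinarith [norm_nonneg w, norm_nonneg ζ]
  have h := (hd.mono Metric.closure_ball_subset_closedBall).diffContOnCl
  have h2 := DiffContOnCl.circleAverage (f := fun ζ : ℂ => f (x - ζ • w)) (c := 0) (R := 1) (by simpa using h)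
  rw [Real.circleAverage, intervalIntegral.integral_of_le (by positivity)] at h2
  simp only [circleMap, zero_add, ofReal_one, one_mul, zero_smul, sub_zero] at h2
  rw [← h2]
  simp only [un]
  rw [real_smul, ← mul_assoc]
  have : (2 * Real.pi : ℂ) * (((2 * Real.pi)⁻¹ : ℝ) : ℂ) = 1 := by
    have hp : (Real.pi : ℂ) ≠ 0 := by exact_mod_cast Real.pi_ne_zero
    push_cast
    field_simp
  rw [this, one_mul]

lemma moll_hol {f : Cn N → ℂ} {U : Set (Cn N)} (hU : IsOpen U) (hf : DifferentiableOn ℂ f U) {x : Cn N} {δ : ℝ}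
    (hδ : 0 < δ) (hx : Metric.closedBall x δ ⊆ U) : moll δ f x = f x := by
  rw [moll_eq]
  set h : Cn N → ℂ := fun w => chiC δ w * f (x - w) with hh
  have hs : ∀ w, w ∉ Metric.closedBall (0 : Cn N) δ → h w = 0 := fun w hw => by simp [hh, supp_chiC hδ hw]
  have hcb : ContinuousOn h (Metric.closedBall 0 δ) := by
    refine (cd_chiC δ).continuous.continuousOn.mul (hf.continuousOn.comp (by fun_prop) fun w hw => hx ?_)
    simpa [dist_eq_norm] using hw
  have hrot : ∀ θ, ∫ w in Metric.closedBall (0 : Cn N) δ, h (un θ • w) = ∫ w, h w := fun θ => by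
    rw [setIntegral_eq_integral_of_forall_compl_eq_zero fun w hw => hs _ (by
      rw [mem_closedBall_zero_iff] at hw ⊢; rwa [norm_smul, norm_un, one_mul])]
    exact (mp_smul (norm_un θ)).integral_comp
      (measurableEmbedding_const_smul₀ (by simp [un])) h
  have hI : Integrable (Function.uncurry fun (θ : ℝ) (w : Cn N) => h (un θ • w))
      ((volume.restrict (Ioc 0 (2 * Real.pi))).prod (volume.restrict (Metric.closedBall (0 : Cn N) δ))) := by
    rw [Measure.prod_restrict]
    have : IntegrableOn (Function.uncurry fun (θ : ℝ) (w : Cn N) => h (un θ • w))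
      (Icc 0 (2 * Real.pi) ×ˢ Metric.closedBall (0 : Cn N) δ) (volume.prod volume) := by
      refine ContinuousOn.integrableOn_compact (isCompact_Icc.prod (isCompact_closedBall _ _)) ?_
      refine hcb.comp (Continuous.continuousOn ?_) fun p hp => ?_
      · exact (cont_un.comp continuous_fst).smul continuous_snd
      · have := hp.2
        rw [mem_closedBall_zero_iff] at this ⊢; rwa [norm_smul, norm_un, one_mul]
    exact this.mono_set (Set.prod_mono Ioc_subset_Icc_self le_rfl)
  have sw := integral_integral_swap hI
  simp only [hrot] at sw
  rw [integral_const] at sw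
  have e : ∫ w in Metric.closedBall (0 : Cn N) δ, ∫ θ in Ioc 0 (2 * Real.pi), h (un θ • w) =
      ∫ w in Metric.closedBall (0 : Cn N) δ, chiC δ w * ((2 * Real.pi) * f x) := by
    refine setIntegral_congr_fun measurableSet_closedBall fun w hw => ?_
    simp only [hh, chiC, chi_smul δ (norm_un _)]
    rw [integral_const_mul, line_mean hU hf hx hw]
  rw [e, setIntegral_eq_integral_of_forall_compl_eq_zero fun w hw => by simp [supp_chiC hδ hw],
    integral_mul_const] at sw
  have e2 : ∫ w : Cn N, chiC δ w = 1 := by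
    simp only [chiC]; rw [integral_complex_ofReal, int_chi hδ, ofReal_one]
  rw [e2] at sw
  simp at sw
  have hp : (Real.pi : ℂ) ≠ 0 := by exact_mod_cast Real.pi_ne_zero
  have e3 : max (2 * Real.pi) 0 = 2 * Real.pi := max_eq_left (by positivity)
  try rw [e3] at sw
  have : (2 * Real.pi : ℂ) * (∫ w, h w) = (2 * Real.pi : ℂ) * f x := by
    simpa using sw
  exact mul_left_cancel₀ (by simpa using hp) this

lemma moll_congr {δ : ℝ} (hδ : 0 < δ) {f g : Cn N → ℂ} {x : Cn N}
    (h : ∀ w ∈ Metric.closedBall x δ, f w = g w) : moll δ f x = moll δ g x := by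
  unfold moll
  congr 1; ext w
  by_cases hw : w ∈ Metric.closedBall x δ
  · rw [h w hw]
  · rw [supp_chiC hδ (x := x - w) (by simpa [dist_eq_norm, norm_sub_rev] using hw)]; simp

lemma hol_smooth {f : Cn N → ℂ} {U : Set (Cn N)} (hU : IsOpen U) (hf : DifferentiableOn ℂ f U) :
    ContDiffOn ℝ ∞ f U := by
  intro x hx
  obtain ⟨ε, hε, hb⟩ := Metric.isOpen_iff.1 hU x hx
  set δ := ε / 4
  have hδ : 0 < δ := by positivity
  have hb2 : Metric.closedBall x (2 * δ) ⊆ U := (Metric.closedBall_subset_ball (by simp only [δ]; linarith)).trans hb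
  set g := (Metric.closedBall x (2 * δ)).indicator f
  have hg : Integrable g := by
    rw [integrable_indicator_iff measurableSet_closedBall]
    exact (hf.continuousOn.mono hb2).integrableOn_compact (isCompact_closedBall _ _)
  have e : f =ᶠ[𝓝 x] moll δ g := by
    filter_upwards [Metric.ball_mem_nhds x hδ] with y hy
    have hs : Metric.closedBall y δ ⊆ Metric.closedBall x (2 * δ) :=
      Metric.closedBall_subset_closedBall' (by rw [Metric.mem_ball] at hy; linarith)
    rw [← moll_hol hU hf hδ (hs.trans hb2)]
    exact moll_congr hδ fun w hw => by simp [g, indicator_of_mem (hs hw)]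
  exact ((cd_moll hδ hg.locallyIntegrable).contDiffAt.congr_of_eventuallyEq e).contDiffWithinAt

end BP

namespace BP
open Filter Topology
set_option linter.all false
open scoped ContDiff ComplexConjugate
variable {N : ℕ}

lemma loc_of_memLp {f : Cn N → ℂ} (hf : MemLp f 2) : LocallyIntegrable f :=
  hf.locallyIntegrable (by norm_num)

lemma int_chi_mul {δ : ℝ} (hδ : 0 < δ) {f : Cn N → ℂ} (hf : LocallyIntegrable f) (x : Cn N) :
    Integrable fun w => chiC δ (x - w) * f w :=
  ((hcs_chiC hδ).convolutionExists_left (ContinuousLinearMap.mul ℝ ℂ)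
    (cd_chiC δ).continuous hf x).integrable_swap

lemma int_chi_mul' {δ : ℝ} (hδ : 0 < δ) {f : Cn N → ℂ} (hf : LocallyIntegrable f) (x : Cn N) :
    Integrable fun w => chiC δ w * f (x - w) :=
  ((hcs_chiC hδ).convolutionExists_left (ContinuousLinearMap.mul ℝ ℂ)
    (cd_chiC δ).continuous hf x).integrable

lemma moll_sub {δ : ℝ} (hδ : 0 < δ) {f g : Cn N → ℂ} (hf : LocallyIntegrable f) (hg : LocallyIntegrable g) :
    moll δ (f - g) = moll δ f - moll δ g := by
  ext x
  simp only [moll, Pi.sub_apply, mul_sub]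
  rw [integral_sub (int_chi_mul hδ hf x) (int_chi_mul hδ hg x)]

lemma cs_prob {α : Type*} [MeasurableSpace α] {μ : Measure α} {c g : α → ℝ≥0∞} (hc : AEMeasurable c μ)
    (hg : AEMeasurable g μ) (h1 : ∫⁻ a, c a ∂μ = 1) : (∫⁻ a, c a * g a ∂μ)^2 ≤ ∫⁻ a, c a * g a^2 ∂μ := by
  have h := ENNReal.lintegral_mul_le_Lp_mul_Lq μ (p := 2) (q := 2) (by constructor <;> norm_num)
    (f := fun a => c a ^ (1/2 : ℝ)) (g := fun a => c a ^ (1/2 : ℝ) * g a) (hc.pow_const _) ((hc.pow_const _).mul hg)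
  have e1 : ∀ a, c a ^ (1/2 : ℝ) * (c a ^ (1/2 : ℝ) * g a) = c a * g a := fun a => by
    rw [← mul_assoc, ← ENNReal.rpow_add_of_nonneg _ _ (by norm_num) (by norm_num)]; norm_num
  have e2 : ∀ a, (c a ^ (1/2 : ℝ)) ^ (2:ℝ) = c a := fun a => by
    rw [← ENNReal.rpow_mul]; norm_num
  simp only [Pi.mul_apply, e1, ENNReal.mul_rpow_of_nonneg _ _ (zero_le_two : (0:ℝ) ≤ 2), e2, h1,
    ENNReal.one_rpow, one_mul] at h
  have h3 := ENNReal.rpow_le_rpow h (z := 2) (by norm_num)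
  rw [← ENNReal.rpow_mul] at h3
  norm_num at h3
  exact h3

lemma enorm_moll_sq {δ : ℝ} (hδ : 0 < δ) {f : Cn N → ℂ} (hf : AEStronglyMeasurable f volume) (x : Cn N) :
    ‖moll δ f x‖ₑ^2 ≤ ∫⁻ w, ENNReal.ofReal (chi δ w) * ‖f (x - w)‖ₑ^2 := by
  rw [moll_eq]
  have e : ∀ w, ‖chiC δ w * f (x - w)‖ₑ = ENNReal.ofReal (chi δ w) * ‖f (x - w)‖ₑ := fun w => by
    rw [enorm_mul, chiC, ← ofReal_norm, norm_real, Real.norm_of_nonneg (chi_nonneg _ _)]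
  have h1 : ‖∫ w, chiC δ w * f (x - w)‖ₑ ≤ ∫⁻ w, ENNReal.ofReal (chi δ w) * ‖f (x - w)‖ₑ := by
    refine (enorm_integral_le_lintegral_enorm _).trans (le_of_eq ?_)
    simp only [e]
  refine (pow_le_pow_left' h1 2).trans (cs_prob ?_ ?_ (lint_chi hδ))
  · exact (cd_chi δ).continuous.measurable.ennreal_ofReal.aemeasurable
  · exact (hf.comp_quasiMeasurePreserving (quasiMeasurePreserving_sub_left volume x)).enorm

lemma lint_moll_sq {δ : ℝ} (hδ : 0 < δ) {f : Cn N → ℂ} (hf : AEStronglyMeasurable f volume) :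
    ∫⁻ x, ‖moll δ f x‖ₑ^2 ≤ ∫⁻ x, ‖f x‖ₑ^2 := by
  refine (lintegral_mono fun x => enorm_moll_sq hδ hf x).trans ?_
  rw [lintegral_lintegral_swap]
  · have : ∀ w, ∫⁻ x, ENNReal.ofReal (chi δ w) * ‖f (x - w)‖ₑ^2 =
        ENNReal.ofReal (chi δ w) * ∫⁻ x, ‖f x‖ₑ^2 := fun w => by
      rw [lintegral_const_mul' _ _ ENNReal.ofReal_ne_top]
      congr 1
      exact lintegral_sub_right_eq_self (fun x => ‖f x‖ₑ^2) w
    simp only [this]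
    rw [lintegral_mul_const'' _ ((cd_chi δ).continuous.measurable.ennreal_ofReal.aemeasurable), lint_chi hδ, one_mul]
  · refine AEMeasurable.mul (f := fun p : Cn N × Cn N => ENNReal.ofReal (chi δ p.2)) (g := fun p : Cn N × Cn N => ‖f (p.1 - p.2)‖ₑ^2) ?_ ?_
    · exact ((cd_chi δ).continuous.measurable.ennreal_ofReal.comp measurable_snd).aemeasurable
    · have : Measure.QuasiMeasurePreserving (fun p : Cn N × Cn N => p.1 - p.2) (volume.prod volume) volume :=
        quasiMeasurePreserving_sub volume volume
      exact ((hf.comp_quasiMeasurePreserving this).enorm).pow_const 2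

lemma eLpNorm_two {α : Type*} [MeasurableSpace α] {μ : Measure α} {f : α → ℂ} :
    eLpNorm f 2 μ = (∫⁻ x, ‖f x‖ₑ^2 ∂μ)^(1/2 : ℝ) := by
  rw [eLpNorm_eq_lintegral_rpow_enorm_toReal (by norm_num) (by norm_num)]
  simp

lemma eLpNorm_moll {δ : ℝ} (hδ : 0 < δ) {f : Cn N → ℂ} (hf : AEStronglyMeasurable f volume) :
    eLpNorm (moll δ f) 2 volume ≤ eLpNorm f 2 volume := by
  rw [eLpNorm_two, eLpNorm_two]
  exact ENNReal.rpow_le_rpow (lint_moll_sq hδ hf) (by norm_num)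

lemma moll_unif {δ ε : ℝ} (hδ : 0 < δ) {f : Cn N → ℂ} (hf : LocallyIntegrable f) {x : Cn N}
    (h : ∀ w ∈ Metric.closedBall (0:Cn N) δ, ‖f (x - w) - f x‖ ≤ ε) : ‖moll δ f x - f x‖ ≤ ε := by
  have e2 : ∫ w : Cn N, chiC δ w = 1 := by
    simp only [chiC]; rw [integral_complex_ofReal, int_chi hδ, ofReal_one]
  have e : moll δ f x - f x = ∫ w, chiC δ w * (f (x - w) - f x) := by
    simp only [mul_sub]
    rw [integral_sub (int_chi_mul' hδ hf x) (Integrable.mul_const (int_of_hcs (cd_chiC δ).continuous (hcs_chiC hδ)) _),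
      integral_mul_const, e2, one_mul, moll_eq]
  rw [e]
  calc _ ≤ ∫ w : Cn N, chi δ w * ε := by
        refine norm_integral_le_of_norm_le ((integrable_chi hδ).mul_const _) (ae_of_all _ fun w => ?_)
        rw [norm_mul, chiC, norm_real, Real.norm_of_nonneg (chi_nonneg _ _)]
        by_cases hw : w ∈ Metric.closedBall (0:Cn N) δ
        · exact mul_le_mul_of_nonneg_left (h w hw) (chi_nonneg _ _)
        · simp [supp_chi hδ hw]
    _ = ε := by rw [integral_mul_const, int_chi hδ, one_mul]

lemma moll_cc {g : Cn N → ℂ} (hg : Continuous g) (hc : HasCompactSupport g) :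
    Tendsto (fun δ => eLpNorm (moll δ g - g) 2 volume) (𝓝[>] 0) (𝓝 0) := by
  set K := Metric.cthickening 1 (tsupport g)
  have hK : IsCompact K := (hc : IsCompact (tsupport g)).cthickening
  have hfin : volume K ≠ (⊤ : ℝ≥0∞) := hK.measure_lt_top.ne
  rw [ENNReal.tendsto_nhds_zero]
  intro ε hε
  obtain ⟨c, hc0, hcε⟩ : ∃ c : ℝ≥0, 0 < c ∧ (c : ℝ≥0∞) * volume K ^ (1/2 : ℝ) ≤ ε := by
    by_cases h0 : volume K ^ (1/2 : ℝ) = 0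
    · exact ⟨1, one_pos, by rw [h0]; simp⟩
    · have hne : volume K ^ (1/2 : ℝ) ≠ (⊤ : ℝ≥0∞) := ENNReal.rpow_ne_top_of_nonneg (by norm_num) hfin
      obtain ⟨c, hc0, hcc⟩ := ENNReal.lt_iff_exists_nnreal_btwn.1 (ENNReal.div_pos hε.ne' hne)
      exact ⟨c, by exact_mod_cast hc0, (mul_le_mul' hcc.le le_rfl).trans (by rw [mul_comm]; exact ENNReal.mul_div_le)⟩
  obtain ⟨d, hd, hu⟩ := Metric.uniformContinuous_iff.1 (hc.uniformContinuous_of_continuous hg) c hc0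
  have hmem : Ioo (0:ℝ) (min d 1) ∈ 𝓝[>] (0:ℝ) := Ioo_mem_nhdsGT (by positivity)
  filter_upwards [hmem] with δ hδ
  have hδ1 : δ < d := hδ.2.trans_le (min_le_left _ _)
  have hδ2 : δ < 1 := hδ.2.trans_le (min_le_right _ _)
  have hb : ∀ x, ‖(moll δ g - g) x‖ₑ ≤ ‖K.indicator (fun _ => (c : ℝ)) x‖ₑ := fun x => by
    by_cases hx : x ∈ K
    · rw [indicator_of_mem hx, enorm_le_iff_norm_le]
      rw [show ‖((c:ℝ≥0):ℝ)‖ = (c:ℝ) from Real.norm_of_nonneg c.2, Pi.sub_apply]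
      refine moll_unif hδ.1 hg.locallyIntegrable fun w hw => ?_
      have := @hu (x - w) x (by
        rw [dist_eq_norm]; simp at hw ⊢; linarith)
      rw [dist_eq_norm] at this
      exact this.le
    · have h1 : moll δ g x = 0 := moll_supp hδ.1 (K := tsupport g)
        (fun y hy => image_eq_zero_of_notMem_tsupport hy)
        (fun h => hx (Metric.cthickening_mono hδ2.le _ h))
      have h2 : g x = 0 := image_eq_zero_of_notMem_tsupport fun h =>
        hx (Metric.self_subset_cthickening _ h)
      simp [h1, h2]
  refine (eLpNorm_mono_enorm hb).trans (le_trans ?_ hcε)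
  refine (eLpNorm_indicator_const_le _ _).trans ?_
  simp

lemma moll_L2 {f : Cn N → ℂ} (hf : MemLp f 2) :
    Tendsto (fun δ => eLpNorm (moll δ f - f) 2 volume) (𝓝[>] 0) (𝓝 0) := by
  rw [ENNReal.tendsto_nhds_zero]
  intro ε hε
  have hε3 : ε / 3 ≠ 0 := by simp [hε.ne']
  obtain ⟨g, hgc, hgn, hg, hgL⟩ := hf.exists_hasCompactSupport_eLpNorm_sub_le (by norm_num) hε3
  filter_upwards [ENNReal.tendsto_nhds_zero.1 (moll_cc hg hgc) (ε/3) (pos_iff_ne_zero.2 hε3),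
    self_mem_nhdsWithin] with δ h1 hδ
  have hδ : 0 < δ := hδ
  have lf := loc_of_memLp hf
  have e : moll δ f - f = moll δ (f - g) + ((moll δ g - g) - (f - g)) := by
    rw [moll_sub hδ lf hg.locallyIntegrable]; abel
  have m1 : AEStronglyMeasurable (moll δ (f - g)) volume := 
    (cd_moll hδ (lf.sub hg.locallyIntegrable)).continuous.aestronglyMeasurable
  have m2 : AEStronglyMeasurable (moll δ g - g) volume := 
    ((cd_moll hδ hg.locallyIntegrable).continuous.sub hg).aestronglyMeasurable
  have m3 : AEStronglyMeasurable (f - g) volume := hf.1.sub hgL.1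
  rw [e]
  calc _ ≤ eLpNorm (moll δ (f - g)) 2 volume + eLpNorm ((moll δ g - g) - (f - g)) 2 volume :=
        eLpNorm_add_le m1 (m2.sub m3) (by norm_num)
    _ ≤ ε/3 + (ε/3 + ε/3) := by
        gcongr
        · exact (eLpNorm_moll hδ m3).trans hgn
        · exact (eLpNorm_sub_le m2 m3 (by norm_num)).trans (add_le_add h1 hgn)
    _ = ε := by rw [← add_assoc, ENNReal.add_thirds]

end BP

namespace BP
open Filter Topology
set_option linter.all false
open scoped ContDiff ComplexConjugate
variable {N : ℕ}

lemma moll_L2' {f : Cn N → ℂ} (hf : MemLp f 2) :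
    Tendsto (fun δ => ∫⁻ x, ‖moll δ f x - f x‖ₑ^2) (𝓝[>] 0) (𝓝 0) := by
  have h := (ENNReal.Tendsto.pow (n := 2) (moll_L2 hf))
  have e : ∀ δ, eLpNorm (moll δ f - f) 2 volume ^ 2 = ∫⁻ x, ‖moll δ f x - f x‖ₑ^2 := fun δ => by
    rw [eLpNorm_two, ← ENNReal.rpow_natCast, ← ENNReal.rpow_mul]; simp
  simpa [e] using h

lemma enorm_add_sq (a b : ℂ) : ‖a + b‖ₑ^2 ≤ 2 * ‖a‖ₑ^2 + 2 * ‖b‖ₑ^2 := by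
  refine (pow_le_pow_left' (enorm_add_le a b) 2).trans ?_
  rw [← ofReal_norm, ← ofReal_norm, ← ENNReal.ofReal_add (norm_nonneg _) (norm_nonneg _),
    ← ENNReal.ofReal_pow (by positivity), ← ENNReal.ofReal_pow (by positivity), ← ENNReal.ofReal_pow (by positivity),
    show (2:ℝ≥0∞) = ENNReal.ofReal 2 by simp, ← ENNReal.ofReal_mul (by norm_num), ← ENNReal.ofReal_mul (by norm_num),
    ← ENNReal.ofReal_add (by positivity) (by positivity)]
  apply ENNReal.ofReal_le_ofReal
  nlinarith [sq_nonneg (‖a‖ - ‖b‖)]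

lemma weyl_loc {x : Cn N} {r : ℝ} (hr : 0 < r) {g : Cn N → ℂ} (hg : MemLp g 2)
    (hw : ∀ h : Cn N → ℂ, ContDiff ℝ ∞ h → HasCompactSupport h → tsupport h ⊆ Metric.ball x (4*r) →
      ∀ j, ∫ y, db j h y * g y = 0) :
    ∃ U : Cn N → ℂ, DifferentiableOn ℂ U (Metric.ball x r) ∧ ∀ᵐ y ∂volume.restrict (Metric.ball x r), U y = g y := by
  have hl := loc_of_memLp hg
  have hol : ∀ δ, 0 < δ → δ ≤ r → DifferentiableOn ℂ (moll δ g) (Metric.ball x (3*r)) := by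
    intro δ hδ hδr y hy
    refine (hol_of_db ((cd_diff (cd_moll hδ hl)) y) fun j => ?_).differentiableWithinAt
    rw [db_moll' hδ hl, hw _ (cd_tst δ y) (hcs_tst hδ y) ((supp_tst hδ y).trans ?_) j, neg_zero]
    intro z hz
    rw [Metric.mem_ball] at *; rw [Metric.mem_closedBall] at hz
    linarith [dist_triangle z y x]
  obtain ⟨b, hb⟩ := (cd_chi r : ContDiff ℝ ∞ (chi r : Cn N → ℝ)).continuous.bounded_above_of_compact_support (hcs_chi hr)
  refine ⟨moll r g, (hol r hr le_rfl).mono (Metric.ball_subset_ball (by linarith)), ?_⟩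
  set e : ℝ → ℝ≥0∞ := fun δ => ∫⁻ x, ‖moll δ g x - g x‖ₑ^2
  have he : Tendsto e (𝓝[>] 0) (𝓝 0) := moll_L2' hg
  have key : ∀ δ, 0 < δ → δ ≤ r → ∀ y ∈ Metric.ball x r, ‖moll r g y - moll δ g y‖ₑ^2 ≤ ENNReal.ofReal b * e δ := by
    intro δ hδ hδr y hy
    have hcm := (cd_moll hδ hl).continuous
    have h1 : moll r (moll δ g) y = moll δ g y := by
      refine moll_hol Metric.isOpen_ball (hol δ hδ hδr) hr ?_
      intro z hz
      rw [Metric.mem_ball] at *; rw [Metric.mem_closedBall] at hz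
      linarith [dist_triangle z y x]
    have h2 : moll r g y - moll δ g y = - moll r (moll δ g - g) y := by
      rw [moll_sub hr hcm.locallyIntegrable hl, Pi.sub_apply, h1]; ring
    rw [h2, enorm_neg]
    refine (enorm_moll_sq hr (hcm.aestronglyMeasurable.sub hg.1) y).trans ?_
    calc _ ≤ ∫⁻ w, ENNReal.ofReal b * ‖(moll δ g - g) (y - w)‖ₑ^2 := by
          refine lintegral_mono fun w => ?_
          gcongr
          exact (le_abs_self _).trans (hb w)
      _ = _ := by
          rw [lintegral_const_mul' _ _ ENNReal.ofReal_ne_top]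
          congr 1
          exact lintegral_sub_left_eq_self (fun x => ‖(moll δ g - g) x‖ₑ^2) y
  set V := volume (Metric.ball x r)
  have hV : V ≠ (⊤:ℝ≥0∞) := Metric.isBounded_ball.measure_lt_top.ne
  have h3 : ∀ δ, 0 < δ → δ ≤ r → ∫⁻ y in Metric.ball x r, ‖moll r g y - g y‖ₑ^2 ≤ (2 * ENNReal.ofReal b * V + 2) * e δ := by
    intro δ hδ hδr
    have hcm := (cd_moll hδ hl).continuous
    calc _ ≤ ∫⁻ y in Metric.ball x r, (2 * (ENNReal.ofReal b * e δ) + 2 * ‖moll δ g y - g y‖ₑ^2) := by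
          refine setLIntegral_mono' measurableSet_ball fun y hy => ?_
          have := enorm_add_sq (moll r g y - moll δ g y) (moll δ g y - g y)
          rw [sub_add_sub_cancel] at this
          refine this.trans ?_
          gcongr
          exact key δ hδ hδr y hy
      _ = 2 * (ENNReal.ofReal b * e δ) * V + 2 * ∫⁻ y in Metric.ball x r, ‖moll δ g y - g y‖ₑ^2 := by
          rw [lintegral_add_left measurable_const, lintegral_const, lintegral_const_mul' 2 _ (by norm_num), Measure.restrict_apply_univ]
      _ ≤ 2 * (ENNReal.ofReal b * e δ) * V + 2 * e δ := by
          gcongr; exact setLIntegral_le_lintegral _ _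
      _ = _ := by ring
  have h4 : ∫⁻ y in Metric.ball x r, ‖moll r g y - g y‖ₑ^2 ≤ 0 := by
    have ht : Tendsto (fun δ => (2 * ENNReal.ofReal b * V + 2) * e δ) (𝓝[>] 0) (𝓝 ((2 * ENNReal.ofReal b * V + 2) * 0)) :=
      ENNReal.Tendsto.const_mul he (Or.inr (by
        simp [ENNReal.mul_eq_top, hV]))
    rw [mul_zero] at ht
    refine ge_of_tendsto ht ?_
    filter_upwards [Ioo_mem_nhdsGT hr] with δ hδ using h3 δ hδ.1 hδ.2.le
  have h5 := (lintegral_eq_zero_iff' (by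
    exact (((cd_moll hr hl).continuous.aestronglyMeasurable.sub hg.1).restrict.enorm).pow_const 2)).1 (le_antisymm h4 bot_le)
  filter_upwards [h5] with y hy
  simpa [sub_eq_zero] using hy

lemma weyl {D : Set (Cn N)} (hD : IsOpen D) {f : Cn N → ℂ}
    (hf : ∀ K, IsCompact K → K ⊆ D → MemLp f 2 (volume.restrict K))
    (hw : ∀ h : Cn N → ℂ, ContDiff ℝ ∞ h → HasCompactSupport h → tsupport h ⊆ D →
      ∀ j, ∫ y, db j h y * f y = 0) :
    ∃ U : Cn N → ℂ, DifferentiableOn ℂ U D ∧ ∀ᵐ y ∂volume.restrict D, U y = f y := by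
  have h1 : ∀ x ∈ D, ∃ r > 0, ∃ U : Cn N → ℂ, Metric.ball x r ⊆ D ∧ DifferentiableOn ℂ U (Metric.ball x r) ∧ 
      ∀ᵐ y ∂volume.restrict (Metric.ball x r), U y = f y := by
    intro x hx
    obtain ⟨r0, hr0, hb⟩ := Metric.nhds_basis_closedBall.mem_iff.1 (hD.mem_nhds hx)
    set B := Metric.closedBall x r0
    have hg : MemLp (B.indicator f) 2 volume := 
      (memLp_indicator_iff_restrict Metric.isClosed_closedBall.measurableSet).2 (hf B (isCompact_closedBall x r0) hb)
    have hbB : Metric.ball x (4*(r0/4)) ⊆ B := by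
      rw [mul_div_cancel₀ _ (by norm_num : (4:ℝ) ≠ 0)]; exact Metric.ball_subset_closedBall
    obtain ⟨U, hU, hUe⟩ := weyl_loc (x := x) (r := r0/4) (by positivity) hg (by
      intro h hh hc hs j
      rw [← hw h hh hc (hs.trans (hbB.trans hb)) j]
      refine integral_congr_ae (ae_of_all _ fun y => ?_)
      by_cases hy : y ∈ tsupport h
      · simp only [indicator_of_mem (hbB (hs hy))]
      · simp only [db_eq_zero hy, zero_mul])
    have hbs : Metric.ball x (r0/4) ⊆ B := (Metric.ball_subset_ball (by linarith)).trans Metric.ball_subset_closedBall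
    refine ⟨r0/4, by positivity, U, hbs.trans hb, hU, ?_⟩
    filter_upwards [hUe, ae_restrict_mem measurableSet_ball] with y hy hy2
    rw [hy, indicator_of_mem (hbs hy2)]
  choose! r hr U hsub hU hUe using h1
  have hloc : ∀ x ∈ D, ∀ y ∈ Metric.ball x (r x), U y y = U x y := by
    intro x hx y hy
    have hyD := hsub x hx hy
    set W := Metric.ball x (r x) ∩ Metric.ball y (r y)
    have hW : IsOpen W := Metric.isOpen_ball.inter Metric.isOpen_ball
    have e : ∀ᵐ z ∂volume.restrict W, U y z = U x z := by
      have a1 := ae_restrict_of_ae_restrict_of_subset (inter_subset_left : W ⊆ _) (hUe x hx)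
      have a2 := ae_restrict_of_ae_restrict_of_subset (inter_subset_right : W ⊆ _) (hUe y hyD)
      filter_upwards [a1, a2] with z h1 h2 
      rw [h1, h2]
    exact Measure.eqOn_open_of_ae_eq e hW ((hU y hyD).continuousOn.mono inter_subset_right) 
      ((hU x hx).continuousOn.mono inter_subset_left) ⟨hy, Metric.mem_ball_self (hr y hyD)⟩
  refine ⟨fun y => U y y, fun x hx => ?_, ?_⟩
  · have : (fun y => U y y) =ᶠ[𝓝 x] U x := by
      filter_upwards [Metric.ball_mem_nhds x (hr x hx)] with y hy using hloc x hx y hy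
    exact (((hU x hx).differentiableAt (Metric.ball_mem_nhds x (hr x hx))).congr_of_eventuallyEq this).differentiableWithinAt
  · rw [ae_restrict_iff' hD.measurableSet, ae_iff]
    refine measure_null_of_locally_null _ fun x hx => ?_
    have hxD : x ∈ D := by
      by_contra h; exact hx fun h' => absurd h' h
    refine ⟨_, inter_mem_nhdsWithin _ (Metric.ball_mem_nhds x (hr x hxD)), ?_⟩
    have := hUe x hxD
    rw [ae_restrict_iff' measurableSet_ball, ae_iff] at this
    refine measure_mono_null ?_ this
    rintro y ⟨hy, hyb⟩ h
    exact hy fun _ => (hloc x hxD y hyb).trans (h hyb)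
end BP

namespace BP
open Filter Topology
set_option linter.all false
open scoped ContDiff ComplexConjugate
variable {N : ℕ}

lemma circle_log {g : ℂ → ℂ} (hg : AnalyticOnNhd ℂ g (Metric.closedBall 0 1)) (h0 : g 0 ≠ 0) :
    Real.log ‖g 0‖ ≤ Real.circleAverage (fun z => Real.log ‖g z‖) 0 1 := by
  have h := AnalyticOnNhd.circleAverage_log_norm (c := 0) (R := 1) one_ne_zero (by simpa using hg) h0
  rw [h, le_add_iff_nonneg_left]
  refine finsum_nonneg fun u => ?_
  by_cases hu : u ∈ Metric.closedBall (0:ℂ) |1|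
  · refine mul_nonneg ?_ ?_
    · have := MeromorphicOn.AnalyticOnNhd.divisor_nonneg (U := Metric.closedBall (0:ℂ) |1|) (by simpa using hg)
      exact_mod_cast this u
    · rw [one_mul, Real.log_inv, zero_sub, norm_neg, neg_nonneg]
      exact Real.log_nonpos (norm_nonneg _) (by simpa using hu)
  · rw [Function.locallyFinsuppWithin.apply_eq_zero_of_notMem _ hu]; simp

lemma sub_circle_aux {g : ℂ → ℂ} (hg : AnalyticOnNhd ℂ g (Metric.closedBall 0 1)) {p : ℝ} (hp : 0 < p)
    (h0 : g 0 ≠ 0) (h1 : Real.log ‖g 0‖ = 1 / p) :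
    2 * Real.pi * ‖g 0‖^p ≤ ∫ θ in Ioc 0 (2 * Real.pi), ‖g (un θ)‖^p := by
  have hc := circle_log hg h0
  have hInt := MeromorphicOn.circleIntegrable_log_norm (f := g) (c := 0) (R := 1)
    (fun z hz => (hg z (by simpa using Metric.sphere_subset_closedBall hz)).meromorphicAt)
  rw [CircleIntegrable, intervalIntegrable_iff_integrableOn_Ioc_of_le (by positivity)] at hInt
  have hcont : Continuous fun θ : ℝ => g (un θ) := by
    refine (hg.continuousOn).comp_continuous cont_un fun θ => ?_
    simp [norm_un]
  have e1 : ‖g 0‖^p = Real.exp 1 := by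
    rw [Real.rpow_def_of_pos (norm_pos_iff.2 h0), h1]; field_simp
  have e2 : ∀ θ : ℝ, circleMap 0 1 θ = un θ := fun θ => by simp [circleMap, un]
  rw [Real.circleAverage, intervalIntegral.integral_of_le (by positivity)] at hc
  simp only [e2] at hc hInt
  rw [h1, smul_eq_mul] at hc
  have h3 : ∫ θ in Ioc 0 (2 * Real.pi), Real.exp 1 * p * Real.log ‖g (un θ)‖ ≤ ∫ θ in Ioc 0 (2 * Real.pi), ‖g (un θ)‖^p := by
    refine integral_mono (hInt.const_mul _) ?_ fun θ => ?_
    · have : Continuous fun θ : ℝ => ‖g (un θ)‖^p := hcont.norm.rpow_const fun _ => Or.inr hp.le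
      exact (this.integrableOn_Icc).mono_set Ioc_subset_Icc_self
    · by_cases hz : g (un θ) = 0
      · simp [hz, Real.zero_rpow hp.ne']
      · simp only
        rw [Real.rpow_def_of_pos (norm_pos_iff.2 hz)]
        set t := Real.log ‖g (un θ)‖ * p
        have := Real.add_one_le_exp (t - 1)
        have e : Real.exp t = Real.exp 1 * Real.exp (t - 1) := by rw [← Real.exp_add]; ring_nf
        rw [e, mul_assoc, mul_comm p]
        exact mul_le_mul_of_nonneg_left (by linarith) (Real.exp_pos 1).le
  rw [integral_const_mul] at h3
  refine le_trans ?_ h3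
  rw [e1]
  have hpi := Real.pi_pos
  rw [div_le_iff₀ hp, mul_assoc, ← div_eq_inv_mul, le_div_iff₀ (by positivity), one_mul] at hc
  nlinarith [Real.exp_pos 1]

lemma sub_circle {g : ℂ → ℂ} (hg : AnalyticOnNhd ℂ g (Metric.closedBall 0 1)) {p : ℝ} (hp : 0 < p) :
    2 * Real.pi * ‖g 0‖^p ≤ ∫ θ in Ioc 0 (2 * Real.pi), ‖g (un θ)‖^p := by
  by_cases h0 : g 0 = 0
  · rw [h0, norm_zero, Real.zero_rpow hp.ne', mul_zero]
    exact integral_nonneg fun θ => by positivity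
  set l := Real.exp (1/p - Real.log ‖g 0‖)
  have hl : 0 < l := Real.exp_pos _
  have h := sub_circle_aux (g := fun z => (l:ℂ) * g z) (analyticOnNhd_const.mul hg) hp 
    (mul_ne_zero (by exact_mod_cast hl.ne') h0) (by
      rw [norm_mul, norm_real, Real.norm_of_nonneg hl.le, Real.log_mul hl.ne' (norm_ne_zero_iff.2 h0), Real.log_exp]
      ring)
  simp only [norm_mul, norm_real, Real.norm_of_nonneg hl.le, Real.mul_rpow hl.le (norm_nonneg _)] at h
  rw [integral_const_mul, mul_left_comm] at h
  exact le_of_mul_le_mul_left h (by positivity)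

lemma lint_rot {δ : ℝ} {G : Cn N → ℝ≥0∞} (hG : Measurable G) :
    ENNReal.ofReal (2 * Real.pi) * ∫⁻ w, ENNReal.ofReal (chi δ w) * G w = 
      ∫⁻ w, ENNReal.ofReal (chi δ w) * ∫⁻ θ in Ioc 0 (2 * Real.pi), G (un θ • w) := by
  have hm : Measurable fun w : Cn N => ENNReal.ofReal (chi δ w) := (cd_chi δ).continuous.measurable.ennreal_ofReal
  have hj : Measurable fun q : Cn N × ℝ => G (un q.2 • q.1) := 
    hG.comp (by have := cont_un; fun_prop : Continuous fun q : Cn N × ℝ => un q.2 • q.1).measurable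
  have h1 : ∀ θ : ℝ, ∫⁻ w, ENNReal.ofReal (chi δ w) * G (un θ • w) = ∫⁻ w, ENNReal.ofReal (chi δ w) * G w := fun θ => by
    refine Eq.trans ?_ ((mp_smul (N := N) (norm_un θ)).lintegral_comp (hm.mul hG))
    refine lintegral_congr fun w => ?_
    show ENNReal.ofReal (chi δ w) * G (un θ • w) = ENNReal.ofReal (chi δ (un θ • w)) * G (un θ • w)
    rw [chi_smul δ (norm_un θ)]
  calc _ = ∫⁻ θ in Ioc 0 (2 * Real.pi), ∫⁻ w, ENNReal.ofReal (chi δ w) * G (un θ • w) := by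
        simp only [h1]
        rw [lintegral_const, Measure.restrict_apply_univ, Real.volume_Ioc, sub_zero, mul_comm]
    _ = ∫⁻ w, ∫⁻ θ in Ioc 0 (2 * Real.pi), ENNReal.ofReal (chi δ w) * G (un θ • w) := by
        rw [lintegral_lintegral_swap]
        exact ((hm.comp measurable_snd).mul (hj.comp measurable_swap)).aemeasurable
    _ = _ := by
        refine lintegral_congr fun w => lintegral_const_mul' _ _ ENNReal.ofReal_ne_top

lemma sub_mean {f : Cn N → ℂ} {U : Set (Cn N)} (hU : IsOpen U) (hf : DifferentiableOn ℂ f U) {x : Cn N} {δ : ℝ}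
    (hδ : 0 < δ) (hx : Metric.closedBall x δ ⊆ U) {p : ℝ} (hp : 0 < p) :
    ‖f x‖ₑ^p ≤ ∫⁻ w, ENNReal.ofReal (chi δ w) * ‖(Metric.closedBall x δ).indicator f (x - w)‖ₑ^p := by
  set F := (Metric.closedBall x δ).indicator f
  have hFm : Measurable F := by
    classical
    have := ContinuousOn.measurable_piecewise (s := Metric.closedBall x δ) (f := f) (g := 0) 
      (hf.continuousOn.mono hx) continuousOn_const Metric.isClosed_closedBall.measurableSet
    rwa [piecewise_eq_indicator] at this
  have hGm : Measurable fun w => ‖F (x - w)‖ₑ^p := (hFm.comp (measurable_const.sub measurable_id)).enorm.pow_const p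
  have h2 := lint_rot (δ := δ) hGm
  have hpi : ENNReal.ofReal (2 * Real.pi) ≠ 0 := by simp [Real.pi_pos]
  refine (ENNReal.mul_le_mul_iff_right hpi ENNReal.ofReal_ne_top).1 ?_
  rw [h2]
  calc _ = ∫⁻ w : Cn N, ENNReal.ofReal (chi δ w) * (ENNReal.ofReal (2 * Real.pi) * ‖f x‖ₑ^p) := by
        rw [lintegral_mul_const _ ((cd_chi δ).continuous.measurable.ennreal_ofReal), lint_chi hδ, one_mul]
    _ ≤ _ := by
        refine lintegral_mono fun w => ?_
        by_cases hw : w ∈ Metric.closedBall (0:Cn N) δ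
        swap
        · simp [supp_chi hδ hw]
        gcongr
        have hmem : ∀ ζ : ℂ, ‖ζ‖ ≤ 1 → x - ζ • w ∈ Metric.closedBall x δ := fun ζ hζ => by
          rw [mem_closedBall_zero_iff] at hw
          rw [Metric.mem_closedBall, dist_eq_norm]
          have : x - ζ • w - x = -(ζ • w) := by abel
          rw [this, norm_neg, norm_smul]
          nlinarith [norm_nonneg w, norm_nonneg ζ]
        have hO : IsOpen {ζ : ℂ | x - ζ • w ∈ U} := hU.preimage (by fun_prop)
        have hd : DifferentiableOn ℂ (fun ζ : ℂ => f (x - ζ • w)) {ζ : ℂ | x - ζ • w ∈ U} := 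
          hf.comp (by fun_prop) fun ζ hζ => hζ
        have ha := (hd.analyticOnNhd hO).mono (fun ζ hζ => hx (hmem ζ (by simpa using hζ)) : Metric.closedBall (0:ℂ) 1 ⊆ _)
        have hs := sub_circle ha hp
        have hcont : Continuous fun θ : ℝ => f (x - un θ • w) := by
          refine (ha.continuousOn).comp_continuous cont_un fun θ => ?_
          simp [norm_un]
        have hci : Continuous fun θ : ℝ => ‖f (x - un θ • w)‖^p := hcont.norm.rpow_const fun _ => Or.inr hp.le
        rw [zero_smul, sub_zero] at hs
        have e : ∀ z : ℂ, ‖z‖ₑ^p = ENNReal.ofReal (‖z‖^p) := fun z => by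
          rw [← ofReal_norm, ENNReal.ofReal_rpow_of_nonneg (norm_nonneg _) hp.le]
        rw [e, ← ENNReal.ofReal_mul (by positivity)]
        refine (ENNReal.ofReal_le_ofReal hs).trans (le_of_eq ?_)
        rw [ofReal_integral_eq_lintegral_ofReal ((hci.integrableOn_Icc).mono_set Ioc_subset_Icc_self) 
          (ae_of_all _ fun θ => by positivity)]
        refine lintegral_congr fun θ => ?_
        rw [← e, show F (x - un θ • w) = f (x - un θ • w) from indicator_of_mem (hmem _ (norm_un θ).le) _]

lemma sub_mean' {δ : ℝ} (hδ : 0 < δ) : ∃ b : ℝ≥0, 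
    ∀ (f : Cn N → ℂ) (U : Set (Cn N)) (x : Cn N), IsOpen U → DifferentiableOn ℂ f U → Metric.closedBall x δ ⊆ U → ∀ p : ℝ, 0 < p → 
    ‖f x‖ₑ^p ≤ b * ∫⁻ y in U, ‖f y‖ₑ^p := by
  obtain ⟨b, hb⟩ := (cd_chi δ : ContDiff ℝ ∞ (chi δ : Cn N → ℝ)).continuous.bounded_above_of_compact_support (hcs_chi hδ)
  refine ⟨b.toNNReal, fun f U x hU hf hx p hp => (sub_mean hU hf hδ hx hp).trans ?_⟩
  calc _ ≤ ∫⁻ w, ENNReal.ofReal b * ‖(Metric.closedBall x δ).indicator f (x - w)‖ₑ^p := by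
        refine lintegral_mono fun w => ?_
        gcongr
        exact (le_abs_self _).trans (hb w)
    _ = ENNReal.ofReal b * ∫⁻ y in Metric.closedBall x δ, ‖f y‖ₑ^p := by
        rw [lintegral_const_mul' _ _ ENNReal.ofReal_ne_top]
        rw [lintegral_sub_left_eq_self (fun y => ‖(Metric.closedBall x δ).indicator f y‖ₑ^p) x,
          ← lintegral_indicator Metric.isClosed_closedBall.measurableSet]
        congr 1
        refine lintegral_congr fun y => ?_
        by_cases hy : y ∈ Metric.closedBall x δ
        · simp only [indicator_of_mem hy]
        · simp [indicator_of_notMem hy, hp]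
    _ ≤ _ := by
        refine mul_le_mul' le_rfl (lintegral_mono_set hx)
end BP

namespace BP
open Filter Topology
set_option linter.all false
open scoped ContDiff ComplexConjugate
variable {N : ℕ}

lemma hol_weak {f : Cn N → ℂ} {U : Set (Cn N)} (hU : IsOpen U) (hf : DifferentiableOn ℂ f U) {h : Cn N → ℂ}
    (hh : ContDiff ℝ ∞ h) (hc : HasCompactSupport h) (hs : tsupport h ⊆ U) (j : Fin N) : ∫ y, db j h y * f y = 0 := by
  obtain ⟨g, hg, hge⟩ := exists_ext (hc : IsCompact (tsupport h)) hU hs (hol_smooth hU hf)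
  have e1 : ∫ y, db j h y * f y = ∫ y, db j h y * g y := by
    refine integral_congr_ae (ae_of_all _ fun y => ?_)
    by_cases hy : y ∈ tsupport h
    · simp only [(hge y hy).self_of_nhds]
    · simp only [db_eq_zero hy, zero_mul]
  have e2 : ∫ y, h y * db j g y = 0 := by
    rw [← integral_zero (Cn N) ℂ]
    refine integral_congr_ae (ae_of_all _ fun y => ?_)
    by_cases hy : y ∈ tsupport h
    · simp only [db_congr (hge y hy), db_of_hol (hf.differentiableAt (hU.mem_nhds (hs hy))), mul_zero]
    · simp only [image_eq_zero_of_notMem_tsupport hy, zero_mul]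
  have := ibp_db_g j (cd_le1 hh) (cd_le1 hg) hc
  rw [e1, ← neg_eq_zero, ← this, e2]

lemma hol_lip {f : Cn N → ℂ} {x : Cn N} {r B : ℝ} (hr : 0 < r) (hf : DifferentiableOn ℂ f (Metric.ball x r))
    (hB : ∀ y ∈ Metric.ball x r, ‖f y‖ ≤ B) {y z : Cn N} (hy : y ∈ Metric.ball x (r/4)) (hz : z ∈ Metric.ball x (r/4)) :
    dist (f z) (f y) ≤ 4 * B / r * dist z y := by
  have hsub : Metric.ball y (r/2) ⊆ Metric.ball x r := by
    intro w hw
    rw [Metric.mem_ball] at *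
    linarith [dist_triangle w y x]
  have := Complex.dist_le_div_mul_dist_of_mapsTo_ball (R₂ := 2 * B) (hf.mono hsub) (fun w hw => by
      rw [Metric.mem_closedBall, dist_eq_norm]
      have h1 := hB w (hsub hw)
      have h2 := hB y (hsub (Metric.mem_ball_self (by positivity)))
      linarith [norm_sub_le (f w) (f y)]) (z := z) (by
      rw [Metric.mem_ball] at *
      linarith [dist_triangle z x y, dist_comm x y])
  refine this.trans (le_of_eq ?_)
  congr 1
  field_simp; ring

lemma montel {Ω : Set (Cn N)} (hΩ : IsOpen Ω) {U : ℕ → Cn N → ℂ}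
    (h : ∀ x ∈ Ω, ∃ r > 0, ∃ B : ℝ, Metric.ball x r ⊆ Ω ∧ ∀ᶠ k in atTop, DifferentiableOn ℂ (U k) (Metric.ball x r) ∧ 
      ∀ y ∈ Metric.ball x r, ‖U k y‖ ≤ B) :
    ∃ s : ℕ → ℕ, StrictMono s ∧ ∃ V : Cn N → ℂ, DifferentiableOn ℂ V Ω ∧ 
      ∀ x ∈ Ω, Tendsto (fun k => U (s k) x) atTop (𝓝 (V x)) := by
  classical
  set d := TopologicalSpace.denseSeq (Cn N)
  set X : ℕ → ℕ → ℂ := fun k i => if d i ∈ Ω then U k (d i) else 0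
  have hbd : ∀ i, ∃ B : ℝ, ∀ k, X k i ∈ Metric.closedBall (0:ℂ) B := by
    intro i
    by_cases hi : d i ∈ Ω
    · obtain ⟨r, hr, B, -, hk⟩ := h _ hi
      have h2 : IsBoundedUnder (· ≤ ·) atTop fun k => ‖U k (d i)‖ := 
        ⟨B, by simpa using hk.mono fun k hk => hk.2 _ (Metric.mem_ball_self hr)⟩
      obtain ⟨B', hB'⟩ := h2.bddAbove_range
      refine ⟨B', fun k => ?_⟩
      simp only [X, if_pos hi, mem_closedBall_zero_iff]
      exact hB' ⟨k, rfl⟩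
    · exact ⟨0, fun k => by simp [X, hi]⟩
  choose B hB using hbd
  have hcomp : IsCompact (Set.univ.pi fun i => Metric.closedBall (0:ℂ) (B i)) := 
    isCompact_univ_pi fun i => isCompact_closedBall _ _
  obtain ⟨L, -, s, hs, hL⟩ := hcomp.tendsto_subseq (x := X) fun k i _ => hB i k
  rw [tendsto_pi_nhds] at hL
  have hconv : ∀ x ∈ Ω, ∃ v, Tendsto (fun k => U (s k) x) atTop (𝓝 v) := by
    intro x hx
    refine cauchySeq_tendsto_of_complete ?_
    obtain ⟨r, hr, B, hsub, hk⟩ := h _ hx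
    have hB0 : 0 ≤ B := by
      obtain ⟨k, hk⟩ := hk.exists
      exact (norm_nonneg _).trans (hk.2 x (Metric.mem_ball_self hr))
    rw [Metric.cauchySeq_iff']
    intro ε hε
    set ρ := min (r/4) (ε / (4 * (4 * B / r + 1)))
    have hρ : 0 < ρ := by positivity
    obtain ⟨i, hi⟩ := (TopologicalSpace.denseRange_denseSeq (Cn N)).exists_dist_lt x hρ
    have hi4 : d i ∈ Metric.ball x (r/4) := by
      rw [Metric.mem_ball, dist_comm]; exact hi.trans_le (min_le_left _ _)
    have hiΩ : d i ∈ Ω := hsub (Metric.ball_subset_ball (by linarith) hi4)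
    have hLi : CauchySeq fun k => U (s k) (d i) := by
      have := (hL i).cauchySeq
      simpa [X, Function.comp_def, hiΩ] using this
    obtain ⟨n1, hn1⟩ := Metric.cauchySeq_iff'.1 hLi (ε/4) (by positivity)
    obtain ⟨n2, hn2⟩ := eventually_atTop.1 (hs.tendsto_atTop.eventually hk)
    obtain ⟨n1', hn1'⟩ := Metric.cauchySeq_iff.1 hLi (ε/4) (by positivity)
    have hlip : ∀ k ≥ n2, dist (U (s k) x) (U (s k) (d i)) ≤ ε/4 := by
      intro k hk
      have := hol_lip hr (hn2 k hk).1 (hn2 k hk).2 hi4 (Metric.mem_ball_self (by positivity))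
      refine this.trans ?_
      have h5 : dist x (d i) ≤ ε / (4 * (4 * B / r + 1)) := (hi.trans_le (min_le_right _ _)).le
      have h6 : 0 ≤ 4 * B / r := by positivity
      calc _ ≤ (4 * B / r + 1) * (ε / (4 * (4 * B / r + 1))) := by gcongr; linarith
        _ = ε/4 := by field_simp
    refine ⟨max n1' n2, fun k hk => ?_⟩
    have a1 := hlip k (le_of_max_le_right hk)
    have a2 := hlip (max n1' n2) (le_max_right _ _)
    have a3 := hn1' k (le_of_max_le_left hk) (max n1' n2) (le_max_left _ _)
    have t1 := dist_triangle (U (s k) x) (U (s k) (d i)) (U (s (max n1' n2)) x)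
    have t2 := dist_triangle (U (s k) (d i)) (U (s (max n1' n2)) (d i)) (U (s (max n1' n2)) x)
    rw [dist_comm] at a2
    linarith
  choose! V hV using hconv
  refine ⟨s, hs, V, fun x hx => DifferentiableAt.differentiableWithinAt ?_, hV⟩
  obtain ⟨r, hr, B, hsub, hk⟩ := h _ hx
  obtain ⟨n2, hn2⟩ := eventually_atTop.1 (hs.tendsto_atTop.eventually hk)
  set W := Metric.ball x (r/4)
  have hWr : W ⊆ Metric.ball x r := Metric.ball_subset_ball (by linarith)
  have hVB : ∀ y ∈ W, ‖V y‖ ≤ B := fun y hy => 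
    le_of_tendsto (hV y (hsub (hWr hy))).norm (eventually_atTop.2 ⟨n2, fun k hk => (hn2 k hk).2 y (hWr hy)⟩)
  have hVc : ContinuousOn V W := by
    have : LipschitzOnWith (4 * B / r).toNNReal V W := by
      refine LipschitzOnWith.of_dist_le' fun y hy z hz => ?_
      refine le_of_tendsto ((hV y (hsub (hWr hy))).dist (hV z (hsub (hWr hz)))) (eventually_atTop.2 ⟨n2, fun k hk => ?_⟩)
      exact hol_lip hr (hn2 k hk).1 (hn2 k hk).2 hz hy
    exact this.continuousOn
  obtain ⟨G, hG, hGe⟩ := weyl (D := W) Metric.isOpen_ball (f := V) (fun K hK hKW => by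
      haveI : IsFiniteMeasure (volume.restrict K) := ⟨by rw [Measure.restrict_apply_univ]; exact hK.measure_lt_top⟩
      refine MemLp.of_bound ?_ B ?_
      · exact (hVc.mono hKW).aestronglyMeasurable hK.measurableSet
      · exact (ae_restrict_iff' hK.measurableSet).2 (ae_of_all _ fun y hy => hVB y (hKW hy))) (by
      intro g hg hgc hgs j
      have ht : Tendsto (fun k => ∫ y, db j g y * U (s k) y) atTop (𝓝 (∫ y, db j g y * V y)) := by
        have hi : Integrable (fun y => ‖db j g y‖ * B) := 
          ((int_of_hcs (cd_db hg j).continuous (hcs_db hgc)).norm).mul_const B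
        refine tendsto_integral_filter_of_dominated_convergence _ ?_ ?_ hi (ae_of_all _ fun y => ?_)
        · filter_upwards [eventually_ge_atTop n2] with k hk
          have : Continuous fun y => db j g y * U (s k) y := by
            rw [continuous_iff_continuousAt]
            intro y
            by_cases hy : y ∈ tsupport g
            · exact (cd_db hg j).continuous.continuousAt.mul 
                (((hn2 k hk).1.continuousOn.continuousAt (Metric.isOpen_ball.mem_nhds (hWr (hgs hy)))))
            · refine ContinuousAt.congr continuousAt_const (f := fun _ => 0) ?_
              filter_upwards [(isClosed_tsupport g).isOpen_compl.mem_nhds hy] with z hz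
              rw [db_eq_zero hz, zero_mul]
          exact this.aestronglyMeasurable
        · filter_upwards [eventually_ge_atTop n2] with k hk
          refine ae_of_all _ fun y => ?_
          rw [norm_mul]
          by_cases hy : y ∈ tsupport g
          · gcongr
            exact (hn2 k hk).2 y (hWr (hgs hy))
          · simp [db_eq_zero hy]
        · by_cases hy : y ∈ tsupport g
          · exact (hV y (hsub (hWr (hgs hy)))).const_mul _
          · simp [db_eq_zero hy]
      refine tendsto_nhds_unique ht (tendsto_const_nhds.congr' ?_)
      filter_upwards [eventually_ge_atTop n2] with k hk
      exact (hol_weak Metric.isOpen_ball (hn2 k hk).1 hg hgc (hgs.trans hWr) j).symm)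
  have he := Measure.eqOn_open_of_ae_eq hGe Metric.isOpen_ball hG.continuousOn hVc
  have hxW : W ∈ 𝓝 x := Metric.ball_mem_nhds x (by positivity)
  exact (hG.congr fun y hy => (he hy).symm).differentiableAt hxW
end BP

namespace BP
open Filter Topology
set_option linter.all false
open scoped ContDiff ComplexConjugate
variable {N : ℕ}

/-- weighted square integral -/
def q2 (W : Cn N → ℝ) (K : Set (Cn N)) (f : Cn N → ℂ) : ℝ≥0∞ := ∫⁻ x in K, ENNReal.ofReal (W x) * ‖f x‖ₑ^2

lemma q2_eq {K : Set (Cn N)} (hK : IsCompact K) {W : Cn N → ℝ} {f : Cn N → ℂ} (hW : ContinuousOn W K)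
    (hf : ContinuousOn f K) (h0 : ∀ x ∈ K, 0 ≤ W x) : 
    q2 W K f = ENNReal.ofReal (∫ x in K, W x * ‖f x‖^2) ∧ 0 ≤ ∫ x in K, W x * ‖f x‖^2 := by
  have hi : IntegrableOn (fun x => W x * ‖f x‖^2) K := (hW.mul (hf.norm.pow 2)).integrableOn_compact hK
  have hn : 0 ≤ᵐ[volume.restrict K] fun x => W x * ‖f x‖^2 := 
    (ae_restrict_iff' hK.measurableSet).2 (ae_of_all _ fun x hx => mul_nonneg (h0 x hx) (by positivity))
  refine ⟨?_, integral_nonneg_of_ae hn⟩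
  rw [ofReal_integral_eq_lintegral_ofReal hi hn]
  refine setLIntegral_congr_fun hK.measurableSet fun x hx => ?_
  rw [ENNReal.ofReal_mul (h0 x hx), ENNReal.ofReal_pow (norm_nonneg _), ofReal_norm]

lemma twisted' {D K : Set (Cn N)} (hK : IsCompact K) (hD : IsOpen D) (hKD : K ⊆ D)
    {Φ σ s p : Cn N → ℝ} (hΦ : ContDiffOn ℝ ∞ Φ D) (hσ : ContDiffOn ℝ ∞ σ D)
    (hs : ContinuousOn s D) (hp : ContinuousOn p D) (hs0 : ∀ x ∈ D, 0 < s x) (hp0 : ∀ x ∈ D, 0 ≤ p x) (i0 : Fin N)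
    (hL : ∀ x ∈ D, ∀ b : Cn N, p x * ‖b i0‖^2 ≤ levi Φ x b - (1 + s x) * gr σ x b)
    {β : Fin N → Cn N → ℂ} (hβ : ∀ j, ContDiff ℝ ∞ (β j)) (hc : ∀ j, tsupport (β j) ⊆ K) :
    q2 (fun x => p x * Real.exp (-Φ x)) K (β i0) ≤ 
      q2 (fun x => (1 + 1 / s x) * Real.exp (-Φ x)) K 
        (fun x => ∑ j, dz j (β j) x - ∑ j, dz j (fun y => ((Φ y - σ y : ℝ) : ℂ)) x * β j x) +
      ∑ j, ∑ k, q2 (fun x => Real.exp (-Φ x)) K (fun x => db j (β k) x - db k (β j) x) := by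
  have h := twisted hK hD hKD hΦ hσ hs hp hs0 i0 hL hβ hc
  have hE : ContinuousOn (fun x => Real.exp (-Φ x)) K := (hΦ.continuousOn.mono hKD).neg.rexp
  have hS : ContinuousOn (fun x => (1 + 1 / s x)) K := 
    continuousOn_const.add (continuousOn_const.div (hs.mono hKD) fun x hx => (hs0 x (hKD hx)).ne')
  have hco : ∀ j, ContinuousOn (dz j (fun y => ((Φ y - σ y : ℝ) : ℂ))) K := fun j => by
    have : ContDiffOn ℝ ((⊤ : ℕ∞) : WithTop ℕ∞) (fun y => ((Φ y - σ y : ℝ) : ℂ)) D := ofRealCLM.contDiff.comp_contDiffOn (hΦ.sub hσ)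
    exact ((contDiffOn_dz hD this (m := ⊤) (by simp)).continuousOn).mono hKD
  have hX : ContinuousOn (fun x => ∑ j, dz j (β j) x - ∑ j, dz j (fun y => ((Φ y - σ y : ℝ) : ℂ)) x * β j x) K := 
    (continuousOn_finsetSum _ fun j _ => ((cd_dz (hβ j) j).continuous.continuousOn)).sub 
      (continuousOn_finsetSum _ fun j _ => (hco j).mul (hβ j).continuous.continuousOn)
  have hdb : ∀ j k, ContinuousOn (fun x => db j (β k) x - db k (β j) x) K := fun j k => 
    ((cd_db (hβ k) j).continuous.sub (cd_db (hβ j) k).continuous).continuousOn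
  have a1 := q2_eq (W := fun x => p x * Real.exp (-Φ x)) hK ((hp.mono hKD).mul hE) (hβ i0).continuous.continuousOn 
    (fun x hx => mul_nonneg (hp0 x (hKD hx)) (Real.exp_pos _).le)
  have a2 := q2_eq (W := fun x => (1 + 1 / s x) * Real.exp (-Φ x)) hK (hS.mul hE) hX (fun x hx => by have := hs0 x (hKD hx); positivity)
  have a3 := fun j k => q2_eq hK hE (hdb j k) (fun x hx => (Real.exp_pos _).le)
  rw [a1.1, a2.1]
  simp only [fun j k => (a3 j k).1]
  have hnn : ∀ j, 0 ≤ ∑ k, ∫ x in K, Real.exp (-Φ x) * ‖db j (β k) x - db k (β j) x‖^2 := fun j => 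
    Finset.sum_nonneg fun k _ => (a3 j k).2
  rw [Finset.sum_congr rfl fun j _ => (ENNReal.ofReal_sum_of_nonneg fun k _ => (a3 j k).2).symm,
    ← ENNReal.ofReal_sum_of_nonneg fun j _ => hnn j, ← ENNReal.ofReal_add a2.2 (Finset.sum_nonneg fun j _ => hnn j)]
  refine ENNReal.ofReal_le_ofReal (h.trans ?_)
  gcongr with j _ k _
  have := (a3 j k).2
  linarith

lemma q2_tendsto {ι : Type*} {l : Filter ι} {K : Set (Cn N)} {W : Cn N → ℝ} {c : ℝ} (hK : MeasurableSet K)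
    (hW : AEMeasurable W (volume.restrict K)) (hc : ∀ x ∈ K, W x ≤ c) {F : ι → Cn N → ℂ} {f : Cn N → ℂ} (hF : ∀ i, AEStronglyMeasurable (F i) volume)
    (hf : MemLp f 2) (ht : Tendsto (fun i => ∫⁻ x in K, ‖F i x - f x‖ₑ^2) l (𝓝 0)) :
    Tendsto (fun i => q2 W K (F i)) l (𝓝 (q2 W K f)) := by
  set μ := (volume.restrict K).withDensity fun x => ENNReal.ofReal (W x)
  have hac : μ ≪ volume := (withDensity_absolutelyContinuous _ _).trans Measure.absolutelyContinuous_restrict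
  have hle : ∀ g : Cn N → ℂ, AEStronglyMeasurable g volume → ∫⁻ x, ‖g x‖ₑ^2 ∂μ = q2 W K g := fun g hg => by
    rw [lintegral_withDensity_eq_lintegral_mul₀ hW.ennreal_ofReal (hg.restrict.enorm.pow_const 2)]; rfl
  have hq : ∀ g : Cn N → ℂ, AEStronglyMeasurable g volume → eLpNorm g 2 μ ^ 2 = q2 W K g := fun g hg => by
    rw [← hle g hg, eLpNorm_two, ← ENNReal.rpow_natCast, ← ENNReal.rpow_mul]; simp
  have hbd : ∀ g : Cn N → ℂ, q2 W K g ≤ ENNReal.ofReal c * ∫⁻ x in K, ‖g x‖ₑ^2 := fun g => by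
    rw [← lintegral_const_mul' _ _ ENNReal.ofReal_ne_top]
    refine setLIntegral_mono' hK fun x hx => ?_
    gcongr; exact hc x hx
  have hd : Tendsto (fun i => eLpNorm (F i - f) 2 μ) l (𝓝 0) := by
    have h1 : Tendsto (fun i => q2 W K (F i - f)) l (𝓝 0) := by
      refine tendsto_of_tendsto_of_tendsto_of_le_of_le tendsto_const_nhds ?_ (fun _ => bot_le) (fun i => hbd (F i - f))
      have := ENNReal.Tendsto.const_mul (a := ENNReal.ofReal c) ht (Or.inr ENNReal.ofReal_ne_top)
      rwa [mul_zero] at this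
    have h2 := ((ENNReal.continuous_rpow_const (y := (1/2:ℝ))).tendsto 0).comp h1
    rw [ENNReal.zero_rpow_of_pos (by norm_num)] at h2
    refine h2.congr fun i => ?_
    show (q2 W K (F i - f)) ^ (1/2:ℝ) = _
    rw [← hle _ ((hF i).sub hf.1), eLpNorm_two]
  have hfin : eLpNorm f 2 μ ≠ (⊤:ℝ≥0∞) := by
    rw [eLpNorm_two, hle f hf.1]
    refine ENNReal.rpow_ne_top_of_nonneg (by norm_num) (((hbd f).trans_lt ?_).ne)
    refine ENNReal.mul_lt_top ENNReal.ofReal_lt_top ((setLIntegral_le_lintegral _ _).trans_lt ?_)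
    have := hf.2
    rw [eLpNorm_two] at this
    by_contra h
    rw [not_lt, top_le_iff] at h
    rw [h] at this; simp at this
  have hmain : Tendsto (fun i => eLpNorm (F i) 2 μ) l (𝓝 (eLpNorm f 2 μ)) := by
    have hFm := fun i => (hF i).mono_ac hac
    have hfm := hf.1.mono_ac hac
    refine tendsto_of_tendsto_of_tendsto_of_le_of_le (g := fun i => eLpNorm f 2 μ - eLpNorm (F i - f) 2 μ) 
      (h := fun i => eLpNorm f 2 μ + eLpNorm (F i - f) 2 μ) ?_ ?_ (fun i => ?_) (fun i => ?_)
    · have := ENNReal.Tendsto.sub (tendsto_const_nhds (x := eLpNorm f 2 μ)) hd (Or.inl hfin)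
      simpa using this
    · simpa using (tendsto_const_nhds (x := eLpNorm f 2 μ)).add hd
    · simp only
      rw [tsub_le_iff_right]
      have := eLpNorm_sub_le (p := 2) (hFm i) ((hFm i).sub hfm) (by norm_num)
      rwa [sub_sub_cancel] at this
    · have := eLpNorm_add_le (p := 2) hfm ((hFm i).sub hfm) (by norm_num)
      rwa [add_sub_cancel] at this
  rw [← hq f hf.1]
  refine (ENNReal.Tendsto.pow (n := 2) hmain).congr fun i => hq _ (hF i)
end BP

namespace BP
open Filter Topology
set_option linter.all false
open scoped ContDiff ComplexConjugate
variable {N : ℕ}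

lemma memLp_cut {D K : Set (Cn N)} (hK : IsCompact K) (hKD : K ⊆ D) {a f : Cn N → ℂ} (ha : ContinuousOn a D)
    (h0 : ∀ x, x ∉ K → a x = 0) (hf : MemLp f 2 (volume.restrict K)) : MemLp (fun x => a x * f x) 2 := by
  have e : (fun x => a x * f x) = K.indicator (fun x => a x * f x) := by
    ext x
    by_cases hx : x ∈ K
    · rw [indicator_of_mem hx]
    · rw [indicator_of_notMem hx, h0 x hx, zero_mul]
  rw [e, memLp_indicator_iff_restrict hK.measurableSet]
  obtain ⟨c, hc⟩ := hK.exists_bound_of_continuousOn (ha.mono hKD)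
  refine hf.of_le_mul (c := c) (((ha.mono hKD).aestronglyMeasurable hK.measurableSet).mul hf.1) ?_
  refine (ae_restrict_iff' hK.measurableSet).2 (ae_of_all _ fun x hx => ?_)
  rw [norm_mul]
  gcongr
  exact hc x hx

lemma int_cut {D K : Set (Cn N)} (hK : IsCompact K) (hKD : K ⊆ D) {a f : Cn N → ℂ} (ha : ContinuousOn a D)
    (h0 : ∀ x, x ∉ K → a x = 0) (hf : MemLp f 2 (volume.restrict K)) : Integrable (fun x => a x * f x) := by
  have h := memLp_cut hK hKD ha h0 hf
  have hfin : IsFiniteMeasure (volume.restrict K) := ⟨by simpa using hK.measure_lt_top⟩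
  have h1 : IntegrableOn (fun x => a x * f x) K := (h.restrict K).integrable (by norm_num)
  rw [← integrableOn_iff_integrable_of_support_subset (s := K)]
  · exact h1
  · intro x hx
    by_contra hxK
    exact hx (by simp [h0 x hxK])

lemma enorm_sum_sq (f : Fin N → ℂ) : ‖∑ j, f j‖ₑ^2 ≤ N * ∑ j, ‖f j‖ₑ^2 := by
  have h1 : ‖∑ j, f j‖₊^2 ≤ (N : ℝ≥0) * ∑ j, ‖f j‖₊^2 := by
    calc ‖∑ j, f j‖₊^2 ≤ (∑ j, ‖f j‖₊)^2 := by gcongr; exact nnnorm_sum_le _ _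
      _ ≤ _ := by simpa using sq_sum_le_card_mul_sum_sq (s := Finset.univ) (f := fun j => ‖f j‖₊)
  simp only [enorm]
  exact_mod_cast h1

/-- smoothness of a product with a compactly supported factor -/
lemma cd_cut {D K : Set (Cn N)} (hD : IsOpen D) (hK : IsClosed K) (hKD : K ⊆ D) {a : Cn N → ℂ} (ha : ContDiffOn ℝ ∞ a D)
    (h0 : ∀ x, x ∉ K → a x = 0) : ContDiff ℝ ∞ a := by
  rw [contDiff_iff_contDiffAt]
  intro x
  by_cases hx : x ∈ D
  · exact ha.contDiffAt (hD.mem_nhds hx)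
  · have : a =ᶠ[𝓝 x] fun _ => 0 := by
      filter_upwards [hK.isOpen_compl.mem_nhds (fun h => hx (hKD h))] with y hy using h0 y hy
    exact (contDiffAt_const (c := (0:ℂ))).congr_of_eventuallyEq this

lemma moll_tst (δ : ℝ) (f : Cn N → ℂ) (x : Cn N) : moll δ f x = ∫ w, tst δ x w * f w := rfl

lemma weak3 {D : Set (Cn N)} (hD : IsOpen D) {b : Fin N → Cn N → ℂ} 
   (hb : ∀ j K, IsCompact K → K ⊆ D → MemLp (b j) 2 (volume.restrict K))
  {w : Cn N → ℂ} (hw : ContDiffOn ℝ ∞ w D) (h3 : ∀ h : Cn N → ℂ, ContDiff ℝ ∞ h → HasCompactSupport h → tsupport h ⊆ D → 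
     ∀ j k, ∫ y, w y * db j h y * b k y = ∫ y, w y * db k h y * b j y)
  {η : Cn N → ℂ} (hη : ContDiff ℝ ∞ η) (hc : HasCompactSupport η) (hs : tsupport η ⊆ D) {δ : ℝ} (hδ : 0 < δ) 
    (j k : Fin N) (x : Cn N) :
    db j (moll δ fun y => η y * w y * b k y) x - db k (moll δ fun y => η y * w y * b j y) x = 
      moll δ (fun y => db j η y * w y * b k y - db k η y * w y * b j y) x := by
  have hz : ∀ y, y ∉ tsupport η → η y = 0 := fun y hy => image_eq_zero_of_notMem_tsupport hy
  have hL : ∀ k, MemLp (fun y => η y * w y * b k y) 2 := fun k => memLp_cut (D := D) hc hs 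
    (hη.continuous.continuousOn.mul hw.continuousOn) (fun y hy => by simp [hz y hy]) (hb k _ hc hs)
  have hh := cd_tst (N := N) δ x
  rw [db_moll' hδ (loc_of_memLp (hL k)), db_moll' hδ (loc_of_memLp (hL j)), moll_tst]
  have hH : ContDiff ℝ ∞ fun y => η y * tst δ x y := hη.mul hh
  have hHs : tsupport (fun y => η y * tst δ x y) ⊆ tsupport η := tsupport_mul_subset_left
  have h := h3 _ hH (hc.mono' (subset_tsupport _ |>.trans hHs)) (hHs.trans hs) j k
  have e : ∀ j y, db j (fun y => η y * tst δ x y) y = db j η y * tst δ x y + η y * db j (tst δ x) y := fun j y => 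
    db_mul (cd_diff hη y) (cd_diff hh y)
  have i1 : ∀ j k, Integrable fun y => tst δ x y * (db j η y * w y * b k y) := fun j k => by
    have := int_cut (D := D) (a := fun y => tst δ x y * (db j η y * w y)) hc hs 
      (hh.continuous.continuousOn.mul ((cd_db hη j).continuous.continuousOn.mul hw.continuousOn)) 
      (fun y hy => by simp [db_eq_zero hy]) (hb k _ hc hs)
    refine this.congr (ae_of_all _ fun y => ?_); simp only; ring
  have i2 : ∀ j k, Integrable fun y => db j (tst δ x) y * (η y * w y * b k y) := fun j k => by
    have := int_cut (D := D) (a := fun y => db j (tst δ x) y * (η y * w y)) hc hs 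
      ((cd_db hh j).continuous.continuousOn.mul (hη.continuous.continuousOn.mul hw.continuousOn)) 
      (fun y hy => by simp [hz y hy]) (hb k _ hc hs)
    refine this.congr (ae_of_all _ fun y => ?_); simp only; ring
  have e2 : ∀ j k, ∫ y, w y * db j (fun y => η y * tst δ x y) y * b k y = 
      (∫ y, tst δ x y * (db j η y * w y * b k y)) + ∫ y, db j (tst δ x) y * (η y * w y * b k y) := fun j k => by
    rw [← integral_add (i1 j k) (i2 j k)]
    refine integral_congr_ae (ae_of_all _ fun y => ?_)
    simp only [e]; ring
  rw [e2, e2] at h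
  simp only [mul_sub]
  rw [integral_sub (i1 j k) (i1 k j)]
  linear_combination -h

lemma weak2 {D : Set (Cn N)} (hD : IsOpen D) {b : Fin N → Cn N → ℂ} {g : Cn N → ℂ} 
   (hb : ∀ j K, IsCompact K → K ⊆ D → MemLp (b j) 2 (volume.restrict K))
  (hg : Continuous g)
  (h2 : ∀ h : Cn N → ℂ, ContDiff ℝ ∞ h → HasCompactSupport h → tsupport h ⊆ D → 
     ∑ j, ∫ y, dz j h y * b j y = - ∫ y, h y * g y)
  {A : Cn N → ℂ} (hη : ContDiff ℝ ∞ A) (hc : HasCompactSupport A) (hs : tsupport A ⊆ D) {δ : ℝ} (hδ : 0 < δ) 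
    (x : Cn N) :
    ∑ j, dz j (moll δ fun y => A y * b j y) x = 
      moll δ (fun y => A y * g y + ∑ j, dz j A y * b j y) x := by
  have hz : ∀ y, y ∉ tsupport A → A y = 0 := fun y hy => image_eq_zero_of_notMem_tsupport hy
  have hL : ∀ k, MemLp (fun y => A y * b k y) 2 := fun k => memLp_cut (D := D) hc hs 
    (hη.continuous.continuousOn) (fun y hy => by simp [hz y hy]) (hb k _ hc hs)
  have hh := cd_tst (N := N) δ x
  simp only [fun j => dz_moll' hδ (loc_of_memLp (hL j)) j x]
  rw [moll_tst]
  have hH : ContDiff ℝ ∞ fun y => A y * tst δ x y := hη.mul hh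
  have hHs : tsupport (fun y => A y * tst δ x y) ⊆ tsupport A := tsupport_mul_subset_left
  have h := h2 _ hH (hc.mono' (subset_tsupport _ |>.trans hHs)) (hHs.trans hs)
  have e : ∀ j y, dz j (fun y => A y * tst δ x y) y = dz j A y * tst δ x y + A y * dz j (tst δ x) y := fun j y => 
    dz_mul (cd_diff hη y) (cd_diff hh y)
  have i1 : ∀ j, Integrable fun y => tst δ x y * (dz j A y * b j y) := fun j => by
    have := int_cut (D := D) (a := fun y => tst δ x y * dz j A y) hc hs 
      (hh.continuous.mul (cd_dz hη j).continuous).continuousOn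
      (fun y hy => by simp [dz_eq_zero hy]) (hb j _ hc hs)
    refine this.congr (ae_of_all _ fun y => ?_); simp only; ring
  have i2 : ∀ j, Integrable fun y => dz j (tst δ x) y * (A y * b j y) := fun j => by
    have := int_cut (D := D) (a := fun y => dz j (tst δ x) y * A y) hc hs 
      ((cd_dz hh j).continuous.mul hη.continuous).continuousOn
      (fun y hy => by simp [hz y hy]) (hb j _ hc hs)
    refine this.congr (ae_of_all _ fun y => ?_); simp only; ring
  have i3 : Integrable fun y => tst δ x y * (A y * g y) := int_of_hcs (by fun_prop (disch := exact hh.continuous)) 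
    ((hc.mul_right (f' := g)).mul_left)
  have e2 : ∀ j, ∫ y, dz j (fun y => A y * tst δ x y) y * b j y = 
      (∫ y, tst δ x y * (dz j A y * b j y)) + ∫ y, dz j (tst δ x) y * (A y * b j y) := fun j => by
    rw [← integral_add (i1 j) (i2 j)]
    refine integral_congr_ae (ae_of_all _ fun y => ?_)
    simp only [e]; ring
  simp only [e2, Finset.sum_add_distrib] at h
  have e3 : ∫ y, tst δ x y * (A y * g y + ∑ j, dz j A y * b j y) = (∫ y, tst δ x y * (A y * g y)) + 
      ∑ j, ∫ y, tst δ x y * (dz j A y * b j y) := by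
    rw [← integral_finset_sum _ fun j _ => i1 j, ← integral_add i3 (integrable_finset_sum _ fun j _ => i1 j)]
    refine integral_congr_ae (ae_of_all _ fun y => ?_)
    simp only [mul_add, Finset.mul_sum]
  have e4 : ∫ y, A y * tst δ x y * g y = ∫ y, tst δ x y * (A y * g y) := 
    integral_congr_ae (ae_of_all _ fun y => by simp only; ring)
  rw [e3, Finset.sum_neg_distrib]
  rw [e4] at h
  linear_combination -h
end BP

namespace BP
open Filter Topology
set_option linter.all false
open scoped ContDiff ComplexConjugate
variable {N : ℕ}

lemma dz_expw {u : Cn N → ℝ} {x : Cn N} (j : Fin N) (h : DifferentiableAt ℝ u x) :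
    dz j (fun y => ((Real.exp (u y) : ℝ) : ℂ)) x = dz j (fun y => (u y : ℂ)) x * (Real.exp (u x) : ℝ) := by
  have h1 := dz_wt (Φ := fun y => - u y) (x := x) j h.neg
  have e : wt (fun y => - u y) = fun y => ((Real.exp (u y) : ℝ) : ℂ) := by ext y; simp [wt]
  rw [e] at h1
  rw [h1]
  have : dz j (fun y => ((- u y : ℝ) : ℂ)) x = - dz j (fun y => (u y : ℂ)) x := by
    have e2 : (fun y => ((- u y : ℝ) : ℂ)) = fun y => - ((u y : ℂ)) := by ext y; simp
    rw [e2]; simp only [dz, fderiv_fun_neg, ContinuousLinearMap.neg_apply]; ring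
  rw [this, neg_neg]

lemma q2_mono {K L : Set (Cn N)} (h : K ⊆ L) (W : Cn N → ℝ) (f : Cn N → ℂ) : q2 W K f ≤ q2 W L f := 
  lintegral_mono_set h

lemma q2_congr {K : Set (Cn N)} (hK : MeasurableSet K) {W W' : Cn N → ℝ} {f f' : Cn N → ℂ} 
    (h : ∀ x ∈ K, ENNReal.ofReal (W x) * ‖f x‖ₑ^2 = ENNReal.ofReal (W' x) * ‖f' x‖ₑ^2) : q2 W K f = q2 W' K f' := 
  setLIntegral_congr_fun hK h

lemma wt_conv {Φ σ W t : ℝ} {f : ℂ} (hW : t = W * Real.exp (Φ - 2 * σ)) : ENNReal.ofReal (W * Real.exp (-Φ)) * ‖((Real.exp (Φ - σ) : ℝ) : ℂ) * f‖ₑ^2 = 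
    ENNReal.ofReal t * ‖f‖ₑ^2 := by
  rw [hW, enorm_mul, mul_pow, ← mul_assoc]
  congr 1
  have : ‖((Real.exp (Φ - σ) : ℝ) : ℂ)‖ₑ^2 = ENNReal.ofReal (Real.exp (2 * (Φ - σ))) := by
    rw [← ofReal_norm, Complex.norm_real, Real.norm_of_nonneg (Real.exp_pos _).le, ← ENNReal.ofReal_pow (Real.exp_pos _).le,
      ← Real.exp_nat_mul]; push_cast; rfl
  rw [this, ← ENNReal.ofReal_mul' (Real.exp_pos _).le, mul_assoc, ← Real.exp_add]
  congr 3; ring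

lemma measurable_indicator_of_restrict {K : Set (Cn N)} (hK : MeasurableSet K) {f : Cn N → ℂ}
    (h : Measurable (fun x : K => f x)) : Measurable (K.indicator f) := by
  refine measurable_of_restrict_of_restrict_compl hK ?_ ?_
  · convert h using 1; ext ⟨x, hx⟩; exact indicator_of_mem hx f
  · convert measurable_const (a := (0:ℂ)) using 1; ext ⟨x, hx⟩; exact indicator_of_notMem hx f

lemma L2_comb {N : ℕ} {K : Set (Cn N)} (hK : MeasurableSet K) {c : Fin N → Cn N → ℂ} {C : ℝ≥0} (hC : ∀ j, ∀ x ∈ K, ‖c j x‖ₑ ≤ C) {θ : Cn N → ℂ} {β : Fin N → Cn N → ℂ}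
    (hc : ∀ j, Measurable (c j)) (hθ : MemLp θ 2) (hβ : ∀ j, MemLp (β j) 2) : 
    Tendsto (fun δ => ∫⁻ x in K, ‖(moll δ θ x - ∑ j, c j x * moll δ (β j) x) - (θ x - ∑ j, c j x * β j x)‖ₑ^2) (𝓝[>] 0) (𝓝 0) := by
  have hlim : Tendsto (fun δ => 2 * (∫⁻ x, ‖moll δ θ x - θ x‖ₑ^2) + 2 * (N * ∑ j, (C:ℝ≥0∞)^2 * ∫⁻ x, ‖moll δ (β j) x - β j x‖ₑ^2)) (𝓝[>] 0) (𝓝 0) := by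
    have h1 := ENNReal.Tendsto.const_mul (a := 2) (moll_L2' hθ) (Or.inr (by norm_num))
    have h2 : ∀ j, Tendsto (fun δ => (C:ℝ≥0∞)^2 * ∫⁻ x, ‖moll δ (β j) x - β j x‖ₑ^2) (𝓝[>] 0) (𝓝 0) := fun j => by
      have := ENNReal.Tendsto.const_mul (a := (C:ℝ≥0∞)^2) (moll_L2' (hβ j)) (Or.inr (by simp))
      simpa using this
    have h3 := ENNReal.Tendsto.const_mul (a := (2:ℝ≥0∞)) (ENNReal.Tendsto.const_mul (a := (N:ℝ≥0∞)) (tendsto_finsetSum Finset.univ fun j _ => h2 j) (Or.inr (by simp))) (Or.inr (by norm_num))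
    simpa using h1.add h3
  refine tendsto_of_tendsto_of_tendsto_of_le_of_le' tendsto_const_nhds hlim (Eventually.of_forall fun _ => bot_le) ?_
  filter_upwards [self_mem_nhdsWithin] with δ hδ
  have m1 : AEMeasurable (fun x => ‖moll δ θ x - θ x‖ₑ^2) volume := 
    (((cd_moll hδ (loc_of_memLp hθ)).continuous.aestronglyMeasurable.sub hθ.1).enorm.pow_const 2)
  have m2 : ∀ j, AEMeasurable (fun x => ‖moll δ (β j) x - β j x‖ₑ^2) volume := fun j => 
    (((cd_moll hδ (loc_of_memLp (hβ j))).continuous.aestronglyMeasurable.sub (hβ j).1).enorm.pow_const 2)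
  calc _ ≤ ∫⁻ x in K, (2 * ‖moll δ θ x - θ x‖ₑ^2 + 2 * (N * ∑ j, (C:ℝ≥0∞)^2 * ‖moll δ (β j) x - β j x‖ₑ^2)) := by
        refine setLIntegral_mono' hK fun x hx => ?_
        have e : (moll δ θ x - ∑ j, c j x * moll δ (β j) x) - (θ x - ∑ j, c j x * β j x) = 
          (moll δ θ x - θ x) + ∑ j, c j x * (β j x - moll δ (β j) x) := by
          simp only [mul_sub, Finset.sum_sub_distrib]; ring
        rw [e]
        refine (enorm_add_sq _ _).trans ?_
        gcongr
        refine (enorm_sum_sq _).trans ?_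
        gcongr with j
        rw [enorm_mul, mul_pow, ← enorm_neg (β j x - _), neg_sub]
        gcongr
        exact hC j x hx
    _ ≤ ∫⁻ x, (2 * ‖moll δ θ x - θ x‖ₑ^2 + 2 * (N * ∑ j, (C:ℝ≥0∞)^2 * ‖moll δ (β j) x - β j x‖ₑ^2)) := setLIntegral_le_lintegral _ _
    _ = _ := by
        rw [lintegral_add_left' (m1.const_mul 2), lintegral_const_mul'' _ m1, lintegral_const_mul' _ _ (by norm_num),
          lintegral_const_mul' _ _ (by simp), lintegral_finset_sum' _ fun j _ => (m2 j).const_mul _]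
        congr 3
        exact Finset.sum_congr rfl fun j _ => lintegral_const_mul'' _ (m2 j)

set_option maxHeartbeats 1000000 in
lemma ineq_eta {D : Set (Cn N)} (hD : IsOpen D) 
    {Φ σ s p : Cn N → ℝ} (hΦ : ContDiffOn ℝ ∞ Φ D) (hσ : ContDiffOn ℝ ∞ σ D)
    (hs : ContinuousOn s D) (hp : ContinuousOn p D) (hs0 : ∀ x ∈ D, 0 < s x) (hp0 : ∀ x ∈ D, 0 ≤ p x) (i0 : Fin N)
    (hL : ∀ x ∈ D, ∀ b : Cn N, p x * ‖b i0‖^2 ≤ levi Φ x b - (1 + s x) * gr σ x b)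
    {b : Fin N → Cn N → ℂ} {g : Cn N → ℂ} (hb : ∀ j K, IsCompact K → K ⊆ D → MemLp (b j) 2 (volume.restrict K))
    (hg : Continuous g) (h2 : ∀ h : Cn N → ℂ, ContDiff ℝ ∞ h → HasCompactSupport h → tsupport h ⊆ D → 
     ∑ j, ∫ y, dz j h y * b j y = - ∫ y, h y * g y)
    (h3 : ∀ h : Cn N → ℂ, ContDiff ℝ ∞ h → HasCompactSupport h → tsupport h ⊆ D → 
     ∀ j k, ∫ y, ((Real.exp (Φ y - σ y) : ℝ) : ℂ) * db j h y * b k y = ∫ y, ((Real.exp (Φ y - σ y) : ℝ) : ℂ) * db k h y * b j y)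
    {η : Cn N → ℂ} (hη : ContDiff ℝ ∞ η) (hc : HasCompactSupport η) (hsu : tsupport η ⊆ D) :
    q2 (fun x => p x * Real.exp (Φ x - 2 * σ x)) D (fun x => η x * b i0 x) ≤ 
      q2 (fun x => (1 + 1 / s x) * Real.exp (Φ x - 2 * σ x)) D (fun x => η x * g x + ∑ j, dz j η x * b j x) +
      ∑ j, ∑ k, q2 (fun x => Real.exp (Φ x - 2 * σ x)) D (fun x => db j η x * b k x - db k η x * b j x) := by
  set u : Cn N → ℝ := fun y => Φ y - σ y with hu
  set w : Cn N → ℂ := fun y => ((Real.exp (u y) : ℝ) : ℂ) with hwdef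
  have hus : ContDiffOn ℝ ∞ u D := hΦ.sub hσ
  have hw : ContDiffOn ℝ ∞ w D := ofRealCLM.contDiff.comp_contDiffOn hus.exp
  obtain ⟨δ0, hδ0, hKD⟩ := hc.isCompact.exists_cthickening_subset_open hD hsu
  set K := Metric.cthickening δ0 (tsupport η) with hKdef
  have hK : IsCompact K := hc.isCompact.cthickening
  have hKm := hK.measurableSet
  have hηK : tsupport η ⊆ K := Metric.self_subset_cthickening _
  have hz : ∀ y, y ∉ tsupport η → η y = 0 := fun y hy => image_eq_zero_of_notMem_tsupport hy
  set A : Cn N → ℂ := fun y => η y * w y with hAdef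
  have hA : ContDiff ℝ ∞ A := cd_cut hD (isClosed_tsupport η) hsu (hη.contDiffOn.mul hw) (fun y hy => by simp [A, hz y hy])
  have hAs : tsupport A ⊆ tsupport η := tsupport_mul_subset_left
  have hAc : HasCompactSupport A := hc.mono' ((subset_tsupport _).trans hAs)
  have hβL : ∀ k, MemLp (fun y => A y * b k y) 2 := fun k => memLp_cut (D := D) hc hsu 
    hA.continuous.continuousOn (fun y hy => by simp [A, hz y hy]) (hb k _ hc hsu)
  set θ : Cn N → ℂ := fun y => A y * g y + ∑ j, dz j A y * b j y with hθ
  have hθL : MemLp θ 2 := by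
    refine MemLp.add ((hA.continuous.mul hg).memLp_of_hasCompactSupport (hAc.mul_right)) (memLp_finset_sum _ fun j _ => ?_)
    exact memLp_cut (D := D) hAc (hAs.trans hsu) (cd_dz hA j).continuous.continuousOn (fun y hy => dz_eq_zero hy) (hb j _ hAc (hAs.trans hsu))
  set κ : Fin N → Fin N → Cn N → ℂ := fun j k y => db j η y * w y * b k y - db k η y * w y * b j y with hκ
  have hκ1 : ∀ j k, MemLp (fun y => db j η y * w y * b k y) 2 := fun j k => memLp_cut (D := D) hc hsu 
    ((cd_db hη j).continuous.continuousOn.mul hw.continuousOn) (fun y hy => by simp [db_eq_zero hy]) (hb k _ hc hsu)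
  have hκL : ∀ j k, MemLp (κ j k) 2 := fun j k => (hκ1 j k).sub (hκ1 k j)
  set c : Fin N → Cn N → ℂ := fun j => K.indicator (dz j (fun y => (u y : ℂ))) with hcdef
  have hdu : ∀ j, ContinuousOn (dz j (fun y => (u y : ℂ))) D := fun j => by
    have : ContDiffOn ℝ ((⊤ : ℕ∞) : WithTop ℕ∞) (fun y => (u y : ℂ)) D := ofRealCLM.contDiff.comp_contDiffOn hus
    exact (contDiffOn_dz hD this (m := ⊤) (by simp)).continuousOn
  have hcm : ∀ j, Measurable (c j) := fun j => by
    have := (continuousOn_iff_continuous_restrict.1 ((hdu j).mono hKD)).measurable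
    exact (measurable_indicator_of_restrict hKm this)
  have hcK : ∀ j, ∀ x ∈ K, c j x = dz j (fun y => (u y : ℂ)) x := fun j x hx => by simp [c, hx]
  obtain ⟨C, hC⟩ : ∃ C : ℝ≥0, ∀ j, ∀ x ∈ K, ‖c j x‖ₑ ≤ C := by
    choose C hC using fun j => hK.exists_bound_of_continuousOn ((hdu j).mono hKD)
    refine ⟨∑ j, (C j).toNNReal, fun j x hx => ?_⟩
    rw [hcK j x hx, enorm_le_coe]
    refine le_trans ?_ (Finset.single_le_sum (f := fun j => (C j).toNNReal) (fun _ _ => zero_le) (Finset.mem_univ j))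
    exact NNReal.coe_le_coe.1 ((hC j x hx).trans (Real.le_coe_toNNReal _))
  set f' : Cn N → ℂ := fun x => θ x - ∑ j, c j x * (A x * b j x) with hf'
  have hf'L : MemLp f' 2 := by
    refine hθL.sub (memLp_finset_sum _ fun j _ => ?_)
    have := memLp_cut (D := D) (a := fun x => dz j (fun y => (u y : ℂ)) x * A x) hc hsu ((hdu j).mul hA.continuous.continuousOn)
      (fun y hy => by simp [A, hz y hy]) (hb j _ hc hsu)
    refine this.ae_eq (ae_of_all _ fun x => ?_)
    by_cases hx : x ∈ K
    · simp only [hcK j x hx]; ring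
    · simp [A, hz x (fun h => hx (hηK h))]
  -- the inequality for mollified forms
  have key : ∀ᶠ δ in 𝓝[>] (0:ℝ), q2 (fun x => p x * Real.exp (-Φ x)) K (moll δ fun y => A y * b i0 y) ≤ 
      q2 (fun x => (1 + 1 / s x) * Real.exp (-Φ x)) K (fun x => moll δ θ x - ∑ j, c j x * moll δ (fun y => A y * b j y) x) +
      ∑ j, ∑ k, q2 (fun x => Real.exp (-Φ x)) K (moll δ (κ j k)) := by
    filter_upwards [Ioo_mem_nhdsGT hδ0] with δ hδ
    have hsup : ∀ j, tsupport (moll δ fun y => A y * b j y) ⊆ K := fun j => by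
      refine closure_minimal (fun x hx => ?_) hK.isClosed
      by_contra hxK
      refine hx (moll_supp hδ.1 (K := tsupport η) (fun y hy => by simp [A, hz y hy]) fun h => hxK ?_)
      exact Metric.cthickening_mono hδ.2.le _ h
    refine (twisted' hK hD hKD hΦ hσ hs hp hs0 hp0 i0 hL (β := fun j => moll δ fun y => A y * b j y) 
      (fun j => cd_moll hδ.1 (loc_of_memLp (hβL j))) hsup).trans (le_of_eq ?_)
    congr 1
    · refine q2_congr hKm fun x hx => ?_
      rw [weak2 hD hb hg h2 hA hAc (hAs.trans hsu) hδ.1 x]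
      simp only [hcK _ x hx]
      rfl
    · refine Finset.sum_congr rfl fun j _ => Finset.sum_congr rfl fun k _ => ?_
      refine q2_congr hKm fun x hx => ?_
      rw [← weak3 hD hb hw h3 hη hc hsu hδ.1 j k x]
  -- limit
  have hΦc := hΦ.continuousOn.mono hKD
  have hE : ContinuousOn (fun x => Real.exp (-Φ x)) K := hΦc.neg.rexp
  have hS : ContinuousOn (fun x => (1 + 1 / s x)) K := 
    continuousOn_const.add (continuousOn_const.div (hs.mono hKD) fun x hx => (hs0 x (hKD hx)).ne')
  have lim : ∀ {W : Cn N → ℝ} (hW : ContinuousOn W K) {F : ℝ → Cn N → ℂ} {f : Cn N → ℂ} (hF : ∀ δ > 0, AEStronglyMeasurable (F δ) volume)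
     (hf : MemLp f 2) (ht : Tendsto (fun i => ∫⁻ x in K, ‖F i x - f x‖ₑ^2) (𝓝[>] 0) (𝓝 0)), 
       Tendsto (fun i => q2 W K (F i)) (𝓝[>] 0) (𝓝 (q2 W K f)) := by
    intro W hW F f hF hf ht
    obtain ⟨C, hC⟩ := hK.exists_bound_of_continuousOn hW
    have := q2_tendsto (l := comap ((↑) : Ioi (0:ℝ) → ℝ) (𝓝[>] 0)) (F := fun δ : Ioi (0:ℝ) => F δ) hKm (hW.aemeasurable hKm) (c := C) (fun x hx => (le_abs_self _).trans (hC x hx)) 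
      (fun δ => hF δ δ.2) hf (ht.comp tendsto_comap)
    have h2 := this.comp (f := fun δ : ℝ => if h : 0 < δ then (⟨δ, h⟩ : Ioi (0:ℝ)) else ⟨1, (one_pos : (0:ℝ) < 1)⟩) (x := 𝓝[>] 0) ?_
    · refine h2.congr' ?_
      filter_upwards [self_mem_nhdsWithin] with δ hδ
      simp [show 0 < δ from hδ]
    · rw [tendsto_comap_iff]
      refine tendsto_id.congr' ?_
      filter_upwards [self_mem_nhdsWithin] with δ hδ
      simp [show 0 < δ from hδ]
  have hmL : ∀ {f : Cn N → ℂ}, MemLp f 2 → Tendsto (fun i => ∫⁻ x in K, ‖moll i f x - f x‖ₑ^2) (𝓝[>] 0) (𝓝 0) := fun {f} hf => 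
    tendsto_of_tendsto_of_tendsto_of_le_of_le tendsto_const_nhds (moll_L2' hf) (fun _ => bot_le) (fun _ => setLIntegral_le_lintegral _ _)
  have hmm : ∀ {f : Cn N → ℂ}, MemLp f 2 → ∀ δ > 0, AEStronglyMeasurable (moll δ f) volume := fun {f} hf δ hδ => 
    (cd_moll hδ (loc_of_memLp hf)).continuous.aestronglyMeasurable
  have l1 := lim (W := fun x => p x * Real.exp (-Φ x)) ((hp.mono hKD).mul hE) (hmm (hβL i0)) (hβL i0) (hmL (hβL i0))
  have l2 := lim (W := fun x => (1 + 1 / s x) * Real.exp (-Φ x)) (hS.mul hE) 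
    (F := fun δ x => moll δ θ x - ∑ j, c j x * moll δ (fun y => A y * b j y) x) 
    (fun δ hδ => (hmm hθL δ hδ).sub (Finset.aestronglyMeasurable_fun_sum _ fun j _ => (hcm j).aestronglyMeasurable.mul (hmm (hβL j) δ hδ))) 
    hf'L (L2_comb hKm hC hcm hθL hβL)
  have l3 := fun j k => lim hE (hmm (hκL j k)) (hκL j k) (hmL (hκL j k))
  have fin := le_of_tendsto_of_tendsto l1 (l2.add (tendsto_finsetSum Finset.univ fun j _ => tendsto_finsetSum Finset.univ fun k _ => l3 j k)) key
  have hDm := hD.measurableSet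
  have r1 : q2 (fun x => p x * Real.exp (Φ x - 2 * σ x)) D (fun x => η x * b i0 x) = q2 (fun x => p x * Real.exp (-Φ x)) K (fun y => A y * b i0 y) := by
    have : q2 (fun x => p x * Real.exp (Φ x - 2 * σ x)) D (fun x => η x * b i0 x) = q2 (fun x => p x * Real.exp (Φ x - 2 * σ x)) K (fun x => η x * b i0 x) := by
      simp only [q2]
      rw [← lintegral_indicator hDm, ← lintegral_indicator hKm]
      refine lintegral_congr fun x => ?_
      by_cases hx : x ∈ K
      · rw [indicator_of_mem hx, indicator_of_mem (hKD hx)]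
      · classical rw [indicator_of_notMem hx, indicator_apply, hz x (fun h => hx (hηK h))]; simp
    rw [this]
    refine q2_congr hKm fun x hx => ?_
    rw [← wt_conv (Φ := Φ x) (σ := σ x) (W := p x) rfl]
    simp only [A, w, u]; congr 3; ring
  rw [r1]
  refine fin.trans (add_le_add ?_ (Finset.sum_le_sum fun j _ => Finset.sum_le_sum fun k _ => ?_))
  · refine le_trans (le_of_eq ?_) (q2_mono hKD _ _)
    refine q2_congr hKm fun x hx => ?_
    rw [← wt_conv (Φ := Φ x) (σ := σ x) (W := 1 + 1 / s x) rfl]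
    congr 3
    have hxD := hKD hx
    have ud : DifferentiableAt ℝ u x := (hus.contDiffAt (hD.mem_nhds hxD)).differentiableAt (by simp)
    have wd : DifferentiableAt ℝ w x := (hw.contDiffAt (hD.mem_nhds hxD)).differentiableAt (by simp)
    have e : ∀ j, dz j A x = dz j η x * w x + η x * (dz j (fun y => (u y : ℂ)) x * w x) := fun j => by
      rw [dz_mul (cd_diff hη x) wd, dz_expw j ud]
    simp only [f', θ, hcK _ x hx, e]
    rw [mul_add, Finset.mul_sum, add_sub_assoc, ← Finset.sum_sub_distrib]
    congr 1
    · simp only [A, w, u]; ring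
    · refine Finset.sum_congr rfl fun j _ => ?_
      simp only [A, w, u]; ring
  · refine le_trans (le_of_eq ?_) (q2_mono hKD _ _)
    refine q2_congr hKm fun x hx => ?_
    rw [← wt_conv (Φ := Φ x) (σ := σ x) (W := 1) (t := Real.exp (Φ x - 2 * σ x)) (by simp), one_mul]
    congr 3
    simp only [κ, w, u]; ring
end BP

namespace BP
open Filter Topology
set_option linter.all false
open scoped ContDiff ComplexConjugate
variable {N : ℕ}

lemma dz_max {η : Cn N → ℝ} (hη : ContDiff ℝ ∞ η) (h1 : ∀ x, η x ≤ 1) {x : Cn N} (hx : η x = 1) (j : Fin N) :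
    dz j (fun y => (η y : ℂ)) x = 0 ∧ db j (fun y => (η y : ℂ)) x = 0 := by
  have hm : IsLocalMax η x := Eventually.of_forall fun y => by rw [hx]; exact h1 y
  have h0 := hm.fderiv_eq_zero
  have hd : DifferentiableAt ℝ η x := cd_diff hη x
  simp only [dz, db, fderiv_ofReal hd, h0]
  simp

lemma norm_db_real {η : Cn N → ℝ} (x : Cn N) (j : Fin N) :
    ‖db j (fun y => (η y : ℂ)) x‖ₑ = ‖dz j (fun y => (η y : ℂ)) x‖ₑ := by
  have := dz_conj (j := j) (f := fun y => (η y : ℂ)) (x := x)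
  simp only [Complex.conj_ofReal] at this
  rw [this]
  simp [enorm_eq_nnnorm]

lemma dz_bd {W σ s B : ℝ} (hs : 0 < s) {z : ℂ} (h : ‖z‖^2 * Real.exp (-σ) * (1 + 1/s) ≤ B) (b : ℂ) {t : ℝ} (ht : t ≤ 1 + 1/s) : 
    ENNReal.ofReal (t * Real.exp (W - 2 * σ)) * ‖z * b‖ₑ^2 ≤ ENNReal.ofReal B * (ENNReal.ofReal (Real.exp (W - σ)) * ‖b‖ₑ^2) := by
  rw [enorm_mul, mul_pow, ← mul_assoc, ← mul_assoc]
  refine mul_le_mul' ?_ le_rfl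
  rw [← ofReal_norm z, ← ENNReal.ofReal_pow (norm_nonneg _), ← ENNReal.ofReal_mul' (by positivity), ← ENNReal.ofReal_mul' (Real.exp_pos _).le]
  apply ENNReal.ofReal_le_ofReal
  have : Real.exp (W - 2 * σ) = Real.exp (-σ) * Real.exp (W - σ) := by rw [← Real.exp_add]; congr 1; ring
  rw [this]
  calc t * (Real.exp (-σ) * Real.exp (W - σ)) * ‖z‖^2 ≤ (1 + 1/s) * (Real.exp (-σ) * Real.exp (W - σ)) * ‖z‖^2 := by gcongr
    _ = (‖z‖^2 * Real.exp (-σ) * (1 + 1/s)) * Real.exp (W - σ) := by ring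
    _ ≤ _ := by gcongr

set_option maxHeartbeats 1000000 in
lemma weak_ineq {D : Set (Cn N)} (hD : IsOpen D) 
    {Φ σ s p : Cn N → ℝ} (hΦ : ContDiffOn ℝ ∞ Φ D) (hσ : ContDiffOn ℝ ∞ σ D)
    (hs : ContinuousOn s D) (hp : ContinuousOn p D) (hs0 : ∀ x ∈ D, 0 < s x) (hp0 : ∀ x ∈ D, 0 ≤ p x) (i0 : Fin N)
    (hL : ∀ x ∈ D, ∀ b : Cn N, p x * ‖b i0‖^2 ≤ levi Φ x b - (1 + s x) * gr σ x b)
    {η : ℕ → Cn N → ℝ} (hη : ∀ n, ContDiff ℝ ∞ (η n)) (hηc : ∀ n, HasCompactSupport (η n)) (hηs : ∀ n, tsupport (η n) ⊆ D)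
    (hη0 : ∀ n x, 0 ≤ η n x) (hη1 : ∀ n x, η n x ≤ 1) (hηe : ∀ x ∈ D, ∀ᶠ n in atTop, η n x = 1) {B : ℝ}
    (hηB : ∀ n, ∀ x ∈ D, ∀ j, ‖dz j (fun y => (η n y : ℂ)) x‖^2 * Real.exp (-σ x) * (1 + 1 / s x) ≤ B)
    {b : Fin N → Cn N → ℂ} {g : Cn N → ℂ} (hb : ∀ j K, IsCompact K → K ⊆ D → MemLp (b j) 2 (volume.restrict K))
    (hbm : ∀ j, AEStronglyMeasurable (b j) (volume.restrict D))
    (hbf : ∀ j, q2 (fun x => Real.exp (Φ x - σ x)) D (b j) ≠ (⊤ : ℝ≥0∞))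
    (hg : Continuous g) (hgc : HasCompactSupport g) (hgs : tsupport g ⊆ D) 
    (h2 : ∀ h : Cn N → ℂ, ContDiff ℝ ∞ h → HasCompactSupport h → tsupport h ⊆ D → 
     ∑ j, ∫ y, dz j h y * b j y = - ∫ y, h y * g y)
    (h3 : ∀ h : Cn N → ℂ, ContDiff ℝ ∞ h → HasCompactSupport h → tsupport h ⊆ D → 
     ∀ j k, ∫ y, ((Real.exp (Φ y - σ y) : ℝ) : ℂ) * db j h y * b k y = ∫ y, ((Real.exp (Φ y - σ y) : ℝ) : ℂ) * db k h y * b j y) :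
    q2 (fun x => p x * Real.exp (Φ x - 2 * σ x)) D (b i0) ≤ 
      q2 (fun x => (1 + 1 / s x) * Real.exp (Φ x - 2 * σ x)) D g := by
  have hDm := hD.measurableSet
  have hηC : ∀ n, ContDiff ℝ ∞ (fun y => (η n y : ℂ)) := fun n => cd_ofReal (hη n)
  have hsub : ∀ n, tsupport (fun y => (η n y : ℂ)) ⊆ tsupport (η n) := fun n => 
    closure_mono fun x hx => by simpa using hx
  have key := fun n => ineq_eta hD hΦ hσ hs hp hs0 hp0 i0 hL hb hg h2 h3 (hηC n) 
    ((hηc n).mono' ((subset_tsupport _).trans (hsub n))) ((hsub n).trans (hηs n))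
  have hW : ContinuousOn (fun x => Real.exp (Φ x - 2 * σ x)) D := (hΦ.continuousOn.sub (continuousOn_const.mul hσ.continuousOn)).rexp
  have hW1 : ContinuousOn (fun x => Real.exp (Φ x - σ x)) D := (hΦ.continuousOn.sub hσ.continuousOn).rexp
  have hS : ContinuousOn (fun x => (1 + 1 / s x)) D := 
    continuousOn_const.add (continuousOn_const.div hs fun x hx => (hs0 x hx).ne')
  have hSW : ContinuousOn (fun x => (1 + 1 / s x) * Real.exp (Φ x - 2 * σ x)) D := hS.mul hW
  have hpW : ContinuousOn (fun x => p x * Real.exp (Φ x - 2 * σ x)) D := hp.mul hW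
  have mW : ∀ {W : Cn N → ℝ}, ContinuousOn W D → AEMeasurable (fun x => ENNReal.ofReal (W x)) (volume.restrict D) := 
    fun h => (h.aemeasurable hDm).ennreal_ofReal
  have mq : ∀ {W : Cn N → ℝ} {f : Cn N → ℂ}, ContinuousOn W D → AEStronglyMeasurable f (volume.restrict D) →
    AEMeasurable (fun x => ENNReal.ofReal (W x) * ‖f x‖ₑ^2) (volume.restrict D) := fun hW hf => (mW hW).mul (hf.enorm.pow_const 2)
  -- left: Fatou
  have hleft : q2 (fun x => p x * Real.exp (Φ x - 2 * σ x)) D (b i0) ≤ 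
      liminf (fun n => q2 (fun x => p x * Real.exp (Φ x - 2 * σ x)) D (fun x => (η n x : ℂ) * b i0 x)) atTop := by
    refine le_trans (le_of_eq ?_) (lintegral_liminf_le' fun n => mq hpW ((hηC n).continuous.aestronglyMeasurable.mul (hbm i0)))
    refine setLIntegral_congr_fun hDm fun x hx => ?_
    have : (fun n => ENNReal.ofReal (p x * Real.exp (Φ x - 2 * σ x)) * ‖(η n x : ℂ) * b i0 x‖ₑ^2) =ᶠ[atTop] 
      fun _ => ENNReal.ofReal (p x * Real.exp (Φ x - 2 * σ x)) * ‖b i0 x‖ₑ^2 := by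
      filter_upwards [hηe x hx] with n hn
      rw [hn]; simp
    exact ((tendsto_const_nhds.congr' this.symm).liminf_eq).symm
  -- right: dominated convergence
  set bd : Cn N → ℝ≥0∞ := fun x => ∑ j, ENNReal.ofReal B * (ENNReal.ofReal (Real.exp (Φ x - σ x)) * ‖b j x‖ₑ^2) with hbd
  have mbd : AEMeasurable bd (volume.restrict D) := Finset.aemeasurable_fun_sum _ fun j _ => (mq hW1 (hbm j)).const_mul _
  have ibd : ∫⁻ x in D, bd x ≠ (⊤ : ℝ≥0∞) := by
    rw [lintegral_finset_sum' _ fun j _ => (mq hW1 (hbm j)).const_mul _]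
    refine ENNReal.sum_ne_top.2 fun j _ => ?_
    rw [lintegral_const_mul' _ _ ENNReal.ofReal_ne_top]
    exact ENNReal.mul_ne_top ENNReal.ofReal_ne_top (hbf j)
  have ig : q2 (fun x => (1 + 1 / s x) * Real.exp (Φ x - 2 * σ x)) D g ≠ (⊤ : ℝ≥0∞) := by
    have h1 := (q2_eq hgc (hSW.mono hgs) hg.continuousOn fun x hx => by have := hs0 x (hgs hx); positivity).1
    have h2 : q2 (fun x => (1 + 1 / s x) * Real.exp (Φ x - 2 * σ x)) D g = q2 (fun x => (1 + 1 / s x) * Real.exp (Φ x - 2 * σ x)) (tsupport g) g := by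
      simp only [q2]
      rw [← lintegral_indicator hDm, ← lintegral_indicator (isClosed_tsupport g).measurableSet]
      refine lintegral_congr fun x => ?_
      by_cases hx : x ∈ tsupport g
      · rw [indicator_of_mem hx, indicator_of_mem (hgs hx)]
      · classical rw [indicator_of_notMem hx, indicator_apply, image_eq_zero_of_notMem_tsupport hx]; simp
    rw [h2, h1]; exact ENNReal.ofReal_ne_top
  have bj : ∀ n, ∀ x ∈ D, ∀ j, ∀ (k : Fin N) (t : ℝ), t ≤ 1 + 1/s x → 
      ENNReal.ofReal (t * Real.exp (Φ x - 2 * σ x)) * ‖dz j (fun y => (η n y : ℂ)) x * b k x‖ₑ^2 ≤ bd x := fun n x hx j k t ht => 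
    (dz_bd (hs0 x hx) (hηB n x hx j) (b k x) ht).trans 
      (Finset.single_le_sum (f := fun k => ENNReal.ofReal B * (ENNReal.ofReal (Real.exp (Φ x - σ x)) * ‖b k x‖ₑ^2)) (fun _ _ => zero_le) (Finset.mem_univ k))
  have hr1 : Tendsto (fun n => q2 (fun x => (1 + 1 / s x) * Real.exp (Φ x - 2 * σ x)) D 
      (fun x => (η n x : ℂ) * g x + ∑ j, dz j (fun y => (η n y : ℂ)) x * b j x)) atTop (𝓝 (q2 (fun x => (1 + 1 / s x) * Real.exp (Φ x - 2 * σ x)) D g)) := by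
    refine tendsto_lintegral_of_dominated_convergence' (bound := fun x => 2 * (ENNReal.ofReal ((1 + 1 / s x) * Real.exp (Φ x - 2 * σ x)) * ‖g x‖ₑ^2) + 2 * (N * (N * bd x))) ?_ ?_ ?_ ?_
    · intro n
      exact mq hSW (((hηC n).continuous.mul hg).aestronglyMeasurable.add (Finset.aestronglyMeasurable_fun_sum _ fun j _ => 
        (cd_dz (hηC n) j).continuous.aestronglyMeasurable.mul (hbm j)))
    · intro n
      refine (ae_restrict_iff' hDm).2 (ae_of_all _ fun x hx => ?_)
      refine (mul_le_mul' le_rfl (enorm_add_sq _ _)).trans ?_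
      rw [mul_add, mul_left_comm, mul_left_comm _ 2]
      beta_reduce
      gcongr ?_ + ?_
      · gcongr
        rw [enorm_mul]
        have : ‖(η n x : ℂ)‖ₑ ≤ 1 := by
          rw [← ofReal_norm, Complex.norm_real, Real.norm_of_nonneg (hη0 n x)]
          exact ENNReal.ofReal_le_one.2 (hη1 n x)
        exact (mul_le_mul' this le_rfl).trans (one_mul _).le
      · refine mul_le_mul' le_rfl ?_
        refine (mul_le_mul' le_rfl (enorm_sum_sq _)).trans ?_
        rw [mul_left_comm, Finset.mul_sum]
        refine mul_le_mul' le_rfl ?_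
        refine (Finset.sum_le_sum fun j _ => bj n x hx j j _ le_rfl).trans ?_
        simp
    · rw [lintegral_add_left' ((mq hSW hg.aestronglyMeasurable).const_mul 2), lintegral_const_mul' _ _ (by norm_num), lintegral_const_mul' _ _ (by norm_num),
        lintegral_const_mul' _ _ (by simp), lintegral_const_mul' _ _ (by simp)]
      refine ENNReal.add_ne_top.2 ⟨ENNReal.mul_ne_top (by norm_num) ig, ENNReal.mul_ne_top (by norm_num) (ENNReal.mul_ne_top (by simp) (ENNReal.mul_ne_top (by simp) ibd))⟩
    · refine (ae_restrict_iff' hDm).2 (ae_of_all _ fun x hx => ?_)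
      refine tendsto_const_nhds.congr' ?_
      filter_upwards [hηe x hx] with n hn
      simp [hn, fun j => (dz_max (hη n) (hη1 n) hn j).1]
  have hr2 : ∀ j k, Tendsto (fun n => q2 (fun x => Real.exp (Φ x - 2 * σ x)) D 
      (fun x => db j (fun y => (η n y : ℂ)) x * b k x - db k (fun y => (η n y : ℂ)) x * b j x)) atTop (𝓝 0) := by
    intro j k
    have : (0 : ℝ≥0∞) = ∫⁻ x in D, 0 := by simp
    rw [this]
    refine tendsto_lintegral_of_dominated_convergence' (bound := fun x => 2 * bd x + 2 * bd x) ?_ ?_ ?_ ?_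
    · intro n
      exact mq hW (((cd_db (hηC n) j).continuous.aestronglyMeasurable.mul (hbm k)).sub ((cd_db (hηC n) k).continuous.aestronglyMeasurable.mul (hbm j)))
    · intro n
      refine (ae_restrict_iff' hDm).2 (ae_of_all _ fun x hx => ?_)
      beta_reduce
      rw [sub_eq_add_neg (_ * _) (_ * _)]
      refine (mul_le_mul' le_rfl (enorm_add_sq _ _)).trans ?_
      rw [mul_add, mul_left_comm, mul_left_comm _ 2, enorm_neg]
      have h1 : (1:ℝ) ≤ 1 + 1 / s x := by have := hs0 x hx; simp only [le_add_iff_nonneg_right]; positivity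
      gcongr
      · have := bj n x hx j k 1 h1
        rwa [one_mul, enorm_mul, ← norm_db_real, ← enorm_mul] at this
      · have := bj n x hx k j 1 h1
        rwa [one_mul, enorm_mul, ← norm_db_real, ← enorm_mul] at this
    · rw [lintegral_add_left' (mbd.const_mul 2), lintegral_const_mul' _ _ (by norm_num)]
      exact ENNReal.add_ne_top.2 ⟨ENNReal.mul_ne_top (by norm_num) ibd, ENNReal.mul_ne_top (by norm_num) ibd⟩
    · refine (ae_restrict_iff' hDm).2 (ae_of_all _ fun x hx => ?_)
      refine tendsto_const_nhds.congr' ?_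
      filter_upwards [hηe x hx] with n hn
      simp [fun j => (dz_max (hη n) (hη1 n) hn j).2]
  have hr := hr1.add (tendsto_finsetSum Finset.univ fun j _ => tendsto_finsetSum Finset.univ fun k _ => hr2 j k)
  simp only [Finset.sum_const_zero, add_zero] at hr
  refine hleft.trans (le_trans (liminf_le_liminf (Eventually.of_forall key)) (le_of_eq hr.liminf_eq))
end BP

namespace BP
open Filter Topology
set_option linter.all false
open scoped ContDiff ComplexConjugate
variable {N : ℕ}

lemma mem_span_orth {H : Type*} [NormedAddCommGroup H] [InnerProductSpace ℂ H] {G : Set H} {v : H} 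
    (h : ∀ x ∈ G, inner ℂ x v = 0) : v ∈ (Submodule.span ℂ G)ᗮ := by
  rw [Submodule.mem_orthogonal]
  intro u hu
  induction hu using Submodule.span_induction with
  | mem x hx => exact h x hx
  | zero => simp
  | add x y _ _ hx hy => rw [inner_add_left, hx, hy, add_zero]
  | smul a x _ hx => rw [inner_smul_left, hx, mul_zero]

abbrev HL (D : Set (Cn N)) := PiLp 2 (fun _ : Fin N => Lp ℂ 2 (volume.restrict D))

lemma inner_toLp {D : Set (Cn N)} {f : Cn N → ℂ} (hf : MemLp f 2 (volume.restrict D)) (v : Lp ℂ 2 (volume.restrict D)) :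
    inner ℂ (hf.toLp f) v = ∫ x in D, conj (f x) * v x := by
  rw [L2.inner_def]
  refine integral_congr_ae ?_
  filter_upwards [hf.coeFn_toLp] with x hx
  rw [hx, RCLike.inner_apply, mul_comm]

lemma inner_toLp2 {D : Set (Cn N)} {f g : Cn N → ℂ} (hf : MemLp f 2 (volume.restrict D)) (hg : MemLp g 2 (volume.restrict D)) :
    inner ℂ (hf.toLp f) (hg.toLp g) = ∫ x in D, conj (f x) * g x := by
  rw [inner_toLp]
  refine integral_congr_ae ?_
  filter_upwards [hg.coeFn_toLp] with x hx
  rw [hx]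

lemma dbdb_ibp {D : Set (Cn N)} (hD : IsOpen D) {F h : Cn N → ℂ} (hF : ContDiffOn ℝ ∞ F D) (hh : ContDiff ℝ ∞ h) (hc : HasCompactSupport h)
    (hs : tsupport h ⊆ D) (j k : Fin N) : ∫ x, db k h x * db j F x = ∫ x, db j h x * db k F x := by
  obtain ⟨Ψ, hΨ, he⟩ := exists_ext hc.isCompact hD hs hF
  have e : ∀ j k, ∫ x, db k h x * db j F x = - ∫ x, h x * db k (db j Ψ) x := fun j k => by
    rw [ibp_db_g k (le1 hh) (le1 (cd_db hΨ j)) hc, neg_neg]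
    refine integral_congr_ae (ae_of_all _ fun x => ?_)
    by_cases hx : x ∈ tsupport h
    · simp only [db_congr (he x hx)]
    · simp [db_eq_zero hx]
  rw [e, e]
  congr 2; ext x
  rw [db_db_comm _ _ (cd_at2 hΨ x)]

lemma int_supp {D : Set (Cn N)} {f : Cn N → ℂ} (h : ∀ x, x ∉ D → f x = 0) : ∫ x in D, f x = ∫ x, f x := 
  setIntegral_eq_integral_of_forall_compl_eq_zero h

lemma memLp_of_q2 {D : Set (Cn N)} (hD : MeasurableSet D) {f : Cn N → ℂ} {W : Cn N → ℝ} (hf : AEStronglyMeasurable f (volume.restrict D)) (hW : ContinuousOn W D)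
    (h : q2 (fun x => Real.exp (W x)) D f ≠ (⊤ : ℝ≥0∞)) : MemLp (fun x => ((Real.exp (W x / 2) : ℝ) : ℂ) * f x) 2 (volume.restrict D) := by
  have hc : ContinuousOn (fun x => ((Real.exp (W x / 2) : ℝ) : ℂ)) D := continuous_ofReal.comp_continuousOn (hW.div_const 2).rexp
  refine ⟨(hc.aestronglyMeasurable hD).mul hf, ?_⟩
  rw [eLpNorm_two]
  refine ENNReal.rpow_lt_top_of_nonneg (by norm_num) ?_
  convert h using 1
  refine lintegral_congr fun x => ?_
  rw [enorm_mul, mul_pow, ← ofReal_norm, Complex.norm_real, Real.norm_of_nonneg (Real.exp_pos _).le, ← ENNReal.ofReal_pow (Real.exp_pos _).le, ← Real.exp_nat_mul]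
  congr 3; push_cast; ring

set_option maxHeartbeats 1000000 in
lemma hodge {D : Set (Cn N)} (hD : IsOpen D) {u : Cn N → ℝ} (hu : ContDiffOn ℝ ∞ u D) {b : Fin N → Cn N → ℂ} 
    (hb : ∀ j, ContDiff ℝ ∞ (b j)) (hbc : ∀ j, HasCompactSupport (b j)) (hbs : ∀ j, tsupport (b j) ⊆ D) :
    ∃ b1 : Fin N → Cn N → ℂ, (∀ j, AEStronglyMeasurable (b1 j) (volume.restrict D)) ∧ 
      (∀ j, q2 (fun x => Real.exp (u x)) D (b1 j) ≠ (⊤ : ℝ≥0∞)) ∧ 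
      (∀ h : Cn N → ℂ, ContDiff ℝ ∞ h → HasCompactSupport h → tsupport h ⊆ D → 
        ∀ j k, ∫ y, ((Real.exp (u y) : ℝ) : ℂ) * db j h y * b1 k y = ∫ y, ((Real.exp (u y) : ℝ) : ℂ) * db k h y * b1 j y) ∧
      (∀ F : Cn N → ℂ, ContDiffOn ℝ ∞ F D → (∀ j, q2 (fun x => Real.exp (- u x)) D (db j F) ≠ (⊤ : ℝ≥0∞)) → 
        ∑ j, ∫ x in D, conj (db j F x) * b1 j x = ∑ j, ∫ x in D, conj (db j F x) * b j x) := by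
  have hDm := hD.measurableSet
  set μ := volume.restrict D with hμ
  set e : Cn N → ℂ := fun x => ((Real.exp (u x / 2) : ℝ) : ℂ) with he
  set e' : Cn N → ℂ := fun x => ((Real.exp (- u x / 2) : ℝ) : ℂ) with he'
  have hec : ContinuousOn e D := continuous_ofReal.comp_continuousOn (hu.continuousOn.div_const 2).rexp
  have hec' : ContinuousOn e' D := continuous_ofReal.comp_continuousOn (hu.continuousOn.neg.div_const 2).rexp
  have hee : ∀ x, e x * e' x = 1 := fun x => by
    simp only [e, e']; rw [← ofReal_mul, ← Real.exp_add, show u x / 2 + -u x / 2 = 0 by ring]; simp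
  have hce : ∀ x, conj (e x) = e x := fun x => Complex.conj_ofReal _
  have hce' : ∀ x, conj (e' x) = e' x := fun x => Complex.conj_ofReal _
  have he2 : ∀ x, ((Real.exp (u x) : ℝ) : ℂ) = e x * e x := fun x => by
    simp only [e]; rw [← ofReal_mul, ← Real.exp_add]; congr 2; ring
  have cut : ∀ {f : Cn N → ℂ}, Continuous f → HasCompactSupport f → tsupport f ⊆ D → MemLp (fun x => e x * f x) 2 μ := by
    intro f hf hfc hfs
    have := memLp_cut (D := D) (a := fun x => e x * f x) (f := fun _ => 1) hfc hfs (hec.mul hf.continuousOn) 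
      (fun x hx => by simp [image_eq_zero_of_notMem_tsupport hx]) ?_
    · simpa using this.restrict D
    · have : IsFiniteMeasure (volume.restrict (tsupport f)) := ⟨by simpa using hfc.isCompact.measure_lt_top⟩
      exact memLp_const _
  have hγ : ∀ j, MemLp (fun x => e x * b j x) 2 μ := fun j => cut (hb j).continuous (hbc j) (hbs j)
  have hA : ∀ {h : Cn N → ℂ}, ContDiff ℝ ∞ h → HasCompactSupport h → tsupport h ⊆ D → ∀ k, MemLp (fun x => e x * conj (db k h x)) 2 μ := by
    intro h hh hhc hhs k
    refine cut (cd_conj (cd_db hh k)).continuous (hcs_conj (hcs_db hhc)) ?_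
    refine (closure_mono fun x hx => ?_).trans ((tsupport_db (j := k)).trans hhs)
    simpa using hx
  set G : Set (HL D) := {x | ∃ (h : Cn N → ℂ) (hh : ContDiff ℝ ∞ h) (hc : HasCompactSupport h) (hs : tsupport h ⊆ D) (j k : Fin N), 
    x = WithLp.toLp 2 (fun l => (if l = j then (hA hh hc hs k).toLp _ else 0) - (if l = k then (hA hh hc hs j).toLp _ else 0))} with hG
  set K := (Submodule.span ℂ G).topologicalClosure with hK
  have hKc : CompleteSpace K := (Submodule.span ℂ G).isClosed_topologicalClosure.completeSpace_coe
  set γ : HL D := WithLp.toLp 2 (fun j => (hγ j).toLp _) with hγd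
  set γ2 : HL D := K.starProjection γ with hγ2
  set γ1 : HL D := γ - γ2 with hγ1
  have hγ2K : γ2 ∈ K := Submodule.starProjection_apply_mem _ _
  have hγ1K : γ1 ∈ Kᗮ := Submodule.sub_starProjection_mem_orthogonal _
  have hin : ∀ (h : Cn N → ℂ) (hh : ContDiff ℝ ∞ h) (hc : HasCompactSupport h) (hs : tsupport h ⊆ D) (j k : Fin N) (v : HL D), 
    inner ℂ (WithLp.toLp 2 (fun l => (if l = j then (hA hh hc hs k).toLp _ else 0) - (if l = k then (hA hh hc hs j).toLp _ else 0)) : HL D) v = 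
      (∫ x in D, e x * db k h x * v j x) - ∫ x in D, e x * db j h x * v k x := by
    intro h hh hc hs j k v
    rw [PiLp.inner_apply]
    have : ∀ l, inner ℂ ((if l = j then (hA hh hc hs k).toLp _ else 0) - (if l = k then (hA hh hc hs j).toLp _ else 0)) (v l) = 
      (if l = j then inner ℂ ((hA hh hc hs k).toLp _) (v l) else 0) - (if l = k then inner ℂ ((hA hh hc hs j).toLp _) (v l) else 0) := by
      intro l; rw [inner_sub_left]
      congr 1 <;> split_ifs <;> simp
    refine (Finset.sum_congr rfl fun l _ => this l).trans ?_
    simp only [Finset.sum_sub_distrib, Finset.sum_ite_eq', Finset.mem_univ, if_true, inner_toLp]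
    have a1 := inner_toLp (hA hh hc hs k) (v j)
    have a2 := inner_toLp (hA hh hc hs j) (v k)
    simp only [map_mul, hce, Complex.conj_conj] at a1 a2
    exact congrArg₂ _ a1 a2
  refine ⟨fun j x => e' x * γ1 j x, fun j => (hec'.aestronglyMeasurable hDm).mul (Lp.aestronglyMeasurable _), fun j => ?_, ?_, ?_⟩
  · have h1 := (Lp.memLp (γ1 j)).2
    rw [eLpNorm_two] at h1
    have h2 : (∫⁻ x, ‖γ1 j x‖ₑ^2 ∂μ) ≠ (⊤ : ℝ≥0∞) := fun h => by rw [h] at h1; simp at h1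
    convert h2 using 1
    refine lintegral_congr fun x => ?_
    have : ENNReal.ofReal (Real.exp (u x)) = ‖e x‖ₑ^2 := by
      rw [← ofReal_norm, Complex.norm_real, Real.norm_of_nonneg (Real.exp_pos _).le, ← ENNReal.ofReal_pow (Real.exp_pos _).le, ← Real.exp_nat_mul]
      congr 2; push_cast; ring
    rw [this, ← mul_pow, ← enorm_mul, ← mul_assoc, hee, one_mul]
  · intro h hh hc hs j k
    have hz : ∀ x, x ∉ D → ∀ j, db j h x = 0 := fun x hx j => db_eq_zero fun hx' => hx (hs hx')
    have h1 : inner ℂ (WithLp.toLp 2 (fun l => (if l = k then (hA hh hc hs j).toLp _ else 0) - (if l = j then (hA hh hc hs k).toLp _ else 0)) : HL D) γ1 = 0 := 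
      (Submodule.mem_orthogonal _ _).1 hγ1K _ (Submodule.le_topologicalClosure _ (Submodule.subset_span ⟨h, hh, hc, hs, k, j, rfl⟩))
    rw [hin h hh hc hs, sub_eq_zero, int_supp fun x hx => by simp [hz x hx], int_supp fun x hx => by simp [hz x hx]] at h1
    have c : ∀ j k, ∫ y, ((Real.exp (u y) : ℝ) : ℂ) * db j h y * (e' y * γ1 k y) = ∫ x, e x * db j h x * γ1 k x := fun j k => by
      congr 1; ext y; rw [he2]; linear_combination e y * db j h y * γ1 k y * hee y
    rw [c, c, h1]
  · intro F hF hq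
    have hdF : ∀ j, ContinuousOn (db j F) D := fun j => (contDiffOn_db hD hF (n := ⊤) (m := ⊤) (by simp)).continuousOn
    have hv : ∀ j, MemLp (fun x => e' x * db j F x) 2 μ := fun j => memLp_of_q2 hDm ((hdF j).aestronglyMeasurable hDm) hu.continuousOn.neg (hq j)
    set v : HL D := WithLp.toLp 2 (fun j => (hv j).toLp _) with hvd
    have hvK : v ∈ Kᗮ := by
      rw [hK, Submodule.orthogonal_closure]
      refine mem_span_orth ?_
      rintro x ⟨h, hh, hc, hs, j, k, rfl⟩
      have hz : ∀ x, x ∉ D → ∀ j, db j h x = 0 := fun x hx j => db_eq_zero fun hx' => hx (hs hx')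
      rw [hin h hh hc hs]
      have c : ∀ j k, ∫ x in D, e x * db k h x * v j x = ∫ x, db k h x * db j F x := fun j k => by
        rw [← int_supp (D := D) fun x hx => by simp [hz x hx]]
        refine integral_congr_ae ?_
        filter_upwards [(hv j).coeFn_toLp] with x hx
        have : v j x = e' x * db j F x := hx
        rw [this]; linear_combination db k h x * db j F x * hee x
      rw [c, c, dbdb_ibp hD hF hh hc hs, sub_self]
    have h0 : inner ℂ v γ2 = 0 := (Submodule.mem_orthogonal' _ _).1 hvK _ hγ2K
    have h1 : inner ℂ v γ1 = inner ℂ v γ := by rw [hγ1, inner_sub_right, h0, sub_zero]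
    rw [PiLp.inner_apply, PiLp.inner_apply] at h1
    have c1 : ∀ j, inner ℂ (v j) (γ1 j) = ∫ x in D, conj (db j F x) * (e' x * γ1 j x) := fun j => by
      have : inner ℂ (v j) (γ1 j) = _ := inner_toLp (hv j) (γ1 j)
      rw [this]; congr 1; ext x; rw [map_mul, hce']; ring
    have c2 : ∀ j, inner ℂ (v j) (γ j) = ∫ x in D, conj (db j F x) * b j x := fun j => by
      have : inner ℂ (v j) (γ j) = _ := inner_toLp2 (hv j) (hγ j)
      rw [this]; congr 1; ext x; rw [map_mul, hce']; linear_combination conj (db j F x) * b j x * hee x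
    simp only [c1, c2] at h1
    exact h1
end BP

namespace BP
open Filter Topology
set_option linter.all false
open scoped ContDiff ComplexConjugate
variable {N : ℕ}

lemma riesz_ext {X H : Type*} [AddCommGroup X] [Module ℂ X] [NormedAddCommGroup H] [InnerProductSpace ℂ H] [CompleteSpace H]
    (A : X →ₗ[ℂ] H) (T : X →ₗ[ℂ] ℂ) {c : ℝ} (hc : 0 ≤ c) (h : ∀ x, ‖T x‖ ≤ c * ‖A x‖) :
    ∃ v : H, ‖v‖ ≤ c ∧ ∀ x, inner ℂ v (A x) = T x := by
  have hk : LinearMap.ker A ≤ LinearMap.ker T := by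
    intro x hx
    rw [LinearMap.mem_ker] at hx ⊢
    have := h x
    rw [hx, norm_zero, mul_zero] at this
    exact norm_le_zero_iff.mp this
  let T' : LinearMap.range A →ₗ[ℂ] ℂ := ((LinearMap.ker A).liftQ T hk).comp A.quotKerEquivRange.symm.toLinearMap
  have hT' : ∀ x, T' ⟨A x, x, rfl⟩ = T x := by
    intro x
    have : A.quotKerEquivRange.symm ⟨A x, x, rfl⟩ = (LinearMap.ker A).mkQ x := by
      rw [LinearEquiv.symm_apply_eq]; rfl
    simp only [T', LinearMap.comp_apply, LinearEquiv.coe_coe, this]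
    rfl
  let T2 : LinearMap.range A →L[ℂ] ℂ := T'.mkContinuous c (by
    rintro ⟨_, x, rfl⟩
    rw [hT']; exact h x)
  obtain ⟨g, hg, hn⟩ := exists_extension_norm_eq (LinearMap.range A) T2
  refine ⟨(InnerProductSpace.toDual ℂ H).symm g, ?_, fun x => ?_⟩
  · rw [LinearIsometryEquiv.norm_map, hn]; exact LinearMap.mkContinuous_norm_le _ hc _
  · rw [InnerProductSpace.toDual_symm_apply]
    exact (hg ⟨A x, x, rfl⟩).trans (hT' x)

lemma ibp_db_loc {D : Set (Cn N)} (hD : IsOpen D) {F h : Cn N → ℂ} (hF : ContDiffOn ℝ ∞ F D) (hh : ContDiff ℝ ∞ h) (hc : HasCompactSupport h)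
    (hs : tsupport h ⊆ D) (j : Fin N) : ∫ x, h x * db j F x = - ∫ x, db j h x * F x := by
  obtain ⟨G, hG, he⟩ := exists_ext hc hD hs hF
  rw [show (∫ x, h x * db j F x) = ∫ x, h x * db j G x from ?_, show (∫ x, db j h x * F x) = ∫ x, db j h x * G x from ?_]
  · exact ibp_db_g j (le1 hh) (le1 hG) hc
  · refine integral_congr_ae (Eventually.of_forall fun x => ?_)
    by_cases hx : x ∈ tsupport h
    · simp only [(he x hx).self_of_nhds]
    · simp only [db_eq_zero hx, zero_mul]
  · refine integral_congr_ae (Eventually.of_forall fun x => ?_)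
    by_cases hx : x ∈ tsupport h
    · simp only [db_congr (he x hx)]
    · simp only [image_eq_zero_of_notMem_tsupport hx, zero_mul]

lemma loc_of_q2 {D : Set (Cn N)} {f : Cn N → ℂ} {W : Cn N → ℝ} (hf : AEStronglyMeasurable f (volume.restrict D)) (hW : ContinuousOn W D)
    (h : q2 (fun x => Real.exp (W x)) D f ≠ (⊤ : ℝ≥0∞)) {K : Set (Cn N)} (hK : IsCompact K) (hKD : K ⊆ D) : MemLp f 2 (volume.restrict K) := by
  have hfK := hf.mono_measure (Measure.restrict_mono hKD le_rfl)
  have h1 := memLp_of_q2 hK.measurableSet hfK (hW.mono hKD) (ne_top_of_le_ne_top h (q2_mono hKD _ _))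
  obtain ⟨c, hc⟩ := hK.exists_bound_of_continuousOn (hW.mono hKD)
  refine MemLp.of_le_mul (c := Real.exp (c/2)) h1 hfK ?_
  refine (ae_restrict_iff' hK.measurableSet).2 (Eventually.of_forall fun x hx => ?_)
  rw [norm_mul, ← mul_assoc, Complex.norm_real, Real.norm_eq_abs, abs_of_pos (Real.exp_pos _), ← Real.exp_add]
  refine le_mul_of_one_le_left (norm_nonneg _) (Real.one_le_exp ?_)
  have := hc x hx
  rw [Real.norm_eq_abs] at this
  have := (abs_le.1 this).1
  linarith

lemma cs_enorm {D : Set (Cn N)} {a b : Cn N → ℂ} {A B : Cn N → ℝ≥0∞} (hA : AEMeasurable A (volume.restrict D))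
    (hB : AEMeasurable B (volume.restrict D)) (h : ∀ᵐ x ∂volume.restrict D, ‖a x‖ₑ * ‖b x‖ₑ ≤ A x * B x) :
    ‖∫ x in D, a x * b x‖ₑ^2 ≤ (∫⁻ x in D, A x^2) * ∫⁻ x in D, B x^2 := by
  have h1 : ‖∫ x in D, a x * b x‖ₑ ≤ ∫⁻ x in D, A x * B x := by
    refine (enorm_integral_le_lintegral_enorm _).trans (lintegral_mono_ae (h.mono fun x hx => ?_))
    rw [enorm_mul]; exact hx
  have h2 := ENNReal.lintegral_mul_le_Lp_mul_Lq (volume.restrict D) Real.HolderConjugate.two_two hA hB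
  simp only [ENNReal.rpow_ofNat] at h2
  calc _ ≤ ((∫⁻ x in D, A x^2) ^ (1/2:ℝ) * (∫⁻ x in D, B x^2) ^ (1/2:ℝ))^2 := pow_le_pow_left' (h1.trans h2) 2
    _ = _ := by
      rw [mul_pow, ← ENNReal.rpow_natCast, ← ENNReal.rpow_natCast, ← ENNReal.rpow_mul, ← ENNReal.rpow_mul]; norm_num

lemma dbar_est {D : Set (Cn N)} (hD : IsOpen D) 
    {Φ σ s p : Cn N → ℝ} (hΦ : ContDiffOn ℝ ∞ Φ D) (hσ : ContDiffOn ℝ ∞ σ D)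
    (hs : ContinuousOn s D) (hp : ContinuousOn p D) (hs0 : ∀ x ∈ D, 0 < s x) (hp0 : ∀ x ∈ D, 0 < p x) (i0 : Fin N)
    (hL : ∀ x ∈ D, ∀ b : Cn N, p x * ‖b i0‖^2 ≤ levi Φ x b - (1 + s x) * gr σ x b)
    {η : ℕ → Cn N → ℝ} (hη : ∀ n, ContDiff ℝ ∞ (η n)) (hηc : ∀ n, HasCompactSupport (η n)) (hηs : ∀ n, tsupport (η n) ⊆ D)
    (hη0 : ∀ n x, 0 ≤ η n x) (hη1 : ∀ n x, η n x ≤ 1) (hηe : ∀ x ∈ D, ∀ᶠ n in atTop, η n x = 1) {B : ℝ}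
    (hηB : ∀ n, ∀ x ∈ D, ∀ j, ‖dz j (fun y => (η n y : ℂ)) x‖^2 * Real.exp (-σ x) * (1 + 1 / s x) ≤ B)
    {F : Cn N → ℂ} (hF : ContDiffOn ℝ ∞ F D) (hF0 : ∀ x ∈ D, ∀ j, j ≠ i0 → db j F x = 0) {B' : ℝ} 
    (hB' : ∀ x ∈ D, p x * Real.exp (-σ x) ≤ B') {C : ℝ} 
    (hC : ∫⁻ x in D, ENNReal.ofReal (‖db i0 F x‖^2 / p x * Real.exp (2 * σ x - Φ x)) ≤ ENNReal.ofReal C)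
    {b : Fin N → Cn N → ℂ} 
    (hb : ∀ j, ContDiff ℝ ∞ (b j)) (hbc : ∀ j, HasCompactSupport (b j)) (hbs : ∀ j, tsupport (b j) ⊆ D) :
    ‖∫ x in D, conj (db i0 F x) * b i0 x‖ₑ^2 ≤ ENNReal.ofReal C * 
      q2 (fun x => (1 + 1 / s x) * Real.exp (Φ x - 2 * σ x)) D (fun x => ∑ j, dz j (b j) x) := by
  have hDm := hD.measurableSet
  have hu : ContDiffOn ℝ ∞ (fun x => Φ x - σ x) D := hΦ.sub hσ
  obtain ⟨b1, hm, hfin, h3, hFF⟩ := hodge hD hu hb hbc hbs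
  have hloc : ∀ j K, IsCompact K → K ⊆ D → MemLp (b1 j) 2 (volume.restrict K) := fun j K hK hKD =>
    loc_of_q2 (hm j) hu.continuousOn (hfin j) hK hKD
  have hdF : ContinuousOn (db i0 F) D := (contDiffOn_db (n := ⊤) (m := ⊤) hD hF (by simp)).continuousOn
  have hsum : tsupport (fun x => ∑ j, dz j (b j) x) ⊆ ⋃ j, tsupport (b j) := by
    refine closure_minimal (fun x hx => ?_) (isClosed_iUnion_of_finite fun j => isClosed_tsupport _)
    by_contra hx'
    simp only [mem_iUnion, not_exists] at hx'
    exact hx (Finset.sum_eq_zero fun j _ => dz_eq_zero (hx' j))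
  have hgc : Continuous (fun x => ∑ j, dz j (b j) x) := continuous_finset_sum _ fun j _ => continuous_dz (le1 (hb j))
  have hcomp : IsCompact (⋃ j, tsupport (b j)) := isCompact_iUnion fun j => hbc j
  have h2 : ∀ h : Cn N → ℂ, ContDiff ℝ ∞ h → HasCompactSupport h → tsupport h ⊆ D → 
     ∑ j, ∫ y, dz j h y * b1 j y = - ∫ y, h y * (∑ j, dz j (b j) y) := by
    intro h hh hhc hhs
    have hq : ∀ j, q2 (fun x => Real.exp (- (Φ x - σ x))) D (db j (fun y => conj (h y))) ≠ (⊤ : ℝ≥0∞) := by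
      intro j
      have hcj : ContDiff ℝ ∞ (db j (fun y => conj (h y))) := cd_db (cd_conj hh) j
      have hz : ∀ x, x ∉ tsupport h → db j (fun y => conj (h y)) x = 0 := fun x hx => by
        rw [db_conj, dz_eq_zero hx, map_zero]
      have : Integrable (fun x => Real.exp (- (Φ x - σ x)) * ‖db j (fun y => conj (h y)) x‖^2) := by
        refine int_of_contOn hhc hD hhs (hu.continuousOn.neg.rexp.mul (hcj.continuous.norm.pow 2).continuousOn) fun x hx => ?_
        simp [hz x hx]
      have h5 := hasFiniteIntegral_iff_enorm.1 (this.integrableOn (s := D)).2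
      refine ne_top_of_le_ne_top h5.ne (le_of_eq ?_)
      unfold q2
      refine lintegral_congr fun x => ?_
      rw [enorm_mul, Real.enorm_eq_ofReal (Real.exp_pos _).le, enorm_pow, enorm_norm]
    have h4 := hFF _ (cd_conj hh).contDiffOn hq
    simp only [db_conj, Complex.conj_conj] at h4
    have e1 : ∀ (c : Cn N → ℂ) j, ∫ x in D, dz j h x * c x = ∫ x, dz j h x * c x := fun c j => by
      refine int_supp fun x hx => ?_
      rw [dz_eq_zero fun hh => hx (hhs hh), zero_mul]
    simp only [e1] at h4
    rw [h4]
    have e2 : ∀ j, ∫ x, dz j h x * b j x = - ∫ x, h x * dz j (b j) x := fun j => by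
      rw [ibp_dz_g j (le1 hh) (le1 (hb j)) hhc, neg_neg]
    simp only [e2, Finset.mul_sum]
    rw [integral_finset_sum, Finset.sum_neg_distrib]
    intro j _
    exact int_of_hcs (hh.continuous.mul (continuous_dz (le1 (hb j)))) (hhc.mul_right)
  have hw := weak_ineq hD hΦ hσ hs hp hs0 (fun x hx => (hp0 x hx).le) i0 hL hη hηc hηs hη0 hη1 hηe hηB hloc hm hfin hgc
    (hcomp.of_isClosed_subset (isClosed_tsupport _) hsum) (hsum.trans (iUnion_subset hbs)) h2 h3
  have hqF : ∀ j, q2 (fun x => Real.exp (- (Φ x - σ x))) D (db j F) ≠ (⊤ : ℝ≥0∞) := by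
    intro j
    by_cases hj : j = i0
    · subst hj
      refine ne_top_of_le_ne_top (b := ENNReal.ofReal B' * ENNReal.ofReal C) (by finiteness) ?_
      refine le_trans ?_ (mul_le_mul' le_rfl hC)
      rw [← lintegral_const_mul' _ _ ENNReal.ofReal_ne_top]
      refine setLIntegral_mono' hDm fun x hx => ?_
      have hB0 : 0 ≤ B' := le_trans (mul_nonneg (hp0 x hx).le (Real.exp_pos _).le) (hB' x hx)
      rw [← ofReal_norm_eq_enorm, ← ENNReal.ofReal_pow (norm_nonneg _), ← ENNReal.ofReal_mul (Real.exp_pos _).le, ← ENNReal.ofReal_mul hB0]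
      refine ENNReal.ofReal_le_ofReal ?_
      have hpx := hp0 x hx
      calc _ = p x * Real.exp (-σ x) * (‖db j F x‖^2 / p x * Real.exp (2 * σ x - Φ x)) := by
            rw [show -(Φ x - σ x) = -σ x + (2 * σ x - Φ x) by ring, Real.exp_add]; field_simp
        _ ≤ _ := mul_le_mul_of_nonneg_right (hB' x hx) (by positivity)
    · have : q2 (fun x => Real.exp (- (Φ x - σ x))) D (db j F) = 0 := by
        unfold q2
        rw [setLIntegral_congr_fun hDm (g := fun _ => 0)]
        · simp
        · intro x hx
          simp [hF0 x hx j hj]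
      rw [this]; simp
  have hT := hFF F hF hqF
  have e3 : ∀ (c : Fin N → Cn N → ℂ), ∑ j, ∫ x in D, conj (db j F x) * c j x = ∫ x in D, conj (db i0 F x) * c i0 x := by
    intro c
    refine Finset.sum_eq_single i0 (fun j _ hj => ?_) (fun h => absurd (Finset.mem_univ _) h)
    rw [setIntegral_congr_fun hDm (g := fun _ => 0)]
    · simp
    · intro x hx
      simp [hF0 x hx j hj]
  rw [e3, e3] at hT
  rw [← hT]
  have hsp : ContinuousOn (fun x => √(p x)) D := hp.sqrt
  have hw1 : ContinuousOn (fun x => ‖db i0 F x‖ / √(p x) * Real.exp (σ x - Φ x / 2)) D := 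
    (hdF.norm.div hsp fun x hx => (Real.sqrt_pos.2 (hp0 x hx)).ne').mul (hσ.continuousOn.sub (hΦ.continuousOn.div_const 2)).rexp
  have hw2 : ContinuousOn (fun x => √(p x) * Real.exp (Φ x / 2 - σ x)) D := hsp.mul ((hΦ.continuousOn.div_const 2).sub hσ.continuousOn).rexp
  have := cs_enorm (D := D) (a := fun x => conj (db i0 F x)) (b := b1 i0) (A := fun x => ENNReal.ofReal (‖db i0 F x‖ / √(p x) * Real.exp (σ x - Φ x / 2)))
    (B := fun x => ENNReal.ofReal (√(p x) * Real.exp (Φ x / 2 - σ x)) * ‖b1 i0 x‖ₑ) (hw1.aemeasurable hDm).ennreal_ofReal 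
      ((hw2.aemeasurable hDm).ennreal_ofReal.mul (hm i0).enorm) ?_
  · refine this.trans (mul_le_mul' (le_trans (le_of_eq ?_) hC) (le_trans (le_of_eq ?_) hw))
    · refine setLIntegral_congr_fun hDm fun x hx => ?_
      have hpx := hp0 x hx
      beta_reduce
      rw [← ENNReal.ofReal_pow (by positivity), mul_pow, div_pow, Real.sq_sqrt hpx.le, ← Real.exp_nat_mul]
      congr 3; push_cast; ring
    · refine setLIntegral_congr_fun hDm fun x hx => ?_
      have hpx := hp0 x hx
      beta_reduce
      rw [mul_pow, ← ENNReal.ofReal_pow (by positivity), mul_pow, Real.sq_sqrt hpx.le, ← Real.exp_nat_mul]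
      congr 4; push_cast; ring
  · refine (ae_restrict_iff' hDm).2 (Eventually.of_forall fun x hx => le_of_eq ?_)
    have hpx := Real.sqrt_pos.2 (hp0 x hx)
    rw [← mul_assoc, ← ENNReal.ofReal_mul (by positivity)]
    congr 1
    rw [← ofReal_norm_eq_enorm, RCLike.norm_conj]
    congr 1
    rw [show Φ x / 2 - σ x = -(σ x - Φ x / 2) by ring, Real.exp_neg]
    field_simp
end BP

namespace BP
open Filter Topology
set_option linter.all false
open scoped ContDiff ComplexConjugate
variable {N : ℕ}

def TF (D : Set (Cn N)) : Submodule ℂ (Fin N → Cn N → ℂ) where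
  carrier := {b | ∀ j, ContDiff ℝ ∞ (b j) ∧ HasCompactSupport (b j) ∧ tsupport (b j) ⊆ D}
  add_mem' := fun {a b} ha hb j => ⟨(ha j).1.add (hb j).1, (ha j).2.1.add (hb j).2.1, 
    (tsupport_add _ _).trans (union_subset (ha j).2.2 (hb j).2.2)⟩
  zero_mem' := fun j => ⟨contDiff_const, HasCompactSupport.zero, by simp [tsupport]⟩
  smul_mem' := fun c b hb j => ⟨(hb j).1.const_smul c, (hb j).2.1.smul_left (f := fun _ => c), 
    (tsupport_smul_subset_right (fun _ => c) (b j)).trans (hb j).2.2⟩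

lemma TF_p {D : Set (Cn N)} (b : TF D) (j : Fin N) : ContDiff ℝ ∞ (b.1 j) ∧ HasCompactSupport (b.1 j) ∧ tsupport (b.1 j) ⊆ D := b.2 j

lemma dz_smul_c {j : Fin N} {f : Cn N → ℂ} {x : Cn N} (hf : DifferentiableAt ℝ f x) (c : ℂ) :
    dz j (c • f) x = c * dz j f x := by
  have := dz_mul (j := j) (f := fun _ => c) (g := f) (differentiableAt_const c) hf
  have h0 : dz j (fun _ => c) x = 0 := by simp [dz]
  rw [h0, zero_mul, zero_add] at this
  exact this

lemma dbar_solve {D : Set (Cn N)} (hD : IsOpen D) 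
    {Φ σ s p : Cn N → ℝ} (hΦ : ContDiffOn ℝ ∞ Φ D) (hσ : ContDiffOn ℝ ∞ σ D)
    (hs : ContinuousOn s D) (hp : ContinuousOn p D) (hs0 : ∀ x ∈ D, 0 < s x) (hp0 : ∀ x ∈ D, 0 < p x) (i0 : Fin N)
    (hL : ∀ x ∈ D, ∀ b : Cn N, p x * ‖b i0‖^2 ≤ levi Φ x b - (1 + s x) * gr σ x b)
    {η : ℕ → Cn N → ℝ} (hη : ∀ n, ContDiff ℝ ∞ (η n)) (hηc : ∀ n, HasCompactSupport (η n)) (hηs : ∀ n, tsupport (η n) ⊆ D)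
    (hη0 : ∀ n x, 0 ≤ η n x) (hη1 : ∀ n x, η n x ≤ 1) (hηe : ∀ x ∈ D, ∀ᶠ n in atTop, η n x = 1) {B : ℝ}
    (hηB : ∀ n, ∀ x ∈ D, ∀ j, ‖dz j (fun y => (η n y : ℂ)) x‖^2 * Real.exp (-σ x) * (1 + 1 / s x) ≤ B)
    {F : Cn N → ℂ} (hF : ContDiffOn ℝ ∞ F D) (hF0 : ∀ x ∈ D, ∀ j, j ≠ i0 → db j F x = 0) {B' : ℝ} 
    (hB' : ∀ x ∈ D, p x * Real.exp (-σ x) ≤ B') {C : ℝ} (hC0 : 0 ≤ C)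
    (hC : ∫⁻ x in D, ENNReal.ofReal (‖db i0 F x‖^2 / p x * Real.exp (2 * σ x - Φ x)) ≤ ENNReal.ofReal C) :
    ∃ U : Cn N → ℂ, DifferentiableOn ℂ U D ∧ 
      ∫⁻ x in D, ENNReal.ofReal (s x / (1 + s x) * Real.exp (2 * σ x - Φ x)) * ‖F x - U x‖ₑ^2 ≤ ENNReal.ofReal C := by
  have hDm := hD.measurableSet
  have h1s : ContinuousOn (fun x => √(1 + 1 / s x)) D := 
    (continuousOn_const.add (continuousOn_const.div hs fun x hx => (hs0 x hx).ne')).sqrt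
  set wr : Cn N → ℝ := fun x => √(1 + 1 / s x) * Real.exp (Φ x / 2 - σ x) with hwr
  have hwrc : ContinuousOn wr D := h1s.mul ((hΦ.continuousOn.div_const 2).sub hσ.continuousOn).rexp
  have hwc : ContinuousOn (fun x => (wr x : ℂ)) D := continuous_ofReal.comp_continuousOn hwrc
  have hwr0 : ∀ x ∈ D, 0 < wr x := fun x hx => by
    have := hs0 x hx
    simp only [hwr]; positivity
  have hwsq : ∀ x ∈ D, wr x ^ 2 = (1 + 1 / s x) * Real.exp (Φ x - 2 * σ x) := fun x hx => by
    have := hs0 x hx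
    simp only [hwr]
    rw [mul_pow, Real.sq_sqrt (by positivity), ← Real.exp_nat_mul]
    congr 2; push_cast; ring
  have hmem : ∀ b : TF D, MemLp (fun x => (wr x : ℂ) * ∑ j, dz j (b.1 j) x) 2 (volume.restrict D) := by
    intro b
    have hcomp : IsCompact (⋃ j, tsupport (b.1 j)) := isCompact_iUnion fun j => (TF_p b j).2.1
    have hgc : Continuous (fun x => ∑ j, dz j (b.1 j) x) := continuous_finset_sum _ fun j _ => continuous_dz (le1 (TF_p b j).1)
    have := memLp_cut (D := D) (f := fun _ => 1) (a := fun x => (wr x : ℂ) * ∑ j, dz j (b.1 j) x) hcomp (iUnion_subset fun j => (TF_p b j).2.2) 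
      (hwc.mul hgc.continuousOn) (fun x hx => ?_) ?_
    · simpa using this.restrict D
    · simp only [mem_iUnion, not_exists] at hx
      rw [Finset.sum_eq_zero fun j _ => dz_eq_zero (hx j), mul_zero]
    · haveI : IsFiniteMeasure (volume.restrict (⋃ j, tsupport (b.1 j))) := ⟨by simpa using hcomp.measure_lt_top⟩
      exact memLp_const 1
  let A : TF D →ₗ[ℂ] Lp ℂ 2 (volume.restrict D) := 
    { toFun := fun b => (hmem b).toLp _
      map_add' := fun a b => by
        rw [← MemLp.toLp_add]
        refine (MemLp.toLp_eq_toLp_iff _ _).2 (Eventually.of_forall fun x => ?_)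
        simp only [Pi.add_apply]
        rw [← mul_add, ← Finset.sum_add_distrib]
        congr 1
        refine Finset.sum_congr rfl fun j _ => ?_
        exact dz_add (cd_diff (TF_p a j).1 x) (cd_diff (TF_p b j).1 x)
      map_smul' := fun c b => by
        rw [RingHom.id_apply, ← MemLp.toLp_const_smul]
        refine (MemLp.toLp_eq_toLp_iff _ _).2 (Eventually.of_forall fun x => ?_)
        simp only [Pi.smul_apply, smul_eq_mul]
        rw [mul_left_comm]
        refine congrArg _ ?_
        rw [Finset.mul_sum]
        refine Finset.sum_congr rfl fun j _ => ?_
        exact dz_smul_c (cd_diff (TF_p b j).1 x) c }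
  have hdF : ContinuousOn (db i0 F) D := (contDiffOn_db (n := ⊤) (m := ⊤) hD hF (by simp)).continuousOn
  have hInt : ∀ b : TF D, Integrable (fun x => conj (db i0 F x) * b.1 i0 x) (volume.restrict D) := fun b => by
    refine (int_of_contOn (TF_p b i0).2.1 hD (TF_p b i0).2.2 ((Complex.continuous_conj.comp_continuousOn hdF).mul (TF_p b i0).1.continuous.continuousOn) fun x hx => ?_).restrict
    simp [image_eq_zero_of_notMem_tsupport hx]
  let T : TF D →ₗ[ℂ] ℂ := 
    { toFun := fun b => ∫ x in D, conj (db i0 F x) * b.1 i0 x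
      map_add' := fun a b => by
        rw [← integral_add (hInt a) (hInt b)]
        refine integral_congr_ae (Eventually.of_forall fun x => ?_)
        simp [mul_add]
      map_smul' := fun c b => by
        rw [RingHom.id_apply, smul_eq_mul, ← integral_const_mul]
        refine integral_congr_ae (Eventually.of_forall fun x => ?_)
        simp only [Submodule.coe_smul, Pi.smul_apply, smul_eq_mul]; ring }
  have hnA : ∀ b : TF D, q2 (fun x => (1 + 1 / s x) * Real.exp (Φ x - 2 * σ x)) D (fun x => ∑ j, dz j (b.1 j) x) = ‖A b‖ₑ^2 := by
    intro b
    have : ‖A b‖ₑ = eLpNorm (fun x => (wr x : ℂ) * ∑ j, dz j (b.1 j) x) 2 (volume.restrict D) := Lp.enorm_toLp (hf := hmem b)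
    rw [this, eLpNorm_two, ← ENNReal.rpow_natCast, ← ENNReal.rpow_mul]
    rw [show (1/2:ℝ) * ((2:ℕ):ℝ) = 1 by norm_num, ENNReal.rpow_one]
    unfold q2
    refine setLIntegral_congr_fun hDm fun x hx => ?_
    beta_reduce
    rw [enorm_mul, mul_pow, ← hwsq x hx, ← ofReal_norm_eq_enorm (wr x : ℂ), Complex.norm_real, Real.norm_eq_abs, abs_of_pos (hwr0 x hx), ENNReal.ofReal_pow (hwr0 x hx).le]
  have hest : ∀ b, ‖T b‖ ≤ √C * ‖A b‖ := by
    intro b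
    have := dbar_est hD hΦ hσ hs hp hs0 hp0 i0 hL hη hηc hηs hη0 hη1 hηe hηB hF hF0 hB' hC (fun j => (TF_p b j).1) (fun j => (TF_p b j).2.1) (fun j => (TF_p b j).2.2)
    rw [hnA b] at this
    change ‖T b‖ₑ^2 ≤ _ at this
    rw [← ofReal_norm_eq_enorm, ← ofReal_norm_eq_enorm, ← ENNReal.ofReal_pow (norm_nonneg _), ← ENNReal.ofReal_pow (norm_nonneg _), 
      ← ENNReal.ofReal_mul hC0, ENNReal.ofReal_le_ofReal_iff (by positivity)] at this
    refine le_of_sq_le_sq ?_ (by positivity)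
    rw [mul_pow, Real.sq_sqrt hC0]; exact this
  obtain ⟨v, hv, hvT⟩ := riesz_ext A T (Real.sqrt_nonneg C) hest
  have hvT' : ∀ b : TF D, ∫ x in D, conj (v x) * ((wr x : ℂ) * ∑ j, dz j (b.1 j) x) = ∫ x in D, conj (db i0 F x) * b.1 i0 x := by
    intro b
    change _ = T b
    rw [← hvT b, L2.inner_def]
    refine integral_congr_ae ?_
    filter_upwards [(hmem b).coeFn_toLp] with x hx
    change _ = inner ℂ (v x) (((hmem b).toLp _ : Lp ℂ 2 (volume.restrict D)) x)
    rw [hx, RCLike.inner_apply, mul_comm]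
  set f : Cn N → ℂ := fun x => F x + (wr x : ℂ) * v x with hf
  have hvL := Lp.memLp v
  have hlocV : ∀ K, IsCompact K → K ⊆ D → MemLp (fun x => (wr x : ℂ) * v x) 2 (volume.restrict K) := by
    intro K hK hKD
    have hvK : MemLp v 2 (volume.restrict K) := hvL.mono_measure (Measure.restrict_mono hKD le_rfl)
    obtain ⟨c, hc⟩ := hK.exists_bound_of_continuousOn (hwc.mono hKD)
    refine MemLp.of_le_mul (c := c) hvK (((hwc.mono hKD).aestronglyMeasurable hK.measurableSet).mul hvK.1) ?_
    refine (ae_restrict_iff' hK.measurableSet).2 (Eventually.of_forall fun x hx => ?_)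
    rw [norm_mul]
    exact mul_le_mul_of_nonneg_right (hc x hx) (norm_nonneg _)
  have hlocF : ∀ K, IsCompact K → K ⊆ D → MemLp F 2 (volume.restrict K) := by
    intro K hK hKD
    haveI : IsFiniteMeasure (volume.restrict K) := ⟨by simpa using hK.measure_lt_top⟩
    obtain ⟨c, hc⟩ := hK.exists_bound_of_continuousOn (hF.continuousOn.mono hKD)
    exact MemLp.of_bound ((hF.continuousOn.mono hKD).aestronglyMeasurable hK.measurableSet) c 
      ((ae_restrict_iff' hK.measurableSet).2 (Eventually.of_forall fun x hx => hc x hx))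
  obtain ⟨U, hU, hUe⟩ := weyl hD (f := f) (fun K hK hKD => (hlocF K hK hKD).add (hlocV K hK hKD)) (by
    intro h hh hc hs' j
    have hdb : Continuous (db j h) := continuous_db (le1 hh)
    have i1 : Integrable (fun y => db j h y * F y) := int_cut hc hs' hdb.continuousOn (fun x hx => db_eq_zero hx) (hlocF _ hc hs')
    have i2 : Integrable (fun y => db j h y * ((wr y : ℂ) * v y)) := int_cut hc hs' hdb.continuousOn (fun x hx => db_eq_zero hx) (hlocV _ hc hs')
    simp only [hf, mul_add]
    rw [integral_add i1 i2]
    have hbj : (Pi.single j (fun y => conj (h y)) : Fin N → Cn N → ℂ) ∈ TF D := by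
      change ∀ k, _
      intro k
      by_cases hk : k = j
      · subst hk
        rw [Pi.single_eq_same]
        refine ⟨cd_conj hh, hcs_conj hc, Subset.trans (closure_mono fun x hx => ?_) hs'⟩
        simpa using hx
      · rw [Pi.single_eq_of_ne hk]
        exact ⟨contDiff_const, HasCompactSupport.zero, by simp [tsupport]⟩
    have e := hvT' ⟨_, hbj⟩
    have e1 : ∀ x, ∑ k, dz k ((Pi.single j (fun y => conj (h y)) : Fin N → Cn N → ℂ) k) x = conj (db j h x) := by
      intro x
      rw [Finset.sum_eq_single j, Pi.single_eq_same, dz_conj]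
      · intro k _ hk
        rw [Pi.single_eq_of_ne hk]; simp [dz]
      · simp
    simp only [e1] at e
    have e2 : ∫ x in D, conj (db i0 F x) * (Pi.single j (fun y => conj (h y)) : Fin N → Cn N → ℂ) i0 x = conj (∫ x, h x * db j F x) := by
      rw [← integral_conj, ← int_supp (D := D)]
      · refine setIntegral_congr_fun hDm fun x hx => ?_
        by_cases hk : i0 = j
        · subst hk
          simp [mul_comm]
        · rw [Pi.single_eq_of_ne hk, hF0 x hx j (Ne.symm hk)]
          simp
      · intro x hx
        rw [image_eq_zero_of_notMem_tsupport fun h' => hx (hs' h')]; simp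
    rw [e2, ibp_db_loc hD hF hh hc hs' j] at e
    have e3 : ∫ x in D, conj (v x) * ((wr x : ℂ) * conj (db j h x)) = conj (∫ y, db j h y * ((wr y : ℂ) * v y)) := by
      rw [← integral_conj, ← int_supp (D := D)]
      · refine setIntegral_congr_fun hDm fun x hx => ?_
        simp only [map_mul, conj_ofReal]; ring
      · intro x hx
        rw [db_eq_zero fun h' => hx (hs' h')]; simp
    rw [e3] at e
    have e4 := (starRingEnd ℂ).injective e
    rw [e4, add_neg_cancel])
  refine ⟨U, hU, ?_⟩
  have h6 : ‖v‖ₑ^2 ≤ ENNReal.ofReal C := by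
    rw [← ofReal_norm_eq_enorm, ← ENNReal.ofReal_pow (norm_nonneg _)]
    refine ENNReal.ofReal_le_ofReal ?_
    calc _ ≤ (√C)^2 := pow_le_pow_left₀ (norm_nonneg _) hv 2
      _ = C := Real.sq_sqrt hC0
  refine le_trans (le_of_eq ?_) h6
  rw [Lp.enorm_def, eLpNorm_two, ← ENNReal.rpow_natCast, ← ENNReal.rpow_mul]
  rw [show (1/2:ℝ) * ((2:ℕ):ℝ) = 1 by norm_num, ENNReal.rpow_one]
  refine lintegral_congr_ae ?_
  filter_upwards [hUe, ae_restrict_mem hDm] with x hx hxD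
  rw [hx, hf]
  simp only [sub_add_cancel_left, enorm_neg, enorm_mul, mul_pow]
  rw [← mul_assoc, ← ofReal_norm_eq_enorm (wr x : ℂ), Complex.norm_real, Real.norm_eq_abs, abs_of_pos (hwr0 x hxD), ← ENNReal.ofReal_pow (hwr0 x hxD).le, 
    hwsq x hxD, ← ENNReal.ofReal_mul (by have := hs0 x hxD; positivity)]
  have : s x / (1 + s x) * Real.exp (2 * σ x - Φ x) * ((1 + 1 / s x) * Real.exp (Φ x - 2 * σ x)) = 1 := by
    rw [show 2 * σ x - Φ x = -(Φ x - 2 * σ x) by ring, Real.exp_neg]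
    have := hs0 x hxD
    field_simp
    ring
  rw [this]; simp
end BP

namespace BP
open Filter Topology
set_option linter.all false
open scoped ContDiff ComplexConjugate
variable {N : ℕ}

lemma D2_comp {g : Cn N → ℝ} {x : Cn N} (hg : ContDiffAt ℝ 2 g x) {H H' : ℝ → ℝ} {H2 : ℝ}
    (h1 : ∀ᶠ y in 𝓝 (g x), HasDerivAt H (H' y) y) (h2 : HasDerivAt H' H2 (g x)) (v w : Cn N) : 
    D2 (fun y => H (g y)) x v w = H' (g x) * D2 g x v w + H2 * (fderiv ℝ g x v * fderiv ℝ g x w) := by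
  have hev : (fderiv ℝ fun y => H (g y)) =ᶠ[𝓝 x] fun y => H' (g y) • fderiv ℝ g y := by
    have a1 := hg.continuousAt.eventually h1
    have a2 : ∀ᶠ y in 𝓝 x, DifferentiableAt ℝ g y := 
      (hg.eventually (by simp)).mono fun y hy => hy.differentiableAt (by norm_num)
    filter_upwards [a1, a2] with y b1 b2
    exact (b1.comp_hasFDerivAt y b2.hasFDerivAt).fderiv
  have hd : DifferentiableAt ℝ (fderiv ℝ g) x := 
    (hg.fderiv_right (m := 1) (by norm_num)).differentiableAt (by norm_num)
  have hH : HasFDerivAt (fun y => H' (g y)) (H2 • fderiv ℝ g x) x := 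
    h2.comp_hasFDerivAt x (hg.differentiableAt (by norm_num)).hasFDerivAt
  unfold D2
  rw [hev.fderiv_eq, (hH.fun_smul hd.hasFDerivAt).fderiv]
  simp only [ContinuousLinearMap.add_apply, ContinuousLinearMap.smul_apply, ContinuousLinearMap.smulRight_apply, smul_eq_mul]
  ring

lemma levi_comp {g : Cn N → ℝ} {x : Cn N} (hg : ContDiffAt ℝ 2 g x) {H H' : ℝ → ℝ} {H2 : ℝ}
    (h1 : ∀ᶠ y in 𝓝 (g x), HasDerivAt H (H' y) y) (h2 : HasDerivAt H' H2 (g x)) (b : Cn N) : 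
    levi (fun y => H (g y)) x b = H' (g x) * levi g x b + H2 * gr g x b := by
  unfold levi gr
  rw [D2_comp hg h1 h2, D2_comp hg h1 h2]; ring

lemma gr_comp {g : Cn N → ℝ} {x : Cn N} (hg : DifferentiableAt ℝ g x) {H : ℝ → ℝ} {H1 : ℝ}
    (h1 : HasDerivAt H H1 (g x)) (b : Cn N) : 
    gr (fun y => H (g y)) x b = H1^2 * gr g x b := by
  unfold gr
  have : fderiv ℝ (fun y => H (g y)) x = H1 • fderiv ℝ g x := (h1.comp_hasFDerivAt x hg.hasFDerivAt).fderiv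
  rw [this]
  simp only [ContinuousLinearMap.smul_apply, smul_eq_mul]; ring

lemma levi_add {f g : Cn N → ℝ} {x : Cn N} (hf : ContDiffAt ℝ 2 f x) (hg : ContDiffAt ℝ 2 g x) (b : Cn N) :
    levi (fun y => f y + g y) x b = levi f x b + levi g x b := by
  have hd : ∀ {g : Cn N → ℝ}, ContDiffAt ℝ 2 g x → DifferentiableAt ℝ (fderiv ℝ g) x := fun hg => 
    (hg.fderiv_right (m := 1) (by norm_num)).differentiableAt (by norm_num)
  have ha : ∀ {g : Cn N → ℝ}, ContDiffAt ℝ 2 g x → ∀ᶠ y in 𝓝 x, DifferentiableAt ℝ g y := fun hg => 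
      (hg.eventually (by simp)).mono fun y hy => hy.differentiableAt (by norm_num)
  have hev : (fderiv ℝ fun y => f y + g y) =ᶠ[𝓝 x] fun y => fderiv ℝ f y + fderiv ℝ g y := by
    filter_upwards [ha hf, ha hg] with y h1 h2
    exact fderiv_fun_add h1 h2
  unfold levi D2
  rw [hev.fderiv_eq, fderiv_fun_add (hd hf) (hd hg)]
  simp only [ContinuousLinearMap.add_apply]; ring

lemma levi_const (c : ℝ) (x b : Cn N) : levi (fun _ => c) x b = 0 := by
  simp [levi, D2]

lemma gr_nonneg (f : Cn N → ℝ) (x b : Cn N) : 0 ≤ gr f x b := by unfold gr; positivity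

lemma gr_add_le {f g : Cn N → ℝ} {x : Cn N} (hf : DifferentiableAt ℝ f x) (hg : DifferentiableAt ℝ g x) {τ : ℝ} (hτ : 0 < τ) (b : Cn N) :
    gr (fun y => f y + g y) x b ≤ (1 + τ) * gr f x b + (1 + 1 / τ) * gr g x b := by
  unfold gr
  rw [fderiv_fun_add hf hg]
  simp only [ContinuousLinearMap.add_apply]
  have key : ∀ u v : ℝ, (u + v)^2 ≤ (1 + τ) * u^2 + (1 + 1/τ) * v^2 := by
    intro u v
    have : (1 + τ) * u^2 + (1 + 1/τ) * v^2 - (u+v)^2 = (τ * u - v)^2 / τ := by field_simp; ring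
    have h2 : 0 ≤ (τ * u - v)^2 / τ := by positivity
    linarith
  have := key (fderiv ℝ f x b) (fderiv ℝ g x b)
  have := key (fderiv ℝ f x (I • b)) (fderiv ℝ g x (I • b))
  linarith

/-- squared modulus of a holomorphic function -/
def dsum (h : Cn N → ℂ) (x b : Cn N) : ℂ := ∑ j, dz j h x * b j

lemma levi_absq {h : Cn N → ℂ} {U : Set (Cn N)} (hU : IsOpen U) (hh : DifferentiableOn ℂ h U) {x : Cn N} (hx : x ∈ U) (b : Cn N) (δ : ℝ) :
    ContDiffAt ℝ ∞ (fun y => ‖h y‖^2 + δ) x ∧ levi (fun y => ‖h y‖^2 + δ) x b = ‖dsum h x b‖^2 ∧ gr (fun y => ‖h y‖^2 + δ) x b = ‖h x‖^2 * ‖dsum h x b‖^2 := by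
  have hs := hol_smooth hU hh
  have hsa : ∀ y ∈ U, ContDiffAt ℝ ∞ h y := fun y hy => hs.contDiffAt (hU.mem_nhds hy)
  have hcd : ContDiffAt ℝ ∞ (fun y => ‖h y‖^2 + δ) x := ((hsa x hx).norm_sq ℝ).add contDiffAt_const
  have hdz : ∀ k, ContDiffOn ℝ ∞ (dz k h) U := fun k => contDiffOn_dz (n := ⊤) (m := ⊤) hU hs (by simp)
  have heq : (fun y => ((‖h y‖^2 + δ : ℝ) : ℂ)) = fun y => h y * conj (h y) + (δ:ℂ) := by
    funext y; push_cast; rw [Complex.mul_conj']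
  have hcj : ∀ y ∈ U, DifferentiableAt ℝ (fun y => conj (h y)) y := fun y hy => 
    (Complex.conjCLE.differentiableAt).comp y ((hsa y hy).differentiableAt (by simp))
  have hzero : ∀ j y, dz j (fun _ : Cn N => (δ:ℂ)) y = 0 ∧ db j (fun _ : Cn N => (δ:ℂ)) y = 0 := fun j y => by simp [dz, db]
  have hdbS : ∀ k, ∀ y ∈ U, db k (fun y => ((‖h y‖^2 + δ : ℝ) : ℂ)) y = h y * conj (dz k h y) := by
    intro k y hy
    have d1 := (hsa y hy).differentiableAt (n := ∞) (by simp)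
    rw [heq, db_add (d1.fun_mul (hcj y hy)) (differentiableAt_const _), (hzero k y).2, add_zero, db_mul d1 (hcj y hy), 
      db_conj, db_of_hol (hh.differentiableAt (hU.mem_nhds hy)), zero_mul, zero_add]
  have hdzS : ∀ j, dz j (fun y => ((‖h y‖^2 + δ : ℝ) : ℂ)) x = dz j h x * conj (h x) := by
    intro j
    have d1 := (hsa x hx).differentiableAt (n := ∞) (by simp)
    rw [heq, dz_add (d1.fun_mul (hcj x hx)) (differentiableAt_const _), (hzero j x).1, add_zero, dz_mul d1 (hcj x hx), 
      dz_conj, db_of_hol (hh.differentiableAt (hU.mem_nhds hx)), map_zero, mul_zero, add_zero]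
  refine ⟨hcd, ?_, ?_⟩
  · have := levi_eq (hcd.of_le (by norm_cast)) b
    have e : ∀ j k, dz j (db k (fun y => ((‖h y‖^2 + δ : ℝ) : ℂ))) x = dz j h x * conj (dz k h x) := by
      intro j k
      have hk : DifferentiableAt ℝ (dz k h) x := ((hdz k).contDiffAt (hU.mem_nhds hx)).differentiableAt (by simp)
      have hkc : DifferentiableAt ℝ (fun y => conj (dz k h y)) x := (Complex.conjCLE.differentiableAt).comp x hk
      rw [dz_congr (g := fun y => h y * conj (dz k h y)) (eventually_of_mem (hU.mem_nhds hx) fun y hy => hdbS k y hy), 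
        dz_mul ((hsa x hx).differentiableAt (by simp)) hkc, dz_conj]
      have : db j (dz k h) x = 0 := by
        rw [← dz_db_comm k j ((hsa x hx).of_le (by norm_cast)), 
          dz_congr (g := fun y => 0) (eventually_of_mem (hU.mem_nhds hx) fun y hy => db_of_hol (hh.differentiableAt (hU.mem_nhds hy)) j)]
        simp [dz]
      rw [this]; simp
    simp only [e] at this
    have h3 : ((‖dsum h x b‖^2 : ℝ) : ℂ) = (levi (fun y => ‖h y‖^2 + δ) x b : ℂ) := by
      rw [← this]; push_cast
      rw [← Complex.mul_conj', dsum, map_sum, Finset.sum_mul_sum]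
      refine Finset.sum_congr rfl fun j _ => Finset.sum_congr rfl fun k _ => ?_
      rw [map_mul]; ring
    exact_mod_cast h3.symm
  · rw [← gr_eq (hcd.differentiableAt (by simp))]
    simp only [hdzS]
    rw [show (∑ j, dz j h x * conj (h x) * b j) = conj (h x) * dsum h x b by
      rw [dsum, Finset.mul_sum]; exact Finset.sum_congr rfl fun j _ => by ring]
    rw [norm_mul, mul_pow, RCLike.norm_conj]

lemma levi_log {h : Cn N → ℂ} {U : Set (Cn N)} (hU : IsOpen U) (hh : DifferentiableOn ℂ h U) {x : Cn N} (hx : x ∈ U) (b : Cn N) {δ : ℝ} (hδ : 0 < δ) :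
    ContDiffAt ℝ ∞ (fun y => Real.log (‖h y‖^2 + δ)) x ∧ levi (fun y => Real.log (‖h y‖^2 + δ)) x b = δ / (‖h x‖^2 + δ)^2 * ‖dsum h x b‖^2 ∧ 
      gr (fun y => Real.log (‖h y‖^2 + δ)) x b = ‖h x‖^2 / (‖h x‖^2 + δ)^2 * ‖dsum h x b‖^2 := by
  obtain ⟨h1, h2, h3⟩ := levi_absq hU hh hx b δ
  have hpos : 0 < ‖h x‖^2 + δ := by positivity
  refine ⟨h1.log hpos.ne', ?_, ?_⟩
  · rw [levi_comp (g := fun y => ‖h y‖^2 + δ) (H := Real.log) (H' := fun y => y⁻¹) (h1.of_le (by norm_cast)) 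
      ((eventually_ne_nhds hpos.ne').mono fun y hy => Real.hasDerivAt_log hy) (hasDerivAt_inv hpos.ne'), h2, h3]
    field_simp; ring
  · rw [gr_comp (g := fun y => ‖h y‖^2 + δ) (H := Real.log) (h1.differentiableAt (by simp)) (Real.hasDerivAt_log hpos.ne'), h3]
    field_simp
end BP

namespace BP
open Filter Topology
set_option linter.all false
open scoped ContDiff ComplexConjugate
variable {N : ℕ}

lemma enorm_rpow_le {p : ℝ} (hp : 0 < p) (G U : ℂ) : ‖U‖ₑ^p ≤ 2^p * (‖G - U‖ₑ^p + ‖G‖ₑ^p) := by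
  have h1 : ‖U‖ₑ ≤ ‖G - U‖ₑ + ‖G‖ₑ := by
    calc ‖U‖ₑ = ‖G - (G - U)‖ₑ := by rw [sub_sub_cancel]
      _ ≤ _ := by rw [add_comm]; exact enorm_sub_le
  have h2 : ‖U‖ₑ ≤ 2 * max ‖G - U‖ₑ ‖G‖ₑ := h1.trans (by
    rw [two_mul]; exact add_le_add (le_max_left _ _) (le_max_right _ _))
  calc _ ≤ (2 * max ‖G - U‖ₑ ‖G‖ₑ)^p := ENNReal.rpow_le_rpow h2 hp.le
    _ = 2^p * (max ‖G - U‖ₑ ‖G‖ₑ)^p := ENNReal.mul_rpow_of_nonneg _ _ hp.le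
    _ ≤ _ := by
      refine mul_le_mul' le_rfl ?_
      rcases max_cases ‖G - U‖ₑ ‖G‖ₑ with h | h <;> rw [h.1]
      · exact le_self_add
      · exact le_add_self

lemma limit_lem {Ω : Set (Cn N)} (hΩ : IsOpen Ω) {D : ℕ → Set (Cn N)} (hD : ∀ k, IsOpen (D k)) (hDΩ : ∀ k, D k ⊆ Ω)
    {U : ℕ → Cn N → ℂ} (hU : ∀ k, DifferentiableOn ℂ (U k) (D k)) {w : ℕ → Cn N → ℝ≥0∞} {w' : Cn N → ℝ≥0∞}
    (hw : ∀ k, AEMeasurable (w k) (volume.restrict (D k))) {G : Cn N → ℂ} (hG : ContinuousOn G Ω) {p : ℝ} (hp : 0 < p) {C : ℝ≥0∞} (hC : C ≠ ⊤)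
    (hb : ∀ k, ∫⁻ x in D k, w k x * ‖G x - U k x‖ₑ^p ≤ C)
    (hloc : ∀ x ∈ Ω, ∃ r > 0, ∃ c : ℝ≥0, 0 < c ∧ ∃ B : ℝ, Metric.ball x r ⊆ Ω ∧ ∀ᶠ k in atTop, Metric.ball x r ⊆ D k ∧ 
      ∀ y ∈ Metric.ball x r, (c : ℝ≥0∞) ≤ w k y ∧ ‖G y‖ ≤ B)
    (hlim : ∀ s : ℕ → ℕ, StrictMono s → ∀ᵐ x ∂volume.restrict Ω, w' x ≤ liminf (fun k => w (s k) x) atTop) :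
    ∃ s : ℕ → ℕ, StrictMono s ∧ ∃ V : Cn N → ℂ, DifferentiableOn ℂ V Ω ∧ (∀ x ∈ Ω, Tendsto (fun k => U (s k) x) atTop (𝓝 (V x))) ∧
      ∫⁻ x in Ω, w' x * ‖G x - V x‖ₑ^p ≤ C := by
  obtain ⟨s, hs, V, hV, hVt⟩ := montel hΩ (U := U) (by
    intro x hx
    obtain ⟨r, hr, c, hc, B, hrΩ, hev⟩ := hloc x hx
    obtain ⟨b, hbb⟩ := sub_mean' (N := N) (δ := r/4) (by positivity)
    set M : ℝ≥0∞ := b * (2^p * (C / c + (ENNReal.ofReal B)^p * volume (Metric.ball x r))) with hM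
    have hMt : M ≠ ⊤ := by
      have : volume (Metric.ball x r) ≠ ⊤ := Metric.isBounded_ball.measure_lt_top.ne
      have h2 : C / c ≠ ⊤ := ENNReal.div_ne_top hC (by exact_mod_cast hc.ne')
      have h3 : (ENNReal.ofReal B)^p ≠ ⊤ := ENNReal.rpow_ne_top_of_nonneg hp.le ENNReal.ofReal_ne_top
      have h4 : (2 : ℝ≥0∞)^p ≠ ⊤ := ENNReal.rpow_ne_top_of_nonneg hp.le (by simp)
      exact ENNReal.mul_ne_top (by simp) (ENNReal.mul_ne_top h4 (ENNReal.add_ne_top.2 ⟨h2, ENNReal.mul_ne_top h3 this⟩))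
    refine ⟨r/4, by positivity, (M^(1/p)).toReal, (Metric.ball_subset_ball (by linarith)).trans hrΩ, hev.mono fun k hk => ⟨(hU k).mono ((Metric.ball_subset_ball (by linarith)).trans hk.1), fun y hy => ?_⟩⟩
    have hsub : Metric.closedBall y (r/4) ⊆ Metric.ball x r := fun z hz => by
      rw [Metric.mem_ball] at hy ⊢; rw [Metric.mem_closedBall] at hz
      linarith [dist_triangle z y x]
    have h1 := hbb (U k) (Metric.ball x r) y Metric.isOpen_ball ((hU k).mono hk.1) hsub p hp
    have hcC : ∫⁻ z in Metric.ball x r, ‖G z - U k z‖ₑ^p ≤ C / c := by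
      rw [ENNReal.le_div_iff_mul_le (by left; exact_mod_cast hc.ne') (by left; simp), mul_comm, ← lintegral_const_mul' _ _ (by simp)]
      calc _ ≤ ∫⁻ z in Metric.ball x r, w k z * ‖G z - U k z‖ₑ^p := 
            setLIntegral_mono' Metric.isOpen_ball.measurableSet fun z hz => mul_le_mul' (hk.2 z hz).1 le_rfl
        _ ≤ ∫⁻ z in D k, w k z * ‖G z - U k z‖ₑ^p := lintegral_mono_set hk.1
        _ ≤ C := hb k
    have h2 : ∫⁻ z in Metric.ball x r, ‖U k z‖ₑ^p ≤ 2^p * (C / c + (ENNReal.ofReal B)^p * volume (Metric.ball x r)) := by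
      calc _ ≤ ∫⁻ z in Metric.ball x r, 2^p * (‖G z - U k z‖ₑ^p + (ENNReal.ofReal B)^p) := by
            refine setLIntegral_mono' Metric.isOpen_ball.measurableSet fun z hz => (enorm_rpow_le hp (G z) (U k z)).trans (mul_le_mul' le_rfl (add_le_add le_rfl (ENNReal.rpow_le_rpow ?_ hp.le)))
            rw [← ofReal_norm_eq_enorm]
            exact ENNReal.ofReal_le_ofReal (hk.2 z hz).2
        _ = 2^p * ((∫⁻ z in Metric.ball x r, ‖G z - U k z‖ₑ^p) + ∫⁻ z in Metric.ball x r, (ENNReal.ofReal B)^p) := by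
            rw [lintegral_const_mul' _ _ (ENNReal.rpow_ne_top_of_nonneg hp.le (by simp)), lintegral_add_right _ measurable_const]
        _ ≤ _ := by
            rw [setLIntegral_const]
            exact mul_le_mul' le_rfl (add_le_add hcC le_rfl)
    have h3 : ‖U k y‖ₑ^p ≤ M := h1.trans (mul_le_mul' le_rfl h2)
    have h4 : ‖U k y‖ₑ ≤ M^(1/p) := by
      have := ENNReal.rpow_le_rpow h3 (z := 1/p) (by positivity)
      rwa [← ENNReal.rpow_mul, mul_one_div_cancel hp.ne', ENNReal.rpow_one] at this
    have := ENNReal.toReal_mono (ENNReal.rpow_ne_top_of_nonneg (by positivity) hMt) h4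
    rwa [toReal_enorm] at this)
  refine ⟨s, hs, V, hV, hVt, ?_⟩
  set g : ℕ → Cn N → ℝ≥0∞ := fun k => (D (s k)).indicator (fun x => w (s k) x * ‖G x - U (s k) x‖ₑ^p) with hg
  have hgm : ∀ k, AEMeasurable (g k) (volume.restrict Ω) := by
    intro k
    refine AEMeasurable.restrict ?_
    rw [hg]
    refine (aemeasurable_indicator_iff (hD _).measurableSet).2 ?_
    refine (hw _).mul ((((hG.mono (hDΩ _)).sub (hU (s k)).continuousOn).aestronglyMeasurable (hD _).measurableSet).enorm.pow_const p)
  have hgi : ∀ k, ∫⁻ x in Ω, g k x ≤ C := by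
    intro k
    rw [hg]
    beta_reduce
    rw [lintegral_indicator (hD _).measurableSet, Measure.restrict_restrict (hD _).measurableSet, inter_eq_left.2 (hDΩ _)]
    exact hb _
  calc _ ≤ ∫⁻ x in Ω, liminf (fun k => g k x) atTop := by
        refine lintegral_mono_ae ?_
        filter_upwards [hlim s hs, ae_restrict_mem hΩ.measurableSet] with x hx hxΩ
        have ht : Tendsto (fun k => ‖G x - U (s k) x‖ₑ^p) atTop (𝓝 (‖G x - V x‖ₑ^p)) := 
          ((ENNReal.continuous_rpow_const.tendsto _).comp ((continuous_enorm.tendsto _).comp (tendsto_const_nhds.sub (hVt x hxΩ))))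
        calc _ ≤ liminf (fun k => w (s k) x) atTop * liminf (fun k => ‖G x - U (s k) x‖ₑ^p) atTop := 
              mul_le_mul' hx ht.liminf_eq.ge
          _ ≤ liminf ((fun k => w (s k) x) * fun k => ‖G x - U (s k) x‖ₑ^p) atTop := ENNReal.le_liminf_mul
          _ = _ := by
              obtain ⟨r, hr, c, hc, B, hrΩ, hev⟩ := hloc x hxΩ
              refine liminf_congr ((hs.tendsto_atTop.eventually hev).mono fun k hk => ?_)
              simp only [hg, Pi.mul_apply]
              rw [indicator_of_mem (hk.1 (Metric.mem_ball_self hr))]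
    _ ≤ liminf (fun k => ∫⁻ x in Ω, g k x) atTop := lintegral_liminf_le' hgm
    _ ≤ C := by
        refine liminf_le_of_le ?_ fun b hb => ?_
        · isBoundedDefault
        · obtain ⟨k, hk⟩ := hb.exists
          exact hk.trans (hgi k)
end BP

namespace BP
open Filter Topology
set_option linter.all false
open scoped ContDiff ComplexConjugate
variable {N : ℕ}

/-- The twisting function `L + log L`. -/
def Nf (L : ℝ) : ℝ := L + Real.log L

lemma Nf_ge {L : ℝ} (h : 1 ≤ L) : L ≤ Nf L := by
  unfold Nf; linarith [Real.log_nonneg h]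
lemma Nf_le {L : ℝ} (h : 1 ≤ L) : Nf L ≤ 2 * L := by
  unfold Nf; linarith [Real.log_le_sub_one_of_pos (by linarith : 0 < L)]

lemma hasDeriv_Nf {L : ℝ} (h : 0 < L) : HasDerivAt Nf (1 + 1 / L) L := by
  have := (hasDerivAt_id' L).fun_add (Real.hasDerivAt_log h.ne')
  rw [one_div]; exact this

lemma hasDeriv_H {κ y : ℝ} (h : 1/2 < κ - y) (h2 : 0 < Nf (κ - y)) :
    HasDerivAt (fun y => - Real.log (Nf (κ - y))) ((1 + 1 / (κ - y)) / Nf (κ - y)) y := by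
  have h1 : HasDerivAt (fun y => κ - y) (-1) y := by simpa using (hasDerivAt_id y).const_sub κ
  have := (((hasDeriv_Nf (by linarith : 0 < κ - y)).comp y h1).log h2.ne').fun_neg
  refine HasDerivAt.congr_deriv this ?_
  simp only [Function.comp]; ring

lemma hasDeriv_H2 {κ y : ℝ} (h : 1 ≤ κ - y) :
    HasDerivAt (fun y => (1 + 1 / (κ - y)) / Nf (κ - y)) 
      (((1 + 1 / (κ - y)) / Nf (κ - y))^2 + 1 / ((κ - y)^2 * Nf (κ - y))) y := by
  have h1 : HasDerivAt (fun y => κ - y) (-1) y := by simpa using (hasDerivAt_id y).const_sub κ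
  have hp : 0 < κ - y := by linarith
  have hN : 0 < Nf (κ - y) := by linarith [Nf_ge h]
  have hn := (hasDeriv_Nf hp).comp y h1
  have := ((h1.fun_inv hp.ne').const_add 1).fun_div hn hN.ne'
  simp only [one_div] at this ⊢
  refine HasDerivAt.congr_deriv this ?_
  simp only [Function.comp]
  field_simp
  ring

lemma key_alg {L A μ G P Q lh lφ lq lρ n g s : ℝ} (hκ : 1 ≤ L) (hA : 17 * L ≤ A) (hn : L ≤ n) (hG : 0 ≤ G) (hP : 0 ≤ P) (hφ : 0 ≤ lφ) (hq : 0 ≤ lq)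
    (hQ : 0 ≤ Q) (hs : s = 1 / (16 * L)) (hlρ : 0 ≤ lρ) (hgr : g ≤ (1 + s) * (((1 + 1 / L) / n)^2 * G) + (1 + 1 / s) * (μ^2 * P)) :
    (1 + 1 / L) / n * lh ≤ lφ + lq + ((1 + 1 / L) / n * lh + (((1 + 1 / L) / n)^2 + 1 / (L^2 * n)) * G) + (A * μ^2 * (2 * Q) * lρ + A * μ^2 * 2 * P) - (1 + s) * g := by
  have hLp : 0 < L := by linarith
  have hsp : 0 < s := by rw [hs]; positivity
  have hsL : s * L = 1/16 := by rw [hs]; field_simp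
  have hs1 : s ≤ 1/16 := by nlinarith
  have hA0 : 0 ≤ A := by linarith
  have hn0 : 0 < n := by linarith
  have hinv : 1 / s = 16 * L := by rw [hs]; simp
  rw [hinv] at hgr
  clear hs hinv
  have k1 : (1 + s) * ((1 + s) * (((1 + 1 / L) / n)^2 * G)) ≤ (((1 + 1 / L) / n)^2 + 1 / (L^2 * n)) * G := by
    have e1 : (1 + 1 / L) / n = (L + 1) / (L * n) := by field_simp
    have : (2 * s + s^2) * (L+1)^2 ≤ n := by
      have a1 : (L+1)^2 ≤ 4 * L^2 := by nlinarith
      have a2 : 2 * s + s^2 ≤ 4 * s := by nlinarith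
      calc (2 * s + s^2) * (L+1)^2 ≤ (4 * s) * (4 * L^2) := mul_le_mul a2 a1 (by positivity) (by positivity)
        _ = 16 * (s * L) * L := by ring
        _ = L := by rw [hsL]; ring
        _ ≤ _ := hn
    rw [← mul_assoc, ← mul_assoc]
    refine mul_le_mul_of_nonneg_right ?_ hG
    rw [e1]
    have : (2 * s + s^2) * ((L + 1) / (L * n))^2 ≤ 1 / (L^2 * n) := by
      rw [div_pow, mul_div_assoc', div_le_div_iff₀ (by positivity) (by positivity)]
      have := mul_le_mul_of_nonneg_right this (by positivity : 0 ≤ L^2 * n)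
      linarith
    linarith
  have k2 : (1 + s) * ((1 + 16 * L) * (μ^2 * P)) ≤ A * μ^2 * 2 * P := by
    have : (1 + s) * (1 + 16 * L) ≤ 2 * A := by nlinarith
    have := mul_le_mul_of_nonneg_right this (by positivity : 0 ≤ μ^2 * P)
    linarith
  have k3 : 0 ≤ A * μ^2 * (2 * Q) * lρ := by positivity
  have k4 := mul_le_mul_of_nonneg_left hgr (by positivity : 0 ≤ 1 + s)
  linarith

lemma key_levi {φ q h ρ : Cn N → ℝ} {x : Cn N} (hφ : ContDiffAt ℝ 2 φ x) (hq : ContDiffAt ℝ 2 q x) (hh : ContDiffAt ℝ 2 h x) (hρ : ContDiffAt ℝ 2 ρ x)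
    (b : Cn N) (hφ0 : 0 ≤ levi φ x b) (hq0 : 0 ≤ levi q x b) (hρ0 : 0 ≤ levi ρ x b) (hρp : 0 < ρ x) {κ A μ : ℝ} (hκ : 1 ≤ κ - h x)
    (hA : 17 * (κ - h x) ≤ A) :
    (1 + 1 / (κ - h x)) / Nf (κ - h x) * levi h x b ≤
      levi (fun y => φ y + q y + - Real.log (Nf (κ - h y)) + A * μ^2 * ρ y ^2) x b - 
      (1 + 1 / (16 * (κ - h x))) * gr (fun y => - Real.log (Nf (κ - h y)) + μ * ρ y) x b := by
  set L := κ - h x with hL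
  have hN : 0 < Nf L := by linarith [Nf_ge hκ]
  have hc : ∀ᶠ y in 𝓝 (h x), 1/2 < κ - y ∧ 0 < Nf (κ - y) := by
    have h1 : ContinuousAt (fun y => κ - y) (h x) := by fun_prop
    refine (h1.eventually_const_lt (by linarith)).and ?_
    have h2 : ContinuousAt (fun y => Nf (κ - y)) (h x) :=
      ContinuousAt.comp (f := fun y => κ - y) (g := Nf) (hasDeriv_Nf (by linarith : (0:ℝ) < κ - h x)).continuousAt h1
    exact h2.eventually_const_lt hN
  have d1 : ∀ᶠ y in 𝓝 (h x), HasDerivAt (fun y => - Real.log (Nf (κ - y))) ((1 + 1 / (κ - y)) / Nf (κ - y)) y :=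
    hc.mono fun y hy => hasDeriv_H hy.1 hy.2
  have d2 := hasDeriv_H2 (κ := κ) (y := h x) hκ
  have l1 := levi_comp hh d1 d2 b
  have g1 := gr_comp (hh.differentiableAt (by norm_num)) d1.self_of_nhds b
  have hlogc : ContDiffAt ℝ 2 (fun y => - Real.log (Nf (κ - h y))) x := by
    have h1 : ContDiffAt ℝ 2 (fun y => κ - h y) x := contDiffAt_const.sub hh
    have h2 : ContDiffAt ℝ 2 (fun y => Nf (κ - h y)) x := by
      unfold Nf
      exact h1.add (h1.log (by linarith))
    exact (h2.log hN.ne').neg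
  have r1 := levi_comp (g := ρ) hρ (H := fun t => A * μ^2 * t^2) (H' := fun t => A * μ^2 * (2 * t)) (H2 := A * μ^2 * 2)
    (Eventually.of_forall fun t => by simpa using (hasDerivAt_pow 2 t).const_mul (A * μ^2)) (by simpa using ((hasDerivAt_id (ρ x)).const_mul 2).const_mul (A * μ^2)) b
  have r2 := gr_comp (g := ρ) (hρ.differentiableAt (by norm_num)) (H := fun t => μ * t) (H1 := μ) (by simpa using (hasDerivAt_id (ρ x)).const_mul μ) b
  have hρc : ContDiffAt ℝ 2 (fun y => A * μ^2 * ρ y ^2) x := contDiffAt_const.mul (hρ.pow 2)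
  rw [levi_add ((hφ.add hq).add hlogc) hρc, levi_add (hφ.add hq) hlogc, levi_add hφ hq, l1, r1]
  have hgr := gr_add_le (f := fun y => - Real.log (Nf (κ - h y))) (g := fun y => μ * ρ y) (hlogc.differentiableAt (by norm_num)) ((contDiffAt_const.mul hρ).differentiableAt (by norm_num)) (τ := 1 / (16 * L)) (by positivity) b
  rw [g1, r2] at hgr
  rw [← hL]  at *
  exact key_alg hκ hA (Nf_ge hκ) (gr_nonneg _ _ _) (gr_nonneg _ _ _) hφ0 hq0 hρp.le rfl hρ0 hgr

/-- The exhaustion weight `1/(c-ψ)`. -/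
lemma levi_rho {ψ : Cn N → ℝ} {x : Cn N} (hψ : ContDiffAt ℝ 2 ψ x) {c : ℝ} (hc : ψ x < c) (b : Cn N) (h0 : 0 ≤ levi ψ x b) :
    0 ≤ levi (fun y => (c - ψ y)⁻¹) x b := by
  have h1 : ∀ y, HasDerivAt (fun y => c - y) (-1) y := fun y => by simpa using (hasDerivAt_id y).const_sub c
  have d1 : ∀ᶠ y in 𝓝 (ψ x), HasDerivAt (fun y => (c - y)⁻¹) (((c - y)⁻¹)^2) y := by
    filter_upwards [eventually_lt_nhds hc] with y hy
    have := (h1 y).fun_inv (by linarith)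
    refine HasDerivAt.congr_deriv this ?_
    simp
  rw [levi_comp hψ (H := fun y => (c - y)⁻¹) d1 (H2 := 2 * ((c - ψ x)⁻¹) * ((c - ψ x)⁻¹)^2) (by simpa using d1.self_of_nhds.fun_pow 2) b]
  have := gr_nonneg ψ x b
  have : 0 < c - ψ x := by linarith
  positivity

end BP

namespace BP
open Filter Topology
set_option linter.all false
open scoped ContDiff ComplexConjugate
variable {N : ℕ}

lemma deriv_st : ∃ K : ℝ, 0 < K ∧ ∀ y, |deriv Real.smoothTransition y| ≤ K := by
  have hc : Continuous (deriv Real.smoothTransition) := 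
    (Real.smoothTransition.contDiff (n := 1)).continuous_deriv le_rfl
  obtain ⟨K, hK⟩ := (isCompact_Icc (a := (0:ℝ)) (b := 1)).exists_bound_of_continuousOn hc.continuousOn
  refine ⟨|K| + 1, by positivity, fun y => ?_⟩
  by_cases hy : y ∈ Icc (0:ℝ) 1
  · have := hK y hy
    rw [Real.norm_eq_abs] at this
    linarith [le_abs_self K]
  · have : deriv Real.smoothTransition y = 0 := by
      rw [mem_Icc, not_and_or, not_le, not_le] at hy
      rcases hy with hy | hy
      · have : Real.smoothTransition =ᶠ[𝓝 y] fun _ => 0 := by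
          filter_upwards [eventually_lt_nhds hy] with z hz using Real.smoothTransition.zero_of_nonpos hz.le
        rw [this.deriv_eq]; simp
      · have : Real.smoothTransition =ᶠ[𝓝 y] fun _ => 1 := by
          filter_upwards [eventually_gt_nhds hy] with z hz using Real.smoothTransition.one_of_one_le hz.le
        rw [this.deriv_eq]; simp
    rw [this]; simp; positivity

lemma dz_comp_real {g : Cn N → ℝ} {x : Cn N} (hg : DifferentiableAt ℝ g x) {H : ℝ → ℝ} {H1 : ℝ} (h1 : HasDerivAt H H1 (g x)) (j : Fin N) :
    dz j (fun y => (H (g y) : ℂ)) x = H1 * dz j (fun y => (g y : ℂ)) x := by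
  have h := h1.comp_hasFDerivAt x hg.hasFDerivAt
  have hd : DifferentiableAt ℝ (fun y => H (g y)) x := h.differentiableAt
  have hf : fderiv ℝ (fun y => H (g y)) x = H1 • fderiv ℝ g x := h.fderiv
  simp only [dz, fderiv_ofReal hd, fderiv_ofReal hg, hf]
  simp; ring

lemma pow4_exp {μ ρ : ℝ} (hμ : 0 < μ) (hρ : 0 ≤ ρ) : ρ^4 * Real.exp (-(μ * ρ)) ≤ 24 / μ^4 := by
  have h := Real.pow_div_factorial_le_exp (μ * ρ) (by positivity) 4
  rw [Real.exp_neg, ← div_eq_mul_inv, div_le_div_iff₀ (Real.exp_pos _) (by positivity)]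
  norm_num [Nat.factorial] at h
  rw [mul_pow] at h
  linarith

lemma cutoffs {O : Set (Cn N)} (hO : IsOpen O) {ψ : Cn N → ℝ} (hψ : ContDiffOn ℝ ∞ ψ O) {c : ℝ} (hK : IsCompact {x | x ∈ O ∧ ψ x ≤ c}) :
    ∃ η : ℕ → Cn N → ℝ, (∀ n, ContDiff ℝ ∞ (η n)) ∧ (∀ n, HasCompactSupport (η n)) ∧ (∀ n, tsupport (η n) ⊆ {x | x ∈ O ∧ ψ x < c}) ∧
      (∀ n x, 0 ≤ η n x) ∧ (∀ n x, η n x ≤ 1) ∧ (∀ x ∈ {x | x ∈ O ∧ ψ x < c}, ∀ᶠ n in atTop, η n x = 1) ∧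
      ∀ μ > 0, ∃ B, 0 ≤ B ∧ ∀ n, ∀ x ∈ {x | x ∈ O ∧ ψ x < c}, ∀ j, ‖dz j (fun y => (η n y : ℂ)) x‖^2 * Real.exp (- (μ * (c - ψ x)⁻¹)) ≤ B := by
  classical
  set D := {x | x ∈ O ∧ ψ x < c} with hD
  have hDo : IsOpen D := by
    have := hψ.continuousOn.isOpen_inter_preimage hO (isOpen_Iio (a := c))
    exact this
  obtain ⟨K1, hK1, hst⟩ := deriv_st
  set ρ : Cn N → ℝ := fun x => (c - ψ x)⁻¹ with hρ
  have hρs : ContDiffOn ℝ ∞ ρ D := (contDiffOn_const.sub (hψ.mono fun x hx => hx.1)).inv fun x hx => by have := hx.2; exact (sub_pos.2 this).ne'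
  have hρp : ∀ x ∈ D, 0 < ρ x := fun x hx => inv_pos.2 (sub_pos.2 hx.2)
  set g : ℕ → Cn N → ℝ := fun n x => Real.smoothTransition (2 - ρ x / (n+1)) with hg
  have hgs : ∀ n, ContDiffOn ℝ ∞ (g n) D := fun n => 
    (Real.smoothTransition.contDiff (n := ⊤)).comp_contDiffOn (contDiffOn_const.sub (hρs.div_const _))
  set η : ℕ → Cn N → ℝ := fun n => D.indicator (g n) with hη
  have hηD : ∀ n, ∀ x ∈ D, η n =ᶠ[𝓝 x] g n := fun n x hx => by
    filter_upwards [hDo.mem_nhds hx] with y hy using indicator_of_mem hy _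
  set Kn : ℕ → Set (Cn N) := fun n => {x | x ∈ O ∧ ψ x ≤ c} ∩ {x | ψ x ≤ c - (2*(n+1:ℝ))⁻¹} with hKn
  have hKnc : ∀ n, IsCompact (Kn n) := fun n => by
    have : IsClosed (Kn n) := (hψ.continuousOn.mono fun x hx => hx.1).preimage_isClosed_of_isClosed hK.isClosed (isClosed_Iic (a := c - (2*(n+1:ℝ))⁻¹))
    exact hK.of_isClosed_subset this inter_subset_left
  have hKnD : ∀ n, Kn n ⊆ D := fun n x hx => by
    refine ⟨hx.1.1, lt_of_le_of_lt hx.2 ?_⟩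
    have : (0:ℝ) < (2*(n+1:ℝ))⁻¹ := by positivity
    linarith
  have hηsupp : ∀ n, Function.support (η n) ⊆ Kn n := fun n x hx => by
    by_contra hcon
    apply hx
    by_cases hxD : x ∈ D
    · simp only [hη, indicator_of_mem hxD, hg]
      apply Real.smoothTransition.zero_of_nonpos
      have h1 : ¬ (ψ x ≤ c - (2*(n+1:ℝ))⁻¹) := fun h => hcon ⟨⟨hxD.1, hxD.2.le⟩, h⟩
      push Not at h1
      have h2 : c - ψ x < (2*(n+1:ℝ))⁻¹ := by linarith
      have h3 : 2*(n+1:ℝ) < ρ x := by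
        rw [hρ]; exact (lt_inv_comm₀ (by linarith [hxD.2]) (by positivity)).1 h2
      rw [sub_nonpos, le_div_iff₀ (by positivity)]; linarith
    · simp [hη, hxD]
  have hηt : ∀ n, tsupport (η n) ⊆ Kn n := fun n => closure_minimal (hηsupp n) (hKnc n).isClosed
  refine ⟨η, fun n => ?_, fun n => ?_, fun n => (hηt n).trans (hKnD n), fun n x => ?_, fun n x => ?_, fun x hx => ?_, fun μ hμ => ?_⟩
  · rw [contDiff_iff_contDiffAt]
    intro x
    by_cases hx : x ∈ D
    · exact ((hgs n).contDiffAt (hDo.mem_nhds hx)).congr_of_eventuallyEq (hηD n x hx)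
    · have : η n =ᶠ[𝓝 x] fun _ => 0 := notMem_tsupport_iff_eventuallyEq.1 fun h => hx (hKnD n (hηt n h))
      exact contDiffAt_const.congr_of_eventuallyEq this
  · exact (hKnc n).of_isClosed_subset (isClosed_tsupport _) (hηt n)
  · exact indicator_nonneg (fun x _ => Real.smoothTransition.nonneg _) x
  · exact indicator_le' (fun x _ => Real.smoothTransition.le_one _) (fun _ _ => zero_le_one) x
  · obtain ⟨n0, hn0⟩ := exists_nat_ge (ρ x)
    filter_upwards [eventually_ge_atTop n0] with n hn
    simp only [hη, indicator_of_mem hx, hg]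
    apply Real.smoothTransition.one_of_one_le
    have : (n0:ℝ) ≤ n := by exact_mod_cast hn
    have : ρ x / (n+1) ≤ 1 := by rw [div_le_one (by positivity)]; linarith
    linarith
  · have hdc : ∀ j, ContinuousOn (dz j (fun y => (ψ y : ℂ))) O := fun j => 
      (contDiffOn_dz (n := ⊤) (m := ⊤) (f := fun y => (ψ y : ℂ)) hO (ofRealCLM.contDiff.comp_contDiffOn hψ) (by simp)).continuousOn
    have hb : ∀ j, ∃ M, ∀ x ∈ {x | x ∈ O ∧ ψ x ≤ c}, ‖dz j (fun y => (ψ y : ℂ)) x‖ ≤ M := fun j => 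
      hK.exists_bound_of_continuousOn ((hdc j).mono fun x hx => hx.1)
    choose M hM using hb
    refine ⟨K1^2 * ((∑ j, |M j|)^2 * (24 / μ^4)), by positivity, fun n x hx j => ?_⟩
    have hψd : DifferentiableAt ℝ ψ x := (hψ.contDiffAt (hO.mem_nhds hx.1)).differentiableAt (by simp)
    have e1 : (fun y => (η n y : ℂ)) =ᶠ[𝓝 x] fun y => ((Real.smoothTransition (2 - (c - ψ y)⁻¹ / (n+1)) : ℝ) : ℂ) := by
      filter_upwards [hηD n x hx] with y hy
      rw [hy]
    have hsub : HasDerivAt (fun t => c - t) (-1) (ψ x) := by simpa using (hasDerivAt_id (ψ x)).const_sub c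
    have hd1 : HasDerivAt (fun t => 2 - (c - t)⁻¹ / (n+1:ℝ)) (- (ρ x ^2 / (n+1))) (ψ x) := by
      have := ((hsub.fun_inv (sub_pos.2 hx.2).ne').div_const (n+1:ℝ)).const_sub 2
      refine HasDerivAt.congr_deriv this ?_
      simp [hρ]
    have hd2 : HasDerivAt Real.smoothTransition (deriv Real.smoothTransition (2 - (c - ψ x)⁻¹ / (n+1:ℝ))) (2 - (c - ψ x)⁻¹ / (n+1:ℝ)) := 
      ((Real.smoothTransition.contDiff (n := 1)).differentiable (by simp) _).hasDerivAt
    have hd3 := hd2.comp (ψ x) hd1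
    rw [dz_congr e1, dz_comp_real hψd (H := fun t => Real.smoothTransition (2 - (c - t)⁻¹ / (n+1:ℝ))) hd3 j]
    rw [norm_mul, mul_pow, norm_real, Real.norm_eq_abs, sq_abs]
    set q := deriv Real.smoothTransition (2 - (c - ψ x)⁻¹ / (n+1:ℝ))
    have hq : q^2 ≤ K1^2 := by rw [← sq_abs]; exact pow_le_pow_left₀ (abs_nonneg _) (hst _) 2
    have hz : ‖dz j (fun y => (ψ y : ℂ)) x‖^2 ≤ (∑ j, |M j|)^2 := by
      refine pow_le_pow_left₀ (norm_nonneg _) ?_ 2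
      exact ((hM j x ⟨hx.1, hx.2.le⟩).trans (le_abs_self _)).trans (Finset.single_le_sum (f := fun j => |M j|) (fun _ _ => abs_nonneg _) (Finset.mem_univ j))
    have hr : (ρ x^2/(n+1))^2 ≤ ρ x^4 := by
      have h1 : ρ x^2/(n+1) ≤ ρ x^2 := div_le_self (by positivity) (by linarith [(Nat.cast_nonneg n : (0:ℝ) ≤ n)])
      have := pow_le_pow_left₀ (by positivity) h1 2
      calc _ ≤ _ := this
        _ = _ := by ring
    have hp4 := pow4_exp hμ (hρp x hx).le
    calc (q * -(ρ x^2/(n+1)))^2 * ‖dz j (fun y => (ψ y : ℂ)) x‖^2 * Real.exp (-(μ * (c - ψ x)⁻¹))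
        = q^2 * (‖dz j (fun y => (ψ y : ℂ)) x‖^2 * ((ρ x^2/(n+1))^2 * Real.exp (-(μ * ρ x)))) := by simp only [hρ]; ring
      _ ≤ K1^2 * ((∑ j, |M j|)^2 * (24 / μ^4)) := by
          refine mul_le_mul hq (mul_le_mul hz ?_ (by positivity) (by positivity)) (by positivity) (by positivity)
          exact (mul_le_mul_of_nonneg_right hr (Real.exp_pos _).le).trans hp4

end BP

namespace BP
open Filter Topology
set_option linter.all false
open scoped ContDiff ComplexConjugate
variable {N : ℕ}

lemma dsum_coord (i0 : Fin N) (a : ℂ) (x b : Cn N) : dsum (fun y => y i0 - a) x b = b i0 := by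
  have hf : ∀ v, fderiv ℝ (fun y : Cn N => y i0 - a) x v = v i0 := fun v => by
    rw [fderiv_sub_const]
    have := (ContinuousLinearMap.proj (R := ℝ) (φ := fun _ : Fin N => ℂ) i0).hasFDerivAt (x := x)
    rw [show (fun y : Cn N => y i0) = (ContinuousLinearMap.proj (R := ℝ) (φ := fun _ : Fin N => ℂ) i0) from rfl, this.fderiv]; rfl
  unfold dsum
  rw [Finset.sum_eq_single i0]
  · simp [dz, hf, e1, eI]
    ring_nf
  · intro j _ hj
    simp [dz, hf, e1, eI, Pi.single_apply, hj.symm]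
  · simp

lemma log_t (i0 : Fin N) (a : ℂ) {δ : ℝ} (hδ : 0 < δ) (x b : Cn N) :
    ContDiffAt ℝ ∞ (fun y : Cn N => Real.log (‖y i0 - a‖^2 + δ)) x ∧ 
    levi (fun y : Cn N => Real.log (‖y i0 - a‖^2 + δ)) x b = δ / (‖x i0 - a‖^2 + δ)^2 * ‖b i0‖^2 := by
  have hd : DifferentiableOn ℂ (fun y : Cn N => y i0 - a) univ := by
    refine Differentiable.differentiableOn ?_
    exact (differentiable_apply i0).sub_const a
  have := levi_log isOpen_univ hd (mem_univ x) b hδ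
  rw [dsum_coord] at this
  exact ⟨this.1, this.2.1⟩

lemma solve1 {O : Set (Cn N)} (hO : IsOpen O) {ψ φ : Cn N → ℝ} (hψ : ContDiffOn ℝ ∞ ψ O) (hφ : ContDiffOn ℝ ∞ φ O)
    (hψl : ∀ x ∈ O, ∀ b, 0 ≤ levi ψ x b) (hφl : ∀ x ∈ O, ∀ b, 0 ≤ levi φ x b) {c : ℝ} (hK : IsCompact {x | x ∈ O ∧ ψ x ≤ c})
    {D : Set (Cn N)} (hDd : D = {x | x ∈ O ∧ ψ x < c}) (i0 : Fin N) (a : ℂ) {δ κ : ℝ} (hδ : 0 < δ) 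
    (hκ : ∀ x ∈ D, 1 ≤ κ - Real.log (‖x i0 - a‖^2 + δ)) {F : Cn N → ℂ} (hF : ContDiffOn ℝ ∞ F D)
    (hF0 : ∀ x ∈ D, ∀ j, j ≠ i0 → db j F x = 0) {g : Cn N → ℝ} (hg0 : ∀ x ∈ D, 0 ≤ g x)
    (hFg : ∀ x ∈ D, ‖db i0 F x‖^2 * ((‖x i0 - a‖^2 + δ)^2 / δ) * Real.exp 1 ≤ ‖x i0 - a‖^2 * g x) {C : ℝ} (hC0 : 0 ≤ C)
    (hC : ∫⁻ x in D, ENNReal.ofReal (g x * Real.exp (- φ x)) ≤ ENNReal.ofReal C) {d μ : ℝ} (hd : 0 < d) (hμ : 0 < μ) :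
    ∃ U : Cn N → ℂ, DifferentiableOn ℂ U D ∧ ∫⁻ x in D, ENNReal.ofReal 
      (1 / (16 * (κ - Real.log (‖x i0 - a‖^2 + δ)) + 1) * Real.exp 
        (- Real.log (Nf (κ - Real.log (‖x i0 - a‖^2 + δ))) - φ x - Real.log (‖x i0 - a‖^2 + d) + (2 * (μ * (c - ψ x)⁻¹) - 17 * (κ - Real.log δ) * (μ * (c - ψ x)⁻¹)^2))) * ‖F x - U x‖ₑ^2 ≤ ENNReal.ofReal C := by
  have hDo : IsOpen D := by
    rw [hDd]
    exact hψ.continuousOn.isOpen_inter_preimage hO (isOpen_Iio (a := c))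
  have hDO : ∀ x ∈ D, x ∈ O ∧ ψ x < c := fun x hx => by rw [hDd] at hx; exact hx
  obtain ⟨η, hη, hηc, hηs, hη0, hη1, hηe, hηB⟩ := cutoffs hO hψ hK
  rw [← hDd] at hηs hηe hηB
  obtain ⟨B, hB0, hB⟩ := hηB μ hμ
  have hρs : ContDiffOn ℝ ∞ (fun x => (c - ψ x)⁻¹) D := (contDiffOn_const.sub (hψ.mono fun x hx => (hDO x hx).1)).inv fun x hx => (sub_pos.2 (hDO x hx).2).ne'
  have hρp : ∀ x ∈ D, 0 < (c - ψ x)⁻¹ := fun x hx => inv_pos.2 (sub_pos.2 (hDO x hx).2)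
  have hhs : ContDiffOn ℝ ∞ (fun x : Cn N => Real.log (‖x i0 - a‖^2 + δ)) D := fun x hx => (log_t i0 a hδ x 0).1.contDiffWithinAt
  have hqs : ContDiffOn ℝ ∞ (fun x : Cn N => Real.log (‖x i0 - a‖^2 + d)) D := fun x hx => (log_t i0 a hd x 0).1.contDiffWithinAt
  set l : Cn N → ℝ := fun x => κ - Real.log (‖x i0 - a‖^2 + δ) with hl
  have hls : ContDiffOn ℝ ∞ l D := contDiffOn_const.sub hhs
  have hl1 : ∀ x ∈ D, 1 ≤ l x := hκ
  have hlp : ∀ x ∈ D, 0 < l x := fun x hx => by linarith [hl1 x hx]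
  have hNp : ∀ x ∈ D, 0 < Nf (l x) := fun x hx => by linarith [Nf_ge (hl1 x hx), hl1 x hx]
  have hNs : ContDiffOn ℝ ∞ (fun x => Nf (l x)) D := by
    unfold Nf
    exact hls.add (hls.log fun x hx => (hlp x hx).ne')
  have hnls : ContDiffOn ℝ ∞ (fun x => - Real.log (Nf (l x))) D := (hNs.log fun x hx => (hNp x hx).ne').neg
  set A := 17 * (κ - Real.log δ) with hA
  have hlA : ∀ x ∈ D, 17 * l x ≤ A := fun x hx => by
    have : Real.log δ ≤ Real.log (‖x i0 - a‖^2 + δ) := Real.log_le_log hδ (by linarith [sq_nonneg ‖x i0 - a‖])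
    simp only [hA, hl]; linarith
  set Φ : Cn N → ℝ := fun y => φ y + Real.log (‖y i0 - a‖^2 + d) + - Real.log (Nf (κ - Real.log (‖y i0 - a‖^2 + δ))) + A * μ^2 * ((c - ψ y)⁻¹) ^2 with hΦ
  set σ : Cn N → ℝ := fun y => - Real.log (Nf (κ - Real.log (‖y i0 - a‖^2 + δ))) + μ * (c - ψ y)⁻¹ with hσ
  have hΦs : ContDiffOn ℝ ∞ Φ D := (((hφ.mono fun x hx => (hDO x hx).1).add hqs).add hnls).add (contDiffOn_const.mul (hρs.pow 2))
  have hσs : ContDiffOn ℝ ∞ σ D := hnls.add (contDiffOn_const.mul hρs)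
  have at2 : ∀ {f : Cn N → ℝ}, ContDiffOn ℝ ∞ f D → ∀ x ∈ D, ContDiffAt ℝ 2 f x := fun hf x hx => (hf.contDiffAt (hDo.mem_nhds hx)).of_le (by norm_cast)
  set s : Cn N → ℝ := fun x => 1 / (16 * l x) with hs
  set p : Cn N → ℝ := fun x => (1 + 1 / l x) / Nf (l x) * (δ / (‖x i0 - a‖^2 + δ)^2) with hp
  have htc : Continuous fun x : Cn N => ‖x i0 - a‖^2 := by fun_prop
  have hesig : ∀ x ∈ D, Real.exp (-σ x) = Nf (l x) * Real.exp (-(μ * (c - ψ x)⁻¹)) := fun x hx => by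
    have : -σ x = Real.log (Nf (l x)) + -(μ * (c - ψ x)⁻¹) := by simp only [hσ, hl]; ring
    rw [this, Real.exp_add, Real.exp_log (hNp x hx)]
  have hs0 : ∀ x ∈ D, 0 < s x := fun x hx => by have := hlp x hx; simp only [hs]; positivity
  have hp0 : ∀ x ∈ D, 0 < p x := fun x hx => by 
    have := hlp x hx; have := hNp x hx; simp only [hp]; positivity
  have hdiff : ∀ x, 2 * σ x - Φ x = - Real.log (Nf (l x)) - φ x - Real.log (‖x i0 - a‖^2 + d) + (2 * (μ * (c - ψ x)⁻¹) - A * (μ * (c - ψ x)⁻¹)^2) := fun x => by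
    simp only [hσ, hΦ, hl]; ring
  have hpt : ∀ x ∈ D, ‖db i0 F x‖^2 / p x * Real.exp (2 * σ x - Φ x) ≤ g x * Real.exp (- φ x) := by
    intro x hx
    rw [hdiff]
    have h2 := hl1 x hx
    have h3 := hlA x hx
    have h5 := hNp x hx
    set T := ‖x i0 - a‖^2 with hT
    have hT0 : 0 ≤ T := by positivity
    have e1 : Real.exp (- Real.log (Nf (l x)) - φ x - Real.log (T + d) + (2 * (μ * (c - ψ x)⁻¹) - A * (μ * (c - ψ x)⁻¹)^2)) ≤ 
        1 / Nf (l x) * Real.exp (- φ x) * (1 / (T + d)) * Real.exp 1 := by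
      have : 2 * (μ * (c - ψ x)⁻¹) - A * (μ * (c - ψ x)⁻¹)^2 ≤ 1 := by
        have hA1 : 1 ≤ A := by linarith
        nlinarith [sq_nonneg (μ * (c - ψ x)⁻¹ - 1), sq_nonneg (μ * (c - ψ x)⁻¹)]
      have hx1 : 1 / Nf (l x) = Real.exp (- Real.log (Nf (l x))) := by rw [Real.exp_neg, Real.exp_log h5, one_div]
      have hx2 : 1 / (T + d) = Real.exp (- Real.log (T + d)) := by rw [Real.exp_neg, Real.exp_log (by positivity), one_div]
      rw [hx1, hx2, ← Real.exp_add, ← Real.exp_add, ← Real.exp_add]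
      exact Real.exp_le_exp.2 (by linarith)
    have e2 : 1 / p x ≤ Nf (l x) * ((T + δ)^2 / δ) := by
      have : 1 / p x = Nf (l x) * ((T + δ)^2 / δ) / (1 + 1 / l x) := by
        have := hlp x hx
        simp only [hp]
        rw [← hT]
        field_simp
      rw [this]
      refine div_le_self (by positivity) ?_
      have := hlp x hx
      have : 0 < 1 / l x := by positivity
      linarith
    have hG := hFg x hx
    rw [← hT] at hG
    calc ‖db i0 F x‖^2 / p x * Real.exp (- Real.log (Nf (l x)) - φ x - Real.log (T + d) + (2 * (μ * (c - ψ x)⁻¹) - A * (μ * (c - ψ x)⁻¹)^2))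
        = ‖db i0 F x‖^2 * (1 / p x * Real.exp (- Real.log (Nf (l x)) - φ x - Real.log (T + d) + (2 * (μ * (c - ψ x)⁻¹) - A * (μ * (c - ψ x)⁻¹)^2))) := by ring
      _ ≤ ‖db i0 F x‖^2 * (Nf (l x) * ((T + δ)^2 / δ) * (1 / Nf (l x) * Real.exp (- φ x) * (1 / (T + d)) * Real.exp 1)) := by
          refine mul_le_mul_of_nonneg_left ?_ (by positivity)
          exact mul_le_mul e2 e1 (Real.exp_pos _).le (by positivity)
      _ = (‖db i0 F x‖^2 * ((T + δ)^2 / δ) * Real.exp 1) * (Real.exp (- φ x) * (1 / (T + d))) := by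
          field_simp
      _ ≤ (T * g x) * (Real.exp (- φ x) * (1 / (T + d))) := mul_le_mul_of_nonneg_right hG (by positivity)
      _ = g x * Real.exp (- φ x) * (T / (T + d)) := by ring
      _ ≤ g x * Real.exp (- φ x) * 1 := by
          refine mul_le_mul_of_nonneg_left ?_ (mul_nonneg (hg0 x hx) (Real.exp_pos _).le)
          rw [div_le_one (by positivity)]; linarith
      _ = _ := mul_one _
  obtain ⟨U, hU, hUb⟩ := dbar_solve hDo (s := s) (p := p) hΦs hσs (continuousOn_const.div (continuousOn_const.mul hls.continuousOn) fun x hx => by have := hlp x hx; positivity)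
    (((continuousOn_const.add (continuousOn_const.div hls.continuousOn fun x hx => (hlp x hx).ne')).div hNs.continuousOn fun x hx => (hNp x hx).ne').mul 
      (continuousOn_const.div ((htc.add_const δ).pow 2).continuousOn fun x hx => by positivity)) hs0 hp0 i0
    (fun x hx b => by
      have h1 := key_levi (κ := κ) (A := A) (μ := μ) (at2 (hφ.mono fun x hx => (hDO x hx).1) x hx) (at2 hqs x hx) (at2 hhs x hx) (at2 hρs x hx) b (hφl x (hDO x hx).1 b)
        (by rw [(log_t i0 a hd x b).2]; positivity) (levi_rho (at2 (hψ.mono fun x hx => (hDO x hx).1) x hx) (hDO x hx).2 b (hψl x (hDO x hx).1 b)) (hρp x hx) (hκ x hx) (hlA x hx)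
      rw [(log_t i0 a hδ x b).2] at h1
      refine le_trans (le_of_eq ?_) h1
      simp only [hp, hl]; ring)
    hη hηc hηs hη0 hη1 hηe (B := B * (2 * A * (1 + 16 * A))) (fun n x hx j => by
      rw [hesig x hx]
      have h1 := hB n x hx j
      have h2 := hl1 x hx
      have h3 := hlA x hx
      have h4 := Nf_le h2
      have h5 := hNp x hx
      have h6 : 1 / s x = 16 * l x := by simp [hs]
      rw [h6]
      calc _ = (‖dz j (fun y => (η n y : ℂ)) x‖^2 * Real.exp (- (μ * (c - ψ x)⁻¹))) * (Nf (l x) * (1 + 16 * l x)) := by ring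
        _ ≤ _ := by
          refine mul_le_mul h1 (mul_le_mul (by linarith) (by linarith) (by positivity) (by linarith)) (by positivity) hB0)
    hF hF0 (B' := 2 / δ) (fun x hx => by
      rw [hesig x hx]
      have h2 := hl1 x hx
      have h5 := hNp x hx
      have h6 : Real.exp (-(μ * (c - ψ x)⁻¹)) ≤ 1 := Real.exp_le_one_iff.2 (by have := hρp x hx; have := mul_pos hμ this; linarith)
      have h7 : 1 + 1 / l x ≤ 2 := by
        have : 1 / l x ≤ 1 := by rw [div_le_one (by linarith)]; exact h2
        linarith
      have h8 : δ / (‖x i0 - a‖^2 + δ)^2 ≤ 1 / δ := by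
        rw [div_le_div_iff₀ (by positivity) hδ]; nlinarith [sq_nonneg ‖x i0 - a‖]
      calc p x * (Nf (l x) * Real.exp (-(μ * (c - ψ x)⁻¹))) = (1 + 1 / l x) * (δ / (‖x i0 - a‖^2 + δ)^2) * Real.exp (-(μ * (c - ψ x)⁻¹)) := by
            simp only [hp]; field_simp
        _ ≤ 2 * (1 / δ) * 1 := by
            refine mul_le_mul (mul_le_mul h7 h8 (by positivity) (by norm_num)) h6 (by positivity) (by positivity)
        _ = _ := by ring)
    hC0 (le_trans (setLIntegral_mono' hDo.measurableSet fun x hx => ENNReal.ofReal_le_ofReal (hpt x hx)) hC)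
  · refine ⟨U, hU, le_trans (le_of_eq (setLIntegral_congr_fun hDo.measurableSet fun x hx => ?_)) hUb⟩
    beta_reduce
    rw [hdiff]
    have : s x / (1 + s x) = 1 / (16 * l x + 1) := by
      have := hlp x hx
      simp only [hs]; field_simp
    rw [this]

end BP

namespace BP
open Filter Topology
set_option linter.all false
open scoped ContDiff ComplexConjugate
variable {N : ℕ}

lemma solve2 {O : Set (Cn N)} (hO : IsOpen O) {ψ φ : Cn N → ℝ} (hψ : ContDiffOn ℝ ∞ ψ O) (hφ : ContDiffOn ℝ ∞ φ O)
    (hψl : ∀ x ∈ O, ∀ b, 0 ≤ levi ψ x b) (hφl : ∀ x ∈ O, ∀ b, 0 ≤ levi φ x b) {c : ℝ} (hK : IsCompact {x | x ∈ O ∧ ψ x ≤ c})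
    {D : Set (Cn N)} (hDd : D = {x | x ∈ O ∧ ψ x < c}) (i0 : Fin N) (a : ℂ) {δ κ : ℝ} (hδ : 0 < δ) 
    (hκ : ∀ x ∈ D, 1 ≤ κ - Real.log (‖x i0 - a‖^2 + δ)) {F : Cn N → ℂ} (hF : ContDiffOn ℝ ∞ F D)
    (hF0 : ∀ x ∈ D, ∀ j, j ≠ i0 → db j F x = 0) {g : Cn N → ℝ} (hg0 : ∀ x ∈ D, 0 ≤ g x)
    (hFg : ∀ x ∈ D, ‖db i0 F x‖^2 * ((‖x i0 - a‖^2 + δ)^2 / δ) * Real.exp 1 ≤ ‖x i0 - a‖^2 * g x) {C : ℝ} (hC0 : 0 ≤ C)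
    (hC : ∫⁻ x in D, ENNReal.ofReal (g x * Real.exp (- φ x)) ≤ ENNReal.ofReal C) :
    ∃ U : Cn N → ℂ, DifferentiableOn ℂ U D ∧ ∫⁻ x in D, ENNReal.ofReal 
      (Real.exp (- φ x) / (34 * (κ - Real.log (‖x i0 - a‖^2 + δ))^2 * ‖x i0 - a‖^2)) * ‖F x - U x‖ₑ^2 ≤ ENNReal.ofReal C := by
  have hDo : IsOpen D := by
    rw [hDd]
    exact hψ.continuousOn.isOpen_inter_preimage hO (isOpen_Iio (a := c))
  have hDO : ∀ x ∈ D, x ∈ O ∧ ψ x < c := fun x hx => by rw [hDd] at hx; exact hx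
  set l : Cn N → ℝ := fun x => κ - Real.log (‖x i0 - a‖^2 + δ) with hl
  have hl1 : ∀ x ∈ D, 1 ≤ l x := hκ
  have hlp : ∀ x ∈ D, 0 < l x := fun x hx => by linarith [hl1 x hx]
  have hNp : ∀ x ∈ D, 0 < Nf (l x) := fun x hx => by linarith [Nf_ge (hl1 x hx), hl1 x hx]
  set A := 17 * (κ - Real.log δ) with hA
  have hlA : ∀ x ∈ D, 17 * l x ≤ A := fun x hx => by
    have : Real.log δ ≤ Real.log (‖x i0 - a‖^2 + δ) := Real.log_le_log hδ (by linarith [sq_nonneg ‖x i0 - a‖])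
    simp only [hA, hl]; linarith
  have htc : Continuous fun x : Cn N => ‖x i0 - a‖^2 := by fun_prop
  have hlc : ContinuousOn l D := continuousOn_const.sub ((htc.add_const δ).continuousOn.log fun x hx => by positivity)
  have hNc : ContinuousOn (fun x => Nf (l x)) D := by
    unfold Nf
    exact hlc.add (hlc.log fun x hx => (hlp x hx).ne')
  have hρc : ContinuousOn (fun x => (c - ψ x)⁻¹) D := (continuousOn_const.sub (hψ.continuousOn.mono fun x hx => (hDO x hx).1)).inv₀ fun x hx => (sub_pos.2 (hDO x hx).2).ne'
  have hρp : ∀ x ∈ D, 0 < (c - ψ x)⁻¹ := fun x hx => inv_pos.2 (sub_pos.2 (hDO x hx).2)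
  have hφc : ContinuousOn φ D := hφ.continuousOn.mono fun x hx => (hDO x hx).1
  set W : ℝ → ℝ → Cn N → ℝ := fun d μ x => 1 / (16 * l x + 1) * Real.exp 
        (- Real.log (Nf (l x)) - φ x - Real.log (‖x i0 - a‖^2 + d) + (2 * (μ * (c - ψ x)⁻¹) - A * (μ * (c - ψ x)⁻¹)^2)) with hW
  have hWc : ∀ d > 0, ∀ μ, ContinuousOn (W d μ) D := fun d hd μ => by
    have hd : 0 < d := hd
    refine (continuousOn_const.div ((continuousOn_const.mul hlc).add continuousOn_const) fun x hx => by have := hlp x hx; change 16 * l x + 1 ≠ 0; positivity).mul (ContinuousOn.rexp ?_)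
    refine ((((hNc.log fun x hx => (hNp x hx).ne').neg).sub hφc).sub ((htc.add_const d).continuousOn.log fun x hx => by positivity)).add ?_
    exact (continuousOn_const.mul (continuousOn_const.mul hρc)).sub (continuousOn_const.mul ((continuousOn_const.mul hρc).pow 2))
  set dk : ℕ → ℝ := fun k => 1 / ((k:ℝ) + 1) with hdk
  have hdk0 : ∀ k, 0 < dk k := fun k => by simp only [hdk]; positivity
  have hdk1 : ∀ k, dk k ≤ 1 := fun k => by 
    simp only [hdk]; rw [div_le_one (by positivity)]; linarith [(Nat.cast_nonneg k : (0:ℝ) ≤ k)]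
  have hdkt : Tendsto dk atTop (𝓝 0) := tendsto_one_div_add_atTop_nhds_zero_nat
  choose U hU hUb using fun k : ℕ => solve1 hO hψ hφ hψl hφl hK hDd i0 a hδ hκ hF hF0 hg0 hFg hC0 hC (hdk0 k) (hdk0 k)
  have hloc : ∀ x ∈ D, ∃ r > 0, ∃ c : ℝ≥0, 0 < c ∧ ∃ B : ℝ, Metric.ball x r ⊆ D ∧ ∀ᶠ k in (atTop : Filter ℕ), Metric.ball x r ⊆ D ∧ 
      ∀ y ∈ Metric.ball x r, (c : ℝ≥0∞) ≤ ENNReal.ofReal (W (dk k) (dk k) y) ∧ ‖F y‖ ≤ B := by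
    intro x hx
    set G0 : Cn N → ℝ := fun x => 1 / (16 * l x + 1) * Real.exp (- Real.log (Nf (l x)) - φ x - Real.log (‖x i0 - a‖^2 + 1) + (0 - A * ((c - ψ x)⁻¹)^2)) with hG0
    have hG0c : ContinuousOn G0 D := by
      refine (continuousOn_const.div ((continuousOn_const.mul hlc).add continuousOn_const) fun x hx => by have := hlp x hx; change 16 * l x + 1 ≠ 0; positivity).mul (ContinuousOn.rexp ?_)
      refine ((((hNc.log fun x hx => (hNp x hx).ne').neg).sub hφc).sub ((htc.add_const 1).continuousOn.log fun x hx => by positivity)).add ?_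
      exact continuousOn_const.sub (continuousOn_const.mul (hρc.pow 2))
    have hG0p : 0 < G0 x := by have := hlp x hx; simp only [hG0]; positivity
    have ev : ∀ᶠ y in 𝓝 x, y ∈ D ∧ G0 x / 2 < G0 y ∧ ‖F y‖ < ‖F x‖ + 1 := by
      refine (hDo.eventually_mem hx).and (((hG0c.continuousAt (hDo.mem_nhds hx)).eventually_const_lt (by linarith)).and ?_)
      exact (hF.continuousOn.continuousAt (hDo.mem_nhds hx)).norm.eventually_lt_const (by linarith)
    obtain ⟨r, hr, hball⟩ := Metric.eventually_nhds_iff_ball.1 ev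
    refine ⟨r, hr, (G0 x / 2).toNNReal, by simpa using hG0p, ‖F x‖ + 1, fun y hy => (hball y hy).1, Eventually.of_forall fun k => ⟨fun y hy => (hball y hy).1, fun y hy => ⟨?_, (hball y hy).2.2.le⟩⟩⟩
    obtain ⟨hyD, hy1, -⟩ := hball y hy
    rw [ENNReal.ofNNReal_toNNReal]
    refine ENNReal.ofReal_le_ofReal (hy1.le.trans ?_)
    have h1 := hlp y hyD
    refine mul_le_mul_of_nonneg_left (Real.exp_le_exp.2 ?_) (by positivity)
    have h2 : Real.log (‖y i0 - a‖^2 + dk k) ≤ Real.log (‖y i0 - a‖^2 + 1) := Real.log_le_log (by have := hdk0 k; positivity) (by linarith [hdk1 k])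
    have h3 : 0 ≤ 2 * (dk k * (c - ψ y)⁻¹) := by have := hdk0 k; have := hρp y hyD; positivity
    have h4 : (dk k * (c - ψ y)⁻¹)^2 ≤ ((c - ψ y)⁻¹)^2 := by
      have := hρp y hyD
      refine pow_le_pow_left₀ (by have := hdk0 k; positivity) ?_ 2
      nlinarith [hdk1 k]
    have h5 : 0 ≤ A := by linarith [hlA y hyD]
    have h6 := mul_le_mul_of_nonneg_left h4 h5
    linarith
  have hlim : ∀ s : ℕ → ℕ, StrictMono s → ∀ᵐ x ∂volume.restrict D, ENNReal.ofReal (Real.exp (- φ x) / (34 * (l x)^2 * ‖x i0 - a‖^2)) ≤ 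
      liminf (fun k => ENNReal.ofReal (W (dk (s k)) (dk (s k)) x)) atTop := by
    intro s hs
    refine (ae_restrict_iff' hDo.measurableSet).2 (Eventually.of_forall fun x hx => ?_)
    beta_reduce
    by_cases ht : ‖x i0 - a‖^2 = 0
    · rw [ht]; simp
    have hT0 : 0 < ‖x i0 - a‖^2 := lt_of_le_of_ne (by positivity) (Ne.symm ht)
    have hlim : Tendsto (fun k => W (dk (s k)) (dk (s k)) x) atTop (𝓝 (W 0 0 x)) := by
      have hst := hdkt.comp hs.tendsto_atTop
      have hcont : ContinuousAt (fun d => W d d x) 0 := by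
        simp only [hW]
        have : ContinuousAt (fun d : ℝ => Real.log (‖x i0 - a‖^2 + d)) 0 := ContinuousAt.log (by fun_prop) (by simpa using ht)
        fun_prop
      exact hcont.tendsto.comp hst
    rw [(ENNReal.tendsto_ofReal hlim).liminf_eq]
    refine ENNReal.ofReal_le_ofReal ?_
    simp only [hW]
    have h1 := hl1 x hx
    have h2 := hNp x hx
    have h3 := Nf_le h1
    have e1 : Real.exp (- Real.log (Nf (l x)) - φ x - Real.log (‖x i0 - a‖^2 + 0) + (2 * (0 * (c - ψ x)⁻¹) - A * (0 * (c - ψ x)⁻¹)^2)) = 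
        Real.exp (- φ x) / (Nf (l x) * ‖x i0 - a‖^2) := by
      rw [show - Real.log (Nf (l x)) - φ x - Real.log (‖x i0 - a‖^2 + 0) + (2 * (0 * (c - ψ x)⁻¹) - A * (0 * (c - ψ x)⁻¹)^2) = - φ x - (Real.log (Nf (l x)) + Real.log (‖x i0 - a‖^2)) by ring_nf,
        Real.exp_sub, Real.exp_add, Real.exp_log h2, Real.exp_log hT0]
    rw [e1, div_mul_div_comm, one_mul]
    refine div_le_div_of_nonneg_left (Real.exp_pos _).le (by positivity) ?_
    rw [← mul_assoc]
    refine mul_le_mul_of_nonneg_right ?_ hT0.le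
    calc (16 * l x + 1) * Nf (l x) ≤ (17 * l x) * (2 * l x) := mul_le_mul (by linarith) h3 h2.le (by linarith)
      _ = _ := by ring
  obtain ⟨s, hs, V, hV, -, hVb⟩ := limit_lem hDo (D := fun _ => D) (fun _ => hDo) (fun _ => subset_rfl) hU 
    (w := fun k x => ENNReal.ofReal (W (dk k) (dk k) x)) (w' := fun x => ENNReal.ofReal (Real.exp (- φ x) / (34 * (l x)^2 * ‖x i0 - a‖^2)))
    (fun k => ((hWc (dk k) (hdk0 k) (dk k)).aemeasurable hDo.measurableSet).ennreal_ofReal) hF.continuousOn (p := 2) (by norm_num) (C := ENNReal.ofReal C) (by simp)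
    (fun k => by simpa only [ENNReal.rpow_two] using hUb k) hloc hlim
  · exact ⟨V, hV, by simpa only [ENNReal.rpow_two] using hVb⟩

end BP

namespace BP
open Filter Topology
set_option linter.all false
open scoped ContDiff ComplexConjugate
variable {N : ℕ}

/-- Drop the first coordinate. -/
def tl {n : ℕ} (x : Cn (n+1)) : Cn n := fun i => x i.succ
/-- Prepend a coordinate. -/
def cn {n : ℕ} (a : ℂ) (z : Cn n) : Cn (n+1) := Fin.cons a z

section
variable {n : ℕ}
lemma cn_zero (a : ℂ) (z : Cn n) : cn a z 0 = a := rfl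
lemma cn_succ (a : ℂ) (z : Cn n) (i : Fin n) : cn a z i.succ = z i := rfl
lemma tl_cn (a : ℂ) (z : Cn n) : tl (cn a z) = z := rfl
lemma cn_tl (x : Cn (n+1)) : cn (x 0) (tl x) = x := by
  ext i
  refine Fin.cases ?_ (fun j => ?_) i
  · rfl
  · rfl

lemma diff_tl : Differentiable ℂ (tl : Cn (n+1) → Cn n) := by
  rw [differentiable_pi]; intro i; exact differentiable_apply _
lemma diff_cn (a : ℂ) : Differentiable ℂ (cn a : Cn n → Cn (n+1)) := by
  rw [differentiable_pi]; intro i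
  refine Fin.cases ?_ (fun j => ?_) i
  · exact differentiable_const _
  · exact differentiable_apply _
lemma cont_tl : Continuous (tl : Cn (n+1) → Cn n) := diff_tl.continuous
lemma cont_cn (a : ℂ) : Continuous (cn a : Cn n → Cn (n+1)) := (diff_cn a).continuous
lemma cont_cn2 : Continuous (fun p : ℂ × Cn n => cn p.1 p.2) := by
  refine continuous_pi fun i => ?_
  refine Fin.cases ?_ (fun j => ?_) i
  · exact continuous_fst
  · exact (continuous_apply j).comp continuous_snd

lemma cn_eq : (fun p : ℂ × Cn n => cn p.1 p.2) = ⇑(MeasurableEquiv.piFinSuccAbove (fun _ : Fin (n+1) => ℂ) 0).symm := by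
  funext p
  apply (MeasurableEquiv.piFinSuccAbove (fun _ : Fin (n+1) => ℂ) 0).injective
  rw [MeasurableEquiv.apply_symm_apply]
  rfl

lemma mp_cn : MeasurePreserving (fun p : ℂ × Cn n => cn p.1 p.2) := by
  have h := (volume_preserving_piFinSuccAbove (fun _ : Fin (n+1) => ℂ) 0).symm
  rw [cn_eq]; exact h

lemma emb_cn : MeasurableEmbedding (fun p : ℂ × Cn n => cn p.1 p.2) := by
  have h := (MeasurableEquiv.piFinSuccAbove (fun _ : Fin (n+1) => ℂ) 0).symm.measurableEmbedding
  rw [cn_eq]; exact h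

lemma lint_mul_cn {H1 : ℂ → ℝ≥0∞} {H2 : Cn n → ℝ≥0∞} (h1 : AEMeasurable H1) (h2 : AEMeasurable H2) :
    ∫⁻ x : Cn (n+1), H1 (x 0) * H2 (tl x) = (∫⁻ w, H1 w) * ∫⁻ z, H2 z := by
  rw [← mp_cn.lintegral_comp_emb emb_cn, ← lintegral_prod_mul h1 h2]
  rfl

lemma vol_box (a : ℂ) (x0 : Cn (n+1)) (ρ r : ℝ) : 
    volume {x : Cn (n+1) | x 0 ∈ Metric.closedBall a ρ ∧ ∀ i : Fin n, x i.succ ∈ Metric.ball (x0 i.succ) r} = 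
      volume (Metric.closedBall a ρ) * ∏ i : Fin n, volume (Metric.ball (x0 i.succ) r) := by
  have : {x : Cn (n+1) | x 0 ∈ Metric.closedBall a ρ ∧ ∀ i : Fin n, x i.succ ∈ Metric.ball (x0 i.succ) r} = 
      Set.pi univ (Fin.cons (Metric.closedBall a ρ) (fun i : Fin n => Metric.ball (x0 i.succ) r) : Fin (n+1) → Set ℂ) := by
    ext x
    simp only [mem_setOf_eq, Set.mem_pi, mem_univ, true_implies, Fin.forall_fin_succ, Fin.cons_zero, Fin.cons_succ]
  rw [this, volume_pi_pi, Fin.prod_univ_succ]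
  simp

/-- Non-integrability of `1/|w|^2` forces vanishing on the fiber. -/
lemma vanish {D : Set (Cn (n+1))} (hD : IsOpen D) {v : Cn (n+1) → ℂ} (hv : ContinuousOn v D) {W : Cn (n+1) → ℝ} (hW : ContinuousOn W D) (hW0 : ∀ x ∈ D, 0 < W x) (a : ℂ)
    (hfin : ∫⁻ x in D, ENNReal.ofReal (W x / ‖x 0 - a‖^2) * ‖v x‖ₑ^2 ≠ ⊤) {x : Cn (n+1)} (hx : x ∈ D) (hxa : x 0 = a) : v x = 0 := by
  by_contra hne
  set q : Cn (n+1) → ℝ := fun y => W y * ‖v y‖^2 with hq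
  have hqc : ContinuousOn q D := hW.mul (hv.norm.pow 2)
  have hqx : 0 < q x := mul_pos (hW0 x hx) (by have := norm_pos_iff.2 hne; positivity)
  set c0 := q x / 2 with hc0
  have hc0p : 0 < c0 := by positivity
  have ev : ∀ᶠ y in 𝓝 x, y ∈ D ∧ c0 < q y := 
    (hD.eventually_mem hx).and ((hqc.continuousAt (hD.mem_nhds hx)).eventually_const_lt (by linarith))
  obtain ⟨r, hr, hball⟩ := Metric.eventually_nhds_iff_ball.1 ev
  set S : ℕ → Set (Cn (n+1)) := fun k => {y | y 0 ∈ Metric.closedBall a (r / (k + 2)) ∧ ∀ i : Fin n, y i.succ ∈ Metric.ball (x i.succ) r} with hS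
  have hrk : ∀ k : ℕ, 0 < r / ((k:ℝ) + 2) ∧ r / ((k:ℝ) + 2) < r := fun k => by
    refine ⟨by positivity, ?_⟩
    exact div_lt_self hr (by linarith [(Nat.cast_nonneg k : (0:ℝ) ≤ k)])
  have hSb : ∀ k, S k ⊆ Metric.ball x r := fun k y hy => by
    rw [Metric.mem_ball, dist_pi_lt_iff hr, Fin.forall_fin_succ]
    refine ⟨?_, fun i => hy.2 i⟩
    rw [hxa]
    exact lt_of_le_of_lt hy.1 (hrk k).2
  have hSm : ∀ k, MeasurableSet (S k) := fun k => by
    have : S k = (fun y : Cn (n+1) => y 0) ⁻¹' Metric.closedBall a (r / (k + 2)) ∩ ⋂ i : Fin n, (fun y : Cn (n+1) => y i.succ) ⁻¹' Metric.ball (x i.succ) r := by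
      ext y; simp [hS]
    rw [this]
    exact ((Metric.isClosed_closedBall.preimage (continuous_apply _)).measurableSet).inter (MeasurableSet.iInter fun i => (Metric.isOpen_ball.preimage (by fun_prop : Continuous fun y : Cn (n+1) => y i.succ)).measurableSet)
  set V := ∏ i : Fin n, volume (Metric.ball (x i.succ) r) with hV
  have hV0 : V ≠ 0 := Finset.prod_ne_zero_iff.2 fun i _ => (Metric.measure_ball_pos volume _ hr).ne'
  have hVt : V ≠ ⊤ := ENNReal.prod_ne_top fun i _ => measure_ball_lt_top.ne
  have hvol : ∀ k, volume (S k) = ENNReal.ofReal ((r / (k+2))^2 * Real.pi) * V := fun k => by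
    simp only [hS]
    rw [vol_box, Complex.volume_closedBall, ← ENNReal.ofReal_pow (hrk k).1.le, ENNReal.ofReal_mul (by positivity)]
    congr 2
    rw [← ENNReal.ofReal_coe_nnreal]; rfl
  have hfin' : ∫⁻ y in Metric.ball x r, ENNReal.ofReal (W y / ‖y 0 - a‖^2) * ‖v y‖ₑ^2 ≠ ⊤ :=
    ne_top_of_le_ne_top hfin (lintegral_mono_set fun y hy => (hball y hy).1)
  have ht0 : Tendsto (fun k => volume (S k)) atTop (𝓝 0) := by
    simp_rw [hvol]
    have h1 : Tendsto (fun k : ℕ => r / ((k:ℝ) + 2)) atTop (𝓝 0) := 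
      tendsto_const_nhds.div_atTop (tendsto_atTop_add_const_right _ _ tendsto_natCast_atTop_atTop)
    have h2 : Tendsto (fun k : ℕ => ENNReal.ofReal ((r / ((k:ℝ) + 2))^2 * Real.pi)) atTop (𝓝 0) := by
      have := ENNReal.tendsto_ofReal ((h1.pow 2).mul_const Real.pi)
      simpa using this
    have := ENNReal.Tendsto.mul_const h2 (Or.inr hVt)
    simpa using this
  have hz := tendsto_setLIntegral_zero (μ := volume.restrict (Metric.ball x r)) hfin' (s := S) (l := atTop) (by
    refine tendsto_of_tendsto_of_tendsto_of_le_of_le tendsto_const_nhds ht0 (fun _ => zero_le) fun k => ?_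
    exact Measure.restrict_apply_le _ _)
  have hlow : ∀ k, ENNReal.ofReal (c0 * Real.pi) * V ≤ ∫⁻ y in S k, ENNReal.ofReal (W y / ‖y 0 - a‖^2) * ‖v y‖ₑ^2 ∂(volume.restrict (Metric.ball x r)) := fun k => by
    rw [Measure.restrict_restrict (hSm k), inter_eq_left.2 (hSb k)]
    have hz0 : volume {y : Cn (n+1) | y 0 = a} = 0 := by
      exact Measure.pi_hyperplane (fun _ : Fin (n+1) => (volume : Measure ℂ)) 0 a
    calc ENNReal.ofReal (c0 * Real.pi) * V = ENNReal.ofReal (c0 / (r / (k+2))^2) * volume (S k) := by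
          rw [hvol, ← mul_assoc, ← ENNReal.ofReal_mul (by positivity)]
          congr 2
          have := (hrk k).1
          field_simp
      _ = ∫⁻ y in S k, ENNReal.ofReal (c0 / (r / (k+2))^2) := by rw [setLIntegral_const]
      _ ≤ _ := by
          refine lintegral_mono_ae ((ae_restrict_iff' (hSm k)).2 ?_)
          have : ∀ᵐ y : Cn (n+1), y 0 ≠ a := by rw [ae_iff]; simpa using hz0
          filter_upwards [this] with y hya hyS
          have hyq := (hball y (hSb k hyS)).2
          have hyD := (hball y (hSb k hyS)).1
          have hya' : 0 < ‖y 0 - a‖ := norm_pos_iff.2 (sub_ne_zero.2 hya)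
          rw [← ofReal_norm_eq_enorm, ← ENNReal.ofReal_pow (norm_nonneg _), ← ENNReal.ofReal_mul (by have := hW0 y hyD; positivity)]
          refine ENNReal.ofReal_le_ofReal ?_
          have h1 : ‖y 0 - a‖ ≤ r / (k+2) := by have := hyS.1; rwa [Metric.mem_closedBall, dist_eq_norm] at this
          calc c0 / (r / (k+2))^2 ≤ c0 / ‖y 0 - a‖^2 := div_le_div_of_nonneg_left hc0p.le (by positivity) (pow_le_pow_left₀ hya'.le h1 2)
            _ ≤ q y / ‖y 0 - a‖^2 := div_le_div_of_nonneg_right hyq.le (by positivity)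
            _ = _ := by simp only [hq]; ring
  have := ge_of_tendsto' hz hlow
  have h3 : ENNReal.ofReal (c0 * Real.pi) * V = 0 := le_antisymm this zero_le
  rcases mul_eq_zero.1 h3 with h | h
  · rw [ENNReal.ofReal_eq_zero] at h
    have : 0 < c0 * Real.pi := by positivity
    linarith
  · exact hV0 h
end

end BP

namespace BP
open Filter Topology
set_option linter.all false
open scoped ContDiff ComplexConjugate
variable {N : ℕ}

section
variable {n : ℕ}

lemma dz_coord (a : ℂ) (j : Fin (n+1)) (x : Cn (n+1)) : dz j (fun y : Cn (n+1) => y 0 - a) x = if j = 0 then 1 else 0 := by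
  have := dsum_coord (0 : Fin (n+1)) a x (Pi.single j 1)
  simp only [dsum] at this
  rw [Finset.sum_eq_single j] at this
  · rw [Pi.single_eq_same, mul_one] at this
    rw [this, Pi.single_apply]
    simp only [eq_comm]
  · intro k _ hk
    rw [Pi.single_eq_of_ne hk, mul_zero]
  · simp

lemma db_t (a : ℂ) (j : Fin (n+1)) (x : Cn (n+1)) : db j (fun y : Cn (n+1) => ((‖y 0 - a‖^2 : ℝ) : ℂ)) x = if j = 0 then x 0 - a else 0 := by
  have e : (fun y : Cn (n+1) => ((‖y 0 - a‖^2 : ℝ) : ℂ)) = fun y => (y 0 - a) * conj (y 0 - a) := by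
    funext y; rw [Complex.mul_conj, Complex.normSq_eq_norm_sq]
  have hd : Differentiable ℂ (fun y : Cn (n+1) => y 0 - a) := by fun_prop
  have hd' : DifferentiableAt ℝ (fun y : Cn (n+1) => y 0 - a) x := by fun_prop
  rw [e, db_mul (f := fun y : Cn (n+1) => y 0 - a) (g := fun y => conj (y 0 - a)) hd' (Complex.conjCLE.differentiableAt.comp x hd'), db_of_hol (hd x),
    db_conj (f := fun y : Cn (n+1) => y 0 - a), dz_coord]
  split_ifs <;> simp

/-- cutoff -/
def et (a : ℂ) (δ : ℝ) (y : Cn (n+1)) : ℝ := Real.smoothTransition (2 - 2 * ‖y 0 - a‖^2 / δ)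

lemma cd_et (a : ℂ) (δ : ℝ) : ContDiff ℝ ∞ (et a δ : Cn (n+1) → ℝ) := by
  unfold et
  refine (Real.smoothTransition.contDiff (n := ⊤)).of_le (by norm_cast) |>.comp ?_
  have : ContDiff ℝ ∞ (fun y : Cn (n+1) => y 0 - a) := by fun_prop
  exact contDiff_const.sub (((contDiff_const).mul (this.norm_sq ℝ)).div_const _)

lemma et_nonneg (a : ℂ) (δ : ℝ) (y : Cn (n+1)) : 0 ≤ et a δ y := Real.smoothTransition.nonneg _
lemma et_le (a : ℂ) (δ : ℝ) (y : Cn (n+1)) : et a δ y ≤ 1 := Real.smoothTransition.le_one _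
lemma et_zero {a : ℂ} {δ : ℝ} (hδ : 0 < δ) {y : Cn (n+1)} (h : δ ≤ ‖y 0 - a‖^2) : et a δ y = 0 := by
  refine Real.smoothTransition.zero_of_nonpos ?_
  rw [mul_div_assoc]
  have := (one_le_div hδ).2 h
  linarith
lemma et_one {a : ℂ} {δ : ℝ} {y : Cn (n+1)} (h : y 0 = a) : et a δ y = 1 := by
  refine Real.smoothTransition.one_of_one_le ?_
  simp [h]

lemma db_et {K : ℝ} (hK0 : 0 < K) (hK : ∀ y, |deriv Real.smoothTransition y| ≤ K) (a : ℂ) {δ : ℝ} (hδ : 0 < δ) (x : Cn (n+1)) :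
    (∀ j, j ≠ 0 → db j (fun y => (et a δ y : ℂ)) x = 0) ∧ ‖db 0 (fun y => (et a δ y : ℂ)) x‖ ≤ 2 * K / δ * ‖x 0 - a‖ := by
  have hdt : DifferentiableAt ℝ (fun y : Cn (n+1) => ‖y 0 - a‖^2) x := by
    have : ContDiff ℝ ∞ (fun y : Cn (n+1) => y 0 - a) := by fun_prop
    exact ((this.norm_sq ℝ).differentiable (by simp)) x
  have hH : HasDerivAt (fun t : ℝ => Real.smoothTransition (2 - 2 * t / δ)) (deriv Real.smoothTransition (2 - 2 * ‖x 0 - a‖^2 / δ) * (-(2 / δ))) (‖x 0 - a‖^2) := by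
    have h1 : HasDerivAt Real.smoothTransition _ (2 - 2 * ‖x 0 - a‖^2 / δ) := ((Real.smoothTransition.contDiff (n := ⊤)).differentiable (by simp) _).hasDerivAt
    have h2 : HasDerivAt (fun t : ℝ => 2 - 2 * t / δ) (-(2 / δ)) (‖x 0 - a‖^2) := by
      have := (((hasDerivAt_id (‖x 0 - a‖^2)).const_mul 2).div_const δ).const_sub 2
      simpa using this
    exact HasDerivAt.comp (h₂ := Real.smoothTransition) (h := fun t : ℝ => 2 - 2 * t / δ) (‖x 0 - a‖^2) h1 h2
  have key : ∀ j, db j (fun y : Cn (n+1) => (et a δ y : ℂ)) x = ((deriv Real.smoothTransition (2 - 2 * ‖x 0 - a‖^2 / δ) * (-(2 / δ)) : ℝ) : ℂ) * (if j = 0 then x 0 - a else 0) := fun j => by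
    have h := dz_comp_real hdt hH j
    have e1 : (fun y : Cn (n+1) => (et a δ y : ℂ)) = fun y => conj (et a δ y : ℂ) := by funext y; rw [Complex.conj_ofReal]
    rw [e1, db_conj]
    change conj (dz j (fun y : Cn (n+1) => ((Real.smoothTransition (2 - 2 * ‖y 0 - a‖^2 / δ) : ℝ) : ℂ)) x) = _
    rw [h, map_mul, Complex.conj_ofReal, ← db_conj]
    congr 1
    simp_rw [Complex.conj_ofReal]
    exact db_t a j x
  constructor
  · intro j hj; rw [key, if_neg hj, mul_zero]
  · rw [key, if_pos rfl, norm_mul, Complex.norm_real, Real.norm_eq_abs, abs_mul, abs_neg, abs_of_pos (by positivity : 0 < 2 / δ)]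
    gcongr
    calc _ ≤ K * (2 / δ) := by gcongr; exact hK _
      _ = _ := by ring

lemma F_facts {K : ℝ} (hK0 : 0 < K) (hK : ∀ y, |deriv Real.smoothTransition y| ≤ K) (a : ℂ) {δ : ℝ} (hδ : 0 < δ) {W : Set (Cn n)} (hW : IsOpen W) 
    {f : Cn n → ℂ} (hf : DifferentiableOn ℂ f W) {x : Cn (n+1)} (hx : ‖x 0 - a‖^2 ≤ δ → tl x ∈ W) :
    ContDiffAt ℝ ∞ (fun y => (et a δ y : ℂ) * f (tl y)) x ∧ (∀ j, j ≠ 0 → db j (fun y => (et a δ y : ℂ) * f (tl y)) x = 0) ∧ 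
    ‖db 0 (fun y => (et a δ y : ℂ) * f (tl y)) x‖ ≤ if ‖x 0 - a‖^2 ≤ δ then 2 * K / δ * ‖x 0 - a‖ * ‖f (tl x)‖ else 0 := by
  by_cases h : ‖x 0 - a‖^2 ≤ δ
  · have hxW := hx h
    have hfx : DifferentiableAt ℂ (fun y : Cn (n+1) => f (tl y)) x := (hf.differentiableAt (hW.mem_nhds hxW)).comp x (diff_tl x)
    have hfc : ContDiffAt ℝ ∞ (fun y : Cn (n+1) => f (tl y)) x := by
      have : DifferentiableOn ℂ (fun y : Cn (n+1) => f (tl y)) (tl ⁻¹' W) := hf.comp diff_tl.differentiableOn (fun y hy => hy)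
      exact (hol_smooth (hW.preimage cont_tl) this).contDiffAt ((hW.preimage cont_tl).mem_nhds hxW)
    have hec : ContDiff ℝ ∞ (fun y : Cn (n+1) => (et a δ y : ℂ)) := Complex.ofRealCLM.contDiff.comp (cd_et a δ)
    have hm : ∀ j, db j (fun y => (et a δ y : ℂ) * f (tl y)) x = db j (fun y => (et a δ y : ℂ)) x * f (tl x) := fun j => by
      rw [db_mul (f := fun y => (et a δ y : ℂ)) (hec.differentiable (by simp) x) (hfc.differentiableAt (by simp)), db_of_hol hfx, mul_zero, add_zero]
    refine ⟨hec.contDiffAt.mul hfc, fun j hj => by rw [hm, (db_et hK0 hK a hδ x).1 j hj, zero_mul], ?_⟩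
    rw [hm, if_pos h, norm_mul]
    gcongr
    exact (db_et hK0 hK a hδ x).2
  · have hev : (fun y => (et a δ y : ℂ) * f (tl y)) =ᶠ[𝓝 x] fun _ => 0 := by
      have : ∀ᶠ y : Cn (n+1) in 𝓝 x, δ < ‖y 0 - a‖^2 := 
        ((by fun_prop : Continuous fun y : Cn (n+1) => ‖y 0 - a‖^2).continuousAt).eventually_const_lt (not_le.1 h)
      filter_upwards [this] with y hy
      rw [et_zero hδ hy.le]; simp
    have hz : ∀ j, db j (fun y => (et a δ y : ℂ) * f (tl y)) x = 0 := fun j => by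
      rw [db_congr hev]; exact db_of_hol (differentiableAt_const _) j
    refine ⟨contDiffAt_const.congr_of_eventuallyEq hev, fun j _ => hz j, ?_⟩
    rw [hz, if_neg h]; simp

lemma shrink {O K : Set (Cn (n+1))} (hO : IsOpen O) (hKO : K ⊆ O) (hK : IsCompact K) {φ : Cn (n+1) → ℝ} (hφ : ContinuousOn φ O) (a : ℂ) :
    ∃ δ, 0 < δ ∧ δ ≤ 1 ∧ ∀ x ∈ K, ‖x 0 - a‖^2 ≤ δ → cn a (tl x) ∈ O ∧ φ (cn a (tl x)) < φ x + Real.log 2 := by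
  have hl : 0 < Real.log 2 := Real.log_pos (by norm_num)
  set q : Cn (n+1) → Cn (n+1) := fun x => cn a (tl x) with hq
  have hqc : Continuous q := (cont_cn a).comp cont_tl
  set A : Set (Cn (n+1)) := O ∩ q ⁻¹' O with hA
  have hAo : IsOpen A := hO.inter (hO.preimage hqc)
  have hc : ContinuousOn (fun x => φ x + Real.log 2 - φ (q x)) A := 
    ((hφ.mono inter_subset_left).add continuousOn_const).sub (hφ.comp hqc.continuousOn (fun x hx => hx.2))
  set G := A ∩ (fun x => φ x + Real.log 2 - φ (q x)) ⁻¹' Ioi 0 with hG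
  have hGo : IsOpen G := hc.isOpen_inter_preimage hAo isOpen_Ioi
  have hKG : IsCompact (K \ G) := hK.diff hGo
  by_cases hne : (K \ G).Nonempty
  · obtain ⟨x0, hx0, hmin⟩ := hKG.exists_isMinOn hne (by fun_prop : Continuous fun x : Cn (n+1) => ‖x 0 - a‖^2).continuousOn
    have hp : 0 < ‖x0 0 - a‖^2 := by
      by_contra hc0
      have h0 : x0 0 = a := by
        have : ‖x0 0 - a‖^2 = 0 := le_antisymm (not_lt.1 hc0) (by positivity)
        simpa [sub_eq_zero] using this
      have hqx : q x0 = x0 := by simp only [hq]; rw [← h0]; exact cn_tl x0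
      exact hx0.2 ⟨⟨hKO hx0.1, by change q x0 ∈ O; rw [hqx]; exact hKO hx0.1⟩, by change 0 < φ x0 + Real.log 2 - φ (q x0); rw [hqx]; linarith⟩
    refine ⟨min 1 (‖x0 0 - a‖^2 / 2), by positivity, min_le_left _ _, fun x hx hxd => ?_⟩
    have hxG : x ∈ G := by
      by_contra hn
      have h1 : ‖x0 0 - a‖^2 ≤ ‖x 0 - a‖^2 := hmin ⟨hx, hn⟩
      have h2 := hxd.trans (min_le_right _ _)
      linarith
    have h3 : 0 < φ x + Real.log 2 - φ (q x) := hxG.2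
    exact ⟨hxG.1.2, by simp only [hq] at h3; linarith⟩
  · refine ⟨1, one_pos, le_rfl, fun x hx _ => ?_⟩
    have hxG : x ∈ G := by
      by_contra hn; exact hne ⟨x, hx, hn⟩
    have h3 : 0 < φ x + Real.log 2 - φ (q x) := hxG.2
    exact ⟨hxG.1.2, by simp only [hq] at h3; linarith⟩

end
end BP

namespace BP
open Filter Topology
set_option linter.all false
open scoped ContDiff ComplexConjugate
variable {N : ℕ}

section
variable {n : ℕ}

lemma logsq {κ R2 s t : ℝ} (hR : Real.exp κ = R2) (hs : 0 < s) (hts : t ≤ s) (hL : 0 ≤ κ - Real.log s) : (κ - Real.log s)^2 * t ≤ 4 * R2 := by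
  have hR0 : 0 < R2 := hR ▸ Real.exp_pos κ
  have hκ : κ = Real.log R2 := by rw [← hR, Real.log_exp]
  have e : κ - Real.log s = 2 * Real.log (√(R2 / s)) := by
    rw [Real.log_sqrt (by positivity), Real.log_div hR0.ne' hs.ne', hκ]; ring
  have h1 : Real.log (√(R2/s)) ≤ √(R2/s) := (Real.log_le_sub_one_of_pos (by positivity)).trans (by linarith)
  have h2 : κ - Real.log s ≤ 2 * √(R2/s) := by rw [e]; linarith
  calc (κ - Real.log s)^2 * t ≤ (κ - Real.log s)^2 * s := by gcongr
    _ ≤ (2 * √(R2/s))^2 * s := by gcongr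
    _ = 4 * R2 := by rw [mul_pow, Real.sq_sqrt (by positivity)]; field_simp; norm_num

lemma slab {O D : Set (Cn (n+1))} (hO : IsOpen O) (hD : IsOpen D) {φ : Cn (n+1) → ℝ} (hφ : ContinuousOn φ O) (a : ℂ) {δ : ℝ} (hδ : 0 < δ)
    (hs : ∀ x ∈ D, ‖x 0 - a‖^2 ≤ δ → cn a (tl x) ∈ O ∧ φ (cn a (tl x)) < φ x + Real.log 2) {f : Cn n → ℂ} (hf : ContinuousOn f {z | cn a z ∈ O}) :
    ∫⁻ x in D, (if ‖x 0 - a‖^2 ≤ δ then ENNReal.ofReal (Real.exp (-φ x)) * ‖f (tl x)‖ₑ^2 else 0) ≤ 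
      ENNReal.ofReal (2 * Real.pi * δ) * ∫⁻ z in {z | cn a z ∈ O}, ENNReal.ofReal (Real.exp (-φ (cn a z))) * ‖f z‖ₑ^2 := by
  set W := {z : Cn n | cn a z ∈ O} with hW
  have hWo : IsOpen W := hO.preimage (cont_cn a)
  set H : Cn n → ℝ≥0∞ := fun z => ENNReal.ofReal (Real.exp (-φ (cn a z))) * ‖f z‖ₑ^2 with hH
  have hHm : AEMeasurable (W.indicator H) := by
    rw [aemeasurable_indicator_iff hWo.measurableSet]
    have h1 : ContinuousOn (fun z : Cn n => Real.exp (-φ (cn a z))) W := (hφ.comp (cont_cn a).continuousOn (fun z hz => hz)).neg.rexp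
    exact ((h1.aemeasurable hWo.measurableSet).ennreal_ofReal).mul (((hf.aemeasurable hWo.measurableSet).enorm).pow_const 2)
  have hB : MeasurableSet (Metric.closedBall a (√δ)) := Metric.isClosed_closedBall.measurableSet
  calc _ ≤ ∫⁻ x in D, (Metric.closedBall a (√δ)).indicator (fun _ => (2 : ℝ≥0∞)) (x 0) * W.indicator H (tl x) := by
        refine setLIntegral_mono' hD.measurableSet fun x hx => ?_
        split_ifs with h
        · obtain ⟨h1, h2⟩ := hs x hx h
          have hxW : tl x ∈ W := h1
          have hxB : x 0 ∈ Metric.closedBall a (√δ) := by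
            rw [Metric.mem_closedBall, dist_eq_norm]; exact Real.le_sqrt_of_sq_le h
          rw [indicator_of_mem hxB, indicator_of_mem hxW]
          simp only [hH]
          rw [← mul_assoc]
          gcongr
          rw [show (2:ℝ≥0∞) = ENNReal.ofReal 2 by simp, ← ENNReal.ofReal_mul (by norm_num)]
          refine ENNReal.ofReal_le_ofReal ?_
          calc Real.exp (-φ x) ≤ Real.exp (Real.log 2 + -φ (cn a (tl x))) := Real.exp_le_exp.2 (by linarith)
            _ = _ := by rw [Real.exp_add, Real.exp_log (by norm_num)]
        · exact zero_le
    _ ≤ ∫⁻ x : Cn (n+1), (Metric.closedBall a (√δ)).indicator (fun _ => (2 : ℝ≥0∞)) (x 0) * W.indicator H (tl x) := setLIntegral_le_lintegral _ _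
    _ = _ := by
        rw [lint_mul_cn ((measurable_const.indicator hB).aemeasurable) hHm, lintegral_indicator hB, lintegral_indicator hWo.measurableSet, setLIntegral_const, 
          Complex.volume_closedBall, ← ENNReal.ofReal_pow (Real.sqrt_nonneg _), Real.sq_sqrt hδ.le]
        congr 1
        rw [show (2:ℝ≥0∞) = ENNReal.ofReal 2 by simp, show (NNReal.pi : ℝ≥0∞) = ENNReal.ofReal Real.pi by rw [← ENNReal.ofReal_coe_nnreal]; rfl, ← ENNReal.ofReal_mul (by positivity), ← ENNReal.ofReal_mul (by positivity)]
        congr 1; ring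

/-- the constant -/
def Cg (R0 K : ℝ) : ℝ := 4 * Real.pi + 272 * (Real.exp 1 * (R0^2+1)) * (32 * Real.exp 1 * Real.pi * K^2)

lemma alg_g {K δ s d N : ℝ} (hK : 0 < K) (hδ : 0 < δ) (hs0 : 0 ≤ s) (hs : s^2 ≤ δ) (hN : 0 ≤ N) (hd0 : 0 ≤ d) (hd : d ≤ 2 * K / δ * s * N) : 
    d^2 * ((s^2+δ)^2/δ) * Real.exp 1 ≤ s^2 * (16 * Real.exp 1 * K^2 / δ * N^2) := by
  have h1 : (s^2+δ)^2/δ ≤ 4 * δ := by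
    rw [div_le_iff₀ hδ]; nlinarith [sq_nonneg s]
  calc d^2 * ((s^2+δ)^2/δ) * Real.exp 1 ≤ (2 * K / δ * s * N)^2 * (4 * δ) * Real.exp 1 := by gcongr
    _ = _ := by field_simp; ring

lemma ot2_good {R0 K : ℝ} (hK0 : 0 < K) (hKd : ∀ y, |deriv Real.smoothTransition y| ≤ K) {O : Set (Cn (n+1))} (hO : IsOpen O) {ψ φ : Cn (n+1) → ℝ} (hψ : ContDiffOn ℝ ∞ ψ O) (hφ : ContDiffOn ℝ ∞ φ O)
    (hψl : ∀ x ∈ O, ∀ b, 0 ≤ levi ψ x b) (hφl : ∀ x ∈ O, ∀ b, 0 ≤ levi φ x b) {c : ℝ} (hK : IsCompact {x | x ∈ O ∧ ψ x ≤ c})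
    {D : Set (Cn (n+1))} (hDd : D = {x | x ∈ O ∧ ψ x < c}) (a : ℂ) (hR : ∀ x ∈ D, ‖x 0 - a‖ ≤ R0) {f : Cn n → ℂ} (hf : DifferentiableOn ℂ f {z | cn a z ∈ O})
    (hI : ∫⁻ z in {z | cn a z ∈ O}, ENNReal.ofReal (Real.exp (-φ (cn a z))) * ‖f z‖ₑ^2 ≠ ⊤) :
    ∃ U : Cn (n+1) → ℂ, DifferentiableOn ℂ U D ∧ (∀ z, cn a z ∈ D → U (cn a z) = f z) ∧ 
      ∫⁻ x in D, ENNReal.ofReal (Real.exp (-φ x)) * ‖U x‖ₑ^2 ≤ ENNReal.ofReal (Cg R0 K) * ∫⁻ z in {z | cn a z ∈ O}, ENNReal.ofReal (Real.exp (-φ (cn a z))) * ‖f z‖ₑ^2 := by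
  have hDo : IsOpen D := by
    have : D = O ∩ ψ ⁻¹' Iio c := by rw [hDd]; rfl
    rw [this]; exact hψ.continuousOn.isOpen_inter_preimage hO isOpen_Iio
  have hDO : D ⊆ O := by rw [hDd]; exact fun x hx => hx.1
  have hDK : D ⊆ {x | x ∈ O ∧ ψ x ≤ c} := by rw [hDd]; exact fun x hx => ⟨hx.1, hx.2.le⟩
  have hWo : IsOpen {z : Cn n | cn a z ∈ O} := hO.preimage (cont_cn a)
  set I := ∫⁻ z in {z | cn a z ∈ O}, ENNReal.ofReal (Real.exp (-φ (cn a z))) * ‖f z‖ₑ^2 with hIdef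
  obtain ⟨δ, hδ, hδ1, hsh⟩ := shrink hO (fun x hx => hx.1) hK hφ.continuousOn a
  have hsD : ∀ x ∈ D, ‖x 0 - a‖^2 ≤ δ → cn a (tl x) ∈ O ∧ φ (cn a (tl x)) < φ x + Real.log 2 := fun x hx => hsh x (hDK hx)
  have hslab := slab hO hDo hφ.continuousOn a hδ hsD hf.continuousOn
  have FF : ∀ x ∈ D, _ := fun x hx => F_facts hK0 hKd a hδ hWo hf (x := x) (fun h => (hsD x hx h).1)
  set F : Cn (n+1) → ℂ := fun y => (et a δ y : ℂ) * f (tl y) with hF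
  set κ : ℝ := 1 + Real.log (R0^2+1) with hκ
  have hκe : Real.exp κ = Real.exp 1 * (R0^2+1) := by rw [hκ, Real.exp_add, Real.exp_log (by positivity)]
  have hL : ∀ x ∈ D, 1 ≤ κ - Real.log (‖x 0 - a‖^2+δ) := fun x hx => by
    have h1 : ‖x 0 - a‖^2 + δ ≤ R0^2+1 := by
      have := pow_le_pow_left₀ (norm_nonneg _) (hR x hx) 2
      linarith
    have := Real.log_le_log (by positivity) h1
    rw [hκ]; linarith
  set g : Cn (n+1) → ℝ := fun x => if ‖x 0 - a‖^2 ≤ δ then 16 * Real.exp 1 * K^2 / δ * ‖f (tl x)‖^2 else 0 with hg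
  set B : ℝ := 32 * Real.exp 1 * Real.pi * K^2 with hB
  have hBp : 0 < B := by rw [hB]; positivity
  have hIr : I = ENNReal.ofReal I.toReal := (ENNReal.ofReal_toReal hI).symm
  have hslab2 := hslab
  rw [← hIdef, hIr] at hslab2
  have hgi : ∫⁻ x in D, ENNReal.ofReal (g x * Real.exp (-φ x)) ≤ ENNReal.ofReal (B * I.toReal) := by
    have e1 : ∀ x, ENNReal.ofReal (g x * Real.exp (-φ x)) = ENNReal.ofReal (16 * Real.exp 1 * K^2 / δ) * (if ‖x 0 - a‖^2 ≤ δ then ENNReal.ofReal (Real.exp (-φ x)) * ‖f (tl x)‖ₑ^2 else 0) := fun x => by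
      simp only [hg]
      split_ifs with h
      · rw [← ofReal_norm_eq_enorm, ← ENNReal.ofReal_pow (norm_nonneg _), ← ENNReal.ofReal_mul (by positivity), ← ENNReal.ofReal_mul (by positivity)]
        congr 1; ring
      · simp
    simp_rw [e1]
    rw [lintegral_const_mul' _ _ ENNReal.ofReal_ne_top]
    refine (mul_le_mul' le_rfl hslab2).trans ?_
    rw [← mul_assoc, ← ENNReal.ofReal_mul (by positivity), ← ENNReal.ofReal_mul (by positivity)]
    refine ENNReal.ofReal_le_ofReal (le_of_eq ?_)
    rw [hB]; field_simp; ring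
  have hg0 : ∀ x ∈ D, 0 ≤ g x := fun x hx => by simp only [hg]; split_ifs <;> positivity
  have hFg : ∀ x ∈ D, ‖db 0 F x‖^2 * ((‖x 0 - a‖^2 + δ)^2 / δ) * Real.exp 1 ≤ ‖x 0 - a‖^2 * g x := fun x hx => by
    have h := (FF x hx).2.2
    simp only [hg]
    split_ifs at h ⊢ with hc
    · exact alg_g hK0 hδ (norm_nonneg _) hc (norm_nonneg _) (norm_nonneg _) h
    · have h0 : ‖db 0 F x‖ = 0 := le_antisymm h (norm_nonneg _)
      rw [h0]; simp
  have hFs : ContDiffOn ℝ ∞ F D := fun x hx => (FF x hx).1.contDiffWithinAt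
  obtain ⟨U, hU, hUi⟩ := solve2 hO hψ hφ hψl hφl hK hDd 0 a hδ hL hFs (fun x hx j hj => (FF x hx).2.1 j hj) hg0 hFg (by positivity) hgi
  have hLc : ContinuousOn (fun x : Cn (n+1) => κ - Real.log (‖x 0 - a‖^2+δ)) D := by
    refine continuousOn_const.sub (ContinuousOn.log (by fun_prop) fun x _ => ?_)
    have : 0 < ‖x 0 - a‖^2+δ := by positivity
    exact this.ne'
  have hφc : ContinuousOn (fun x => Real.exp (-φ x)) D := (hφ.continuousOn.mono hDO).neg.rexp
  refine ⟨U, hU, fun z hz => ?_, ?_⟩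
  · have hWc : ContinuousOn (fun x : Cn (n+1) => Real.exp (-φ x) / (34 * (κ - Real.log (‖x 0 - a‖^2+δ))^2)) D := by
      refine hφc.div (continuousOn_const.mul (hLc.pow 2)) fun x hx => ?_
      have := hL x hx
      have h0 : 0 < κ - Real.log (‖x 0 - a‖^2+δ) := by linarith
      change 34 * (κ - Real.log (‖x 0 - a‖^2+δ))^2 ≠ 0
      positivity
    have hv := vanish hDo (hFs.continuousOn.sub hU.continuousOn) hWc (fun x hx => by
      have := hL x hx
      have h0 : 0 < κ - Real.log (‖x 0 - a‖^2+δ) := by linarith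
      positivity) a (by
        refine ne_top_of_le_ne_top ENNReal.ofReal_ne_top (le_trans (le_of_eq ?_) hUi)
        simp_rw [div_div]
        rfl) hz (cn_zero a z)
    have h2 : F (cn a z) - U (cn a z) = 0 := hv
    have h3 : F (cn a z) = f z := by
      simp only [hF]; rw [et_one (cn_zero a z), tl_cn]; simp
    rw [← h3]; exact (sub_eq_zero.1 h2).symm
  · have hz0 : ∀ᵐ y : Cn (n+1), y 0 ≠ a := by
      have : volume {y : Cn (n+1) | y 0 = a} = 0 := Measure.pi_hyperplane (fun _ : Fin (n+1) => (volume : Measure ℂ)) 0 a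
      rw [ae_iff]; simpa using this
    set R2 := Real.exp 1 * (R0^2+1) with hR2
    have hR2p : 0 < R2 := by positivity
    set A1 : Cn (n+1) → ℝ≥0∞ := fun x => if ‖x 0 - a‖^2 ≤ δ then ENNReal.ofReal (Real.exp (-φ x)) * ‖f (tl x)‖ₑ^2 else 0 with hA1
    set A2 : Cn (n+1) → ℝ≥0∞ := fun x => ENNReal.ofReal (Real.exp (-φ x)/(34*(κ - Real.log (‖x 0 - a‖^2+δ))^2*‖x 0 - a‖^2))*‖F x - U x‖ₑ^2 with hA2
    have hpt : ∀ᵐ x ∂(volume.restrict D), ENNReal.ofReal (Real.exp (-φ x)) * ‖U x‖ₑ^2 ≤ 2 * A1 x + ENNReal.ofReal (272 * R2) * A2 x := by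
      rw [ae_restrict_iff' hDo.measurableSet]
      filter_upwards [hz0] with x hxa hx
      have hp : 0 < ‖x 0 - a‖ := norm_pos_iff.2 (sub_ne_zero.2 hxa)
      have e : U x = F x + (-(F x - U x)) := by ring
      have h1 : ‖U x‖ₑ^2 ≤ 2 * ‖F x‖ₑ^2 + 2 * ‖F x - U x‖ₑ^2 := by
        have := enorm_add_sq (F x) (-(F x - U x))
        rwa [← e, enorm_neg] at this
      refine (mul_le_mul' le_rfl h1).trans ?_
      rw [mul_add]
      refine add_le_add ?_ ?_
      · rw [mul_left_comm]
        refine mul_le_mul' le_rfl ?_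
        simp only [hA1]
        split_ifs with hc
        · refine mul_le_mul' le_rfl ?_
          refine pow_le_pow_left' ?_ 2
          simp only [hF]
          rw [enorm_mul]
          refine mul_le_of_le_one_left zero_le ?_
          rw [← ofReal_norm_eq_enorm, Complex.norm_real, Real.norm_eq_abs, abs_of_nonneg (et_nonneg _ _ _)]
          exact ENNReal.ofReal_le_one.2 (et_le _ _ _)
        · simp only [hF]
          rw [et_zero hδ (not_le.1 hc).le]; simp
      · simp only [hA2]
        rw [← mul_assoc, ← mul_assoc]
        refine mul_le_mul' ?_ le_rfl
        rw [show (2:ℝ≥0∞) = ENNReal.ofReal 2 by simp, ← ENNReal.ofReal_mul (by positivity), ← ENNReal.ofReal_mul (by positivity)]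
        refine ENNReal.ofReal_le_ofReal ?_
        have hl := hL x hx
        have h0 : 0 < κ - Real.log (‖x 0 - a‖^2+δ) := by linarith
        have h2 := logsq hκe (by positivity : 0 < ‖x 0 - a‖^2+δ) (by linarith : ‖x 0 - a‖^2 ≤ ‖x 0 - a‖^2+δ) h0.le
        rw [mul_div_assoc', le_div_iff₀ (by positivity)]
        have h3 := mul_le_mul_of_nonneg_left h2 (Real.exp_pos (-φ x)).le
        nlinarith [h3]
    refine (lintegral_mono_ae hpt).trans ?_
    have hA2m : AEMeasurable (fun x => ENNReal.ofReal (272 * R2) * A2 x) (volume.restrict D) := by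
      refine AEMeasurable.const_mul ?_ _
      refine AEMeasurable.mul (AEMeasurable.ennreal_ofReal ?_) (((hFs.continuousOn.sub hU.continuousOn).aemeasurable hDo.measurableSet).enorm.pow_const 2)
      refine AEMeasurable.div (hφc.aemeasurable hDo.measurableSet) ?_
      exact ContinuousOn.aemeasurable ((continuousOn_const.mul (hLc.pow 2)).mul (by fun_prop)) hDo.measurableSet
    rw [lintegral_add_right' _ hA2m, lintegral_const_mul' _ _ (by simp), lintegral_const_mul' _ _ ENNReal.ofReal_ne_top]
    refine (add_le_add (mul_le_mul' le_rfl hslab2) (mul_le_mul' le_rfl hUi)).trans ?_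
    rw [show (2:ℝ≥0∞) = ENNReal.ofReal 2 by simp, ← ENNReal.ofReal_mul (by positivity), ← ENNReal.ofReal_mul (by positivity), ← ENNReal.ofReal_mul (by positivity),
      ← ENNReal.ofReal_add (by positivity) (by positivity)]
    conv_rhs => rw [hIr]
    rw [← ENNReal.ofReal_mul (by rw [Cg]; positivity)]
    refine ENNReal.ofReal_le_ofReal ?_
    rw [Cg, ← hR2, ← hB, add_mul]
    refine add_le_add ?_ (le_of_eq (by ring))
    have hnn : 0 ≤ I.toReal * Real.pi := by positivity
    nlinarith
end
end BP

namespace BP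
open Filter Topology
set_option linter.all false
open scoped ContDiff ComplexConjugate
variable {N : ℕ}

section
variable {n : ℕ}

lemma young_pt {θ X S : ℝ} (h0 : 0 < θ) (h1 : θ ≤ 1) (hX : 0 ≤ X) (hS : 0 < S) : 
    X^(2*θ) ≤ θ * (Real.exp (-((1-θ) * Real.log S)) * X^2) + (1-θ) * S^θ := by
  set q := Real.exp (-((1-θ) * Real.log S)) with hq
  have hqp : 0 < q := Real.exp_pos _
  have h := Real.geom_mean_le_arith_mean2_weighted h0.le (by linarith : 0 ≤ 1 - θ) (by positivity : 0 ≤ q * X^2) (by positivity : 0 ≤ S^θ) (by ring)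
  refine le_trans (le_of_eq ?_) h
  rw [Real.mul_rpow hqp.le (by positivity), ← Real.rpow_mul hS.le, hq, ← Real.exp_mul, Real.rpow_def_of_pos hS, mul_right_comm, ← Real.exp_add]
  rw [show -((1 - θ) * Real.log S) * θ + Real.log S * (θ * (1-θ)) = 0 by ring, Real.exp_zero, one_mul, Real.rpow_mul hX, Real.rpow_two]

lemma fib_pt {θ X δ : ℝ} (h1 : θ ≤ 1) (hX : 0 ≤ X) (hδ : 0 < δ) : 
    Real.exp (-((1-θ) * Real.log (X^2+δ))) * X^2 ≤ X^(2*θ) := by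
  rcases hX.eq_or_lt with h | h
  · rw [← h]; simp; positivity
  · have h2 : Real.log (X^2) ≤ Real.log (X^2+δ) := Real.log_le_log (by positivity) (by linarith)
    calc _ ≤ Real.exp (-((1-θ) * Real.log (X^2))) * X^2 := by
            gcongr

      _ = Real.exp (-((1-θ) * Real.log (X^2))) * Real.exp (Real.log (X^2)) := by rw [Real.exp_log (by positivity)]
      _ = _ := by
        rw [← Real.exp_add, Real.rpow_def_of_pos h, Real.log_pow]; congr 1; push_cast; ring

lemma enorm_rp (z : ℂ) {p : ℝ} (hp : 0 ≤ p) : ‖z‖ₑ^p = ENNReal.ofReal (‖z‖^p) := by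
  rw [← ofReal_norm_eq_enorm, ENNReal.ofReal_rpow_of_nonneg (norm_nonneg _) hp]

lemma levi_cmul {g : Cn N → ℝ} {x : Cn N} (hg : ContDiffAt ℝ 2 g x) (c : ℝ) (b : Cn N) : levi (fun y => c * g y) x b = c * levi g x b := by
  have := levi_comp (H := fun t => c * t) (H' := fun _ => c) (H2 := 0) hg (Eventually.of_forall fun y => by simpa using (hasDerivAt_id y).const_mul c) (hasDerivAt_const _ _) b
  rw [this]; ring

/-- sublevel set -/
def sub (O : Set (Cn N)) (ψ : Cn N → ℝ) (s : ℝ) : Set (Cn N) := {x | x ∈ O ∧ ψ x < s}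

lemma open_sub {O : Set (Cn N)} (hO : IsOpen O) {ψ : Cn N → ℝ} (hψ : ContinuousOn ψ O) (s : ℝ) : IsOpen (sub O ψ s) := 
  hψ.isOpen_inter_preimage hO isOpen_Iio

lemma cpt_sub {O : Set (Cn N)} {ψ : Cn N → ℝ} (hψ : ContinuousOn ψ O) {c0 s s' : ℝ} (hK : IsCompact {x | x ∈ O ∧ ψ x ≤ c0}) (h1 : s' < s) (h2 : s ≤ c0) : 
    IsCompact {x | x ∈ sub O ψ s ∧ ψ x ≤ s'} := by
  have e : {x | x ∈ sub O ψ s ∧ ψ x ≤ s'} = {x | x ∈ O ∧ ψ x ≤ c0} ∩ ψ ⁻¹' Iic s' := by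
    ext x
    simp only [sub, mem_setOf_eq, mem_inter_iff, mem_preimage, mem_Iic]
    constructor
    · rintro ⟨⟨a, b⟩, c⟩; exact ⟨⟨a, by linarith⟩, c⟩
    · rintro ⟨⟨a, b⟩, c⟩; exact ⟨⟨a, by linarith⟩, c⟩
  rw [e]
  have := (hψ.mono (fun x (hx : x ∈ {x | x ∈ O ∧ ψ x ≤ c0}) => hx.1)).preimage_isClosed_of_isClosed hK.isClosed (isClosed_Iic (a := s'))
  exact hK.of_isClosed_subset this inter_subset_left

lemma e_step {R0 K : ℝ} (hK0 : 0 < K) (hKd : ∀ y, |deriv Real.smoothTransition y| ≤ K) {O : Set (Cn (n+1))} (hO : IsOpen O) {ψ φ : Cn (n+1) → ℝ} (hψ : ContDiffOn ℝ ∞ ψ O) (hφ : ContDiffOn ℝ ∞ φ O)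
    (hψl : ∀ x ∈ O, ∀ b, 0 ≤ levi ψ x b) (hφl : ∀ x ∈ O, ∀ b, 0 ≤ levi φ x b) {c0 : ℝ} (hK : IsCompact {x | x ∈ O ∧ ψ x ≤ c0})
    (a : ℂ) (hR : ∀ x ∈ O, ‖x 0 - a‖ ≤ R0) {f : Cn n → ℂ} (hf : DifferentiableOn ℂ f {z | cn a z ∈ O}) {θ : ℝ} (hθ0 : 0 < θ) (hθ1 : θ ≤ 1)
    (hI : ∫⁻ z in {z | cn a z ∈ O}, ENNReal.ofReal (Real.exp (-φ (cn a z))) * ‖f z‖ₑ^(2*θ) ≠ ⊤) {s s' : ℝ} (hs : s' < s) (hs0 : s ≤ c0)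
    {U : Cn (n+1) → ℂ} (hU : DifferentiableOn ℂ U (sub O ψ s)) (hUf : ∀ z, cn a z ∈ sub O ψ s → U (cn a z) = f z) {δ : ℝ} (hδ : 0 < δ) :
    ∃ U' : Cn (n+1) → ℂ, DifferentiableOn ℂ U' (sub O ψ s') ∧ (∀ z, cn a z ∈ sub O ψ s' → U' (cn a z) = f z) ∧ 
      ∫⁻ x in sub O ψ s', ENNReal.ofReal (Real.exp (-φ x)) * ‖U' x‖ₑ^(2*θ) ≤ 
        ENNReal.ofReal θ * (ENNReal.ofReal (Cg R0 K) * ∫⁻ z in {z | cn a z ∈ O}, ENNReal.ofReal (Real.exp (-φ (cn a z))) * ‖f z‖ₑ^(2*θ)) + 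
        ENNReal.ofReal (1-θ) * ((∫⁻ x in sub O ψ s, ENNReal.ofReal (Real.exp (-φ x)) * ‖U x‖ₑ^(2*θ)) + ENNReal.ofReal (δ^θ) * ∫⁻ x in sub O ψ s, ENNReal.ofReal (Real.exp (-φ x))) := by
  set D := sub O ψ s with hD
  have hDo : IsOpen D := open_sub hO hψ.continuousOn s
  have hDo' : IsOpen (sub O ψ s') := open_sub hO hψ.continuousOn s'
  have hDO : D ⊆ O := fun x hx => hx.1
  have hDD : sub O ψ s' ⊆ D := fun x hx => ⟨hx.1, hx.2.trans hs⟩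
  have hWo : IsOpen {z : Cn n | cn a z ∈ D} := hDo.preimage (cont_cn a)
  set φ' : Cn (n+1) → ℝ := fun x => φ x + (1-θ) * Real.log (‖U x‖^2+δ) with hφ'
  have hS : ∀ x, 0 < ‖U x‖^2+δ := fun x => by positivity
  have hexp : ∀ x, Real.exp (-φ' x) = Real.exp (-φ x) * Real.exp (-((1-θ) * Real.log (‖U x‖^2+δ))) := fun x => by
    rw [← Real.exp_add]; simp only [hφ']; congr 1; ring
  have hφs : ContDiffOn ℝ ∞ φ' D := fun x hx => ((hφ.contDiffAt (hO.mem_nhds (hDO hx))).add (contDiffAt_const.mul (levi_log hDo hU hx 0 hδ).1)).contDiffWithinAt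
  have hφl' : ∀ x ∈ D, ∀ b, 0 ≤ levi φ' x b := fun x hx b => by
    have h1 := levi_log hDo hU hx b hδ
    have h2 : ContDiffAt ℝ 2 (fun y => Real.log (‖U y‖^2+δ)) x := h1.1.of_le (by norm_cast)
    have h3 : ContDiffAt ℝ 2 φ x := (hφ.contDiffAt (hO.mem_nhds (hDO hx))).of_le (by norm_cast)
    simp only [hφ']
    rw [levi_add h3 (contDiffAt_const.mul h2), levi_cmul h2, h1.2.1]
    have := hφl x (hDO hx) b
    have h4 : 0 ≤ 1 - θ := by linarith
    have := hS x
    positivity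
  have hfib : ∫⁻ z in {z | cn a z ∈ D}, ENNReal.ofReal (Real.exp (-φ' (cn a z))) * ‖f z‖ₑ^2 ≤ ∫⁻ z in {z | cn a z ∈ O}, ENNReal.ofReal (Real.exp (-φ (cn a z))) * ‖f z‖ₑ^(2*θ) := by
    refine le_trans ?_ (lintegral_mono_set (fun z (hz : cn a z ∈ D) => hDO hz))
    refine setLIntegral_mono' hWo.measurableSet fun z hz => ?_
    rw [hexp, hUf z hz, ENNReal.ofReal_mul (by positivity), mul_assoc]
    refine mul_le_mul' le_rfl ?_
    rw [enorm_rp _ (by positivity), ← ofReal_norm_eq_enorm, ← ENNReal.ofReal_pow (norm_nonneg _), ← ENNReal.ofReal_mul (by positivity)]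
    exact ENNReal.ofReal_le_ofReal (fib_pt hθ1 (norm_nonneg _) hδ)
  obtain ⟨U', hU', hUf', hUi⟩ := ot2_good hK0 hKd hDo (hψ.mono hDO) hφs (fun x hx => hψl x (hDO hx)) hφl' (cpt_sub hψ.continuousOn hK hs hs0)
    (D := sub O ψ s') (by ext x; exact ⟨fun h => ⟨hDD h, h.2⟩, fun h => ⟨h.1.1, h.2⟩⟩) a (R0 := R0) (fun x hx => hR x hx.1) (hf.mono fun z (hz : cn a z ∈ D) => hDO hz) (ne_top_of_le_ne_top hI hfib)
  refine ⟨U', hU', hUf', ?_⟩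
  have hpt : ∀ x ∈ sub O ψ s', ENNReal.ofReal (Real.exp (-φ x)) * ‖U' x‖ₑ^(2*θ) ≤ ENNReal.ofReal θ * (ENNReal.ofReal (Real.exp (-φ' x)) * ‖U' x‖ₑ^2) + 
      ENNReal.ofReal (1-θ) * (ENNReal.ofReal (Real.exp (-φ x)) * ‖U x‖ₑ^(2*θ) + ENNReal.ofReal (δ^θ) * ENNReal.ofReal (Real.exp (-φ x))) := fun x hx => by
    have h4 : 0 ≤ 1 - θ := by linarith
    have h5 : (‖U x‖^2+δ)^θ ≤ ‖U x‖^(2*θ) + δ^θ := by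
      have := Real.rpow_add_le_add_rpow (by positivity : 0 ≤ ‖U x‖^2) hδ.le hθ0.le hθ1
      rw [Real.rpow_mul (norm_nonneg _), Real.rpow_two]; exact this
    have h6 := young_pt hθ0 hθ1 (norm_nonneg (U' x)) (hS x)
    have he := Real.exp_pos (-φ x)
    have hq := Real.exp_pos (-((1-θ) * Real.log (‖U x‖^2+δ)))
    have hd : 0 ≤ δ^θ := by positivity
    have hu : 0 ≤ ‖U x‖^(2*θ) := by positivity
    rw [enorm_rp _ (by positivity), enorm_rp _ (by positivity), ← ofReal_norm_eq_enorm, ← ENNReal.ofReal_pow (norm_nonneg _), hexp, ← ENNReal.ofReal_mul (by positivity), ← ENNReal.ofReal_mul (by positivity), ← ENNReal.ofReal_mul (by positivity),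
      ← ENNReal.ofReal_mul (by positivity), ← ENNReal.ofReal_mul (by positivity), ← ENNReal.ofReal_add (by positivity) (by positivity), ← ENNReal.ofReal_mul (by positivity), ← ENNReal.ofReal_add (by positivity) (by positivity)]
    refine ENNReal.ofReal_le_ofReal ?_
    calc Real.exp (-φ x) * ‖U' x‖^(2*θ) ≤ Real.exp (-φ x) * (θ * (Real.exp (-((1-θ) * Real.log (‖U x‖^2+δ))) * ‖U' x‖^2) + (1-θ) * (‖U x‖^(2*θ) + δ^θ)) := by
          refine mul_le_mul_of_nonneg_left (h6.trans ?_) he.le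
          have := mul_le_mul_of_nonneg_left h5 h4
          linarith
      _ = _ := by ring
  have hφc : AEMeasurable (fun x => Real.exp (-φ x)) (volume.restrict (sub O ψ s')) := ((hφ.continuousOn.mono (hDD.trans hDO)).neg.rexp).aemeasurable hDo'.measurableSet
  have hm1 : AEMeasurable (fun x => ENNReal.ofReal (1-θ) * (ENNReal.ofReal (Real.exp (-φ x)) * ‖U x‖ₑ^(2*θ) + ENNReal.ofReal (δ^θ) * ENNReal.ofReal (Real.exp (-φ x)))) (volume.restrict (sub O ψ s')) := by
    refine AEMeasurable.const_mul (AEMeasurable.add (hφc.ennreal_ofReal.mul ?_) (hφc.ennreal_ofReal.const_mul _)) _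
    exact ((hU.continuousOn.mono hDD).aemeasurable hDo'.measurableSet).enorm.pow_const _
  refine (setLIntegral_mono' hDo'.measurableSet hpt).trans ?_
  rw [lintegral_add_right' _ hm1, lintegral_const_mul' _ _ ENNReal.ofReal_ne_top, lintegral_const_mul' _ _ ENNReal.ofReal_ne_top, lintegral_add_right' _ (hφc.ennreal_ofReal.const_mul _), lintegral_const_mul' _ _ ENNReal.ofReal_ne_top]
  refine add_le_add (mul_le_mul' le_rfl (hUi.trans (mul_le_mul' le_rfl hfib))) (mul_le_mul' le_rfl (add_le_add (lintegral_mono_set hDD) (mul_le_mul' le_rfl (lintegral_mono_set hDD))))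
end
end BP

namespace BP
open Filter Topology
set_option linter.all false
open scoped ContDiff ComplexConjugate
variable {N : ℕ}

section
variable {n : ℕ}

lemma fin_int {S K : Set (Cn N)} (hK : IsCompact K) (hSK : S ⊆ K) {g : Cn N → ℝ} (hg : ContinuousOn g K) : 
    ∫⁻ x in S, ENNReal.ofReal (g x) ≠ ⊤ := by
  refine ne_top_of_le_ne_top ?_ (lintegral_mono_set hSK)
  have := (hg.integrableOn_compact hK (μ := volume)).2
  refine ne_top_of_le_ne_top (ne_of_lt this) ?_
  refine lintegral_mono fun x => ?_
  rw [← ofReal_norm_eq_enorm]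
  exact ENNReal.ofReal_le_ofReal (le_abs_self _)

lemma zero_case {W : Set (Cn N)} (hW : IsOpen W) {w : Cn N → ℝ} (hw : ContinuousOn w W) (hw0 : ∀ x ∈ W, 0 < w x) {f : Cn N → ℂ} (hf : ContinuousOn f W) {p : ℝ} (hp : 0 < p) 
    (h0 : ∫⁻ z in W, ENNReal.ofReal (w z) * ‖f z‖ₑ^p = 0) : ∀ z ∈ W, f z = 0 := by
  have hmm : AEMeasurable (fun z => ENNReal.ofReal (w z) * ‖f z‖ₑ^p) (volume.restrict W) := (((hw.aemeasurable hW.measurableSet).ennreal_ofReal).mul ((hf.aemeasurable hW.measurableSet).enorm.pow_const _))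
  rw [lintegral_eq_zero_iff' hmm] at h0
  have h1 : f =ᵐ[volume.restrict W] fun _ => 0 := by
    filter_upwards [h0, ae_restrict_mem hW.measurableSet] with z hz hzW
    have : ENNReal.ofReal (w z) * ‖f z‖ₑ^p = 0 := hz
    rcases mul_eq_zero.1 this with h | h
    · exact absurd (ENNReal.ofReal_eq_zero.1 h) (not_le.2 (hw0 z hzW))
    · rcases (ENNReal.rpow_eq_zero_iff.1 h) with h | h
      · simpa using h.1
      · linarith [h.2]
  exact Measure.eqOn_open_of_ae_eq h1 hW hf continuousOn_const

lemma e_good {R0 K : ℝ} (hK0 : 0 < K) (hKd : ∀ y, |deriv Real.smoothTransition y| ≤ K) {O : Set (Cn (n+1))} (hO : IsOpen O) {ψ φ : Cn (n+1) → ℝ} (hψ : ContDiffOn ℝ ∞ ψ O) (hφ : ContDiffOn ℝ ∞ φ O)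
    (hψl : ∀ x ∈ O, ∀ b, 0 ≤ levi ψ x b) (hφl : ∀ x ∈ O, ∀ b, 0 ≤ levi φ x b) {c c0 : ℝ} (hc : c < c0) (hK : IsCompact {x | x ∈ O ∧ ψ x ≤ c0})
    (a : ℂ) (hR : ∀ x ∈ O, ‖x 0 - a‖ ≤ R0) {f : Cn n → ℂ} (hf : DifferentiableOn ℂ f {z | cn a z ∈ O}) {θ : ℝ} (hθ0 : 0 < θ) (hθ1 : θ ≤ 1)
    (hI : ∫⁻ z in {z | cn a z ∈ O}, ENNReal.ofReal (Real.exp (-φ (cn a z))) * ‖f z‖ₑ^(2*θ) ≠ ⊤) :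
    ∃ U' : Cn (n+1) → ℂ, DifferentiableOn ℂ U' (sub O ψ c) ∧ (∀ z, cn a z ∈ sub O ψ c → U' (cn a z) = f z) ∧ 
      ∫⁻ x in sub O ψ c, ENNReal.ofReal (Real.exp (-φ x)) * ‖U' x‖ₑ^(2*θ) ≤ 
        ENNReal.ofReal (3 * Cg R0 K) * ∫⁻ z in {z | cn a z ∈ O}, ENNReal.ofReal (Real.exp (-φ (cn a z))) * ‖f z‖ₑ^(2*θ) := by
  have hψc := hψ.continuousOn
  have hφc := hφ.continuousOn
  have hWo : IsOpen {z : Cn n | cn a z ∈ O} := hO.preimage (cont_cn a)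
  have hφW : ContinuousOn (fun z : Cn n => Real.exp (-φ (cn a z))) {z | cn a z ∈ O} := (hφc.comp (cont_cn a).continuousOn (fun z hz => hz)).neg.rexp
  set I := ∫⁻ z in {z | cn a z ∈ O}, ENNReal.ofReal (Real.exp (-φ (cn a z))) * ‖f z‖ₑ^(2*θ) with hIdef
  by_cases hI0 : I = 0
  · have hf0 := zero_case hWo hφW (fun _ _ => Real.exp_pos _) hf.continuousOn (by positivity : 0 < 2*θ) hI0
    refine ⟨fun _ => 0, differentiableOn_const _, fun z hz => (hf0 z hz.1).symm, ?_⟩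
    have : 0 < 2*θ := by positivity
    simp [ENNReal.zero_rpow_of_pos this]
  have hIr : I = ENNReal.ofReal I.toReal := (ENNReal.ofReal_toReal hI).symm
  have hIp : 0 < I.toReal := ENNReal.toReal_pos hI0 hI
  have hCg : 0 < Cg R0 K := by rw [Cg]; positivity
  set b := Cg R0 K * I.toReal with hb
  have hbp : 0 < b := by positivity
  have hV : ∫⁻ x in sub O ψ c0, ENNReal.ofReal (Real.exp (-φ x)) ≠ ⊤ := 
    fin_int hK (fun x hx => ⟨hx.1, hx.2.le⟩) (hφc.mono fun x hx => hx.1).neg.rexp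
  set V := (∫⁻ x in sub O ψ c0, ENNReal.ofReal (Real.exp (-φ x))).toReal with hVd
  have hV0 : 0 ≤ V := ENNReal.toReal_nonneg
  let P : ℝ → ℝ → Prop := fun s A => ∃ U : Cn (n+1) → ℂ, DifferentiableOn ℂ U (sub O ψ s) ∧ (∀ z, cn a z ∈ sub O ψ s → U (cn a z) = f z) ∧ 
      ∫⁻ x in sub O ψ s, ENNReal.ofReal (Real.exp (-φ x)) * ‖U x‖ₑ^(2*θ) ≤ ENNReal.ofReal A
  have hsm : ∀ {s s'}, s' ≤ s → sub O ψ s' ⊆ sub O ψ s := fun h x hx => ⟨hx.1, hx.2.trans_le h⟩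
  have hstep : ∀ s s' A, 0 ≤ A → s' < s → s ≤ c0 → P s A → P s' (2 * θ * b + (1-θ) * A) := by
    rintro s s' A hA hs hs0 ⟨U, hU, hUf, hUi⟩
    set δ := (θ * b / (V+1))^(1/θ) with hδ
    have hδθ : δ^θ = θ * b / (V+1) := by
      rw [hδ, ← Real.rpow_mul (by positivity), one_div_mul_cancel hθ0.ne', Real.rpow_one]
    obtain ⟨U', hU', hUf', hUi'⟩ := e_step hK0 hKd hO hψ hφ hψl hφl hK a hR hf hθ0 hθ1 hI hs hs0 hU hUf (by positivity : 0 < δ)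
    refine ⟨U', hU', hUf', hUi'.trans ?_⟩
    have h4 : 0 ≤ 1 - θ := by linarith
    have hV2 : ∫⁻ x in sub O ψ s, ENNReal.ofReal (Real.exp (-φ x)) ≤ ENNReal.ofReal V := by
      rw [hVd, ENNReal.ofReal_toReal hV]; exact lintegral_mono_set (hsm hs0)
    rw [← hIdef, hIr, ← ENNReal.ofReal_mul hCg.le]
    refine (add_le_add (le_refl _) (mul_le_mul' le_rfl (add_le_add hUi (mul_le_mul' le_rfl hV2)))).trans ?_
    rw [hδθ, ← ENNReal.ofReal_mul (by positivity), ← ENNReal.ofReal_mul (by positivity), ← ENNReal.ofReal_add (by positivity) (by positivity), ← ENNReal.ofReal_mul (by positivity), ← ENNReal.ofReal_add (by positivity) (by positivity)]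
    refine ENNReal.ofReal_le_ofReal ?_
    rw [← hb]
    have h5 : θ * b / (V+1) * V ≤ θ * b := by
      rw [div_mul_eq_mul_div, div_le_iff₀ (by positivity)]
      nlinarith [mul_pos hθ0 hbp]
    have h6 : (1-θ) * (θ * b / (V+1) * V) ≤ θ * b := by
      have h7 : 0 ≤ θ * b / (V+1) * V := by positivity
      nlinarith
    rw [mul_add]; linarith
  -- initial extension
  obtain ⟨s0, hs01, hs02⟩ := exists_between hc
  obtain ⟨s1, hs11, hs12⟩ := exists_between hs01
  have hDo : IsOpen (sub O ψ c0) := open_sub hO hψc c0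
  have hDO : sub O ψ c0 ⊆ O := fun x hx => hx.1
  have hKf : IsCompact {z : Cn n | cn a z ∈ {x | x ∈ O ∧ ψ x ≤ c0}} := by
    have e : {z : Cn n | cn a z ∈ {x | x ∈ O ∧ ψ x ≤ c0}} = tl '' ({x | x ∈ O ∧ ψ x ≤ c0} ∩ {x | x 0 = a}) := by
      ext z
      simp only [mem_setOf_eq, mem_image, mem_inter_iff]
      constructor
      · intro h; exact ⟨cn a z, ⟨h, cn_zero a z⟩, tl_cn a z⟩
      · rintro ⟨x, ⟨h1, h2⟩, rfl⟩
        rw [← h2, cn_tl]; exact h1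
    rw [e]
    refine (hK.inter_right ?_).image cont_tl
    exact isClosed_eq (continuous_apply _) continuous_const
  have hL2 : ∫⁻ z in {z | cn a z ∈ sub O ψ c0}, ENNReal.ofReal (Real.exp (-φ (cn a z))) * ‖f z‖ₑ^2 ≠ ⊤ := by
    have h := fin_int (S := {z : Cn n | cn a z ∈ sub O ψ c0}) hKf (fun z hz => ⟨hz.1, hz.2.le⟩) (g := fun z => Real.exp (-φ (cn a z)) * ‖f z‖^2) 
      ((hφW.mono fun z hz => hz.1).mul ((hf.continuousOn.mono fun z hz => hz.1).norm.pow 2))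
    convert h using 3 with z
    rw [ENNReal.ofReal_mul (Real.exp_pos _).le, ENNReal.ofReal_pow (norm_nonneg _), ofReal_norm_eq_enorm]
  obtain ⟨U0, hU0, hUf0, -⟩ := ot2_good hK0 hKd hDo (hψ.mono hDO) (hφ.mono hDO) (fun x hx => hψl x (hDO hx)) (fun x hx => hφl x (hDO hx)) (cpt_sub hψc hK hs02 le_rfl)
    (D := sub O ψ s0) (by ext x; exact ⟨fun h => ⟨hsm hs02.le h, h.2⟩, fun h => ⟨h.1.1, h.2⟩⟩) a (R0 := R0) (fun x hx => hR x hx.1) (hf.mono fun z (hz : cn a z ∈ sub O ψ c0) => hDO hz) hL2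
  have hA : ∫⁻ x in sub O ψ s1, ENNReal.ofReal (Real.exp (-φ x)) * ‖U0 x‖ₑ^(2*θ) ≠ ⊤ := by
    have h := fin_int (S := sub O ψ s1) (cpt_sub hψc hK hs12 hs02.le) (fun x hx => ⟨hsm hs12.le hx, hx.2.le⟩) (g := fun x => Real.exp (-φ x) * ‖U0 x‖^(2*θ)) 
      ((hφc.mono fun z hz => hz.1.1).neg.rexp.mul ((hU0.continuousOn.mono fun z hz => hz.1).norm.rpow_const fun x _ => Or.inr (by positivity)))
    convert h using 3 with x
    rw [ENNReal.ofReal_mul (Real.exp_pos _).le, enorm_rp _ (by positivity)]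
  set A0 := (∫⁻ x in sub O ψ s1, ENNReal.ofReal (Real.exp (-φ x)) * ‖U0 x‖ₑ^(2*θ)).toReal with hA0
  have hA00 : 0 ≤ A0 := ENNReal.toReal_nonneg
  have h4 : 0 ≤ 1 - θ := by linarith
  have hiter : ∀ i : ℕ, ∀ s < s1, P s (2 * b + (1-θ)^i * A0) := by
    intro i
    induction i with
    | zero => 
      intro s hs
      refine ⟨U0, hU0.mono (hsm (hs.trans hs12).le), fun z hz => hUf0 z (hsm (hs.trans hs12).le hz), (lintegral_mono_set (hsm hs.le)).trans ?_⟩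
      rw [← ENNReal.ofReal_toReal hA]
      refine ENNReal.ofReal_le_ofReal ?_
      rw [← hA0]; simp; positivity
    | succ i ih =>
      intro s hs
      obtain ⟨t, ht1, ht2⟩ := exists_between hs
      have := hstep t s _ (by positivity) ht1 (by linarith) (ih t ht2)
      convert this using 1
      ring
  obtain ⟨i, hi⟩ := exists_pow_lt_of_lt_one (by positivity : 0 < b / (A0+1)) (by linarith : 1 - θ < 1)
  obtain ⟨U, hU, hUf, hUi⟩ := hiter i c hs11
  refine ⟨U, hU, hUf, hUi.trans ?_⟩
  rw [hIr, ← ENNReal.ofReal_mul (by positivity)]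
  refine ENNReal.ofReal_le_ofReal ?_
  have h8 : (1-θ)^i * A0 ≤ b := by
    calc (1-θ)^i * A0 ≤ b / (A0+1) * A0 := by gcongr
      _ ≤ b := by rw [div_mul_eq_mul_div, div_le_iff₀ (by positivity)]; nlinarith
  rw [mul_assoc, ← hb]; linarith
end
end BP

namespace BP
open Filter Topology
set_option linter.all false
open scoped ContDiff ComplexConjugate
variable {N : ℕ}

/-- bounded measurable -/
def Mbd (h : Cn N → ℝ) : Prop := Measurable h ∧ ∃ B, ∀ x, |h x| ≤ B
/-- real mollification -/
def mo (δ : ℝ) (h : Cn N → ℝ) (x : Cn N) : ℝ := ∫ w, chi δ w * h (x - w)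
/-- circle point -/
def ro (t : ℝ) : ℂ := Complex.exp (t * I)
lemma norm_ro (t : ℝ) : ‖ro t‖ = 1 := Complex.norm_exp_ofReal_mul_I t
lemma cont_ro : Continuous ro := by unfold ro; fun_prop
/-- sub-mean value inequality -/
def SM (h : Cn N → ℝ) (x b : Cn N) : Prop := 2 * Real.pi * h x ≤ ∫ t in Ioc 0 (2 * Real.pi), h (x + ro t • b)

lemma mo_int {δ : ℝ} (hδ : 0 < δ) {h : Cn N → ℝ} (hh : Mbd h) (x : Cn N) : Integrable (fun w => chi δ w * h (x - w)) := by
  obtain ⟨hm, B, hB⟩ := hh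
  refine (integrable_chi hδ).mul_bdd (c := B) ((hm.comp (measurable_const.sub measurable_id)).aestronglyMeasurable) (Eventually.of_forall fun w => hB _)

lemma mo_moll (δ : ℝ) (h : Cn N → ℝ) (x : Cn N) : (mo δ h x : ℂ) = moll δ (fun y => (h y : ℂ)) x := by
  rw [moll_eq, mo, ← integral_complex_ofReal]
  congr 1; ext w; simp [chiC]

lemma cd_mo {δ : ℝ} (hδ : 0 < δ) {h : Cn N → ℝ} (hh : Mbd h) : ContDiff ℝ ∞ (mo δ h) := by
  have e : mo δ h = fun x => (moll δ (fun y => (h y : ℂ)) x).re := by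
    funext x; rw [← mo_moll, Complex.ofReal_re]
  rw [e]
  refine Complex.reCLM.contDiff.comp (cd_moll hδ ?_)
  obtain ⟨hm, B, hB⟩ := hh
  refine (locallyIntegrable_const B).mono (Complex.measurable_ofReal.comp hm).aestronglyMeasurable (Eventually.of_forall fun x => ?_)
  rw [Complex.norm_real]; exact (hB x).trans (le_abs_self B)

lemma mo_le {δ : ℝ} (hδ : 0 < δ) {h : Cn N → ℝ} (hh : Mbd h) {x : Cn N} {c : ℝ} (hc : ∀ w, ‖w‖ ≤ δ → h (x - w) ≤ c) : mo δ h x ≤ c := by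
  calc mo δ h x ≤ ∫ w : Cn N, chi δ w * c := by
        refine integral_mono (mo_int hδ hh x) ((integrable_chi hδ).mul_const c) fun w => ?_
        by_cases hw : w ∈ Metric.closedBall (0 : Cn N) δ
        · exact mul_le_mul_of_nonneg_left (hc w (by simpa using hw)) (chi_nonneg δ w)
        · simp [supp_chi hδ hw]
    _ = c := by rw [integral_mul_const, int_chi hδ, one_mul]

lemma le_mo {δ : ℝ} (hδ : 0 < δ) {h : Cn N → ℝ} (hh : Mbd h) {x : Cn N} {c : ℝ} (hc : ∀ w, ‖w‖ ≤ δ → c ≤ h (x - w)) : c ≤ mo δ h x := by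
  calc c = ∫ w : Cn N, chi δ w * c := by rw [integral_mul_const, int_chi hδ, one_mul]
    _ ≤ mo δ h x := by
        refine integral_mono ((integrable_chi hδ).mul_const c) (mo_int hδ hh x) fun w => ?_
        by_cases hw : w ∈ Metric.closedBall (0 : Cn N) δ
        · exact mul_le_mul_of_nonneg_left (hc w (by simpa using hw)) (chi_nonneg δ w)
        · simp [supp_chi hδ hw]

lemma circ_int {h : Cn N → ℝ} (hh : Mbd h) (x b : Cn N) : IntegrableOn (fun t => h (x + ro t • b)) (Ioc 0 (2 * Real.pi)) := by
  obtain ⟨hm, B, hB⟩ := hh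
  have hm' : Measurable (fun t : ℝ => h (x + ro t • b)) := hm.comp (by have := cont_ro; fun_prop : Continuous fun t : ℝ => x + ro t • b).measurable
  refine Measure.integrableOn_of_bounded (M := B) measure_Ioc_lt_top.ne hm'.aestronglyMeasurable (Eventually.of_forall fun t => hB _)

lemma prod_int {δ : ℝ} (hδ : 0 < δ) {h : Cn N → ℝ} (hh : Mbd h) {q : Cn N × ℝ → Cn N} (hq : Continuous q) : 
    Integrable (fun p : Cn N × ℝ => chi δ p.1 * h (q p)) ((volume : Measure (Cn N)).prod (volume.restrict (Ioc 0 (2 * Real.pi)))) := by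
  obtain ⟨hm, B, hB⟩ := hh
  have h1 : Integrable (fun p : Cn N × ℝ => chi δ p.1) ((volume : Measure (Cn N)).prod (volume.restrict (Ioc 0 (2 * Real.pi)))) := 
    (integrable_chi hδ).comp_fst _
  exact h1.mul_bdd (c := B) ((hm.comp hq.measurable).aestronglyMeasurable) (Eventually.of_forall fun w => hB _)

lemma mo_sm {δ : ℝ} (hδ : 0 < δ) {h : Cn N → ℝ} (hh : Mbd h) {x b : Cn N} (hs : ∀ w, ‖w‖ ≤ δ → SM h (x - w) b) : SM (mo δ h) x b := by
  have hc := cont_ro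
  unfold SM
  calc 2 * Real.pi * mo δ h x = ∫ w : Cn N, chi δ w * (2 * Real.pi * h (x - w)) := by
        rw [mo, ← integral_const_mul]; congr 1; ext w; ring
    _ ≤ ∫ w : Cn N, ∫ t in Ioc 0 (2 * Real.pi), chi δ w * h (x - w + ro t • b) := by
        refine integral_mono ?_ (prod_int hδ hh (q := fun p => x - p.1 + ro p.2 • b) (by fun_prop)).integral_prod_left fun w => ?_
        · have := (mo_int hδ hh x).const_mul (2 * Real.pi)
          refine this.congr (Eventually.of_forall fun w => ?_); ring
        · beta_reduce
          rw [integral_const_mul]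
          by_cases hw : w ∈ Metric.closedBall (0 : Cn N) δ
          · exact mul_le_mul_of_nonneg_left (hs w (by simpa using hw)) (chi_nonneg δ w)
          · simp [supp_chi hδ hw]
    _ = ∫ t in Ioc 0 (2 * Real.pi), ∫ w : Cn N, chi δ w * h (x - w + ro t • b) := 
        integral_integral_swap (prod_int hδ hh (q := fun p => x - p.1 + ro p.2 • b) (by fun_prop))
    _ = _ := by
        congr 1; ext t
        simp only [mo]
        congr 1; ext w; congr 2; abel

lemma le_mo_sm {δ : ℝ} (hδ : 0 < δ) {h : Cn N → ℝ} (hh : Mbd h) {x : Cn N} (hs : ∀ b, ‖b‖ ≤ δ → SM h x b) : h x ≤ mo δ h x := by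
  have hc := cont_ro
  have key : 2 * Real.pi * h x ≤ 2 * Real.pi * mo δ h x := by
    calc 2 * Real.pi * h x = ∫ w : Cn N, chi δ w * (2 * Real.pi * h x) := by rw [integral_mul_const, int_chi hδ, one_mul]
      _ ≤ ∫ w : Cn N, ∫ t in Ioc 0 (2 * Real.pi), chi δ w * h (x + ro t • w) := by
        refine integral_mono ((integrable_chi hδ).mul_const _) (prod_int hδ hh (q := fun p => x + ro p.2 • p.1) (by fun_prop)).integral_prod_left fun w => ?_
        beta_reduce
        rw [integral_const_mul]
        by_cases hw : w ∈ Metric.closedBall (0 : Cn N) δ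
        · exact mul_le_mul_of_nonneg_left (hs w (by simpa using hw)) (chi_nonneg δ w)
        · simp [supp_chi hδ hw]
      _ = ∫ t in Ioc 0 (2 * Real.pi), ∫ w : Cn N, chi δ w * h (x + ro t • w) := 
        integral_integral_swap (prod_int hδ hh (q := fun p => x + ro p.2 • p.1) (by fun_prop))
      _ = ∫ t in Ioc 0 (2 * Real.pi), mo δ h x := by
        congr 1; ext t
        have hn : ‖-ro t‖ = 1 := by rw [norm_neg, norm_ro]
        have h0 : -ro t ≠ 0 := by rw [← norm_ne_zero_iff, hn]; exact one_ne_zero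
        have e := (mp_smul (N := N) hn).integral_comp (Homeomorph.smulOfNeZero (-ro t) h0).measurableEmbedding (fun w => chi δ w * h (x - w))
        rw [mo, ← e]
        congr 1; ext w
        rw [chi_smul δ hn, neg_smul, sub_neg_eq_add]
      _ = _ := by
        rw [setIntegral_const]; simp [Real.pi_pos.le]
  exact le_of_mul_le_mul_left key (by positivity)
end BP

namespace BP
open Filter Topology
set_option linter.all false
open scoped ContDiff ComplexConjugate
variable {N : ℕ}

lemma taylor2 {s : Cn N → ℝ} (hs : ContDiff ℝ ∞ s) (x : Cn N) {ε : ℝ} (hε : 0 < ε) :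
    ∃ r > 0, ∀ v : Cn N, ‖v‖ < r → s (x + v) ≤ s x + fderiv ℝ s x v + D2 s x v v / 2 + ε * ‖v‖^2 := by
  have hd : Differentiable ℝ s := hs.differentiable (by simp)
  have hs1 : ContDiff ℝ 1 (fderiv ℝ s) := hs.fderiv_right (m := 1) (by norm_cast)
  have hd2 : HasFDerivAt (fderiv ℝ s) (fderiv ℝ (fderiv ℝ s) x) x := (hs1.differentiable (by simp) x).hasFDerivAt
  have hsym : ∀ v w, D2 s x v w = D2 s x w v := by
    intro v w
    have : ContDiffAt ℝ 2 s x := (hs.of_le (by norm_cast)).contDiffAt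
    exact (this.isSymmSndFDerivAt (by simp)) v w
  have h1 := hasFDerivAt_iff_isLittleO_nhds_zero.1 hd2
  have h2 := h1.def hε
  obtain ⟨r, hr, hb⟩ := Metric.eventually_nhds_iff_ball.1 h2
  refine ⟨r, hr, fun v hv => ?_⟩
  set L := fderiv ℝ (fderiv ℝ s) x with hL
  set g : Cn N → ℝ := fun v => s (x + v) - fderiv ℝ s x v - L v v / 2 with hg
  have hgd : ∀ w, HasFDerivAt g (fderiv ℝ s (x + w) - fderiv ℝ s x - L w) w := by
    intro w
    have e1 : HasFDerivAt (fun v => s (x + v)) (fderiv ℝ s (x + w)) w := by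
      have := (hd (x + w)).hasFDerivAt.comp w ((hasFDerivAt_id w).const_add x)
      rw [ContinuousLinearMap.comp_id] at this
      exact this
    have e2 : HasFDerivAt (fun v => fderiv ℝ s x v) (fderiv ℝ s x) w := (fderiv ℝ s x).hasFDerivAt
    have e3 := (L.hasFDerivAt (x := w)).clm_apply (hasFDerivAt_id w)
    have e4 := (e1.sub e2).sub (e3.mul_const (1/2 : ℝ))
    refine (e4.congr_fderiv ?_).congr_of_eventuallyEq (Eventually.of_forall fun v => ?_)
    · ext b
      have := hsym w b
      simp only [D2, ← hL] at this
      simp [this]; ring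
    · simp [hg]; ring
  have hmv := (convex_closedBall (0 : Cn N) ‖v‖).norm_image_sub_le_of_norm_hasFDerivWithin_le (f := g) (C := ε * ‖v‖)
    (x := 0) (y := v) (fun w _ => (hgd w).hasFDerivWithinAt) (fun w hw => ?_) (by simp) (by simp)
  · have h3 := (le_abs_self _).trans hmv
    simp only [hg, sub_zero, add_zero, map_zero] at h3
    simp only [D2, ← hL]
    simp at h3
    nlinarith [h3]
  · have hw' : ‖w‖ ≤ ‖v‖ := by simpa using hw
    have := hb w (by simpa using hw'.trans_lt hv)
    exact this.trans (by gcongr)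

lemma ro_smul (t : ℝ) (b : Cn N) : ro t • b = Real.cos t • b + Real.sin t • (I • b) := by
  ext j
  simp [ro, Complex.exp_mul_I]; ring

lemma circ_lin (A B : ℝ) : ∫ t in Ioc 0 (2 * Real.pi), (Real.cos t * A + Real.sin t * B) = 0 := by
  rw [← intervalIntegral.integral_of_le (by positivity), intervalIntegral.integral_add, intervalIntegral.integral_mul_const, intervalIntegral.integral_mul_const]
  · simp
  all_goals exact (by fun_prop : Continuous _).intervalIntegrable _ _

lemma circ_quad (A B C : ℝ) : ∫ t in Ioc 0 (2 * Real.pi), (Real.cos t ^ 2 * A + Real.sin t * Real.cos t * B + Real.sin t ^ 2 * C) = Real.pi * (A + C) := by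
  rw [← intervalIntegral.integral_of_le (by positivity), intervalIntegral.integral_add, intervalIntegral.integral_add, intervalIntegral.integral_mul_const, intervalIntegral.integral_mul_const, intervalIntegral.integral_mul_const, integral_cos_sq, integral_sin_sq, integral_sin_mul_cos₁]
  · simp; ring
  all_goals exact (by fun_prop : Continuous _).intervalIntegrable _ _

lemma levi_nonneg_aux {s : Cn N → ℝ} (hs : ContDiff ℝ ∞ s) (x : Cn N) {r : ℝ} (hr : 0 < r) (h : ∀ b, ‖b‖ ≤ r → SM s x b) 
    {ε : ℝ} (hε : 0 < ε) (b : Cn N) : 0 ≤ levi s x b + ε * ‖b‖^2 := by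
  obtain ⟨r', hr', ht⟩ := taylor2 hs x hε
  obtain ⟨τ, hτ, h1, h2⟩ : ∃ τ : ℝ, 0 < τ ∧ ‖τ • b‖ ≤ r ∧ ‖τ • b‖ < r' := by
    have hc : Tendsto (fun τ : ℝ => ‖τ • b‖) (𝓝[>] 0) (𝓝 0) := by
      have : Tendsto (fun τ : ℝ => ‖τ • b‖) (𝓝 0) (𝓝 ‖(0:ℝ) • b‖) := (by fun_prop : Continuous fun τ : ℝ => ‖τ • b‖).tendsto 0
      rw [zero_smul, norm_zero] at this
      exact this.mono_left nhdsWithin_le_nhds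
    obtain ⟨τ, h1, h2, h3⟩ := ((hc.eventually (gt_mem_nhds hr)).and ((hc.eventually (gt_mem_nhds hr')).and self_mem_nhdsWithin)).exists
    exact ⟨τ, h3, h1.le, h2⟩
  have hsm := h _ h1
  unfold SM at hsm
  set L := fderiv ℝ s x
  set c := τ • b with hc
  have hcn := cont_ro
  have hsym : D2 s x c (I • c) = D2 s x (I • c) c := by
    have : ContDiffAt ℝ 2 s x := (hs.of_le (by norm_cast)).contDiffAt
    exact (this.isSymmSndFDerivAt (by simp)) _ _
  have hle : ∀ t, s (x + ro t • c) ≤ s x + (Real.cos t * L c + Real.sin t * L (I • c)) + 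
      (Real.cos t ^ 2 * (D2 s x c c / 2) + Real.sin t * Real.cos t * (D2 s x c (I • c)) + Real.sin t ^ 2 * (D2 s x (I • c) (I • c) / 2)) + ε * ‖c‖^2 := by
    intro t
    have hn : ‖ro t • c‖ = ‖c‖ := by rw [norm_smul, norm_ro, one_mul]
    have := ht (ro t • c) (by rw [hn]; exact h2)
    rw [hn] at this
    refine this.trans (le_of_eq ?_)
    rw [ro_smul]
    simp only [D2, map_add, map_smul, ContinuousLinearMap.add_apply, ContinuousLinearMap.smul_apply, smul_eq_mul] at hsym ⊢
    rw [← hsym]; ring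
  have ci : ∀ {q : ℝ → ℝ}, Continuous q → IntegrableOn q (Ioc 0 (2 * Real.pi)) := fun hq => (hq.integrableOn_Icc).mono_set Ioc_subset_Icc_self
  have hc1 : Continuous fun t => s (x + ro t • c) := hs.continuous.comp (by fun_prop)
  have h3 := integral_mono (ci hc1) (ci (q := fun t => s x + (Real.cos t * L c + Real.sin t * L (I • c)) + 
      (Real.cos t ^ 2 * (D2 s x c c / 2) + Real.sin t * Real.cos t * (D2 s x c (I • c)) + Real.sin t ^ 2 * (D2 s x (I • c) (I • c) / 2)) + ε * ‖c‖^2) (by fun_prop)) hle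
  rw [integral_add (ci (by fun_prop)) (ci (by fun_prop)), integral_add (ci (by fun_prop)) (ci (by fun_prop)), integral_add (ci (by fun_prop)) (ci (by fun_prop)),
    circ_lin, circ_quad, setIntegral_const, setIntegral_const] at h3
  have hv : volume.real (Ioc (0:ℝ) (2 * Real.pi)) = 2 * Real.pi := by simp [Real.pi_pos.le]
  simp only [hv, smul_eq_mul] at h3
  have h4 := hsm.trans h3
  have h5 : D2 s x c c = τ^2 * D2 s x b b := by simp [D2, hc]; ring
  have h6 : D2 s x (I • c) (I • c) = τ^2 * D2 s x (I • b) (I • b) := by 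
    rw [hc, smul_comm I τ b]; simp [D2]; ring
  have h7 : ‖c‖ ^ 2 = τ^2 * ‖b‖^2 := by rw [hc, norm_smul, mul_pow, Real.norm_eq_abs, sq_abs]
  rw [h5, h6, h7] at h4
  have h8 : 0 ≤ (2 * Real.pi * τ^2) * (levi s x b + ε * ‖b‖^2) := by
    unfold levi; nlinarith [h4]
  exact nonneg_of_mul_nonneg_right h8 (by positivity)

lemma levi_nonneg {s : Cn N → ℝ} (hs : ContDiff ℝ ∞ s) (x : Cn N) {r : ℝ} (hr : 0 < r) (h : ∀ b, ‖b‖ ≤ r → SM s x b) (b : Cn N) : 0 ≤ levi s x b := by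
  have : Tendsto (fun ε : ℝ => levi s x b + ε * ‖b‖^2) (𝓝[>] 0) (𝓝 (levi s x b)) := by
    have : Tendsto (fun ε : ℝ => levi s x b + ε * ‖b‖^2) (𝓝 0) (𝓝 (levi s x b + 0 * ‖b‖^2)) := (by fun_prop : Continuous fun ε : ℝ => levi s x b + ε * ‖b‖^2).tendsto 0
    rw [zero_mul, add_zero] at this
    exact this.mono_left nhdsWithin_le_nhds
  refine ge_of_tendsto this ?_
  filter_upwards [self_mem_nhdsWithin] with ε hε
  exact levi_nonneg_aux hs x hr h hε b
end BP

namespace BP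
open Filter Topology
set_option linter.all false
open scoped ContDiff ComplexConjugate
variable {N : ℕ}

/-- truncation -/
def tr (φ : Cn N → EReal) (k : ℝ) (K : Set (Cn N)) : Cn N → ℝ := K.indicator (fun x => (max (φ x) ((-k : ℝ) : EReal)).toReal)

section
variable {φ : Cn N → EReal} {Ω K : Set (Cn N)} {k : ℝ}

lemma tr_coe {x : Cn N} (hx : x ∈ K) (ht : φ x < ⊤) : ((tr φ k K x : ℝ) : EReal) = max (φ x) ((-k : ℝ) : EReal) := by
  rw [tr, indicator_of_mem hx, EReal.coe_toReal]
  · exact (max_lt ht (EReal.coe_lt_top _)).ne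
  · exact (lt_of_lt_of_le (EReal.bot_lt_coe _) (le_max_right _ _)).ne'

lemma tr_ge {x : Cn N} (hx : x ∈ K) (ht : φ x < ⊤) : -k ≤ tr φ k K x := by
  rw [← EReal.coe_le_coe_iff, tr_coe hx ht]; exact le_max_right _ _

lemma le_tr {x : Cn N} (hx : x ∈ K) (ht : φ x < ⊤) : φ x ≤ ((tr φ k K x : ℝ) : EReal) := by
  rw [tr_coe hx ht]; exact le_max_left _ _

lemma tr_meas (hK : IsCompact K) (hu : UpperSemicontinuousOn φ K) (ht : ∀ x ∈ K, φ x < ⊤) : Measurable (tr φ k K) := by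
  refine measurable_of_Iio fun c => ?_
  have hm : MeasurableSet (K ∩ {x | max (φ x) ((-k : ℝ) : EReal) < (c : EReal)}) := by
    by_cases hc : -k < c
    · obtain ⟨u, hu1, hu2⟩ := (upperSemicontinuousOn_iff_preimage_Iio.1 hu) (c : EReal)
      have : K ∩ {x | max (φ x) ((-k : ℝ) : EReal) < (c : EReal)} = K ∩ u := by
        rw [← hu2]; ext x
        simp only [mem_inter_iff, mem_setOf_eq, max_lt_iff, mem_preimage, mem_Iio, EReal.coe_lt_coe_iff, hc, and_true]
      rw [this]; exact hK.measurableSet.inter hu1.measurableSet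
    · have : K ∩ {x | max (φ x) ((-k : ℝ) : EReal) < (c : EReal)} = ∅ := by
        ext x
        simp only [mem_inter_iff, mem_setOf_eq, max_lt_iff, EReal.coe_lt_coe_iff, hc, and_false, mem_empty_iff_false]
      rw [this]; exact MeasurableSet.empty
  have e : tr φ k K ⁻¹' Iio c = (K ∩ {x | max (φ x) ((-k : ℝ) : EReal) < (c : EReal)}) ∪ (Kᶜ ∩ {x | (0:ℝ) < c}) := by
    ext x
    by_cases hx : x ∈ K
    · simp only [mem_preimage, mem_Iio, mem_union, mem_inter_iff, hx, mem_setOf_eq, true_and, mem_compl_iff, not_true_eq_false, false_and, or_false]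
      rw [← tr_coe hx (ht x hx), EReal.coe_lt_coe_iff]
    · simp [tr, hx]
  rw [e]
  exact hm.union (hK.measurableSet.compl.inter (MeasurableSet.const _))

lemma tr_mbd (hK : IsCompact K) (hu : UpperSemicontinuousOn φ K) (ht : ∀ x ∈ K, φ x < ⊤) : Mbd (tr φ k K) := by
  refine ⟨tr_meas hK hu ht, ?_⟩
  rcases K.eq_empty_or_nonempty with h | h
  · exact ⟨0, fun x => by simp [tr, h]⟩
  obtain ⟨x0, hx0, hm⟩ := hu.exists_isMaxOn h hK
  refine ⟨max |k| |tr φ k K x0|, fun x => ?_⟩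
  by_cases hx : x ∈ K
  · have h1 := tr_ge (k := k) hx (ht x hx)
    have h2 : tr φ k K x ≤ tr φ k K x0 := by
      rw [← EReal.coe_le_coe_iff, tr_coe hx (ht x hx), tr_coe hx0 (ht x0 hx0)]
      exact max_le_max (hm hx) le_rfl
    rw [abs_le]
    constructor
    · have := le_max_left |k| |tr φ k K x0|
      have := le_abs_self k
      linarith
    · exact h2.trans ((le_abs_self _).trans (le_max_right _ _))
  · simp [tr, hx]

lemma toENN_ge {M h : ℝ} {p : EReal} (hp : p ≤ (h : EReal)) : ENNReal.ofReal (M - h) ≤ toENN ((M : EReal) - p) := by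
  induction p with
  | bot => simp [toENN]
  | top => simp at hp
  | coe p => 
    rw [toENN, ← EReal.coe_sub, if_neg (EReal.coe_ne_top _), EReal.toReal_coe]
    exact ENNReal.ofReal_le_ofReal (by have := EReal.coe_le_coe_iff.1 hp; linarith)

lemma tr_sm (hK : IsCompact K) (hKΩ : K ⊆ Ω) (hp : PlurisubharmonicOn φ Ω) (ht : ∀ x ∈ Ω, φ x < ⊤) {x b : Cn N} 
    (hx : ∀ w : ℂ, ‖w‖ ≤ 1 → x + w • b ∈ K) : SM (tr φ k K) x b := by
  have htK : ∀ x ∈ K, φ x < ⊤ := fun x hx => ht x (hKΩ hx)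
  have hM : Mbd (tr φ k K) := tr_mbd hK (hp.1.mono hKΩ) htK
  obtain ⟨B, hB⟩ := hM.2
  have hci := circ_int hM x b
  have hcirc : ∀ t, x + ro t • b ∈ K := fun t => hx _ (norm_ro t).le
  have hx0 : x ∈ K := by simpa using hx 0 (by simp)
  unfold SM
  by_cases hk : tr φ k K x = -k
  · calc 2 * Real.pi * tr φ k K x = ∫ t in Ioc 0 (2 * Real.pi), tr φ k K x := by
          rw [setIntegral_const]; simp [Real.pi_pos.le]
      _ ≤ _ := by
        refine integral_mono (integrable_const _) hci fun t => ?_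
        beta_reduce
        rw [hk]; exact tr_ge (hcirc t) (htK _ (hcirc t))
  have hφ : φ x = ((tr φ k K x : ℝ) : EReal) := by
    have := tr_coe (k := k) hx0 (htK x hx0)
    rcases max_choice (φ x) ((-k : ℝ) : EReal) with h | h
    · rw [this, h]
    · rw [h, EReal.coe_eq_coe_iff] at this; exact absurd this hk
  have hcpt : ∀ t, cpt 0 1 t = ro t := fun t => by simp [cpt, ro]
  have hsub := (hp.2 x b).2 0 1 one_pos (fun w hw => hKΩ (hx w (by simpa using hw))) B (fun t => by
    rw [hcpt]
    exact (le_tr (k := k) (hcirc t) (htK _ (hcirc t))).trans (EReal.coe_le_coe_iff.2 ((le_abs_self _).trans (hB _))))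
  simp only [zero_smul, add_zero] at hsub
  rw [hφ] at hsub
  set S := ∫ t in Ioc 0 (2 * Real.pi), (B - tr φ k K (x + ro t • b)) with hS
  have hSi : IntegrableOn (fun t => B - tr φ k K (x + ro t • b)) (Ioc 0 (2 * Real.pi)) := (integrable_const B).sub hci
  have hd : ENNReal.ofReal (S / (2 * Real.pi)) ≤ circleDeficit (fun w => φ (x + w • b)) 0 1 B := by
    rw [ENNReal.ofReal_div_of_pos (by positivity), circleDeficit, hS, ofReal_integral_eq_lintegral_ofReal hSi (Eventually.of_forall fun t => sub_nonneg.2 ((le_abs_self _).trans (hB _)))]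
    gcongr with t
    rw [hcpt]
    exact toENN_ge (le_tr (hcirc t) (htK _ (hcirc t)))
  have hS0 : 0 ≤ S := integral_nonneg fun t => sub_nonneg.2 ((le_abs_self _).trans (hB _))
  have h3 : ((tr φ k K x : ℝ) : EReal) + ((S / (2 * Real.pi) : ℝ) : EReal) ≤ (B : EReal) := by
    refine le_trans ?_ hsub
    gcongr
    have : ((ENNReal.ofReal (S / (2 * Real.pi)) : ℝ≥0∞) : EReal) ≤ _ := EReal.coe_ennreal_le_coe_ennreal_iff.2 hd
    rwa [EReal.coe_ennreal_ofReal, max_eq_left (by positivity)] at this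
  rw [← EReal.coe_add, EReal.coe_le_coe_iff] at h3
  have h4 : S = 2 * Real.pi * B - ∫ t in Ioc 0 (2 * Real.pi), tr φ k K (x + ro t • b) := by
    rw [hS, integral_sub (integrable_const B) hci, setIntegral_const]; simp [Real.pi_pos.le]
  have h5 : S / (2 * Real.pi) * (2 * Real.pi) = S := div_mul_cancel₀ _ (by positivity)
  have := mul_le_mul_of_nonneg_right h3 (by positivity : (0:ℝ) ≤ 2 * Real.pi)
  nlinarith
end
end BP

namespace BP
open Filter Topology
set_option linter.all false
open scoped ContDiff ComplexConjugate
variable {N : ℕ}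

/-- exhaustion data -/
def Exh (Ω : Set (Cn N)) (ρ : Cn N → ℝ) : Prop := ContinuousOn ρ Ω ∧ PlurisubharmonicOn (fun z => (ρ z : EReal)) Ω ∧
      ∀ c : ℝ, IsCompact {z ∈ Ω | ρ z ≤ c}

lemma approx {Ω : Set (Cn N)} (hΩ : IsOpen Ω) {ρ : Cn N → ℝ} (hρ : Exh Ω ρ) {φ : Cn N → EReal} (hφ : PlurisubharmonicOn φ Ω)
    (ht : ∀ x ∈ Ω, φ x < ⊤) (k : ℕ) : ∃ ψ Φ : Cn N → ℝ, ContDiff ℝ ∞ ψ ∧ ContDiff ℝ ∞ Φ ∧ 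
      (∀ x ∈ Ω, ρ x < k + 1 → |ψ x - ρ x| ≤ 1/4 ∧ (∀ b, 0 ≤ levi ψ x b) ∧ (∀ b, 0 ≤ levi Φ x b) ∧ φ x ≤ (Φ x : EReal) ∧
        ∀ c : ℝ, -k ≤ c → (∀ y ∈ Ω, ‖y - x‖ ≤ 1 / ((k : ℝ) + 1) → φ y ≤ (c : EReal)) → Φ x ≤ c) := by
  obtain ⟨hc, hp, hK⟩ := hρ
  set K : Set (Cn N) := {z ∈ Ω | ρ z ≤ k + 2} with hKdef
  have hKc : IsCompact K := hK _
  have hKΩ : K ⊆ Ω := fun x hx => hx.1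
  have hop : IsOpen {z ∈ Ω | ρ z < k + 2} := hc.isOpen_inter_preimage hΩ isOpen_Iio
  obtain ⟨δ, hδ, hδs⟩ := (hK (k + 1)).exists_cthickening_subset_open hop (fun x hx => ⟨hx.1, by have := hx.2; linarith⟩)
  have huc := hKc.uniformContinuousOn_of_continuous (hc.mono hKΩ)
  obtain ⟨δ', hδ', huc'⟩ := Metric.uniformContinuousOn_iff.1 huc (1/4) (by norm_num)
  set ε := min (δ / 2) (min (δ' / 2) (1 / ((k : ℝ) + 1))) with hε
  have hε0 : 0 < ε := by positivity
  have hε1 : ε ≤ δ / 2 := min_le_left _ _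
  have hε2 : ε ≤ δ' / 2 := (min_le_right _ _).trans (min_le_left _ _)
  have hε3 : ε ≤ 1 / ((k : ℝ) + 1) := (min_le_right _ _).trans (min_le_right _ _)
  have hball : ∀ x ∈ Ω, ρ x < k + 1 → ∀ y, ‖y - x‖ ≤ 2 * ε → y ∈ K := by
    intro x hx hx1 y hy
    have : y ∈ Metric.cthickening δ {z ∈ Ω | ρ z ≤ k + 1} := 
      Metric.mem_cthickening_of_dist_le y x δ _ ⟨hx, hx1.le⟩ (by rw [dist_eq_norm]; linarith)
    have := hδs this
    exact ⟨this.1, this.2.le⟩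
  have htK : ∀ x ∈ K, φ x < ⊤ := fun x hx => ht x (hKΩ hx)
  have htρ : ∀ x ∈ Ω, (ρ x : EReal) < ⊤ := fun x hx => EReal.coe_lt_top _
  obtain ⟨B, hB⟩ := (hKc.image_of_continuousOn (hc.mono hKΩ)).isBounded.exists_norm_le
  have hBK : ∀ x ∈ K, |ρ x| ≤ B := fun x hx => hB _ ⟨x, hx, rfl⟩
  set h1 := tr (fun z => (ρ z : EReal)) B K with hh1
  set h2 := tr φ k K with hh2
  have hm1 : Mbd h1 := tr_mbd hKc (hp.1.mono hKΩ) (fun x hx => htρ x (hKΩ hx))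
  have hm2 : Mbd h2 := tr_mbd hKc (hφ.1.mono hKΩ) htK
  have hh1e : ∀ x ∈ K, h1 x = ρ x := by
    intro x hx
    have := tr_coe (φ := fun z => (ρ z : EReal)) (k := B) hx (EReal.coe_lt_top _)
    rw [max_eq_left (EReal.coe_le_coe_iff.2 (abs_le.1 (hBK x hx)).1), EReal.coe_eq_coe_iff] at this
    exact this
  have hcirc : ∀ x ∈ Ω, ρ x < k + 1 → ∀ y, ‖y - x‖ ≤ ε → ∀ b : Cn N, ‖b‖ ≤ ε → ∀ w : ℂ, ‖w‖ ≤ 1 → y + w • b ∈ K := by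
    intro x hx hx1 y hy b hb w hw
    refine hball x hx hx1 _ ?_
    have : y + w • b - x = (y - x) + w • b := by abel
    rw [this]
    refine (norm_add_le _ _).trans ?_
    rw [norm_smul]
    have : ‖w‖ * ‖b‖ ≤ 1 * ε := by gcongr
    linarith
  refine ⟨mo ε h1, mo ε h2, cd_mo hε0 hm1, cd_mo hε0 hm2, fun x hx hx1 => ⟨?_, ?_, ?_, ?_, ?_⟩⟩
  · have hxK : x ∈ K := hball x hx hx1 x (by simp; positivity)
    have hn : ∀ w : Cn N, ‖w‖ ≤ ε → |ρ (x - w) - ρ x| ≤ 1/4 ∧ h1 (x - w) = ρ (x - w) := by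
      intro w hw
      have hwK : x - w ∈ K := hball x hx hx1 _ (by simp; linarith)
      refine ⟨?_, hh1e _ hwK⟩
      have := huc' (x - w) hwK x hxK (by rw [dist_eq_norm]; simp; linarith)
      rw [Real.dist_eq] at this; exact this.le
    rw [abs_le]
    constructor
    · have := le_mo hε0 hm1 (x := x) (c := ρ x - 1/4) (fun w hw => by
        obtain ⟨e1, e2⟩ := hn w hw
        rw [e2]; have := (abs_le.1 e1).1; linarith)
      linarith
    · have := mo_le hε0 hm1 (x := x) (c := ρ x + 1/4) (fun w hw => by
        obtain ⟨e1, e2⟩ := hn w hw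
        rw [e2]; have := (abs_le.1 e1).2; linarith)
      linarith
  · exact levi_nonneg (cd_mo hε0 hm1) x hε0 fun b hb => mo_sm hε0 hm1 fun w hw => tr_sm hKc hKΩ hp htρ 
      (hcirc x hx hx1 (x - w) (by simpa using hw) b hb)
  · exact levi_nonneg (cd_mo hε0 hm2) x hε0 fun b hb => mo_sm hε0 hm2 fun w hw => tr_sm hKc hKΩ hφ ht 
      (hcirc x hx hx1 (x - w) (by simpa using hw) b hb)
  · have hxK : x ∈ K := hball x hx hx1 x (by simp; positivity)
    refine (le_tr (k := k) hxK (htK x hxK)).trans (EReal.coe_le_coe_iff.2 ?_)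
    exact le_mo_sm hε0 hm2 fun b hb => tr_sm hKc hKΩ hφ ht (hcirc x hx hx1 x (by simp; positivity) b hb)
  · intro c hkc hy
    refine mo_le hε0 hm2 fun w hw => ?_
    have hwK : x - w ∈ K := hball x hx hx1 _ (by simp; linarith)
    rw [← EReal.coe_le_coe_iff, hh2, tr_coe hwK (htK _ hwK)]
    exact max_le (hy _ (hKΩ hwK) (by simp; simp at hε3; linarith)) (EReal.coe_le_coe_iff.2 hkc)

lemma lt_expE {t : ℝ≥0∞} {p : EReal} (hp : p < ⊤) (h : t < expE (-p)) : ∃ c : ℝ, p < (c : EReal) ∧ t ≤ ENNReal.ofReal (Real.exp (-c)) := by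
  unfold expE at h
  rw [← ENNReal.exp_log t, EReal.exp_lt_exp_iff] at h
  obtain ⟨q, h1, h2⟩ := EReal.lt_iff_exists_real_btwn.1 h
  refine ⟨-q, ?_, ?_⟩
  · rw [EReal.coe_neg]; exact EReal.lt_neg_comm.1 h2
  · rw [neg_neg, ← EReal.exp_coe, ← ENNReal.exp_log t]; exact EReal.exp_monotone h1.le
end BP

namespace BP
open Filter Topology
set_option linter.all false
open scoped ContDiff ComplexConjugate
variable {N : ℕ}

variable {n : ℕ}
/-- One-codimensional extension theorem. -/
lemma ot_one {R0 K : ℝ} (hK0 : 0 < K) (hKd : ∀ y, |deriv Real.smoothTransition y| ≤ K) {Ω : Set (Cn (n+1))} (hΩ : IsOpen Ω)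
    {ρ : Cn (n+1) → ℝ} (hρ : Exh Ω ρ) {φ : Cn (n+1) → EReal} (hφ : PlurisubharmonicOn φ Ω)
    (ht : ∀ x ∈ Ω, φ x < ⊤) (a : ℂ) (hR : ∀ x ∈ Ω, ‖x 0 - a‖ ≤ R0) {f : Cn n → ℂ} (hf : DifferentiableOn ℂ f {z | cn a z ∈ Ω})
    {θ : ℝ} (hθ : 0 < θ) (hθ1 : θ ≤ 1) (hI : ∫⁻ z in {z | cn a z ∈ Ω}, expE (-(φ (cn a z))) * ‖f z‖ₑ^(2*θ) ≠ ⊤) :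
    ∃ V : Cn (n+1) → ℂ, DifferentiableOn ℂ V Ω ∧ (∀ z, cn a z ∈ Ω → V (cn a z) = f z) ∧ 
      ∫⁻ x in Ω, expE (-(φ x)) * ‖V x‖ₑ^(2*θ) ≤ ENNReal.ofReal (3 * Cg R0 K) * ∫⁻ z in {z | cn a z ∈ Ω}, expE (-(φ (cn a z))) * ‖f z‖ₑ^(2*θ) := by
  choose ψ Φ hψ hΦ hap using approx hΩ hρ hφ ht
  set O : ℕ → Set (Cn (n+1)) := fun k => {x ∈ Ω | ρ x < k + 1} with hO
  have hOo : ∀ k, IsOpen (O k) := fun k => hρ.1.isOpen_inter_preimage hΩ isOpen_Iio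
  have hOΩ : ∀ k, O k ⊆ Ω := fun k x hx => hx.1
  set J := ∫⁻ z in {z | cn a z ∈ Ω}, expE (-(φ (cn a z))) * ‖f z‖ₑ^(2*θ) with hJ
  have hle : ∀ k, ∫⁻ z in {z | cn a z ∈ O k}, ENNReal.ofReal (Real.exp (-(Φ k (cn a z)))) * ‖f z‖ₑ^(2*θ) ≤ J := by
    intro k
    have hms : MeasurableSet {z : Cn n | cn a z ∈ O k} := ((hOo k).preimage (cont_cn a)).measurableSet
    calc _ ≤ ∫⁻ z in {z | cn a z ∈ O k}, expE (-(φ (cn a z))) * ‖f z‖ₑ^(2*θ) := by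
          refine setLIntegral_mono' hms fun z hz => ?_
          refine mul_le_mul' ?_ le_rfl
          rw [← EReal.exp_coe, expE]
          refine EReal.exp_monotone ?_
          rw [EReal.coe_neg, EReal.neg_le_neg_iff]
          exact (hap k _ hz.1 hz.2).2.2.2.1
      _ ≤ J := lintegral_mono_set fun z hz => hOΩ k hz
  have hex : ∀ k : ℕ, ∃ U' : Cn (n+1) → ℂ, DifferentiableOn ℂ U' (sub (O k) (ψ k) k) ∧ (∀ z, cn a z ∈ sub (O k) (ψ k) k → U' (cn a z) = f z) ∧
      ∫⁻ x in sub (O k) (ψ k) k, ENNReal.ofReal (Real.exp (-(Φ k x))) * ‖U' x‖ₑ^(2*θ) ≤ ENNReal.ofReal (3 * Cg R0 K) * J := by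
    intro k
    have hcp : IsCompact {x | x ∈ O k ∧ ψ k x ≤ (k : ℝ) + 1/2} := by
      have e : {x | x ∈ O k ∧ ψ k x ≤ (k : ℝ) + 1/2} = {x ∈ Ω | ρ x ≤ (k : ℝ) + 3/4} ∩ {x | ψ k x ≤ (k : ℝ) + 1/2} := by
        ext x
        simp only [hO, mem_setOf_eq, mem_inter_iff]
        constructor
        · rintro ⟨⟨h1, h2⟩, h3⟩
          have := (abs_le.1 (hap k x h1 h2).1).1
          exact ⟨⟨h1, by linarith⟩, h3⟩
        · rintro ⟨⟨h1, h2⟩, h3⟩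
          exact ⟨⟨h1, by linarith⟩, h3⟩
      rw [e]
      exact (hρ.2.2 _).inter_right (isClosed_le (hψ k).continuous continuous_const)
    obtain ⟨U', h1, h2, h3⟩ := e_good (R0 := R0) hK0 hKd (hOo k) (ψ := ψ k) (φ := Φ k) (hψ k).contDiffOn (hΦ k).contDiffOn
      (fun x hx => (hap k x hx.1 hx.2).2.1) (fun x hx => (hap k x hx.1 hx.2).2.2.1) (c := k) (c0 := (k : ℝ) + 1/2) (by linarith) hcp a
      (fun x hx => hR x hx.1) (f := f) (hf.mono fun z hz => hOΩ k hz) hθ hθ1 (ne_top_of_le_ne_top hI (hle k))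
    exact ⟨U', h1, h2, h3.trans (mul_le_mul' le_rfl (hle k))⟩
  choose U hU hUf hUb using hex
  have hloc : ∀ x ∈ Ω, ∀ c : ℝ, φ x < (c : EReal) → ∃ r > 0, Metric.ball x r ⊆ Ω ∧ ∀ᶠ k : ℕ in atTop, ∀ y ∈ Metric.ball x r, y ∈ sub (O k) (ψ k) k ∧ Φ k y ≤ c := by
    intro x hx c hc
    have e1 : ∀ᶠ y in 𝓝 x, φ y < (c : EReal) := by
      have := hφ.1 x hx c hc
      rwa [hΩ.nhdsWithin_eq hx] at this
    have e2 : ∀ᶠ y in 𝓝 x, ρ y < ρ x + 1 := (hρ.1.continuousAt (hΩ.mem_nhds hx)).eventually (gt_mem_nhds (by linarith))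
    obtain ⟨r, hr, hb⟩ := Metric.eventually_nhds_iff_ball.1 ((e1.and e2).and (hΩ.mem_nhds hx))
    refine ⟨r / 2, by positivity, fun y hy => (hb y (Metric.ball_subset_ball (by linarith) hy)).2, ?_⟩
    have t1 : ∀ᶠ k : ℕ in atTop, ρ x + 2 < k := tendsto_natCast_atTop_atTop.eventually (eventually_gt_atTop _)
    have t2 : ∀ᶠ k : ℕ in atTop, -c < k := tendsto_natCast_atTop_atTop.eventually (eventually_gt_atTop _)
    have t3 : ∀ᶠ k : ℕ in atTop, 1 / ((k:ℝ) + 1) < r / 2 := tendsto_one_div_add_atTop_nhds_zero_nat.eventually (gt_mem_nhds (by positivity))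
    filter_upwards [t1, t2, t3] with k k1 k2 k3 y hy
    have hy' := hb y (Metric.ball_subset_ball (by linarith) hy)
    have hyO : ρ y < (k : ℝ) + 1 := by linarith [hy'.1.2]
    have ha := hap k y hy'.2 hyO
    refine ⟨⟨⟨hy'.2, hyO⟩, ?_⟩, ?_⟩
    · have := (abs_le.1 ha.1).2
      linarith [hy'.1.2]
    · refine ha.2.2.2.2 c (by linarith) fun y' hy1 hy2 => (hb y' ?_).1.1.le
      rw [Metric.mem_ball, dist_eq_norm] at hy ⊢
      calc ‖y' - x‖ = ‖(y' - y) + (y - x)‖ := by congr 1; abel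
        _ ≤ ‖y' - y‖ + ‖y - x‖ := norm_add_le _ _
        _ < r := by linarith
  obtain ⟨s, hs, V, hV, hVt, hVb⟩ := limit_lem hΩ (D := fun k => sub (O k) (ψ k) k) (fun k => open_sub (hOo k) (hψ k).continuous.continuousOn _)
    (fun k x hx => hOΩ k hx.1) (U := U) hU (w := fun k x => ENNReal.ofReal (Real.exp (-(Φ k x)))) (w' := fun x => expE (-(φ x)))
    (fun k => by have := (hΦ k).continuous; exact (ENNReal.continuous_ofReal.comp (by fun_prop : Continuous fun x => Real.exp (-(Φ k x)))).measurable.aemeasurable)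
    (G := fun _ => 0) continuousOn_const (p := 2 * θ) (by positivity) (C := ENNReal.ofReal (3 * Cg R0 K) * J) (ENNReal.mul_ne_top ENNReal.ofReal_ne_top hI)
    (fun k => by simpa using hUb k) 
    (fun x hx => by
      obtain ⟨c, hc, _⟩ := EReal.lt_iff_exists_real_btwn.1 (ht x hx)
      obtain ⟨r, hr, h1, h2⟩ := hloc x hx c hc
      refine ⟨r, hr, (Real.exp (-c)).toNNReal, by simpa using Real.exp_pos _, 0, h1, ?_⟩
      filter_upwards [h2] with k hk
      refine ⟨fun y hy => (hk y hy).1, fun y hy => ⟨?_, by simp⟩⟩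
      exact ENNReal.ofReal_le_ofReal (Real.exp_le_exp.2 (neg_le_neg (hk y hy).2)))
    (fun s hs => by
      refine (ae_restrict_iff' hΩ.measurableSet).2 (Eventually.of_forall fun x hx => ?_)
      refine le_of_forall_lt fun t htl => ?_
      obtain ⟨t', ht1, ht2⟩ := exists_between htl
      obtain ⟨c, hc1, hc2⟩ := lt_expE (ht x hx) ht2
      obtain ⟨r, hr, h1, h2⟩ := hloc x hx c hc1
      refine lt_of_lt_of_le ht1 (le_liminf_of_le (by isBoundedDefault) ?_)
      filter_upwards [hs.tendsto_atTop.eventually h2] with k hk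
      exact hc2.trans (ENNReal.ofReal_le_ofReal (Real.exp_le_exp.2 (neg_le_neg (hk x (Metric.mem_ball_self hr)).2))))
  refine ⟨V, hV, fun z hz => ?_, by simpa using hVb⟩
  obtain ⟨c, hc, _⟩ := EReal.lt_iff_exists_real_btwn.1 (ht _ hz)
  obtain ⟨r, hr, h1, h2⟩ := hloc _ hz c hc
  refine tendsto_nhds_unique (hVt _ hz) (tendsto_const_nhds.congr' ?_)
  filter_upwards [hs.tendsto_atTop.eventually h2] with k hk
  exact (hUf (s k) z (hk _ (Metric.mem_ball_self hr)).1).symm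
end BP

namespace BP
open Filter Topology
set_option linter.all false
open scoped ContDiff ComplexConjugate
variable {N : ℕ}

variable {n r : ℕ}
section
variable {E F : Type*} [NormedAddCommGroup E] [NormedSpace ℂ E] [NormedAddCommGroup F] [NormedSpace ℂ F]

/-- exhaustion data, general -/
def ExhE (Ω : Set E) (ρ : E → ℝ) : Prop := ContinuousOn ρ Ω ∧ PlurisubharmonicOn (fun z => (ρ z : EReal)) Ω ∧
      ∀ c : ℝ, IsCompact {z ∈ Ω | ρ z ≤ c}

lemma psh_comp {A l : E → F} (hA : Continuous A) (hl : ∀ a b (w : ℂ), A (a + w • b) = A a + w • l b) {φ : F → EReal} {D : Set F}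
    (h : PlurisubharmonicOn φ D) : PlurisubharmonicOn (fun x => φ (A x)) (A ⁻¹' D) := by
  refine ⟨fun x hx y hy => ?_, fun a b => ?_⟩
  · have h1 := h.1 (A x) hx y hy
    have h2 : Tendsto A (𝓝[A ⁻¹' D] x) (𝓝[D] (A x)) := hA.continuousAt.continuousWithinAt.tendsto_nhdsWithin (fun z hz => hz)
    exact h2.eventually h1
  · have := h.2 (A a) (l b)
    simp only [← hl] at this
    exact this

lemma exh_comp {A l : E → F} (hA : Topology.IsClosedEmbedding A) (hl : ∀ a b (w : ℂ), A (a + w • b) = A a + w • l b) {ρ : F → ℝ} {D : Set F}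
    (h : ExhE D ρ) : ExhE (A ⁻¹' D) (fun x => ρ (A x)) := by
  refine ⟨h.1.comp hA.continuous.continuousOn (fun z hz => hz), psh_comp hA.continuous hl h.2.1, fun c => ?_⟩
  exact hA.isCompact_preimage (h.2.2 c)
end

/-- regrouping -/
def T1 (p : Cn (n+1) × Cn r) : Cn n × Cn (r+1) := (tl p.1, cn (p.1 0) p.2)
/-- regrouping, inverse -/
def T2 (p : Cn n × Cn (r+1)) : Cn (n+1) × Cn r := (cn (p.2 0) p.1, tl p.2)

lemma T12 (p : Cn n × Cn (r+1)) : T1 (T2 p) = p := by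
  simp [T1, T2, tl_cn, cn_zero, cn_tl]
lemma T21 (p : Cn (n+1) × Cn r) : T2 (T1 p) = p := by
  simp [T1, T2, tl_cn, cn_zero, cn_tl]

lemma diff_cn2 : Differentiable ℂ (fun p : ℂ × Cn n => cn p.1 p.2) := by
  rw [differentiable_pi]
  intro i
  refine Fin.cases ?_ (fun j => ?_) i
  · simp only [cn_zero]; fun_prop
  · simp only [cn_succ]; fun_prop

lemma diff_T1 : Differentiable ℂ (T1 : Cn (n+1) × Cn r → Cn n × Cn (r+1)) := by
  refine Differentiable.prodMk (diff_tl.comp differentiable_fst) ?_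
  exact diff_cn2.comp (f := fun p : Cn (n+1) × Cn r => (p.1 0, p.2)) (by fun_prop)
lemma diff_T2 : Differentiable ℂ (T2 : Cn n × Cn (r+1) → Cn (n+1) × Cn r) := by
  refine Differentiable.prodMk ?_ (diff_tl.comp differentiable_snd)
  exact diff_cn2.comp (f := fun p : Cn n × Cn (r+1) => (p.2 0, p.1)) (by fun_prop)

lemma T1_lin (a b : Cn (n+1) × Cn r) (w : ℂ) : T1 (a + w • b) = T1 a + w • T1 b := by
  refine Prod.ext ?_ ?_
  · ext i; simp [T1, tl]
  · funext i
    refine Fin.cases ?_ (fun j => ?_) i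
    · simp [T1, cn_zero]
    · simp [T1, cn_succ]

lemma ce_T1 : Topology.IsClosedEmbedding (T1 : Cn (n+1) × Cn r → Cn n × Cn (r+1)) :=
  Function.LeftInverse.isClosedEmbedding (f := T2) T21 diff_T2.continuous diff_T1.continuous

lemma mp_T1 : MeasurePreserving (T1 : Cn (n+1) × Cn r → Cn n × Cn (r+1)) := by
  have h1 : MeasurePreserving (fun x : Cn (n+1) => (x 0, tl x)) (volume : Measure (Cn (n+1))) ((volume : Measure ℂ).prod (volume : Measure (Cn n))) := 
    volume_preserving_piFinSuccAbove (fun _ : Fin (n+1) => ℂ) 0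
  have h2 : MeasurePreserving (fun p : Cn (n+1) × Cn r => ((tl p.1, p.1 0), p.2)) 
      ((volume : Measure (Cn (n+1))).prod (volume : Measure (Cn r))) (((volume : Measure (Cn n)).prod (volume : Measure ℂ)).prod (volume : Measure (Cn r))) := 
    (Measure.measurePreserving_swap.comp h1).prod (MeasurePreserving.id _)
  have h3 := (measurePreserving_prodAssoc (volume : Measure (Cn n)) (volume : Measure ℂ) (volume : Measure (Cn r))).comp h2
  have h4 : MeasurePreserving (fun p : Cn n × (ℂ × Cn r) => (p.1, cn p.2.1 p.2.2)) ((volume : Measure (Cn n)).prod ((volume : Measure ℂ).prod (volume : Measure (Cn r)))) 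
      ((volume : Measure (Cn n)).prod (volume : Measure (Cn (r+1)))) := (MeasurePreserving.id _).prod mp_cn
  exact h4.comp h3

lemma ot_zero (Ω : Set (Cn n × Cn 0)) (y₀ : Cn 0) (F : Cn n × Cn 0 → ℝ≥0∞) : ∫⁻ w in Ω, F w = ∫⁻ z in {z | (z, y₀) ∈ Ω}, F (z, y₀) := by
  have hm : MeasurePreserving (fun z : Cn n => (z, y₀)) (volume : Measure (Cn n)) ((volume : Measure (Cn n)).prod (volume : Measure (Cn 0))) := by
    refine ⟨by fun_prop, ?_⟩
    have e : (volume : Measure (Cn 0)) = Measure.dirac y₀ := Measure.pi_of_empty _ y₀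
    rw [← Measure.prod_dirac, e]
  have he : Topology.IsClosedEmbedding (fun z : Cn n => (z, y₀)) := Function.LeftInverse.isClosedEmbedding (f := Prod.fst) (fun z => rfl) continuous_fst (by fun_prop)
  exact (hm.setLIntegral_comp_preimage_emb he.measurableEmbedding F Ω).symm

lemma ot_r {R0 K : ℝ} (hK0 : 0 < K) (hKd : ∀ y, |deriv Real.smoothTransition y| ≤ K) {θ : ℝ} (hθ : 0 < θ) (hθ1 : θ ≤ 1) (r : ℕ) :
    ∀ (n : ℕ) (Ω : Set (Cn n × Cn r)), IsOpen Ω → ∀ ρ, ExhE Ω ρ → ∀ φ : Cn n × Cn r → EReal, PlurisubharmonicOn φ Ω →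
      (∀ x ∈ Ω, φ x < ⊤) → ∀ y₀ : Cn r, (∀ w ∈ Ω, ∀ i, ‖w.2 i - y₀ i‖ ≤ R0) → ∀ u : Cn n → ℂ, DifferentiableOn ℂ u {z | (z, y₀) ∈ Ω} →
      ∫⁻ z in {z | (z, y₀) ∈ Ω}, expE (-(φ (z, y₀))) * ‖u z‖ₑ^(2*θ) ≠ ⊤ →
      ∃ U : Cn n × Cn r → ℂ, DifferentiableOn ℂ U Ω ∧ (∀ z, (z, y₀) ∈ Ω → U (z, y₀) = u z) ∧
        ∫⁻ w in Ω, expE (-(φ w)) * ‖U w‖ₑ^(2*θ) ≤ ENNReal.ofReal (3 * Cg R0 K) ^ r * ∫⁻ z in {z | (z, y₀) ∈ Ω}, expE (-(φ (z, y₀))) * ‖u z‖ₑ^(2*θ) := by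
  induction r with
  | zero => 
    intro n Ω hΩ ρ hρ φ hφ ht y₀ hR u hu hI
    refine ⟨fun w => u w.1, ?_, fun z hz => rfl, ?_⟩
    · refine hu.comp differentiable_fst.differentiableOn (fun w hw => ?_)
      show (w.1, y₀) ∈ Ω
      rwa [Subsingleton.elim y₀ w.2]
    · rw [pow_zero, one_mul, ot_zero Ω y₀]
  | succ r ih =>
    intro n Ω hΩ ρ hρ φ hφ ht y₀ hR u hu hI
    set Ω' : Set (Cn (n+1) × Cn r) := T1 ⁻¹' Ω with hΩ'
    set y1 : Cn r := tl y₀ with hy1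
    have hΩ'o : IsOpen Ω' := hΩ.preimage diff_T1.continuous
    have hρ' : ExhE Ω' (fun x => ρ (T1 x)) := exh_comp ce_T1 T1_lin hρ
    have hφ' : PlurisubharmonicOn (fun x => φ (T1 x)) Ω' := psh_comp diff_T1.continuous T1_lin hφ
    set j : Cn (n+1) → Cn (n+1) × Cn r := fun x => (x, y1) with hj
    have hjc : Continuous j := by fun_prop
    have hje : Topology.IsClosedEmbedding j := Function.LeftInverse.isClosedEmbedding (f := Prod.fst) (fun z => rfl) continuous_fst hjc
    have hjl : ∀ a b (w : ℂ), j (a + w • b) = j a + w • (b, 0) := by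
      intro a b w; simp [hj]
    have hρ'' := exh_comp hje hjl hρ'
    have hφ'' := psh_comp hjc hjl hφ'
    have hTj : ∀ z, T1 (j (cn (y₀ 0) z)) = (z, y₀) := by
      intro z; simp [hj, T1, tl_cn, cn_zero, hy1, cn_tl]
    have hset : {z | cn (y₀ 0) z ∈ j ⁻¹' Ω'} = {z | (z, y₀) ∈ Ω} := by
      ext z
      show T1 (j (cn (y₀ 0) z)) ∈ Ω ↔ (z, y₀) ∈ Ω
      rw [hTj]
    obtain ⟨V, hV1, hV2, hV3⟩ := ot_one (R0 := R0) hK0 hKd (hΩ'o.preimage hjc) (ρ := fun x => ρ (T1 (j x))) hρ'' (φ := fun x => φ (T1 (j x))) hφ''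
      (fun x hx => ht _ hx) (y₀ 0) (fun x hx => hR _ hx 0) (f := u) (by rw [hset]; exact hu) hθ hθ1 (by simp only [hset, hTj]; exact hI)
    simp only [hset, hTj] at hV3
    obtain ⟨U, hU1, hU2, hU3⟩ := ih (n+1) Ω' hΩ'o _ hρ' _ hφ' (fun x hx => ht _ hx) y1 (fun w hw i => hR _ hw i.succ) V hV1
      (ne_top_of_le_ne_top (ENNReal.mul_ne_top ENNReal.ofReal_ne_top hI) hV3)
    refine ⟨fun w => U (T2 w), ?_, fun z hz => ?_, ?_⟩
    · refine hU1.comp diff_T2.differentiableOn (fun w hw => ?_)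
      show T1 (T2 w) ∈ Ω
      rwa [T12]
    · have e : T2 (z, y₀) = (cn (y₀ 0) z, y1) := rfl
      have hm : T1 (cn (y₀ 0) z, y1) ∈ Ω := by rw [show T1 (cn (y₀ 0) z, y1) = (z, y₀) from hTj z]; exact hz
      show U (T2 (z, y₀)) = u z
      rw [e, hU2 _ hm]
      exact hV2 z hm
    · rw [← mp_T1.setLIntegral_comp_preimage_emb ce_T1.measurableEmbedding]
      simp only [T21]
      refine hU3.trans ?_
      rw [pow_succ, mul_assoc]
      exact mul_le_mul' le_rfl hV3
end BP

/-- (Berndtsson–Păun `L^{2/m}` extension.) For every `r` and `M` there is a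
constant `C = C_{r,M}` such that: for every pseudoconvex `Ω ⊆ ℂⁿ × ℂʳ` whose projection to the
last `r` coordinates is bounded by `M`, every plurisubharmonic `φ` on `Ω`, every integer
`m ≥ 1`, every `y₀ ∈ p(Ω)` such that `φ` is not identically `-∞` on any branch of the fiber
`Ω_{y₀}`, and every holomorphic `u` on `Ω_{y₀}` with `∫_{Ω_{y₀}} |u|^{2/m} e^{-φ} < ∞`, there
is a holomorphic `U` on `Ω` with `U|_{Ω_{y₀}} = u` and
`∫_Ω |U|^{2/m} e^{-φ} ≤ C ∫_{Ω_{y₀}} |u|^{2/m} e^{-φ}`. -/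
theorem statement5 (r : ℕ) (M : ℝ) :
    ∃ C : ℝ, 0 < C ∧
      ∀ (n : ℕ) (Ω : Set ((Fin n → ℂ) × (Fin r → ℂ))),
        IsPseudoconvexDomain Ω →
        (∀ w ∈ Ω, ‖w.2‖ ≤ M) →
        ∀ φ : ((Fin n → ℂ) × (Fin r → ℂ)) → EReal,
          PlurisubharmonicOn φ Ω → (∀ w ∈ Ω, φ w < ⊤) →
        ∀ m : ℕ, 1 ≤ m →
        ∀ y₀ : Fin r → ℂ, (∃ z : Fin n → ℂ, (z, y₀) ∈ Ω) →
          (∀ z : Fin n → ℂ, (z, y₀) ∈ Ω →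
            ∃ z' ∈ connectedComponentIn {w : Fin n → ℂ | (w, y₀) ∈ Ω} z, φ (z', y₀) ≠ ⊥) →
        ∀ u : (Fin n → ℂ) → ℂ,
          DifferentiableOn ℂ u {z : Fin n → ℂ | (z, y₀) ∈ Ω} →
          (∫⁻ z in {z : Fin n → ℂ | (z, y₀) ∈ Ω},
              (‖u z‖₊ : ℝ≥0∞) ^ (2 / (m : ℝ)) * expE (-(φ (z, y₀)))) ≠ ⊤ →
        ∃ U : ((Fin n → ℂ) × (Fin r → ℂ)) → ℂ,
          DifferentiableOn ℂ U Ω ∧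
          (∀ z : Fin n → ℂ, (z, y₀) ∈ Ω → U (z, y₀) = u z) ∧
          (∫⁻ w in Ω, (‖U w‖₊ : ℝ≥0∞) ^ (2 / (m : ℝ)) * expE (-(φ w))) ≤
            ENNReal.ofReal C *
              ∫⁻ z in {z : Fin n → ℂ | (z, y₀) ∈ Ω},
                (‖u z‖₊ : ℝ≥0∞) ^ (2 / (m : ℝ)) * expE (-(φ (z, y₀))) := by
  obtain ⟨K, hK0, hKd⟩ := BP.deriv_st
  set R0 : ℝ := 2 * M with hR0
  have hC : 0 < 3 * BP.Cg R0 K := by rw [BP.Cg]; positivity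
  refine ⟨(3 * BP.Cg R0 K) ^ r, by positivity, ?_⟩
  intro n Ω hΩ hM φ hφ ht m hm y₀ hy₀ _ u hu hI
  obtain ⟨hΩo, _, ρ, hρ1, hρ2, hρ3⟩ := hΩ
  obtain ⟨z0, hz0⟩ := hy₀
  have hm0 : (0 : ℝ) < m := by exact_mod_cast hm
  have hm1 : (1 : ℝ) ≤ m := by exact_mod_cast hm
  have e2 : 2 * (1 / (m : ℝ)) = 2 / (m : ℝ) := by ring
  have hR : ∀ w ∈ Ω, ∀ i, ‖w.2 i - y₀ i‖ ≤ R0 := by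
    intro w hw i
    have h1 := (norm_le_pi_norm w.2 i).trans (hM w hw)
    have h2 := (norm_le_pi_norm y₀ i).trans (hM _ hz0)
    exact (norm_sub_le _ _).trans (by rw [hR0]; linarith)
  simp only [mul_comm _ (expE _)] at hI ⊢
  rw [← e2] at hI ⊢
  rw [ENNReal.ofReal_pow hC.le]
  exact BP.ot_r (R0 := R0) hK0 hKd (θ := 1 / (m : ℝ)) (by positivity) ((div_le_one hm0).2 hm1) r n Ω hΩo ρ ⟨hρ1, hρ2, hρ3⟩ φ hφ ht y₀ hR u hu hI
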